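/- Let f_1 satisfy H1–H4 and let A be an admissible differential operator. Define F_{1,ε}(u) = ∫_{Ω_{1,ε}} f_1(x/ε, u(x)) dx if u ∈ U_1 and +∞ otherwise in L^p(Ω;ℝ^N), and F_1(u) = ∫_Ω f_hom(u(x)) dx if u ∈ U_1 and +∞ otherwise. Then the Γ-limit of {F_{1,ε}} as ε → 0 with respect to the weak L^p(Ω;ℝ^N)-convergence is F_1. -/

import Mathlib

open MeasureTheory Filter Topology Metric Set
open scoped ENNReal NNReal

noncomputable section

attribute [local instance] Classical.propDecidable

namespace HC

abbrev Rd (d : ℕ) := Fin d → ℝ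
abbrev Vec (N : ℕ) := Fin N → ℝ

/-- Euclidean inner product on `ℝ^N`. -/
def dot {N : ℕ} (u v : Vec N) : ℝ := ∑ j, u j * v j

/-- Euclidean norm on `ℝ^N`. -/
def eN {N : ℕ} (ξ : Vec N) : ℝ := Real.sqrt (∑ j, ξ j ^ 2)

/-- The open unit cube `Q = (0,1)^d`. -/
def Qcube (d : ℕ) : Set (Rd d) := {x | ∀ i, x i ∈ Set.Ioo (0 : ℝ) 1}

/-- Translation by an integer vector. -/
def tr {d : ℕ} (z : Fin d → ℤ) (x : Rd d) : Rd d := fun i => x i + (z i : ℝ)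

/-- The cell `ε (S + z)`. -/
def cell {d : ℕ} (ε : ℝ) (z : Fin d → ℤ) (S : Set (Rd d)) : Set (Rd d) :=
  (fun y : Rd d => fun i => ε * (y i + (z i : ℝ))) '' S

/-- The union of the soft inclusions `Ω_{0,ε}`. -/
def softPart {d : ℕ} (ε : ℝ) (Ω D0 : Set (Rd d)) : Set (Rd d) :=
  ⋃ z ∈ {z : Fin d → ℤ | cell ε z D0 ⊆ Ω}, cell ε z D0

/-- The stiff matrix `Ω_{1,ε}`. -/
def stiffPart {d : ℕ} (ε : ℝ) (Ω D0 : Set (Rd d)) : Set (Rd d) := Ω \ softPart ε Ω D0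

/-- `Ω̂_ε`, the union of the ε-cubes contained in `Ω`. -/
def hatOmega {d : ℕ} (ε : ℝ) (Ω : Set (Rd d)) : Set (Rd d) :=
  ⋃ z ∈ {z : Fin d → ℤ | cell ε z (Qcube d) ⊆ Ω}, cell ε z (Qcube d)

/-- `Q`-periodicity of a map defined on `ℝ^d`. -/
def Zper {d : ℕ} {α : Type*} (u : Rd d → α) : Prop :=
  ∀ (x : Rd d) (z : Fin d → ℤ), u (tr z x) = u x

/-- A local Lipschitz-graph description of `Ω` near the point `x`:  after an orthogonal
change of coordinates, `Ω` is locally the epigraph of a Lipschitz function. -/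
def LipschitzGraphAt {d : ℕ} (Ω : Set (Rd d)) (x : Rd d) : Prop :=
  ∃ (L : Rd d ≃ₗ[ℝ] Rd d) (i : Fin d) (φ : Rd d → ℝ) (K : ℝ≥0) (r : ℝ),
    0 < r ∧ (∀ y z : Rd d, dot (L y) (L z) = dot y z) ∧ LipschitzWith K φ ∧
    (∀ y t, φ (Function.update y i t) = φ y) ∧
    (∀ y ∈ Metric.ball x r, (y ∈ Ω ↔ φ (L y) < L y i))

/-- `Ω` has Lipschitz boundary. -/
def HasLipschitzBoundary {d : ℕ} (Ω : Set (Rd d)) : Prop :=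
  ∀ x ∈ frontier Ω, LipschitzGraphAt Ω x

/-- Compact containment `Ω' ⋐ Ω`. -/
def CpctIn {d : ℕ} (Ω' Ω : Set (Rd d)) : Prop :=
  IsOpen Ω' ∧ IsCompact (closure Ω') ∧ closure Ω' ⊆ Ω

/-- The standing geometric assumptions: `d ≥ 2`, `Ω` bounded connected open Lipschitz,
`D₀ ⋐ Q` open connected Lipschitz. -/
def GoodSetting (d : ℕ) (Ω D0 : Set (Rd d)) : Prop :=
  2 ≤ d ∧ IsOpen Ω ∧ IsConnected Ω ∧ Bornology.IsBounded Ω ∧ HasLipschitzBoundary Ω ∧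
    IsOpen D0 ∧ IsConnected D0 ∧ HasLipschitzBoundary D0 ∧
    IsCompact (closure D0) ∧ closure D0 ⊆ Qcube d

/-! ## First-order constant-coefficient operators -/

/-- The pointwise value of the formal adjoint:
`(𝒜*ψ)(x) = - ∑ i (A^{(i)})^T ∂ψ/∂x_i (x)`. -/
def adjApply {d N M : ℕ} (A : Fin d → (Vec N →ₗ[ℝ] Vec M)) (ψ : Rd d → Vec M)
    (x : Rd d) : Vec N :=
  fun n => -∑ i, dot (A i (Pi.single n 1)) (fderiv ℝ ψ x (Pi.single i 1))

/-- Smooth test functions compactly supported in `O`. -/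
def TestOn {d M : ℕ} (O : Set (Rd d)) (ψ : Rd d → Vec M) : Prop :=
  ContDiff ℝ (⊤ : ℕ∞) ψ ∧ HasCompactSupport ψ ∧ tsupport ψ ⊆ O

/-- `𝒜 u = 0` in `W^{-1,p}(O)`, i.e. distributionally on `O`. -/
def AFreeOn {d N M : ℕ} (A : Fin d → (Vec N →ₗ[ℝ] Vec M)) (O : Set (Rd d))
    (u : Rd d → Vec N) : Prop :=
  ∀ ψ : Rd d → Vec M, TestOn O ψ → ∫ x in O, dot (u x) (adjApply A ψ x) = 0

/-- `𝒜 u = 0` on the torus `𝕋^d` (with `Q`-periodic test functions). -/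
def AFreeTorus {d N M : ℕ} (A : Fin d → (Vec N →ₗ[ℝ] Vec M)) (u : Rd d → Vec N) : Prop :=
  ∀ ψ : Rd d → Vec M, ContDiff ℝ (⊤ : ℕ∞) ψ → Zper ψ →
    ∫ x in Qcube d, dot (u x) (adjApply A ψ x) = 0

/-- The symbol `𝔸[ω] = ∑ i ω_i A^{(i)}`. -/
def symb {d N M : ℕ} (A : Fin d → (Vec N →ₗ[ℝ] Vec M)) (ω : Rd d) : Vec N →ₗ[ℝ] Vec M :=
  ∑ i, ω i • A i

/-- Murat's constant rank condition. -/
def ConstantRank {d N M : ℕ} (A : Fin d → (Vec N →ₗ[ℝ] Vec M)) : Prop :=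
  ∃ r : ℕ, ∀ ω : Rd d, ω ≠ 0 → Module.finrank ℝ (LinearMap.range (symb A ω)) = r

/-! ## Lp spaces and convergences -/

def MemLpOn {d N : ℕ} (p : ℝ) (O : Set (Rd d)) (u : Rd d → Vec N) : Prop :=
  MemLp u (ENNReal.ofReal p) (volume.restrict O)

def LpNormOn {d N : ℕ} (p : ℝ) (O : Set (Rd d)) (u : Rd d → Vec N) : ℝ :=
  (eLpNorm (fun x => eN (u x)) (ENNReal.ofReal p) (volume.restrict O)).toReal

/-- The conjugate exponent `p' = p/(p-1)`. -/
def conjExp (p : ℝ) : ℝ := p / (p - 1)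

/-- Weak convergence in `L^p(O; ℝ^N)` of a family along a filter. -/
def WeakLpTendsto {d N : ℕ} (p : ℝ) (O : Set (Rd d)) {ι : Type*} (l : Filter ι)
    (u : ι → Rd d → Vec N) (v : Rd d → Vec N) : Prop :=
  ∀ g : Rd d → Vec N, MemLpOn (conjExp p) O g →
    Tendsto (fun k => ∫ x in O, dot (u k x) (g x)) l (𝓝 (∫ x in O, dot (v x) (g x)))

/-- `p`-equiintegrability of a family in `L^p(O)`. -/
def PEquiintegrable {d N : ℕ} (p : ℝ) (O : Set (Rd d)) {ι : Type*}
    (u : ι → Rd d → Vec N) : Prop :=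
  ∀ η : ℝ, 0 < η → ∃ m : ℝ, 0 < m ∧ ∀ (k : ι) (E : Set (Rd d)), MeasurableSet E → E ⊆ O →
    volume E < ENNReal.ofReal m → ∫ x in E, eN (u k x) ^ p < η

/-- Membership in `L^p(Ω × Q; ℝ^N)`. -/
def MemLpProd {d N : ℕ} (p : ℝ) (Ω : Set (Rd d)) (v : Rd d → Rd d → Vec N) : Prop :=
  MemLp (fun q : Rd d × Rd d => v q.1 q.2) (ENNReal.ofReal p)
    ((volume.restrict Ω).prod (volume.restrict (Qcube d)))

def LpNormProd {d N : ℕ} (p : ℝ) (Ω : Set (Rd d)) (v : Rd d → Rd d → Vec N) : ℝ :=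
  (eLpNorm (fun q : Rd d × Rd d => eN (v q.1 q.2)) (ENNReal.ofReal p)
    ((volume.restrict Ω).prod (volume.restrict (Qcube d)))).toReal

/-- `p`-equiintegrability of a family in `L^p(Ω × Q)`. -/
def PEquiintegrableProd {d N : ℕ} (p : ℝ) (Ω : Set (Rd d)) {ι : Type*}
    (w : ι → Rd d → Rd d → Vec N) : Prop :=
  ∀ η : ℝ, 0 < η → ∃ m : ℝ, 0 < m ∧ ∀ (k : ι) (E : Set (Rd d × Rd d)), MeasurableSet E →
    ((volume.restrict Ω).prod (volume.restrict (Qcube d))) E < ENNReal.ofReal m →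
    ∫ q in E, eN (w k q.1 q.2) ^ p
        ∂((volume.restrict Ω).prod (volume.restrict (Qcube d))) < η

/-! ## Two-scale convergence and unfolding -/

/-- `x ↦ sup_{y ∈ Q̄} |g(x,y)|`. -/
def perSup {d N : ℕ} (g : Rd d → Rd d → Vec N) (x : Rd d) : ℝ :=
  sSup ((fun y => eN (g x y)) '' closure (Qcube d))

/-- Test functions for two-scale convergence: elements of `L^{p'}(Ω; C_per(ℝ^d;ℝ^N))`. -/
def TwoScaleTest {d N : ℕ} (p : ℝ) (Ω : Set (Rd d)) (g : Rd d → Rd d → Vec N) : Prop :=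
  (∀ x, Continuous (g x)) ∧ (∀ x, Zper (g x)) ∧
    MemLp (perSup g) (ENNReal.ofReal (conjExp p)) (volume.restrict Ω)

/-- Weak two-scale convergence in `L^p`, along a filter `l` with scales `η`. -/
def WeakTwoScale {d N : ℕ} (p : ℝ) (Ω : Set (Rd d)) {ι : Type*} (l : Filter ι) (η : ι → ℝ)
    (u : ι → Rd d → Vec N) (v : Rd d → Rd d → Vec N) : Prop :=
  ∀ g : Rd d → Rd d → Vec N, TwoScaleTest p Ω g →
    Tendsto (fun k => ∫ x in Ω, dot (u k x) (g x ((η k)⁻¹ • x))) l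
      (𝓝 (∫ x in Ω, ∫ y in Qcube d, dot (v x y) (g x y)))

/-- Strong two-scale convergence in `L^p`. -/
def StrongTwoScale {d N : ℕ} (p : ℝ) (Ω : Set (Rd d)) {ι : Type*} (l : Filter ι) (η : ι → ℝ)
    (u : ι → Rd d → Vec N) (v : Rd d → Rd d → Vec N) : Prop :=
  WeakTwoScale p Ω l η u v ∧ Tendsto (fun k => LpNormOn p Ω (u k)) l (𝓝 (LpNormProd p Ω v))

/-- The unfolding operator `S_ε v (x,y) = ṽ(ε⌊x/ε⌋ + εy)`, where `ṽ` is the extension of `v`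
by `0` outside `Ω`. -/
def unfold {d N : ℕ} (ε : ℝ) (Ω : Set (Rd d)) (v : Rd d → Vec N) :
    Rd d → Rd d → Vec N :=
  fun x y => Set.indicator Ω v (fun i => ε * ((⌊x i / ε⌋ : ℝ) + y i))

/-! ## The energy densities and their hypotheses -/

def H1soft {N : ℕ} (f0 : ℝ → Vec N → ℝ) : Prop := ∀ ε : ℝ, 0 < ε → Continuous (f0 ε)

def H1stiff {d N : ℕ} (f1 : Rd d → Vec N → ℝ) : Prop :=
  (∀ ξ, Measurable fun x => f1 x ξ) ∧ ∀ x, Continuous (f1 x)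

def H2 {d N : ℕ} (f1 : Rd d → Vec N → ℝ) : Prop :=
  ∀ (x : Rd d) (z : Fin d → ℤ) (ξ : Vec N), f1 (tr z x) ξ = f1 x ξ

def H3soft {N : ℕ} (p a lam Lam : ℝ) (f0 : ℝ → Vec N → ℝ) : Prop :=
  0 < a ∧ 0 < lam ∧ 0 < Lam ∧
    ∀ ε : ℝ, 0 < ε → ∀ ξ, lam * (-a + eN ξ ^ p) ≤ f0 ε ξ ∧ f0 ε ξ ≤ Lam * (1 + eN ξ ^ p)

def H3stiff {d N : ℕ} (p a lam Lam : ℝ) (f1 : Rd d → Vec N → ℝ) : Prop :=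
  0 < a ∧ 0 < lam ∧ 0 < Lam ∧
    ∀ (x : Rd d) (ξ : Vec N), lam * (-a + eN ξ ^ p) ≤ f1 x ξ ∧ f1 x ξ ≤ Lam * (1 + eN ξ ^ p)

def H4soft {N : ℕ} (p mu : ℝ) (f0 : ℝ → Vec N → ℝ) : Prop :=
  0 < mu ∧ ∀ ε : ℝ, 0 < ε → ∀ ξ ζ : Vec N,
    |f0 ε ξ - f0 ε ζ| ≤ mu * (1 + eN ξ ^ (p - 1) + eN ζ ^ (p - 1)) * eN (ξ - ζ)

def H4stiff {d N : ℕ} (p mu : ℝ) (f1 : Rd d → Vec N → ℝ) : Prop :=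
  0 < mu ∧ ∀ (x : Rd d) (ξ ζ : Vec N),
    |f1 x ξ - f1 x ζ| ≤ mu * (1 + eN ξ ^ (p - 1) + eN ζ ^ (p - 1)) * eN (ξ - ζ)

def H5 {N : ℕ} (f0 : ℝ → Vec N → ℝ) (f0lim : Vec N → ℝ) : Prop :=
  ∀ ξ, Tendsto (fun ε => f0 ε ξ) (𝓝[>] (0 : ℝ)) (𝓝 (f0lim ξ))

/-! ## The admissible class: Assumptions 1 and 2 -/

/-- Assumption 1 (null average). -/
def NullAverage {d N M : ℕ} (p : ℝ) (A : Fin d → (Vec N →ₗ[ℝ] Vec M))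
    (D0 : Set (Rd d)) : Prop :=
  ∀ u : Rd d → Vec N, MemLp u (ENNReal.ofReal p) (volume.restrict (Qcube d)) → Zper u →
    (∀ᵐ y ∂volume.restrict (Qcube d \ D0), u y = 0) → AFreeTorus A u →
    (∫ y in Qcube d, u y) = 0

/-- Assumption 2 (`𝒜`-free extension operators on the perforated domains). -/
def ExtensionProperty {d N M : ℕ} (p : ℝ) (A : Fin d → (Vec N →ₗ[ℝ] Vec M))
    (Ω D0 : Set (Rd d)) (c : ℝ) (E : ℝ → (Rd d → Vec N) → (Rd d → Vec N)) : Prop :=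
  0 < c ∧
  (∀ ε : ℝ, 0 < ε → ∀ u : Rd d → Vec N, MemLpOn p Ω u → AFreeOn A Ω u →
    (∀ᵐ x ∂volume.restrict (stiffPart ε Ω D0), E ε u x = u x) ∧
    MemLpOn p Ω (E ε u) ∧
    LpNormOn p Ω (E ε u) ≤ c * LpNormOn p (stiffPart ε Ω D0) u ∧
    AFreeOn A Ω (E ε u)) ∧
  (∀ u : ℝ → Rd d → Vec N, (∀ ε : ℝ, 0 < ε → MemLpOn p Ω (u ε) ∧ AFreeOn A Ω (u ε)) →
    PEquiintegrable p Ω (fun ε : {ε : ℝ // 0 < ε} => u ε.1) →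
    PEquiintegrable p Ω (fun ε : {ε : ℝ // 0 < ε} => E ε.1 (u ε.1)))

/-- An admissible operator: constant rank together with Assumptions 1 and 2. -/
def Admissible {d N M : ℕ} (p : ℝ) (A : Fin d → (Vec N →ₗ[ℝ] Vec M))
    (Ω D0 : Set (Rd d)) : Prop :=
  ConstantRank A ∧ NullAverage p A D0 ∧ ∃ c E, ExtensionProperty p A Ω D0 c E

/-! ## High-contrast convergence -/

/-- High-contrast convergence of a family `u` (with scales `η`) to `v`. -/
def HCTendsto {d N M : ℕ} (p : ℝ) (A : Fin d → (Vec N →ₗ[ℝ] Vec M)) (Ω D0 : Set (Rd d))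
    {ι : Type*} (l : Filter ι) (η : ι → ℝ) (u : ι → Rd d → Vec N) (v : Rd d → Vec N) : Prop :=
  WeakLpTendsto p Ω l (fun k x => η k • u k x) 0 ∧
  ∃ ut : ι → Rd d → Vec N,
    (∀ k, MemLpOn p Ω (ut k) ∧ AFreeOn A Ω (ut k)) ∧
    (∀ k, ∀ᵐ x ∂volume.restrict (stiffPart (η k) Ω D0), u k x = ut k x) ∧
    WeakLpTendsto p Ω l ut v

/-! ## The functionals -/

def U1 {d N M : ℕ} (p : ℝ) (A : Fin d → (Vec N →ₗ[ℝ] Vec M)) (Ω : Set (Rd d)) :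
    Set (Rd d → Vec N) :=
  {u | MemLpOn p Ω u ∧ AFreeOn A Ω u}

def U0 {d N M : ℕ} (p : ℝ) (A : Fin d → (Vec N →ₗ[ℝ] Vec M)) (Ω D0 Ω' : Set (Rd d)) :
    Set (Rd d → Rd d → Vec N) :=
  {u | MemLpProd p Ω u ∧ (∀ x, Zper (u x)) ∧
    (∀ x, ∀ᵐ y ∂volume.restrict (Qcube d \ D0), u x y = 0) ∧
    (∀ᵐ x ∂volume.restrict Ω', AFreeTorus A (u x))}

/-- The constant `α₀`. -/
def alpha0 {d N M : ℕ} (p : ℝ) (A : Fin d → (Vec N →ₗ[ℝ] Vec M)) (Ω D0 : Set (Rd d))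
    (f0lim : Vec N → ℝ) : ℝ :=
  sSup {c : ℝ | ∃ Ω' : Set (Rd d), CpctIn Ω' Ω ∧
    c = sInf {e : ℝ | ∃ u ∈ U0 p A Ω D0 Ω', e = ∫ x in Ω', ∫ y in D0, f0lim (u x y)}}

/-- The `ℤ^d`-periodization of `D₁ = Q ∖ D₀`. -/
def D1per {d : ℕ} (D0 : Set (Rd d)) : Set (Rd d) :=
  ⋃ z : Fin d → ℤ, tr z '' (Qcube d \ D0)

/-- The homogenized stiff energy density `f_hom`. -/
def fhom {d N M : ℕ} (p : ℝ) (A : Fin d → (Vec N →ₗ[ℝ] Vec M)) (D0 : Set (Rd d))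
    (f1 : Rd d → Vec N → ℝ) (ξ : Vec N) : ℝ :=
  liminf (fun k : ℕ =>
    sInf {c : ℝ | ∃ v : Rd d → Vec N,
      MemLp v (ENNReal.ofReal p) (volume.restrict (Qcube d)) ∧ Zper v ∧
      (∫ y in Qcube d, v y) = 0 ∧ AFreeTorus A v ∧
      c = ∫ y in Qcube d ∩ {y | (k : ℝ) • y ∈ D1per D0}, f1 ((k : ℝ) • y) (ξ + v y)}) atTop

/-- The high-contrast energy `F_ε`. -/
def Feps {d N M : ℕ} (p : ℝ) (A : Fin d → (Vec N →ₗ[ℝ] Vec M)) (Ω D0 : Set (Rd d))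
    (f0 : ℝ → Vec N → ℝ) (f1 : Rd d → Vec N → ℝ) (ε : ℝ) (u : Rd d → Vec N) : EReal :=
  if u ∈ U1 p A Ω then
    (((∫ x in softPart ε Ω D0, f0 ε (ε • u x)) +
      ∫ x in stiffPart ε Ω D0, f1 (ε⁻¹ • x) (u x) : ℝ) : EReal)
  else ⊤

/-- The soft energy `F_{0,ε}`. -/
def F0eps {d N M : ℕ} (p : ℝ) (A : Fin d → (Vec N →ₗ[ℝ] Vec M)) (Ω D0 : Set (Rd d))
    (f0 : ℝ → Vec N → ℝ) (ε : ℝ) (u : Rd d → Vec N) : EReal :=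
  if u ∈ U1 p A Ω then ((∫ x in softPart ε Ω D0, f0 ε (ε • u x) : ℝ) : EReal) else ⊤

/-- The stiff energy `F_{1,ε}`. -/
def F1eps {d N M : ℕ} (p : ℝ) (A : Fin d → (Vec N →ₗ[ℝ] Vec M)) (Ω D0 : Set (Rd d))
    (f1 : Rd d → Vec N → ℝ) (ε : ℝ) (u : Rd d → Vec N) : EReal :=
  if u ∈ U1 p A Ω then ((∫ x in stiffPart ε Ω D0, f1 (ε⁻¹ • x) (u x) : ℝ) : EReal) else ⊤

/-- The limiting functional `F = α₀ + ∫_Ω f_hom(u)`. -/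
def Flim {d N M : ℕ} (p : ℝ) (A : Fin d → (Vec N →ₗ[ℝ] Vec M)) (Ω D0 : Set (Rd d))
    (f0lim : Vec N → ℝ) (f1 : Rd d → Vec N → ℝ) (u : Rd d → Vec N) : EReal :=
  if u ∈ U1 p A Ω then
    ((alpha0 p A Ω D0 f0lim + ∫ x in Ω, fhom p A D0 f1 (u x) : ℝ) : EReal)
  else ⊤

/-- The limiting soft functional `F₀`. -/
def F0lim {d N M : ℕ} (p : ℝ) (A : Fin d → (Vec N →ₗ[ℝ] Vec M)) (Ω D0 : Set (Rd d))
    (f0lim : Vec N → ℝ) (u : Rd d → Vec N) : EReal :=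
  if u =ᵐ[volume.restrict Ω] (0 : Rd d → Vec N) then ((alpha0 p A Ω D0 f0lim : ℝ) : EReal)
  else ⊤

/-- The limiting stiff functional `F₁`. -/
def F1lim {d N M : ℕ} (p : ℝ) (A : Fin d → (Vec N →ₗ[ℝ] Vec M)) (Ω D0 : Set (Rd d))
    (f1 : Rd d → Vec N → ℝ) (u : Rd d → Vec N) : EReal :=
  if u ∈ U1 p A Ω then ((∫ x in Ω, fhom p A D0 f1 (u x) : ℝ) : EReal) else ⊤

/-! ## Higher-order operators, potentials, Sobolev spaces -/

/-- The pointwise value of the formal adjoint of the `k`-th order homogeneous operator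
with coefficients `A`. -/
def adjOp {d k N M : ℕ} (A : (Fin k → Fin d) → (Vec N →ₗ[ℝ] Vec M)) (ψ : Rd d → Vec M)
    (x : Rd d) : Vec N :=
  fun n => (-1 : ℝ) ^ k * ∑ j : Fin k → Fin d,
    dot (A j (Pi.single n 1)) (iteratedFDeriv ℝ k ψ x (fun t => Pi.single (j t) 1))

/-- `𝒜 u = 0` in `W^{-k,p}(O)` for a `k`-th order operator. -/
def AFreeOnK {d k N M : ℕ} (A : (Fin k → Fin d) → (Vec N →ₗ[ℝ] Vec M)) (O : Set (Rd d))
    (u : Rd d → Vec N) : Prop :=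
  ∀ ψ : Rd d → Vec M, TestOn O ψ → ∫ x in O, dot (u x) (adjOp A ψ x) = 0

/-- The symbol of a `k`-th order homogeneous operator. -/
def symbK {d k N M : ℕ} (A : (Fin k → Fin d) → (Vec N →ₗ[ℝ] Vec M)) (ω : Rd d) :
    Vec N →ₗ[ℝ] Vec M :=
  ∑ j : Fin k → Fin d, (∏ t, ω (j t)) • A j

def ConstantRankK {d k N M : ℕ} (A : (Fin k → Fin d) → (Vec N →ₗ[ℝ] Vec M)) : Prop :=
  ∃ r : ℕ, ∀ ω : Rd d, ω ≠ 0 → Module.finrank ℝ (LinearMap.range (symbK A ω)) = r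

/-- `g` is the weak partial derivative `∂_j w` (for the `m`-tuple `j` of directions) on `U`. -/
def IsWeakDerivOn {d m M : ℕ} (U : Set (Rd d)) (j : Fin m → Fin d) (w g : Rd d → Vec M) :
    Prop :=
  ∀ φ : Rd d → ℝ, ContDiff ℝ (⊤ : ℕ∞) φ → HasCompactSupport φ → tsupport φ ⊆ U →
    ∀ cc : Fin M, (∫ x in U, w x cc * iteratedFDeriv ℝ m φ x (fun t => Pi.single (j t) 1))
      = (-1 : ℝ) ^ m * ∫ x in U, g x cc * φ x

/-- Membership in the Sobolev space `W^{ℓ,p}(U; ℝ^M)`. -/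
def MemW {d M : ℕ} (ℓ : ℕ) (p : ℝ) (U : Set (Rd d)) (w : Rd d → Vec M) : Prop :=
  MemLpOn p U w ∧ ∀ m : ℕ, m ≤ ℓ → ∀ j : Fin m → Fin d,
    ∃ g : Rd d → Vec M, MemLpOn p U g ∧ IsWeakDerivOn U j w g

/-- A choice of the weak derivative `∂_j w` on `U` (defaults to `0`). -/
def wDeriv {d m M : ℕ} (p : ℝ) (U : Set (Rd d)) (j : Fin m → Fin d) (w : Rd d → Vec M) :
    Rd d → Vec M :=
  if h : ∃ g : Rd d → Vec M, MemLpOn p U g ∧ IsWeakDerivOn U j w g then h.choose else 0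

/-- The `L^p(U)` norm of the `ℓ`-th order (weak) gradient `∇^ℓ w`. -/
def gradLp {d M : ℕ} (ℓ : ℕ) (p : ℝ) (U : Set (Rd d)) (w : Rd d → Vec M) : ℝ :=
  (eLpNorm (fun x => Real.sqrt (∑ j : Fin ℓ → Fin d, eN (wDeriv p U j w x) ^ 2))
    (ENNReal.ofReal p) (volume.restrict U)).toReal

/-- The action `ℬ w = ∑_{|j|=ℓ} B^{(j)} ∂_j w` of an `ℓ`-th order operator on a Sobolev
function, through its weak derivatives. -/
def opApplyW {d ℓ M N : ℕ} (p : ℝ) (U : Set (Rd d))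
    (B : (Fin ℓ → Fin d) → (Vec M →ₗ[ℝ] Vec N)) (w : Rd d → Vec M) : Rd d → Vec N :=
  fun x => ∑ j : Fin ℓ → Fin d, B j (wDeriv p U j w x)

/-- `U` is an `𝒜`-extension domain (for a `k`-th order operator `𝒜`). -/
def AExtensionDomainK {d k N M : ℕ} (p : ℝ) (A : (Fin k → Fin d) → (Vec N →ₗ[ℝ] Vec M))
    (U : Set (Rd d)) : Prop :=
  ∃ (E : (Rd d → Vec N) → (Rd d → Vec N)) (c : ℝ), 0 < c ∧
    ∀ u : Rd d → Vec N, MemLpOn p U u → AFreeOnK A U u →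
      (∀ᵐ x ∂volume.restrict U, E u x = u x) ∧
      MemLp (E u) (ENNReal.ofReal p) volume ∧
      LpNormOn p Set.univ (E u) ≤ c * LpNormOn p U u ∧
      AFreeOnK A Set.univ (E u)

/-- `U` is an `𝒜`-extension domain (first-order version). -/
def AExtensionDomain1 {d N M : ℕ} (p : ℝ) (A : Fin d → (Vec N →ₗ[ℝ] Vec M))
    (U : Set (Rd d)) : Prop :=
  ∃ (E : (Rd d → Vec N) → (Rd d → Vec N)) (c : ℝ), 0 < c ∧
    ∀ u : Rd d → Vec N, MemLpOn p U u → AFreeOn A U u →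
      (∀ᵐ x ∂volume.restrict U, E u x = u x) ∧
      MemLp (E u) (ENNReal.ofReal p) volume ∧
      LpNormOn p Set.univ (E u) ≤ c * LpNormOn p U u ∧
      AFreeOn A Set.univ (E u)

/-- The `W^{m,q}(ℝ^d)` norm of a smooth function. -/
def WmNorm {d M : ℕ} (m : ℕ) (q : ℝ) (ψ : Rd d → Vec M) : ℝ :=
  ∑ j ∈ Finset.range (m + 1),
    (eLpNorm (fun x => ‖iteratedFDeriv ℝ j ψ x‖) (ENNReal.ofReal q) volume).toReal

/-- The `W^{-m,p}(ℝ^d)` norm of `𝒜 u`, via duality with `W^{m,p'}`. -/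
def negNorm {d k N M : ℕ} (m : ℕ) (p : ℝ) (A : (Fin k → Fin d) → (Vec N →ₗ[ℝ] Vec M))
    (u : Rd d → Vec N) : ℝ :=
  sSup {c : ℝ | ∃ ψ : Rd d → Vec M, ContDiff ℝ (⊤ : ℕ∞) ψ ∧ HasCompactSupport ψ ∧
    WmNorm m (conjExp p) ψ ≤ 1 ∧ c = ∫ x, dot (u x) (adjOp A ψ x)}

/-! ## Fourier-analytic material -/

/-- Fourier transform of a (complexified, vector-valued) function. -/
def ftC {d N : ℕ} (f : Rd d → (Fin N → ℂ)) (ω : Rd d) : Fin N → ℂ :=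
  ∫ x : Rd d, Complex.exp (-(2 * Real.pi * Complex.I) * (∑ i, (x i : ℂ) * (ω i : ℂ))) • f x

/-- Complexification of a real vector-valued map. -/
def cplx {d N : ℕ} (u : Rd d → Vec N) : Rd d → (Fin N → ℂ) := fun x n => ((u x n : ℝ) : ℂ)

/-- Action on `ℂ^N` of (the complexification of) a real linear map on `ℝ^N`. -/
def matC {N : ℕ} (P : Vec N →ₗ[ℝ] Vec N) (v : Fin N → ℂ) : Fin N → ℂ :=
  fun m => ∑ n, ((P (Pi.single n 1) m : ℝ) : ℂ) * v n

end HC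


namespace HC

open Bornology

/-- First-order constant-coefficient operators, given by their coefficient matrices. -/
abbrev DiffOp (d N M : ℕ) := Fin d → (Vec N →ₗ[ℝ] Vec M)

variable {d N M : ℕ} {p C s r : ℝ} {A : DiffOp d N M} {O Ω D0 S : Set (Rd d)}
  {f1 : Rd d → Vec N → ℝ} {u v : Rd d → Vec N} {g h : Rd d → ℝ}
  {x X : Rd d} {z : Fin d → ℤ} {B : ℝ} {f : Rd d → Vec N → ℝ}

/-! ### Part 1: elementary inequalities, growth conditions -/

lemma norm_le_eN (ξ : Vec N) : ‖ξ‖ ≤ eN ξ := by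
  unfold eN
  refine (pi_norm_le_iff_of_nonneg (Real.sqrt_nonneg _)).2 fun i => ?_
  rw [Real.norm_eq_abs]
  refine Real.abs_le_sqrt ?_
  exact Finset.single_le_sum (f := fun j => ξ j ^ 2) (fun j _ => sq_nonneg _) (Finset.mem_univ i)

lemma eN_nonneg (ξ : Vec N) : 0 ≤ eN ξ := Real.sqrt_nonneg _

lemma eN_le_norm (ξ : Vec N) : eN ξ ≤ ((N : ℝ) + 1) * ‖ξ‖ := by
  unfold eN
  rw [Real.sqrt_le_iff]
  refine ⟨by positivity, ?_⟩
  have h : ∀ j ∈ Finset.univ, ξ j ^ 2 ≤ ‖ξ‖ ^ 2 := fun j _ => by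
    have := norm_le_pi_norm ξ j
    rw [Real.norm_eq_abs] at this
    calc ξ j ^ 2 = |ξ j| ^ 2 := (sq_abs _).symm
      _ ≤ _ := by gcongr
  have h2 := Finset.sum_le_card_nsmul _ _ _ h
  simp only [Finset.card_univ, Fintype.card_fin, nsmul_eq_mul] at h2
  have h3 : (0 : ℝ) ≤ N := Nat.cast_nonneg N
  have h4 : 0 ≤ ‖ξ‖ ^ 2 := by positivity
  nlinarith [mul_nonneg h3 h4, mul_nonneg (mul_nonneg h3 h3) h4]

/-- Convenient form of the growth hypotheses. -/
structure GF {d N : ℕ} (p C : ℝ) (f : Rd d → Vec N → ℝ) : Prop where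
  one_le : 1 ≤ C
  meas : Measurable (Function.uncurry f)
  per : ∀ (x : Rd d) (z : Fin d → ℤ) (ξ : Vec N), f (tr z x) ξ = f x ξ
  coer : ∀ x ξ, ‖ξ‖ ^ p ≤ C * (f x ξ + C)
  upper : ∀ x ξ, |f x ξ| ≤ C * (1 + ‖ξ‖ ^ p)
  lip : ∀ x ξ ζ, |f x ξ - f x ζ| ≤ C * (1 + ‖ξ‖ ^ (p - 1) + ‖ζ‖ ^ (p - 1)) * ‖ξ - ζ‖

lemma GF.lower (h : GF p C f) (x : Rd d) (ξ : Vec N) :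
    -C ≤ f x ξ := by
  have h1 := h.coer x ξ
  have h2 : 0 ≤ ‖ξ‖ ^ p := by positivity
  have h3 := h.one_le
  by_contra hc
  push Not at hc
  nlinarith

lemma exists_GF {p a lam Lam mu : ℝ} (hp : 1 < p)
    (h1 : H1stiff f1) (h2 : H2 f1) (h3 : H3stiff p a lam Lam f1) (h4 : H4stiff p mu f1) :
    ∃ C, GF p C f1 := by
  obtain ⟨ha, hlam, hLam, h3⟩ := h3
  obtain ⟨hmu, h4⟩ := h4
  set R : ℝ := (N : ℝ) + 1 with hR
  have hR1 : 1 ≤ R := by simp [hR]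
  have hR0 : 0 ≤ R := by linarith
  have hRp : 1 ≤ R ^ p := Real.one_le_rpow hR1 (by linarith)
  have hRp1 : 1 ≤ R ^ (p - 1) := Real.one_le_rpow hR1 (by linarith)
  have hup : ∀ ξ : Vec N, eN ξ ^ p ≤ R ^ p * ‖ξ‖ ^ p := fun ξ => by
    rw [← Real.mul_rpow hR0 (norm_nonneg _)]
    exact Real.rpow_le_rpow (eN_nonneg _) (eN_le_norm _) (by linarith)
  have hup1 : ∀ ξ : Vec N, eN ξ ^ (p - 1) ≤ R ^ (p - 1) * ‖ξ‖ ^ (p - 1) := fun ξ => by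
    rw [← Real.mul_rpow hR0 (norm_nonneg _)]
    exact Real.rpow_le_rpow (eN_nonneg _) (eN_le_norm _) (by linarith)
  have hlo : ∀ ξ : Vec N, ‖ξ‖ ^ p ≤ eN ξ ^ p := fun ξ =>
    Real.rpow_le_rpow (norm_nonneg _) (norm_le_eN _) (by linarith)
  set C : ℝ := 1 + 1 / lam + lam * a + Lam * R ^ p + mu * R ^ (p - 1) * R with hC
  have e1 : 0 < 1 / lam := by positivity
  have e2 : 0 < lam * a := by positivity
  have e3 : 0 < Lam * R ^ p := by positivity
  have e4 : 0 < mu * R ^ (p - 1) * R := by positivity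
  refine ⟨C, ?_, ?_, h2, ?_, ?_, ?_⟩
  · linarith
  · have := stronglyMeasurable_uncurry_of_continuous_of_stronglyMeasurable
      (u := fun (ξ : Vec N) (x : Rd d) => f1 x ξ) (fun x => h1.2 x)
      (fun ξ => (h1.1 ξ).stronglyMeasurable)
    exact this.measurable.comp measurable_swap
  · intro x ξ
    have h5 := (h3 x ξ).1
    have h6 := hlo ξ
    have h7 : 0 ≤ ‖ξ‖ ^ p := by positivity
    have h8 : 0 ≤ eN ξ ^ p := by have := eN_nonneg ξ; positivity
    have h9 : eN ξ ^ p ≤ (1 / lam) * (f1 x ξ + lam * a) := by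
      rw [one_div, ← div_eq_inv_mul, le_div_iff₀ hlam]; nlinarith
    have h10 : 0 ≤ f1 x ξ + lam * a := by nlinarith
    calc ‖ξ‖ ^ p ≤ (1 / lam) * (f1 x ξ + lam * a) := h6.trans h9
      _ ≤ C * (f1 x ξ + lam * a) := by
        apply mul_le_mul_of_nonneg_right _ h10; linarith
      _ ≤ _ := by apply mul_le_mul_of_nonneg_left _ (by linarith); linarith
  · intro x ξ
    have h5 := h3 x ξ
    have h7 : 0 ≤ ‖ξ‖ ^ p := by positivity
    have h8 : 0 ≤ eN ξ ^ p := by have := eN_nonneg ξ; positivity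
    rw [abs_le]
    constructor
    · nlinarith [h5.1]
    · have h6 := hup ξ
      calc f1 x ξ ≤ Lam * (1 + eN ξ ^ p) := h5.2
        _ ≤ Lam * (R ^ p + R ^ p * ‖ξ‖ ^ p) := by gcongr
        _ = Lam * R ^ p * (1 + ‖ξ‖ ^ p) := by ring
        _ ≤ _ := by apply mul_le_mul_of_nonneg_right _ (by positivity); linarith
  · intro x ξ ζ
    have q1 : 0 ≤ ‖ξ‖ ^ (p - 1) := by positivity
    have q2 : 0 ≤ ‖ζ‖ ^ (p - 1) := by positivity
    have q3 := hup1 ξ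
    have q4 := hup1 ζ
    have q5 := eN_le_norm (ξ - ζ)
    have q6 := eN_nonneg (ξ - ζ)
    have q7 : 0 ≤ eN ξ ^ (p - 1) := by have := eN_nonneg ξ; positivity
    have q8 : 0 ≤ eN ζ ^ (p - 1) := by have := eN_nonneg ζ; positivity
    calc |f1 x ξ - f1 x ζ| ≤ mu * (1 + eN ξ ^ (p - 1) + eN ζ ^ (p - 1)) * eN (ξ - ζ) := h4 x ξ ζ
      _ ≤ mu * (R ^ (p - 1) + R ^ (p - 1) * ‖ξ‖ ^ (p - 1) + R ^ (p - 1) * ‖ζ‖ ^ (p - 1))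
          * (R * ‖ξ - ζ‖) := by gcongr
      _ = mu * R ^ (p - 1) * R * ((1 + ‖ξ‖ ^ (p - 1) + ‖ζ‖ ^ (p - 1)) * ‖ξ - ζ‖) := by ring
      _ ≤ C * ((1 + ‖ξ‖ ^ (p - 1) + ‖ζ‖ ^ (p - 1)) * ‖ξ - ζ‖) := by
        apply mul_le_mul_of_nonneg_right _ (by positivity); linarith
      _ = _ := by ring

lemma young_aux (hp : 1 < p) {η x y : ℝ} (hη : 0 < η) (hx : 0 ≤ x) (hy : 0 ≤ y) :
    x ^ (p - 1) * y ≤ η * x ^ p + (1 / η) ^ (p - 1) * y ^ p := by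
  have h1 : 0 ≤ (1 / η) ^ (p - 1) * y ^ p := by positivity
  have h2 : 0 ≤ η * x ^ p := by positivity
  have key : ∀ t : ℝ, 0 ≤ t → t ^ (p - 1) * t = t ^ p := fun t ht => by
    rcases ht.eq_or_lt with rfl | ht
    · rw [Real.zero_rpow (by linarith : p ≠ 0)]; simp
    · rw [← Real.rpow_add_one ht.ne']; ring_nf
  rcases le_or_gt y (η * x) with h | h
  · calc x ^ (p - 1) * y ≤ x ^ (p - 1) * (η * x) := by gcongr
      _ = η * (x ^ (p - 1) * x) := by ring
      _ = η * x ^ p := by rw [key x hx]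
      _ ≤ _ := by linarith
  · have h3 : x ≤ (1 / η) * y := by
      rw [one_div, ← div_eq_inv_mul, le_div_iff₀ hη]; linarith
    calc x ^ (p - 1) * y ≤ ((1 / η) * y) ^ (p - 1) * y := by gcongr
      _ = (1 / η) ^ (p - 1) * (y ^ (p - 1) * y) := by
        rw [Real.mul_rpow (by positivity) hy]; ring
      _ = (1 / η) ^ (p - 1) * y ^ p := by rw [key y hy]
      _ ≤ _ := by linarith

/-- The `p`-modulus-of-continuity form of the local Lipschitz condition. -/
lemma GF.modulus (hp : 1 < p) (h : GF p C f)
    {η : ℝ} (hη : 0 < η) : ∃ D, 0 ≤ D ∧ ∀ x ξ ζ,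
      |f x ξ - f x ζ| ≤ η * (1 + ‖ξ‖ ^ p + ‖ζ‖ ^ p) + D * ‖ξ - ζ‖ ^ p := by
  have hC := h.one_le
  have hη' : 0 < η / C := by positivity
  refine ⟨3 * C * (1 / (η / C)) ^ (p - 1), by positivity, fun x ξ ζ => ?_⟩
  have y0 := young_aux hp hη' zero_le_one (norm_nonneg (ξ - ζ))
  have y1 := young_aux hp hη' (norm_nonneg ξ) (norm_nonneg (ξ - ζ))
  have y2 := young_aux hp hη' (norm_nonneg ζ) (norm_nonneg (ξ - ζ))
  simp only [Real.one_rpow] at y0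
  calc |f x ξ - f x ζ| ≤ C * (1 * ‖ξ - ζ‖ + ‖ξ‖ ^ (p - 1) * ‖ξ - ζ‖
        + ‖ζ‖ ^ (p - 1) * ‖ξ - ζ‖) := by
        have := h.lip x ξ ζ
        calc _ ≤ _ := this
          _ = _ := by ring
    _ ≤ C * ((η / C * 1 + (1 / (η / C)) ^ (p - 1) * ‖ξ - ζ‖ ^ p)
        + (η / C * ‖ξ‖ ^ p + (1 / (η / C)) ^ (p - 1) * ‖ξ - ζ‖ ^ p)
        + (η / C * ‖ζ‖ ^ p + (1 / (η / C)) ^ (p - 1) * ‖ξ - ζ‖ ^ p)) := by gcongr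
    _ = C * (η / C) * (1 + ‖ξ‖ ^ p + ‖ζ‖ ^ p)
        + 3 * C * (1 / (η / C)) ^ (p - 1) * ‖ξ - ζ‖ ^ p := by ring
    _ = _ := by rw [mul_div_cancel₀ η (by linarith : C ≠ 0)]

lemma norm_add_rpow_le {E : Type*} [SeminormedAddCommGroup E] (hp : 1 < p) (a b : E) :
    ‖a + b‖ ^ p ≤ 2 ^ p * (‖a‖ ^ p + ‖b‖ ^ p) := by
  have h0 : 0 ≤ p := by linarith
  have h1 : ‖a + b‖ ≤ 2 * max ‖a‖ ‖b‖ := by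
    have := norm_add_le a b
    have h2 := le_max_left ‖a‖ ‖b‖
    have h3 := le_max_right ‖a‖ ‖b‖
    linarith
  have hm : 0 ≤ max ‖a‖ ‖b‖ := le_max_of_le_left (norm_nonneg _)
  calc ‖a + b‖ ^ p ≤ (2 * max ‖a‖ ‖b‖) ^ p := Real.rpow_le_rpow (norm_nonneg _) h1 h0
    _ = 2 ^ p * (max ‖a‖ ‖b‖) ^ p := Real.mul_rpow (by norm_num) hm
    _ ≤ _ := by
      gcongr
      have q1 : 0 ≤ ‖a‖ ^ p := by positivity
      have q2 : 0 ≤ ‖b‖ ^ p := by positivity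
      rcases max_choice ‖a‖ ‖b‖ with h | h <;> rw [h] <;> linarith

lemma norm_sub_rpow_le {E : Type*} [SeminormedAddCommGroup E] (hp : 1 < p) (a b : E) :
    ‖a - b‖ ^ p ≤ 2 ^ p * (‖a‖ ^ p + ‖b‖ ^ p) := by
  have := norm_add_rpow_le hp a (-b)
  rwa [norm_neg, ← sub_eq_add_neg] at this

lemma norm_rpow_le_sub {E : Type*} [SeminormedAddCommGroup E] (hp : 1 < p) (a b : E) :
    ‖a‖ ^ p ≤ 2 ^ p * (‖a - b‖ ^ p + ‖b‖ ^ p) := by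
  have := norm_add_rpow_le hp (a - b) b
  rwa [sub_add_cancel] at this

/-! ### `MemLpOn` and integrability of powers -/

lemma MemLpOn.integrable_rpow (hp : 1 < p)
    (h : MemLpOn p O u) : IntegrableOn (fun x => ‖u x‖ ^ p) O := by
  have := MemLp.integrable_norm_rpow (μ := volume.restrict O) (f := u) h (by simp; linarith)
    ENNReal.ofReal_ne_top
  rw [ENNReal.toReal_ofReal (by linarith)] at this
  exact this

lemma memLpOn_of_integrable (hp : 1 < p)
    (hm : AEStronglyMeasurable u (volume.restrict O))
    (h : IntegrableOn (fun x => ‖u x‖ ^ p) O) : MemLpOn p O u := by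
  unfold MemLpOn
  rw [← integrable_norm_rpow_iff hm (by simp; linarith) ENNReal.ofReal_ne_top,
    ENNReal.toReal_ofReal (by linarith)]
  exact h

lemma MemLpOn.mono {O O' : Set (Rd d)}
    (h : MemLpOn p O u) (hs : O' ⊆ O) : MemLpOn p O' u :=
  MemLp.mono_measure (Measure.restrict_mono hs le_rfl) h

lemma MemLpOn.aesm
    (h : MemLpOn p O u) : AEStronglyMeasurable u (volume.restrict O) := MemLp.aestronglyMeasurable h

lemma MemLpOn.integrable (hp : 1 < p) (hO : volume O ≠ ⊤)
    (h : MemLpOn p O u) : IntegrableOn u O := by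
  have : IsFiniteMeasure (volume.restrict O) := ⟨by simpa using lt_top_iff_ne_top.2 hO⟩
  exact MemLp.integrable (by simp; linarith) h

lemma GF.aesm (h : GF p C f)
    (hu : AEStronglyMeasurable u (volume.restrict S)) {φ : Rd d → Rd d}
    (hφ : Measurable φ) : AEStronglyMeasurable (fun x => f (φ x) (u x)) (volume.restrict S) := by
  have := h.meas.comp_aemeasurable (hφ.aemeasurable.prodMk hu.aemeasurable)
  exact this.aestronglyMeasurable

lemma GF.integrable (hp : 1 < p) (h : GF p C f)
    (hS : volume S ≠ ⊤)
    (hu : MemLpOn p S u) {φ : Rd d → Rd d}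
    (hφ : Measurable φ) : IntegrableOn (fun x => f (φ x) (u x)) S := by
  have h1 : IntegrableOn (fun x => C * (1 + ‖u x‖ ^ p)) S :=
    ((integrableOn_const hS).add (hu.integrable_rpow hp)).const_mul C
  refine Integrable.mono' h1 (h.aesm hu.aesm hφ) (.of_forall fun x => ?_)
  exact h.upper _ _

/-! ### The unit cube -/

lemma Qcube_eq (d : ℕ) : Qcube d = Set.pi univ (fun _ => Ioo (0 : ℝ) 1) := by
  ext x; simp [Qcube]

lemma isOpen_Qcube (d : ℕ) : IsOpen (Qcube d) := by
  rw [Qcube_eq]; exact isOpen_set_pi finite_univ (fun _ _ => isOpen_Ioo)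

lemma measurableSet_Qcube (d : ℕ) : MeasurableSet (Qcube d) := (isOpen_Qcube d).measurableSet

lemma volume_Qcube (d : ℕ) : volume (Qcube d) = 1 := by
  rw [Qcube_eq, Real.volume_pi_Ioo]; simp

lemma volume_Qcube_ne (d : ℕ) : volume (Qcube d) ≠ ⊤ := by rw [volume_Qcube]; simp

instance (d : ℕ) : IsProbabilityMeasure (volume.restrict (Qcube d)) :=
  ⟨by simp [volume_Qcube]⟩

lemma isOpen_tr_image (z : Fin d → ℤ) (hS : MeasurableSet S) :
    MeasurableSet (tr z '' S) := by
  have : tr z = (fun x : Rd d => x + (fun i => (z i : ℝ))) := rfl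
  rw [this]
  exact (MeasurableEquiv.addRight (fun i => (z i : ℝ) : Rd d)).measurableSet_image.2 hS

lemma measurableSet_D1per (hD : IsOpen D0) :
    MeasurableSet (D1per D0) :=
  MeasurableSet.iUnion fun z => isOpen_tr_image z ((measurableSet_Qcube d).diff hD.measurableSet)

lemma mem_D1per_tr (z : Fin d → ℤ) (x : Rd d) :
    tr z x ∈ D1per D0 ↔ x ∈ D1per D0 := by
  have key : ∀ (z : Fin d → ℤ) (x : Rd d), x ∈ D1per D0 → tr z x ∈ D1per D0 := by
    intro z x hx
    simp only [D1per, mem_iUnion, mem_image] at hx ⊢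
    obtain ⟨w, y, hy, rfl⟩ := hx
    refine ⟨w + z, y, hy, ?_⟩
    funext i; simp [tr]; ring
  refine ⟨fun h => ?_, key z x⟩
  have := key (-z) _ h
  convert this using 1
  funext i; simp [tr]

/-! ### Part 2: the cell minimum values and `fhom` -/

/-- The perforated cell `Q ∩ {k y ∈ D₁}`. -/
def Dk {d : ℕ} (D0 : Set (Rd d)) (k : ℕ) : Set (Rd d) :=
  Qcube d ∩ {y | (k : ℝ) • y ∈ D1per D0}

/-- Competitors. -/
def Comp {d N M : ℕ} (p : ℝ) (A : DiffOp d N M) (v : Rd d → Vec N) : Prop :=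
  MemLp v (ENNReal.ofReal p) (volume.restrict (Qcube d)) ∧ Zper v ∧
      (∫ y in Qcube d, v y) = 0 ∧ AFreeTorus A v

def cset {d N M : ℕ} (p : ℝ) (A : DiffOp d N M) (D0 : Set (Rd d))
    (f1 : Rd d → Vec N → ℝ) (k : ℕ) (ξ : Vec N) : Set ℝ :=
  {c : ℝ | ∃ v : Rd d → Vec N,
      MemLp v (ENNReal.ofReal p) (volume.restrict (Qcube d)) ∧ Zper v ∧
      (∫ y in Qcube d, v y) = 0 ∧ AFreeTorus A v ∧
      c = ∫ y in Qcube d ∩ {y | (k : ℝ) • y ∈ D1per D0}, f1 ((k : ℝ) • y) (ξ + v y)}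

lemma fhom_eq (p : ℝ) (A : DiffOp d N M) (D0 : Set (Rd d))
    (f1 : Rd d → Vec N → ℝ) (ξ : Vec N) :
    fhom p A D0 f1 ξ = liminf (fun k => sInf (cset p A D0 f1 k ξ)) atTop := rfl

lemma Dk_subset (D0 : Set (Rd d)) (k : ℕ) : Dk D0 k ⊆ Qcube d := inter_subset_left

lemma Dk_ne_top (D0 : Set (Rd d)) (k : ℕ) : volume (Dk D0 k) ≠ ⊤ :=
  ne_top_of_le_ne_top (volume_Qcube_ne d) (measure_mono (Dk_subset D0 k))

lemma Dk_real_le (D0 : Set (Rd d)) (k : ℕ) : volume.real (Dk D0 k) ≤ 1 := by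
  have : volume.real (Qcube d) = 1 := by simp [measureReal_def, volume_Qcube]
  rw [← this]
  exact measureReal_mono (Dk_subset D0 k) (volume_Qcube_ne d)

lemma memLpOn_const (hO : volume O ≠ ⊤) (ξ : Vec N) :
    MemLpOn p O (fun _ => ξ) := by
  have : IsFiniteMeasure (volume.restrict O) := ⟨by simpa using lt_top_iff_ne_top.2 hO⟩
  exact memLp_const ξ

lemma comp_zero (p : ℝ) (A : DiffOp d N M) :
    Comp p A (fun _ => (0 : Vec N)) := by
  refine ⟨memLpOn_const (volume_Qcube_ne d) 0, fun _ _ => rfl, by simp, fun ψ _ _ => ?_⟩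
  simp [dot]

lemma comp_add_memLp (hp : 1 < p) (A : DiffOp d N M) (hf : GF p C f1) (hv : Comp p A v) (ξ : Vec N) (k : ℕ) :
    MemLpOn p (Dk D0 k) (fun y => ξ + v y) :=
  MemLpOn.mono (O := Qcube d) (MemLp.add (memLpOn_const (volume_Qcube_ne d) ξ) hv.1)
    (Dk_subset D0 k)

lemma comp_integrable (hp : 1 < p) (A : DiffOp d N M) (hf : GF p C f1) (hv : Comp p A v) (ξ : Vec N) (k : ℕ) :
    IntegrableOn (fun y => f1 ((k : ℝ) • y) (ξ + v y)) (Dk D0 k) :=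
  hf.integrable hp (Dk_ne_top D0 k) (comp_add_memLp hp A hf hv ξ k) (measurable_const_smul (k : ℝ))

lemma energy_lower (hp : 1 < p) (A : DiffOp d N M) (hf : GF p C f1) (hv : Comp p A v) (ξ : Vec N) (k : ℕ) :
    -C ≤ ∫ y in Dk D0 k, f1 ((k : ℝ) • y) (ξ + v y) := by
  have h1 : ∫ y in Dk D0 k, (-C) ≤ ∫ y in Dk D0 k, f1 ((k : ℝ) • y) (ξ + v y) :=
    integral_mono (integrableOn_const (Dk_ne_top D0 k)) (comp_integrable hp A hf hv ξ k)
      (fun y => hf.lower _ _)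
  rw [setIntegral_const, smul_eq_mul] at h1
  have := Dk_real_le D0 k
  have h2 : 0 ≤ volume.real (Dk D0 k) := measureReal_nonneg
  nlinarith [hf.one_le]

lemma cset_bddBelow (hp : 1 < p) (A : DiffOp d N M) (hf : GF p C f1)
    (k : ℕ) (ξ : Vec N) : BddBelow (cset p A D0 f1 k ξ) := by
  refine ⟨-C, ?_⟩
  rintro c ⟨v, h1, h2, h3, h4, rfl⟩
  exact energy_lower hp A hf ⟨h1, h2, h3, h4⟩ ξ k

lemma cmin_le (hp : 1 < p) (A : DiffOp d N M) (hf : GF p C f1) (hv : Comp p A v) (ξ : Vec N) (k : ℕ) :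
    sInf (cset p A D0 f1 k ξ) ≤ ∫ y in Dk D0 k, f1 ((k : ℝ) • y) (ξ + v y) :=
  csInf_le (cset_bddBelow hp A hf k ξ) ⟨v, hv.1, hv.2.1, hv.2.2.1, hv.2.2.2, rfl⟩

lemma cset_nonempty (A : DiffOp d N M) (k : ℕ) (ξ : Vec N) : (cset p A D0 f1 k ξ).Nonempty := by
  obtain ⟨h1, h2, h3, h4⟩ := comp_zero p A (N := N)
  exact ⟨_, _, h1, h2, h3, h4, rfl⟩

lemma exists_near_min (A : DiffOp d N M) (k : ℕ) (ξ : Vec N) {τ : ℝ} (hτ : sInf (cset p A D0 f1 k ξ) < τ) :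
    ∃ v, Comp p A v ∧ ∫ y in Dk D0 k, f1 ((k : ℝ) • y) (ξ + v y) < τ := by
  obtain ⟨c, ⟨v, h1, h2, h3, h4, rfl⟩, hc⟩ := exists_lt_of_csInf_lt (cset_nonempty A k ξ) hτ
  exact ⟨v, ⟨h1, h2, h3, h4⟩, hc⟩

lemma cmin_lower (hp : 1 < p) (A : DiffOp d N M) (hf : GF p C f1)
    (k : ℕ) (ξ : Vec N) : -C ≤ sInf (cset p A D0 f1 k ξ) := by
  refine le_csInf (cset_nonempty A k ξ) ?_
  rintro c ⟨v, h1, h2, h3, h4, rfl⟩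
  exact energy_lower hp A hf ⟨h1, h2, h3, h4⟩ ξ k

lemma cmin_upper (hp : 1 < p) (A : DiffOp d N M) (hf : GF p C f1)
    (k : ℕ) (ξ : Vec N) : sInf (cset p A D0 f1 k ξ) ≤ C * (1 + ‖ξ‖ ^ p) := by
  refine (cmin_le hp A hf (comp_zero p A) ξ k).trans ?_
  have h1 : ∫ y in Dk D0 k, f1 ((k : ℝ) • y) (ξ + 0) ≤ ∫ y in Dk D0 k, C * (1 + ‖ξ‖ ^ p) :=
    integral_mono (comp_integrable hp A hf (comp_zero p A) ξ k)
      (integrableOn_const (Dk_ne_top D0 k))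
      (fun y => by
        have := (abs_le.1 (hf.upper ((k : ℝ) • y) (ξ + 0))).2
        simpa using this)
  rw [setIntegral_const, smul_eq_mul] at h1
  have := Dk_real_le D0 k
  have h2 : 0 ≤ C * (1 + ‖ξ‖ ^ p) := by have := hf.one_le; positivity
  exact h1.trans (mul_le_of_le_one_left h2 this)

/-- Coercivity on the perforated cell. -/
lemma energy_coer (hp : 1 < p) (A : DiffOp d N M) (hf : GF p C f1) (hv : Comp p A v) (ξ : Vec N) (k : ℕ) :
    ∫ y in Dk D0 k, ‖ξ + v y‖ ^ p ≤
      C * ((∫ y in Dk D0 k, f1 ((k : ℝ) • y) (ξ + v y)) + C) := by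
  have hi := comp_integrable (D0 := D0) hp A hf hv ξ k
  have h1 : ∫ y in Dk D0 k, ‖ξ + v y‖ ^ p ≤
      ∫ y in Dk D0 k, C * (f1 ((k : ℝ) • y) (ξ + v y) + C) :=
    integral_mono ((comp_add_memLp hp A hf hv ξ k).integrable_rpow hp)
      ((hi.add (integrableOn_const (Dk_ne_top D0 k))).const_mul C) (fun y => hf.coer _ _)
  refine h1.trans ?_
  rw [integral_const_mul, integral_add hi (integrableOn_const (Dk_ne_top D0 k)),
    setIntegral_const, smul_eq_mul]
  have := Dk_real_le D0 k
  have hC := hf.one_le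
  gcongr
  exact mul_le_of_le_one_left (by linarith) this

lemma cmin_modulus (hp : 1 < p) (A : DiffOp d N M) (hf : GF p C f1)
    {η : ℝ} (hη : 0 < η) : ∃ D, 0 ≤ D ∧ ∀ (k : ℕ) (ξ ζ : Vec N),
    sInf (cset p A D0 f1 k ζ) ≤ sInf (cset p A D0 f1 k ξ)
      + η * (1 + ‖ξ‖ ^ p + ‖ζ‖ ^ p) + D * ‖ξ - ζ‖ ^ p := by
  have hC := hf.one_le
  -- constant
  set B : ℝ := 1 + (1 + 2 ^ p) * (C * (2 * C + 1)) + 2 ^ p with hB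
  have h2p : (0 : ℝ) < 2 ^ p := by positivity
  have hBpos : 0 < B := by positivity
  obtain ⟨D, hD0, hD⟩ := hf.modulus hp (show 0 < η / B by positivity)
  refine ⟨η + D, by positivity, fun k ξ ζ => ?_⟩
  refine le_of_forall_pos_lt_add fun τ hτ => ?_
  set τ' := min τ 1 with hτ'
  have hτ'0 : 0 < τ' := by positivity
  obtain ⟨v, hv, hlt⟩ := exists_near_min (D0 := D0) (f1 := f1) A k ξ (p := p)
    (lt_add_of_pos_right (sInf (cset p A D0 f1 k ξ)) hτ'0)
  have hco := energy_coer (D0 := D0) hp A hf hv ξ k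
  have hup := cmin_upper (D0 := D0) hp A hf k ξ
  set E := ∫ y in Dk D0 k, f1 ((k : ℝ) • y) (ξ + v y) with hE
  set X := ∫ y in Dk D0 k, ‖ξ + v y‖ ^ p with hX
  have hX0 : 0 ≤ X := by positivity
  have hxp : 0 ≤ ‖ξ‖ ^ p := by positivity
  have hzp : 0 ≤ ‖ζ‖ ^ p := by positivity
  have hdp : 0 ≤ ‖ξ - ζ‖ ^ p := by positivity
  have hX1 : X ≤ C * (2 * C + 1) * (1 + ‖ξ‖ ^ p) := by
    have : E ≤ C * (1 + ‖ξ‖ ^ p) + 1 := by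
      have := min_le_right τ 1
      linarith
    have h3 : E + C ≤ (2 * C + 1) * (1 + ‖ξ‖ ^ p) := by nlinarith
    calc X ≤ C * (E + C) := hco
      _ ≤ C * ((2 * C + 1) * (1 + ‖ξ‖ ^ p)) := by gcongr
      _ = _ := by ring
  -- pointwise
  have hi1 := comp_integrable (D0 := D0) hp A hf hv ξ k
  have hi2 := (comp_add_memLp (D0 := D0) hp A hf hv ξ k).integrable_rpow hp
  have hcn : ∀ c : ℝ, IntegrableOn (fun _ : Rd d => c) (Dk D0 k) :=
    fun c => integrableOn_const (Dk_ne_top D0 k)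
  have hpt : ∀ y, f1 ((k : ℝ) • y) (ζ + v y) ≤ f1 ((k : ℝ) • y) (ξ + v y)
      + ((η / B * (1 + 2 ^ p)) * ‖ξ + v y‖ ^ p
        + (η / B * (1 + 2 ^ p * ‖ξ - ζ‖ ^ p) + D * ‖ξ - ζ‖ ^ p)) := fun y => by
    have h1 := (abs_le.1 (hD ((k : ℝ) • y) (ξ + v y) (ζ + v y))).1
    have e : ξ + v y - (ζ + v y) = ξ - ζ := by abel
    rw [e] at h1
    have h2 := norm_sub_rpow_le hp (ξ + v y) (ξ - ζ)
    have e2 : ξ + v y - (ξ - ζ) = ζ + v y := by abel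
    rw [e2] at h2
    have h3 : η / B * ‖ζ + v y‖ ^ p ≤ η / B * (2 ^ p * (‖ξ + v y‖ ^ p + ‖ξ - ζ‖ ^ p)) := by
      gcongr
    nlinarith
  have hitg : ∫ y in Dk D0 k, f1 ((k : ℝ) • y) (ζ + v y) ≤ E
      + ((η / B * (1 + 2 ^ p)) * X
        + volume.real (Dk D0 k) * (η / B * (1 + 2 ^ p * ‖ξ - ζ‖ ^ p) + D * ‖ξ - ζ‖ ^ p)) := by
    refine (integral_mono (comp_integrable (D0 := D0) hp A hf hv ζ k)
      (hi1.add ((hi2.const_mul _).add (hcn _))) hpt).trans_eq ?_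
    simp only [Pi.add_apply]
    have e1 := integral_add (μ := volume.restrict (Dk D0 k)) hi1
      ((hi2.const_mul (η / B * (1 + 2 ^ p))).add
        (hcn (η / B * (1 + 2 ^ p * ‖ξ - ζ‖ ^ p) + D * ‖ξ - ζ‖ ^ p)))
    have e2 := integral_add (μ := volume.restrict (Dk D0 k)) (hi2.const_mul (η / B * (1 + 2 ^ p)))
        (hcn (η / B * (1 + 2 ^ p * ‖ξ - ζ‖ ^ p) + D * ‖ξ - ζ‖ ^ p))
    simp only [Pi.add_apply] at e1 e2
    rw [e1, e2, integral_const_mul, setIntegral_const, smul_eq_mul]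
  have hvol := Dk_real_le D0 k
  have h5 : volume.real (Dk D0 k) * (η / B * (1 + 2 ^ p * ‖ξ - ζ‖ ^ p) + D * ‖ξ - ζ‖ ^ p)
      ≤ η / B * (1 + 2 ^ p * ‖ξ - ζ‖ ^ p) + D * ‖ξ - ζ‖ ^ p :=
    mul_le_of_le_one_left (by positivity) hvol
  have h6 : (η / B * (1 + 2 ^ p)) * X ≤
      (η / B * (1 + 2 ^ p)) * (C * (2 * C + 1) * (1 + ‖ξ‖ ^ p)) := by gcongr
  have hmin := cmin_le (D0 := D0) hp A hf hv ζ k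
  have hτle : τ' ≤ τ := min_le_left τ 1
  have hfin : η / B * (1 + 2 ^ p) * (C * (2 * C + 1) * (1 + ‖ξ‖ ^ p))
      + η / B * (1 + 2 ^ p * ‖ξ - ζ‖ ^ p) ≤ η * (1 + ‖ξ‖ ^ p + ‖ζ‖ ^ p) + η * ‖ξ - ζ‖ ^ p := by
    have hηB : η / B * B = η := by field_simp
    have t0 : 0 < η / B := by positivity
    calc η / B * (1 + 2 ^ p) * (C * (2 * C + 1) * (1 + ‖ξ‖ ^ p))
      + η / B * (1 + 2 ^ p * ‖ξ - ζ‖ ^ p)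
        = η / B * ((1 + 2 ^ p) * (C * (2 * C + 1)) * (1 + ‖ξ‖ ^ p) + 1
          + 2 ^ p * ‖ξ - ζ‖ ^ p) := by ring
      _ ≤ η / B * (B * (1 + ‖ξ‖ ^ p + ‖ζ‖ ^ p) + B * ‖ξ - ζ‖ ^ p) := by
        apply mul_le_mul_of_nonneg_left _ t0.le
        have a1 : (2:ℝ) ^ p * ‖ξ - ζ‖ ^ p ≤ B * ‖ξ - ζ‖ ^ p := by
          apply mul_le_mul_of_nonneg_right _ hdp
          have : 0 ≤ (1 + 2 ^ p) * (C * (2 * C + 1)) := by positivity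
          linarith
        have a2 : (1 + 2 ^ p) * (C * (2 * C + 1)) * (1 + ‖ξ‖ ^ p) + 1
            ≤ B * (1 + ‖ξ‖ ^ p) := by
          have : 0 ≤ 2 ^ p * (1 + ‖ξ‖ ^ p) := by positivity
          rw [hB]; nlinarith
        have a3 : 0 ≤ B * ‖ζ‖ ^ p := by positivity
        nlinarith
      _ = (η / B * B) * (1 + ‖ξ‖ ^ p + ‖ζ‖ ^ p) + (η / B * B) * ‖ξ - ζ‖ ^ p := by ring
      _ = _ := by rw [hηB]
  linarith

lemma cmin_isBounded (hp : 1 < p) (A : DiffOp d N M) (hf : GF p C f1) (ξ : Vec N) :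
    IsBoundedUnder (· ≥ ·) atTop (fun k => sInf (cset p A D0 f1 k ξ)) ∧
    IsBoundedUnder (· ≤ ·) atTop (fun k => sInf (cset p A D0 f1 k ξ)) :=
  ⟨isBoundedUnder_of ⟨-C, fun k => cmin_lower hp A hf k ξ⟩,
   isBoundedUnder_of ⟨_, fun k => cmin_upper hp A hf k ξ⟩⟩

lemma fhom_lower (hp : 1 < p) (A : DiffOp d N M) (hf : GF p C f1) (ξ : Vec N) : -C ≤ fhom p A D0 f1 ξ := by
  rw [fhom_eq]
  exact le_liminf_of_le (cmin_isBounded hp A hf ξ).2.isCoboundedUnder_ge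
    (.of_forall fun k => cmin_lower hp A hf k ξ)

lemma fhom_upper (hp : 1 < p) (A : DiffOp d N M) (hf : GF p C f1)
    (ξ : Vec N) : fhom p A D0 f1 ξ ≤ C * (1 + ‖ξ‖ ^ p) := by
  rw [fhom_eq]
  exact liminf_le_of_le (cmin_isBounded hp A hf ξ).1
    fun b hb => by
      obtain ⟨k, hk⟩ := hb.exists
      exact hk.trans (cmin_upper hp A hf k ξ)

lemma eventually_cmin_gt (hp : 1 < p) (A : DiffOp d N M) (hf : GF p C f1) (ξ : Vec N) {η : ℝ} (hη : 0 < η) :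
    ∀ᶠ k in atTop, fhom p A D0 f1 ξ - η < sInf (cset p A D0 f1 k ξ) := by
  rw [fhom_eq]
  exact eventually_lt_of_lt_liminf (sub_lt_self _ hη) (cmin_isBounded hp A hf ξ).1

lemma frequently_cmin_lt (hp : 1 < p) (A : DiffOp d N M) (hf : GF p C f1) (ξ : Vec N) {η : ℝ} (hη : 0 < η) :
    ∃ᶠ k in atTop, sInf (cset p A D0 f1 k ξ) < fhom p A D0 f1 ξ + η := by
  rw [fhom_eq]
  exact frequently_lt_of_liminf_lt (cmin_isBounded hp A hf ξ).2.isCoboundedUnder_ge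
    (lt_add_of_pos_right _ hη)

lemma fhom_modulus (hp : 1 < p) (A : DiffOp d N M) (hf : GF p C f1)
    {η : ℝ} (hη : 0 < η) : ∃ D, 0 ≤ D ∧ ∀ (ξ ζ : Vec N),
    |fhom p A D0 f1 ξ - fhom p A D0 f1 ζ| ≤ η * (1 + ‖ξ‖ ^ p + ‖ζ‖ ^ p) + D * ‖ξ - ζ‖ ^ p := by
  obtain ⟨D, hD0, hD⟩ := cmin_modulus (D0 := D0) hp A hf hη
  have key : ∀ ξ ζ : Vec N, fhom p A D0 f1 ζ ≤ fhom p A D0 f1 ξ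
      + η * (1 + ‖ξ‖ ^ p + ‖ζ‖ ^ p) + D * ‖ξ - ζ‖ ^ p := by
    intro ξ ζ
    refine le_of_forall_pos_le_add fun τ hτ => ?_
    obtain ⟨k, h1, h2⟩ := ((frequently_cmin_lt (D0 := D0) hp A hf ξ (half_pos hτ)).and_eventually
      (eventually_cmin_gt (D0 := D0) hp A hf ζ (half_pos hτ))).exists
    have := hD k ξ ζ
    linarith
  refine ⟨D, hD0, fun ξ ζ => ?_⟩
  have h1 := key ξ ζ
  have h2 := key ζ ξ
  rw [norm_sub_rev ζ ξ] at h2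
  rw [abs_le]
  constructor <;> linarith

lemma fhom_continuous (hp : 1 < p) (A : DiffOp d N M) (hf : GF p C f1) : Continuous (fhom p A D0 f1) := by
  rw [continuous_iff_continuousAt]
  intro ξ
  rw [Metric.continuousAt_iff]
  intro e he
  set S : ℝ := 1 + ‖ξ‖ ^ p + (‖ξ‖ + 1) ^ p with hS
  have hSpos : 0 < S := by positivity
  obtain ⟨D, hD0, hD⟩ := fhom_modulus (D0 := D0) hp A hf (show 0 < e / 2 / S by positivity)
  have hδ : 0 < (e / 2 / (D + 1)) ^ (1 / p) := by positivity
  refine ⟨min 1 ((e / 2 / (D + 1)) ^ (1 / p)), by positivity, fun {ζ} hζ => ?_⟩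
  rw [dist_eq_norm] at hζ
  rw [Real.dist_eq, abs_sub_comm]
  have h1 : ‖ξ - ζ‖ < 1 := by rw [norm_sub_rev]; exact hζ.trans_le (min_le_left _ _)
  have h2 : ‖ξ - ζ‖ < (e / 2 / (D + 1)) ^ (1 / p) := by
    rw [norm_sub_rev]; exact hζ.trans_le (min_le_right _ _)
  have h3 : ‖ξ - ζ‖ ^ p < e / 2 / (D + 1) := by
    calc ‖ξ - ζ‖ ^ p < ((e / 2 / (D + 1)) ^ (1 / p)) ^ p := by
          apply Real.rpow_lt_rpow (norm_nonneg _) h2 (by linarith)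
      _ = e / 2 / (D + 1) := by
        rw [← Real.rpow_mul (by positivity), one_div_mul_cancel (by linarith), Real.rpow_one]
  have h4 : ‖ζ‖ ^ p ≤ (‖ξ‖ + 1) ^ p := by
    apply Real.rpow_le_rpow (norm_nonneg _) _ (by linarith)
    have := norm_sub_norm_le ζ ξ
    rw [norm_sub_rev] at this
    linarith
  calc |fhom p A D0 f1 ξ - fhom p A D0 f1 ζ| ≤ _ := hD ξ ζ
    _ ≤ e / 2 / S * S + D * ‖ξ - ζ‖ ^ p := by
      gcongr
      rw [hS]; linarith
    _ ≤ e / 2 + D * (e / 2 / (D + 1)) := by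
      rw [div_mul_cancel₀ _ hSpos.ne']; gcongr
    _ < e / 2 + (D + 1) * (e / 2 / (D + 1)) := by
      gcongr; linarith
    _ = e := by field_simp; ring

/-! ### Part 3a: smooth generalized inverses of the symbol -/

lemma exists_geninv {X Y : Type*} [AddCommGroup X] [Module ℝ X] [AddCommGroup Y] [Module ℝ Y]
    (L : X →ₗ[ℝ] Y) : ∃ g : Y →ₗ[ℝ] X, L ∘ₗ g ∘ₗ L = L ∧ g ∘ₗ L ∘ₗ g = g := by
  obtain ⟨s, hs⟩ := L.rangeRestrict.exists_rightInverse_of_surjective L.range_rangeRestrict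
  obtain ⟨g1, hg1⟩ := LinearMap.exists_extend s
  have h1 : ∀ x, L (g1 (L x)) = L x := by
    intro x
    have e1 : g1 (L x) = s (L.rangeRestrict x) := by
      have := LinearMap.congr_fun hg1 (L.rangeRestrict x)
      simpa using this
    have e2 := LinearMap.congr_fun hs (L.rangeRestrict x)
    rw [e1]
    have := congrArg Subtype.val e2
    simpa using this
  refine ⟨g1 ∘ₗ L ∘ₗ g1, ?_, ?_⟩
  · ext x; simp [h1]
  · ext x; simp [h1]

lemma geninv_perturb {X Y : Type*} [AddCommGroup X] [Module ℝ X] [AddCommGroup Y] [Module ℝ Y]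
    [FiniteDimensional ℝ X] [FiniteDimensional ℝ Y]
    (L0 L : X →ₗ[ℝ] Y) (g0 : Y →ₗ[ℝ] X) (h1 : L0 ∘ₗ g0 ∘ₗ L0 = L0) (h2 : g0 ∘ₗ L0 ∘ₗ g0 = g0)
    (hr : Module.finrank ℝ (LinearMap.range L) = Module.finrank ℝ (LinearMap.range L0))
    (Ui : X →ₗ[ℝ] X) (hU1 : ∀ x, Ui (x + g0 (L x - L0 x)) = x)
    (hU2 : ∀ x, Ui x + g0 (L (Ui x) - L0 (Ui x)) = x) (x : X) :
    L (Ui (g0 (L x))) = L x := by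
  have a1 : ∀ x, L0 (g0 (L0 x)) = L0 x := fun x => LinearMap.congr_fun h1 x
  have a2 : ∀ y, g0 (L0 (g0 y)) = g0 y := fun y => LinearMap.congr_fun h2 y
  -- `g0 L Ui = g0 L0`
  have b0 : ∀ x, Ui x - g0 (L0 (Ui x)) = x - g0 (L0 x) := by
    intro x
    have e := hU2 x
    have e' := congrArg (fun z => g0 (L0 z)) e
    simp only [map_add, map_sub, a2] at e e'
    have : x - g0 (L0 x) = (Ui x + (g0 (L (Ui x)) - g0 (L0 (Ui x)))) -
      (g0 (L0 (Ui x)) + (g0 (L (Ui x)) - g0 (L0 (Ui x)))) := by rw [e, e']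
    rw [this]; abel
  have b1 : ∀ x, g0 (L (Ui x)) = g0 (L0 x) := by
    intro x
    have e := hU2 x
    have e2 := b0 x
    simp only [map_sub] at e
    have e3 : g0 (L (Ui x)) = x - Ui x + g0 (L0 (Ui x)) := by
      rw [← sub_eq_zero]
      have : Ui x + (g0 (L (Ui x)) - g0 (L0 (Ui x))) - x = 0 := by rw [e, sub_self]
      rw [← this]; abel
    rw [e3]
    have : x - Ui x + g0 (L0 (Ui x)) = x - (Ui x - g0 (L0 (Ui x))) := by abel
    rw [this, e2]; abel
  -- injectivity of g0 on range L
  have hinj : ∀ y ∈ LinearMap.range L, g0 y = 0 → y = 0 := by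
    set g : LinearMap.range L →ₗ[ℝ] X := g0 ∘ₗ (LinearMap.range L).subtype with hg
    have hk : LinearMap.ker g = ⊥ := by
      have hfr := LinearMap.finrank_range_add_finrank_ker g
      have hle : Module.finrank ℝ (LinearMap.range L0) ≤ Module.finrank ℝ (LinearMap.range g) := by
        have hmap : LinearMap.range L0 ≤ (LinearMap.range g).map L0 := by
          rintro _ ⟨x, rfl⟩
          refine ⟨g0 (L0 x), ⟨⟨L (Ui x), ⟨_, rfl⟩⟩, ?_⟩, a1 x⟩
          simpa [hg] using b1 x
        exact (Submodule.finrank_mono hmap).trans (Submodule.finrank_map_le _ _)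
      have : Module.finrank ℝ (LinearMap.ker g) = 0 := by omega
      exact Submodule.finrank_eq_zero.1 this
    intro y hy h0
    have : (⟨y, hy⟩ : LinearMap.range L) ∈ LinearMap.ker g := by simpa [hg] using h0
    rw [hk] at this
    simpa using this
  -- `Ui g0 L x = x - Ui (x - P x)`
  have c1 : Ui (g0 (L x)) = x - Ui (x - g0 (L0 x)) := by
    have e := hU1 x
    rw [map_sub] at e
    have e4 : x + (g0 (L x) - g0 (L0 x)) = g0 (L x) + (x - g0 (L0 x)) := by abel
    rw [e4, map_add] at e
    rw [eq_sub_iff_add_eq, e]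
  have c2 : L (Ui (x - g0 (L0 x))) = 0 := by
    apply hinj _ ⟨_, rfl⟩
    rw [b1]
    simp [a1]
  rw [c1, map_sub, c2, sub_zero]

/-- The symbol as a continuous linear map. -/
def symbC {d N M : ℕ} (A : DiffOp d N M) (ω : Rd d) : Vec N →L[ℝ] Vec M :=
  ∑ i, ω i • LinearMap.toContinuousLinearMap (A i)

lemma symbC_apply (A : DiffOp d N M) (ω : Rd d) (x : Vec N) :
    symbC A ω x = symb A ω x := by
  simp [symbC, symb, LinearMap.sum_apply]

lemma symb_apply (A : DiffOp d N M) (ω : Rd d) (x : Vec N) :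
    symb A ω x = ∑ i, ω i • A i x := by
  simp [symb, LinearMap.sum_apply]

lemma symbC_contDiff (A : DiffOp d N M) {n : WithTop ℕ∞} :
    ContDiff ℝ n (symbC A) := by
  unfold symbC
  fun_prop

lemma local_geninv (hA : ConstantRank A)
    {ω0 : Rd d} (h0 : ω0 ≠ 0) : ∃ U ∈ 𝓝 ω0, ∃ G : Rd d → (Vec M →L[ℝ] Vec N),
      ContDiffOn ℝ (⊤ : ℕ∞) G U ∧ ∀ ω ∈ U, ∀ x, symb A ω (G ω (symb A ω x)) = symb A ω x := by
  obtain ⟨r, hr⟩ := hA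
  obtain ⟨g0, hg1, hg2⟩ := exists_geninv (symb A ω0)
  set g0c : Vec M →L[ℝ] Vec N := LinearMap.toContinuousLinearMap g0 with hg0c
  set Uf : Rd d → (Vec N →L[ℝ] Vec N) := fun ω => 1 + g0c.comp (symbC A ω - symbC A ω0) with hUf
  have hUc : ContDiff ℝ (⊤ : ℕ∞) Uf := by
    have := symbC_contDiff (n := ((⊤ : ℕ∞) : WithTop ℕ∞)) A
    exact contDiff_const.add (contDiff_const.clm_comp (this.sub contDiff_const))
  have hU0 : Uf ω0 = ((1 : (Vec N →L[ℝ] Vec N)ˣ) : Vec N →L[ℝ] Vec N) := by simp [hUf]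
  have hunit : ∀ᶠ ω in 𝓝 ω0, IsUnit (Uf ω) := by
    have hopen := Units.isOpen (R := (Vec N →L[ℝ] Vec N))
    exact hUc.continuous.continuousAt.eventually (hopen.mem_nhds (by rw [hU0]; exact Units.isUnit _))
  have hnz : ∀ᶠ ω in 𝓝 ω0, ω ≠ 0 := isOpen_ne.mem_nhds h0
  refine ⟨{ω | IsUnit (Uf ω) ∧ ω ≠ 0}, hunit.and hnz,
    fun ω => (Ring.inverse (Uf ω)).comp g0c, ?_, ?_⟩
  · rintro ω ⟨⟨u, hu⟩, -⟩
    have h1 : ContDiffAt ℝ (⊤ : ℕ∞) Ring.inverse (Uf ω) := by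
      rw [← hu]; exact contDiffAt_ringInverse ℝ u
    have h2 : ContDiffAt ℝ (⊤ : ℕ∞) (fun ω => Ring.inverse (Uf ω)) ω :=
      h1.comp ω hUc.contDiffAt
    exact (h2.clm_comp contDiffAt_const).contDiffWithinAt
  · rintro ω ⟨hu, hω⟩ x
    have e1 : Ring.inverse (Uf ω) * Uf ω = 1 := Ring.inverse_mul_cancel _ hu
    have e2 : Uf ω * Ring.inverse (Uf ω) = 1 := Ring.mul_inverse_cancel _ hu
    refine geninv_perturb (symb A ω0) (symb A ω) g0 hg1 hg2 ((hr ω hω).trans (hr ω0 h0).symm)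
      (Ring.inverse (Uf ω)).toLinearMap ?_ ?_ x
    · intro x
      have := DFunLike.congr_fun e1 x
      simpa [hUf, symbC_apply, hg0c] using this
    · intro x
      have := DFunLike.congr_fun e2 x
      simpa [hUf, symbC_apply, hg0c] using this

lemma global_geninv (hA : ConstantRank A)
    {K : Set (Rd d)} (hK : IsClosed K) (h0 : (0 : Rd d) ∉ K) :
    ∃ G : Rd d → (Vec M →L[ℝ] Vec N), ContDiff ℝ (⊤ : ℕ∞) G ∧
      ∀ ω ∈ K, ∀ x, symb A ω (G ω (symb A ω x)) = symb A ω x := by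
  have hconv : ∀ ω : Rd d, Convex ℝ {G : Vec M →L[ℝ] Vec N |
      ω ∈ K → ∀ x, symb A ω (G (symb A ω x)) = symb A ω x} := by
    intro ω G1 h1 G2 h2 a b ha hb hab hω x
    simp only [ContinuousLinearMap.add_apply, ContinuousLinearMap.smul_apply, map_add, map_smul,
      h1 hω x, h2 hω x]
    rw [← add_smul, hab, one_smul]
  obtain ⟨g, hg⟩ := exists_contMDiffMap_forall_mem_convex_of_local (n := (⊤ : ℕ∞))
    (modelWithCornersSelf ℝ (Rd d)) (M := Rd d) hconv (fun ω0 => by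
    by_cases hω : ω0 ∈ K
    · obtain ⟨U, hU, G, hG, hG2⟩ := local_geninv hA (ω0 := ω0) (by rintro rfl; exact h0 hω)
      exact ⟨U, hU, G, hG.contMDiffOn, fun y hy _ => hG2 y hy⟩
    · exact ⟨Kᶜ, hK.isOpen_compl.mem_nhds hω, fun _ => 0, contMDiffOn_const,
        fun y hy h => absurd h hy⟩)
  exact ⟨g, g.contMDiff.contDiff, hg⟩

/-! ### Part 3b: the kernel -/

open scoped FourierTransform SchwartzMap

/-- The character `t ↦ exp (2 π i ω·t)`. -/
def ch {d : ℕ} (ω t : Rd d) : ℂ := Complex.exp (((2 * Real.pi * dot ω t : ℝ) : ℂ) * Complex.I)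

lemma norm_ch (ω t : Rd d) : ‖ch ω t‖ = 1 := Complex.norm_exp_ofReal_mul_I _

lemma continuous_dot {X : Type*} [TopologicalSpace X] {f g : X → Vec N}
    (hf : Continuous f) (hg : Continuous g) : Continuous (fun x => dot (f x) (g x)) := by
  unfold dot; fun_prop

lemma continuous_ch (ω : Rd d) : Continuous (ch ω) := by
  unfold ch
  have := continuous_dot (X := Rd d) (continuous_const (y := ω)) continuous_id
  simp only [id] at this
  fun_prop

lemma ch_neg (ω t : Rd d) : ch (-ω) t = (starRingEnd ℂ) (ch ω t) := by
  unfold ch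
  rw [← Complex.exp_conj]
  rw [map_mul, Complex.conj_ofReal, Complex.conj_I]
  have : dot (-ω) t = - dot ω t := by simp [dot]
  rw [this]
  push_cast
  ring_nf

lemma ch_smul (ω t : Rd d) (c : ℝ) : ch ω (c • t) = ch (c • ω) t := by
  unfold ch dot
  congr 4
  apply Finset.sum_congr rfl
  intro i _
  simp; ring

lemma ch_add (ω s t : Rd d) : ch ω (s + t) = ch ω s * ch ω t := by
  unfold ch
  rw [← Complex.exp_add]
  congr 1
  simp only [dot, Pi.add_apply, mul_add, Finset.sum_add_distrib]
  push_cast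
  ring

lemma exists_ft (hs : ContDiff ℝ (⊤ : ℕ∞) h) (hc : HasCompactSupport h)
    (hodd : ∀ ω, h (-ω) = - h ω) :
    ∃ k : Rd d → ℝ, Integrable k ∧ ∀ ω, ∫ t, (k t : ℂ) * ch ω t = Complex.I * h ω := by
  set E := EuclideanSpace ℝ (Fin d)
  let e : E ≃L[ℝ] Rd d := EuclideanSpace.equiv (Fin d) ℝ
  set φ0 : E → ℂ := fun x => Complex.I * ((h (e x) : ℝ) : ℂ) with hφ0
  have hφs : ContDiff ℝ (⊤ : ℕ∞) φ0 := by
    have h1 : ContDiff ℝ (⊤ : ℕ∞) (fun x : E => h (e x)) := hs.comp e.contDiff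
    have h2 : ContDiff ℝ (⊤ : ℕ∞) (fun x : E => ((h (e x) : ℝ) : ℂ)) :=
      Complex.ofRealCLM.contDiff.comp h1
    exact contDiff_const.mul h2
  have hφc : HasCompactSupport φ0 := by
    have h1 : HasCompactSupport (fun x : E => h (e x)) := hc.comp_homeomorph e.toHomeomorph
    exact h1.comp_left (g := fun r : ℝ => Complex.I * (r : ℂ)) (by simp)
  set φ : 𝓢(E, ℂ) := hφc.toSchwartzMap hφs with hφ
  have hφe : ∀ x, φ x = φ0 x := fun x => rfl
  set g : 𝓢(E, ℂ) := 𝓕 φ with hg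
  have hinv : ∀ w : E, φ0 w = ∫ v : E, Complex.exp (((2 * Real.pi * inner ℝ v w : ℝ) : ℂ)
      * Complex.I) • g v := by
    intro w
    rw [← Real.fourierInv_eq', ← SchwartzMap.fourierInv_coe, hg, FourierPair.fourierInv_fourier_eq,
      hφe]
  have hmp := PiLp.volume_preserving_toLp (Fin d)
  have hme : MeasurableEmbedding (WithLp.toLp 2 : Rd d → E) :=
    (MeasurableEquiv.toLp 2 (Rd d)).measurableEmbedding
  set gr : Rd d → ℂ := fun t => g (WithLp.toLp 2 t) with hgr
  have hgi : Integrable gr := (hmp.integrable_comp_emb hme).2 g.integrable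
  have hF : ∀ ω : Rd d, ∫ t, gr t * ch ω t = Complex.I * h ω := by
    intro ω
    have h1 := hinv (WithLp.toLp 2 ω)
    rw [← hmp.integral_comp hme] at h1
    have h2 : φ0 (WithLp.toLp 2 ω) = Complex.I * h ω := by
      simp only [hφ0]
      rfl
    rw [← h2, h1]
    congr 1; ext t
    rw [smul_eq_mul, mul_comm]
    congr 1
  have hci : ∀ ω, Integrable (fun t => gr t * ch ω t) := fun ω =>
    hgi.mul_bdd (c := 1) (continuous_ch ω).aestronglyMeasurable
      (.of_forall fun t => (norm_ch ω t).le)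
  refine ⟨fun t => (gr t).re, hgi.re, fun ω => ?_⟩
  have h1 : ∀ t, (((gr t).re : ℝ) : ℂ) * ch ω t
      = (1/2 : ℂ) * (gr t * ch ω t + (starRingEnd ℂ) (gr t * ch (-ω) t)) := by
    intro t
    rw [ch_neg, map_mul, Complex.conj_conj, ← add_mul, Complex.add_conj]
    push_cast; ring
  simp_rw [h1]
  have hcj : Integrable (fun t => (starRingEnd ℂ) (gr t * ch (-ω) t)) :=
    (Complex.conjCLE.toContinuousLinearMap).integrable_comp (hci (-ω))
  rw [integral_const_mul, integral_add (hci ω) hcj, integral_conj, hF, hF, hodd]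
  simp
  ring

lemma integrable_tsum_aux {α : Type*} [MeasurableSpace α] {μ : Measure α} {F : ℕ → α → ℝ}
    (hF : ∀ j, Integrable (F j) μ) (hs : Summable fun j => ∫ t, ‖F j t‖ ∂μ) :
    (∀ᵐ t ∂μ, Summable fun j => F j t) ∧ Integrable (fun t => ∑' j, F j t) μ := by
  have h1 : ∫⁻ t, ∑' j, ‖F j t‖ₑ ∂μ < ⊤ := by
    rw [lintegral_tsum fun j => (hF j).1.enorm]
    have e : ∀ j, ∫⁻ t, ‖F j t‖ₑ ∂μ = ENNReal.ofReal (∫ t, ‖F j t‖ ∂μ) := fun j => by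
      rw [ofReal_integral_norm_eq_lintegral_enorm (hF j)]
    simp_rw [e]
    rw [← ENNReal.ofReal_tsum_of_nonneg (fun j => integral_nonneg fun _ => norm_nonneg _) hs]
    exact ENNReal.ofReal_lt_top
  have hm : AEMeasurable (fun t => ∑' j, ‖F j t‖ₑ) μ :=
    AEMeasurable.tsum fun j => (hF j).1.enorm
  have h2 : ∀ᵐ t ∂μ, Summable fun j => F j t := by
    filter_upwards [ae_lt_top' hm h1.ne] with t ht
    have : Summable fun j => ‖F j t‖₊ := ENNReal.tsum_coe_ne_top_iff_summable.1 ht.ne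
    exact this.of_nnnorm
  refine ⟨h2, ?_, ?_⟩
  · refine aestronglyMeasurable_of_tendsto_ae atTop
      (f := fun n t => ∑ j ∈ Finset.range n, F j t) (fun n => ?_) ?_
    · exact Finset.aestronglyMeasurable_fun_sum _ fun j _ => (hF j).1
    · filter_upwards [h2] with t ht
      exact ht.hasSum.tendsto_sum_nat
  · refine lt_of_le_of_lt (lintegral_mono fun t => ?_) h1
    exact enorm_tsum_le_tsum_enorm

lemma HasSum.congr_fun_aux {f g : ℕ → ℂ} {a : ℂ} (h : HasSum f a) (e : ∀ j, g j = f j) :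
    HasSum g a := by
  have : g = f := funext e
  rw [this]; exact h

lemma exists_scaled_sum {k : Rd d → ℝ} (hk : Integrable k) :
    ∃ K : Rd d → ℝ, Integrable K ∧ ∀ ω : Rd d,
      HasSum (fun j : ℕ => (((1/2 : ℝ) ^ j : ℝ) : ℂ) * ∫ t, (k t : ℂ) * ch (((1/2 : ℝ) ^ j) • ω) t)
        (∫ t, (K t : ℂ) * ch ω t) := by
  -- the dyadic pieces
  set kj : ℕ → Rd d → ℝ := fun j t => (1/2 : ℝ) ^ j * (((2 : ℝ) ^ j) ^ d * k ((2 : ℝ) ^ j • t))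
    with hkj
  have hfr : Module.finrank ℝ (Rd d) = d := by simp
  have hkji : ∀ j, Integrable (kj j) := fun j => by
    have := hk.comp_smul (R := (2 : ℝ) ^ j) (by positivity)
    exact (this.const_mul _).const_mul _
  have hnorm : ∀ j, ∫ t, ‖kj j t‖ = (1/2 : ℝ) ^ j * ∫ t, ‖k t‖ := fun j => by
    have e : ∀ t, ‖kj j t‖ = (1/2 : ℝ) ^ j * (((2 : ℝ) ^ j) ^ d * ‖k ((2 : ℝ) ^ j • t)‖) := by
      intro t; simp [hkj]
    simp_rw [e]
    rw [integral_const_mul, integral_const_mul,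
      Measure.integral_comp_smul volume (fun t => ‖k t‖), hfr, smul_eq_mul, abs_of_pos (by positivity)]
    congr 1
    field_simp
  have hsum : Summable fun j => ∫ t, ‖kj j t‖ := by
    simp_rw [hnorm]
    exact (summable_geometric_of_lt_one (by norm_num) (by norm_num)).mul_right _
  have hKi : Integrable (fun t => ∑' j, kj j t) := by
    exact (integrable_tsum_aux hkji hsum).2
  refine ⟨fun t => ∑' j, kj j t, hKi, fun ω => ?_⟩
  have hae : ∀ᵐ t, Summable fun j => kj j t := by
    exact (integrable_tsum_aux hkji hsum).1
  have hF1 : ∀ j, Integrable (fun t => (kj j t : ℂ) * ch ω t) := fun j =>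
    (hkji j).ofReal.mul_bdd (c := 1) (continuous_ch ω).aestronglyMeasurable
      (.of_forall fun t => (norm_ch ω t).le)
  have hF2 : Summable fun j => ∫ t, ‖(kj j t : ℂ) * ch ω t‖ := by
    simpa [norm_ch] using hsum
  have key := hasSum_integral_of_summable_integral_norm hF1 hF2
  have e1 : ∫ t, ∑' j, (kj j t : ℂ) * ch ω t = ∫ t, ((∑' j, kj j t : ℝ) : ℂ) * ch ω t := by
    apply integral_congr_ae
    filter_upwards [hae] with t ht
    rw [tsum_mul_right, Complex.ofReal_tsum]
  rw [e1] at key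
  refine HasSum.congr_fun_aux key (fun j => ?_)
  have e2 : ∀ t, (kj j t : ℂ) * ch ω t = (((1/2 : ℝ) ^ j : ℝ) : ℂ) * ((((2 : ℝ) ^ j) ^ d : ℝ) *
      (fun s => (k s : ℂ) * ch (((1/2 : ℝ) ^ j) • ω) s) ((2 : ℝ) ^ j • t)) := by
    intro t
    simp only [hkj]
    rw [ch_smul, smul_smul, ← mul_pow]
    push_cast
    norm_num
    ring
  simp_rw [e2]
  rw [integral_const_mul, integral_const_mul, Measure.integral_comp_smul volume
    (fun s => (k s : ℂ) * ch (((1/2 : ℝ) ^ j) • ω) s), hfr, abs_of_pos (by positivity)]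
  congr 1
  rw [Complex.real_smul, ← mul_assoc, ← Complex.ofReal_mul, mul_inv_cancel₀ (by positivity)]
  simp

/-! ### Part 3c: the matrix kernel -/

/-- Matrix entries of the symbol. -/
def sy {d N M : ℕ} (A : DiffOp d N M) (ω : Rd d) (c : Fin M) (a : Fin N) : ℝ :=
  symb A ω (Pi.single a 1) c

lemma lin_apply {N M : ℕ} (L : Vec N →ₗ[ℝ] Vec M) (x : Vec N) (c : Fin M) :
    L x c = ∑ a, L (Pi.single a 1) c * x a := by
  have : x = ∑ a, x a • (Pi.single a 1 : Vec N) := by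
    ext i; simp [Finset.sum_apply, Pi.single_apply]
  conv_lhs => rw [this]
  simp [Finset.sum_apply, mul_comm]

lemma HasSum.congr_aux {f g : ℕ → ℝ} {a : ℝ} (h : HasSum f a) (e : ∀ j, f j = g j) :
    HasSum g a := by
  have : f = g := funext e
  rw [← this]; exact h

lemma sy_smul (A : DiffOp d N M) (r : ℝ) (ω : Rd d) (c : Fin M)
    (a : Fin N) : sy A (r • ω) c a = r * sy A ω c a := by
  simp [sy, symb_apply, Finset.mul_sum, mul_assoc]

lemma sy_neg (A : DiffOp d N M) (ω : Rd d) (c : Fin M)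
    (a : Fin N) : sy A (-ω) c a = - sy A ω c a := by
  simp [sy, symb_apply]

lemma sy_triple (A : DiffOp d N M) (ω : Rd d)
    (G : Vec M →L[ℝ] Vec N) (c : Fin M) (e : Fin N) :
    ∑ a, ∑ b, sy A ω c a * G (Pi.single b 1) a * sy A ω b e =
      symb A ω (G (symb A ω (Pi.single e 1))) c := by
  rw [lin_apply (symb A ω) (G _)]
  apply Finset.sum_congr rfl
  intro a _
  have := lin_apply G.toLinearMap (symb A ω (Pi.single e 1)) a
  simp only [ContinuousLinearMap.coe_coe] at this
  rw [this, Finset.mul_sum]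
  apply Finset.sum_congr rfl
  intro b _
  simp [sy, mul_assoc]

lemma exists_theta (d : ℕ) : ∃ θ : Rd d → ℝ, ContDiff ℝ (⊤ : ℕ∞) θ ∧ HasCompactSupport θ ∧
    (0 : Rd d) ∉ tsupport θ ∧ ∀ ω : Rd d, 1 ≤ ‖ω‖ →
      HasSum (fun j : ℕ => θ (((1/2 : ℝ) ^ j) • ω)) 1 := by
  let χ : ContDiffBump (0 : Rd d) := ⟨1/4, 1/2, by norm_num, by norm_num⟩
  set θ : Rd d → ℝ := fun ω => χ ((1/2 : ℝ) • ω) - χ ω with hθ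
  have hs : ContDiff ℝ (⊤ : ℕ∞) θ :=
    (χ.contDiff.comp (contDiff_const_smul _)).sub χ.contDiff
  have hc : HasCompactSupport θ := by
    have h1 : HasCompactSupport (fun ω : Rd d => χ ((1/2 : ℝ) • ω)) :=
      χ.hasCompactSupport.comp_smul (by norm_num)
    exact h1.sub χ.hasCompactSupport
  refine ⟨θ, hs, hc, ?_, fun ω hω => ?_⟩
  · rw [notMem_tsupport_iff_eventuallyEq]
    filter_upwards [ball_mem_nhds (0 : Rd d) (show (0:ℝ) < 1/4 by norm_num)] with x hx
    have h1 : χ x = 1 := χ.one_of_mem_closedBall (ball_subset_closedBall hx)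
    have h2 : χ ((1/2 : ℝ) • x) = 1 := χ.one_of_mem_closedBall (by
      simp only [mem_ball, dist_zero_right, mem_closedBall, norm_smul] at hx ⊢
      norm_num
      linarith [norm_nonneg x])
    simp only [hθ, h1, h2, sub_self, Pi.zero_apply]
  · have ht : ∀ j, θ (((1/2 : ℝ) ^ j) • ω) = χ (((1/2 : ℝ) ^ (j+1)) • ω) - χ (((1/2 : ℝ) ^ j) • ω) := by
      intro j
      simp only [hθ, smul_smul]
      rw [pow_succ, mul_comm]
    have hlim : Tendsto (fun j : ℕ => ((1/2 : ℝ) ^ j) * ‖ω‖) atTop (𝓝 0) := by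
      have := (tendsto_pow_atTop_nhds_zero_of_lt_one (r := (1/2 : ℝ)) (by norm_num) (by norm_num)).mul_const ‖ω‖
      simpa using this
    obtain ⟨n, hn⟩ := eventually_atTop.1 (hlim.eventually (gt_mem_nhds (show (0:ℝ) < 1/4 by norm_num)))
    have hone : ∀ j ≥ n, χ (((1/2 : ℝ) ^ j) • ω) = 1 := fun j hj => χ.one_of_mem_closedBall (by
      simp only [mem_closedBall, dist_zero_right, norm_smul]
      rw [Real.norm_of_nonneg (by positivity)]
      exact (hn j hj).le)
    have h0 : χ ω = 0 := χ.zero_of_le_dist (by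
      simp only [dist_zero_right]
      have : χ.rOut = 1/2 := rfl
      rw [this]; linarith)
    have hsum : ∑ j ∈ Finset.range n, θ (((1/2 : ℝ) ^ j) • ω) = 1 := by
      simp_rw [ht]
      rw [Finset.sum_range_sub (fun j => χ (((1/2 : ℝ) ^ j) • ω)), hone n le_rfl]
      simp [h0]
    have key : HasSum (fun j : ℕ => θ (((1/2 : ℝ) ^ j) • ω))
      (∑ j ∈ Finset.range n, θ (((1/2 : ℝ) ^ j) • ω)) := hasSum_sum_of_ne_finset_zero fun j hj => ?_
    · rw [hsum] at key; exact key
    have hj' : n ≤ j := by simpa using hj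
    rw [ht, hone j hj', hone (j+1) (by omega), sub_self]

/-- Integer vectors as real vectors. -/
def zr {d : ℕ} (m : Fin d → ℤ) : Rd d := fun i => (m i : ℝ)

lemma one_le_norm_zr {m : Fin d → ℤ} (hm : m ≠ 0) : 1 ≤ ‖zr m‖ := by
  obtain ⟨i, hi⟩ := Function.ne_iff.1 hm
  have h1 : (1 : ℝ) ≤ |(m i : ℝ)| := by
    have : 1 ≤ |m i| := Int.one_le_abs (by simpa using hi)
    exact_mod_cast this
  exact h1.trans (norm_le_pi_norm (zr m) i)

lemma exists_kernel (hA : ConstantRank A) :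
    ∃ κ : Fin N → Fin M → Rd d → ℝ, (∀ a b, Integrable (κ a b)) ∧
      ∀ m : Fin d → ℤ, ∃ H : Fin N → Fin M → ℝ,
        (∀ a b, ∫ t, (κ a b t : ℂ) * ch (zr m) t = Complex.I * H a b) ∧
        ∀ c e, 2 * Real.pi * ∑ a, ∑ b, sy A (zr m) c a * H a b * sy A (zr m) b e
          = sy A (zr m) c e := by
  obtain ⟨θ, hθs, hθc, hθ0, hθ1⟩ := exists_theta d
  obtain ⟨G, hGs, hG⟩ := global_geninv hA (isClosed_tsupport θ) hθ0
  set g : Fin N → Fin M → Rd d → ℝ := fun a b ω => θ ω * G ω (Pi.single b 1) a with hg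
  have hgs : ∀ a b, ContDiff ℝ (⊤ : ℕ∞) (g a b) := fun a b => by
    have h1 : ContDiff ℝ (⊤ : ℕ∞) (fun ω => G ω (Pi.single b 1)) := hGs.clm_apply contDiff_const
    exact hθs.mul (contDiff_pi.1 h1 a)
  have hgc : ∀ a b, HasCompactSupport (g a b) := fun a b => hθc.mul_right
  have hg3 : ∀ ω c e, ∑ a, ∑ b, sy A ω c a * g a b ω * sy A ω b e = θ ω * sy A ω c e := by
    intro ω c e
    have h1 := sy_triple A ω (G ω) c e
    have h2 : ∑ a, ∑ b, sy A ω c a * g a b ω * sy A ω b e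
        = θ ω * ∑ a, ∑ b, sy A ω c a * G ω (Pi.single b 1) a * sy A ω b e := by
      rw [Finset.mul_sum]
      refine Finset.sum_congr rfl fun a _ => ?_
      rw [Finset.mul_sum]
      refine Finset.sum_congr rfl fun b _ => ?_
      simp only [hg]; ring
    rw [h2, h1]
    by_cases h : θ ω = 0
    · simp [h]
    · rw [hG ω (subset_tsupport θ h)]; rfl
  set h : Fin N → Fin M → Rd d → ℝ := fun a b ω =>
    (4 * Real.pi)⁻¹ * (g a b ω - g a b (-ω)) with hh
  have hhs : ∀ a b, ContDiff ℝ (⊤ : ℕ∞) (h a b) := fun a b =>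
    contDiff_const.mul ((hgs a b).sub ((hgs a b).comp contDiff_neg))
  have hhc : ∀ a b, HasCompactSupport (h a b) := fun a b => by
    have h1 : HasCompactSupport (fun ω => g a b (-ω)) :=
      (hgc a b).comp_homeomorph (Homeomorph.neg (Rd d))
    exact ((hgc a b).sub h1).mul_left (f := fun _ => (4 * Real.pi)⁻¹)
  have hho : ∀ a b ω, h a b (-ω) = - h a b ω := fun a b ω => by simp only [hh, neg_neg]; ring
  have hh3 : ∀ ω c e, 2 * Real.pi * ∑ a, ∑ b, sy A ω c a * h a b ω * sy A ω b e
      = (θ ω + θ (-ω)) / 2 * sy A ω c e := by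
    intro ω c e
    have h1 := hg3 ω c e
    have h2 := hg3 (-ω) c e
    simp only [sy_neg] at h2
    have h3 : ∑ a, ∑ b, sy A ω c a * h a b ω * sy A ω b e = (4 * Real.pi)⁻¹ *
      (∑ a, ∑ b, sy A ω c a * g a b ω * sy A ω b e
        - ∑ a, ∑ b, -sy A ω c a * g a b (-ω) * -sy A ω b e) := by
      rw [← Finset.sum_sub_distrib, Finset.mul_sum]
      refine Finset.sum_congr rfl fun a _ => ?_
      rw [← Finset.sum_sub_distrib, Finset.mul_sum]
      refine Finset.sum_congr rfl fun b _ => ?_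
      simp only [hh]; ring
    rw [h3, h1, h2]
    have := Real.pi_ne_zero
    field_simp
    ring
  choose k hki hk using fun a b => exists_ft (hhs a b) (hhc a b) (hho a b)
  choose κ hκi hκ using fun a b => exists_scaled_sum (hki a b)
  refine ⟨κ, hκi, fun m => ?_⟩
  have hS : ∀ a b, HasSum (fun j : ℕ => (1/2 : ℝ) ^ j * h a b (((1/2 : ℝ) ^ j) • zr m))
      ((∫ t, (κ a b t : ℂ) * ch (zr m) t).im) ∧
      (∫ t, (κ a b t : ℂ) * ch (zr m) t).re = 0 := by
    intro a b
    have h1 := hκ a b (zr m)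
    simp_rw [hk] at h1
    have h2 := Complex.hasSum_im h1
    have h3 := Complex.hasSum_re h1
    constructor
    · refine HasSum.congr_aux h2 fun j => ?_
      rw [Complex.im_ofReal_mul]; simp
    · refine h3.unique ?_
      refine HasSum.congr_aux (hasSum_zero (β := ℕ)) fun j => ?_
      rw [Complex.re_ofReal_mul]; simp
  refine ⟨fun a b => (∫ t, (κ a b t : ℂ) * ch (zr m) t).im, fun a b => ?_, fun c e => ?_⟩
  · apply Complex.ext
    · rw [(hS a b).2]; simp
    · simp
  by_cases hm : m = 0
  · have hz : zr m = (0 : ℝ) • (0 : Rd d) := by ext i; simp [zr, hm]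
    have hz2 : ∀ c e, sy A (zr m) c e = 0 := fun c e => by rw [hz, sy_smul, zero_mul]
    simp [hz2]
  have hL : HasSum (fun j : ℕ => 2 * Real.pi * ∑ a, ∑ b, sy A (zr m) c a *
      ((1/2 : ℝ) ^ j * h a b (((1/2 : ℝ) ^ j) • zr m)) * sy A (zr m) b e)
      (2 * Real.pi * ∑ a, ∑ b, sy A (zr m) c a *
        (∫ t, (κ a b t : ℂ) * ch (zr m) t).im * sy A (zr m) b e) := by
    refine HasSum.mul_left _ (hasSum_sum fun a _ => hasSum_sum fun b _ => ?_)
    exact ((hS a b).1.mul_left _).mul_right _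
  have hR : HasSum (fun j : ℕ => (θ (((1/2 : ℝ) ^ j) • zr m) + θ (((1/2 : ℝ) ^ j) • (-zr m))) / 2
      * sy A (zr m) c e) ((1 + 1) / 2 * sy A (zr m) c e) := by
    refine HasSum.mul_right _ (HasSum.div_const ?_ _)
    exact (hθ1 _ (one_le_norm_zr hm)).add (hθ1 _ (by rw [norm_neg]; exact one_le_norm_zr hm))
  have := hL.unique (HasSum.congr_aux hR fun j => ?_)
  · rw [this]; ring
  · have h4 := hh3 (((1/2 : ℝ) ^ j) • zr m) c e
    simp only [sy_smul] at h4
    rw [smul_neg]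
    have hr : ((1/2 : ℝ) ^ j) ≠ 0 := by positivity
    apply mul_left_cancel₀ hr
    have e1 : (1/2 : ℝ) ^ j * ((θ (((1/2 : ℝ) ^ j) • zr m) + θ (-(((1/2 : ℝ) ^ j) • zr m))) / 2
      * sy A (zr m) c e) = (θ (((1/2 : ℝ) ^ j) • zr m) + θ (-(((1/2 : ℝ) ^ j) • zr m))) / 2
      * ((1/2 : ℝ) ^ j * sy A (zr m) c e) := by ring
    rw [e1, ← h4]
    simp only [Finset.mul_sum]
    refine Finset.sum_congr rfl fun a _ => Finset.sum_congr rfl fun b _ => ?_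
    ring

/-! ### Periodic functions and the fundamental domain -/

open scoped Pointwise

lemma tr_eq (z : Fin d → ℤ) (x : Rd d) : tr z x = x + zr z := rfl

/-- the integer lattice -/
abbrev Lat (d : ℕ) := Submodule.span ℤ (range (Pi.basisFun ℝ (Fin d)))

instance latCountable (d : ℕ) : Countable (Lat d) := by
  have : Module.Finite ℤ (Lat d) := Module.Finite.span_of_finite ℤ (finite_range _)
  infer_instance

instance latVAdd (d : ℕ) : MeasurableVAdd (Lat d) (Rd d) :=
  (inferInstance : MeasurableVAdd (Lat d).toAddSubgroup (Rd d))

instance latInv (d : ℕ) : VAddInvariantMeasure (Lat d) (Rd d) volume :=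
  (inferInstance : VAddInvariantMeasure (Lat d).toAddSubgroup (Rd d) volume)

lemma lat_exists (g : Lat d) : ∃ z : Fin d → ℤ, (g : Rd d) = zr z := by
  obtain ⟨c, hc⟩ := (Submodule.mem_span_range_iff_exists_fun ℤ).1 g.2
  refine ⟨c, ?_⟩
  rw [← hc]
  funext i
  simp [zr, Pi.single_apply]

lemma Zper.lat {α : Type*} {f : Rd d → α} (hf : Zper f) (g : Lat d) (x : Rd d) :
    f (g +ᵥ x) = f x := by
  obtain ⟨z, hz⟩ := lat_exists g
  have : (g +ᵥ x : Rd d) = tr z x := by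
    rw [tr_eq, ← hz, add_comm]; rfl
  rw [this, hf]

lemma fdQ0 (d : ℕ) : ZSpan.fundamentalDomain (Pi.basisFun ℝ (Fin d)) =ᵐ[volume] Qcube d := by
  have h1 : ZSpan.fundamentalDomain (Pi.basisFun ℝ (Fin d)) = Set.pi univ (fun _ => Ico (0:ℝ) 1) := by
    ext x; simp [ZSpan.mem_fundamentalDomain]
  rw [h1, Qcube_eq]
  exact (Measure.univ_pi_Ioo_ae_eq_Icc.trans Measure.univ_pi_Ico_ae_eq_Icc.symm).symm

lemma fdQ (d : ℕ) : IsAddFundamentalDomain (Lat d) (Qcube d) volume := by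
  have h := ZSpan.isAddFundamentalDomain (Pi.basisFun ℝ (Fin d)) (volume : Measure (Rd d))
  have hae := fdQ0 d
  refine ⟨(measurableSet_Qcube d).nullMeasurableSet, ?_, ?_⟩
  · have hall : ∀ᵐ x : Rd d ∂volume, ∀ g : Lat d, ((g +ᵥ x) ∈ ZSpan.fundamentalDomain (Pi.basisFun ℝ (Fin d)))
        = ((g +ᵥ x) ∈ Qcube d) := by
      rw [ae_all_iff]; intro g
      exact (measurePreserving_vadd g (volume : Measure (Rd d))).quasiMeasurePreserving.ae hae
    filter_upwards [h.ae_covers, hall] with x hx hx2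
    obtain ⟨g, hg⟩ := hx
    exact ⟨g, (hx2 g) ▸ hg⟩
  · intro g g' hgg
    refine (h.aedisjoint hgg).congr ?_ ?_
    · exact ((vadd_set_ae_eq _).2 hae.symm)
    · exact ((vadd_set_ae_eq _).2 hae.symm)

lemma fdQ_vadd (t : Rd d) : IsAddFundamentalDomain (Lat d) (t +ᵥ Qcube d) volume :=
  (fdQ d).vadd_of_comm t


lemma vadd_Q_eq (t : Rd d) : t +ᵥ Qcube d = (fun x => x + t) '' Qcube d := by
  ext x; simp only [Set.mem_vadd_set, mem_image, vadd_eq_add, add_comm]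

lemma setIntegral_image_add {E : Type*} [NormedAddCommGroup E] [NormedSpace ℝ E]
    (f : Rd d → E) (t : Rd d) (S : Set (Rd d)) :
    ∫ x in (fun x => x + t) '' S, f x = ∫ x in S, f (x + t) :=
  (measurePreserving_add_right (volume : Measure (Rd d)) t).setIntegral_image_emb
    (measurableEmbedding_addRight t) f S

/-- translation invariance of periodic integrals -/
lemma Zper.integral_shift {E : Type*} [NormedAddCommGroup E] [NormedSpace ℝ E]
    {f : Rd d → E} (hf : Zper f) (t : Rd d) :
    ∫ x in Qcube d, f (x + t) = ∫ x in Qcube d, f x := by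
  rw [← setIntegral_image_add, ← vadd_Q_eq]
  exact (fdQ_vadd t).setIntegral_eq (fdQ d) (fun g x => hf.lat g x)

lemma Zper.lintegral_shift {f : Rd d → ℝ≥0∞} (hf : Zper f) (t : Rd d) :
    ∫⁻ x in Qcube d, f (x + t) = ∫⁻ x in Qcube d, f x := by
  rw [(measurePreserving_add_right (volume : Measure (Rd d)) t).setLIntegral_comp_emb
    (measurableEmbedding_addRight t) f, ← vadd_Q_eq]
  exact (fdQ_vadd t).setLIntegral_eq (fdQ d) f (fun g x => hf.lat g x)

lemma Zper.integrableOn_shift {E : Type*} [NormedAddCommGroup E]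
    {f : Rd d → E} (hf : Zper f) (hi : IntegrableOn f (Qcube d)) (t : Rd d) :
    IntegrableOn (fun x => f (x + t)) (Qcube d) := by
  have h := ((fdQ_vadd t).integrableOn_iff (fdQ d) (fun g x => hf.lat g x)).2 hi
  rw [vadd_Q_eq] at h
  exact ((measurePreserving_add_right (volume : Measure (Rd d)) t).integrableOn_image
    (measurableEmbedding_addRight t)).1 h

/-- a periodic function measurable on the cube is globally measurable -/
lemma Zper.aesm {E : Type*} [TopologicalSpace E] [TopologicalSpace.PseudoMetrizableSpace E]
    {f : Rd d → E} (hf : Zper f)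
    (hm : AEStronglyMeasurable f (volume.restrict (Qcube d))) : AEStronglyMeasurable f volume := by
  rw [← (fdQ d).sum_restrict]
  refine AEStronglyMeasurable.sum_measure fun g => ?_
  exact ((fdQ d).vadd g |>.aestronglyMeasurable_on_iff (fdQ d) (fun g x => hf.lat g x)).2 hm

lemma Zper.map {E F : Type*} {f : Rd d → E} (hf : Zper f) (g : E → F) :
    Zper (fun x => g (f x)) := fun x z => congrArg g (hf x z)

lemma Zper.map2 {E F G : Type*} {f : Rd d → E} {f' : Rd d → F} (hf : Zper f)
    (hf' : Zper f') (g : E → F → G) : Zper (fun x => g (f x) (f' x)) :=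
  fun x z => congrArg₂ g (hf x z) (hf' x z)

lemma Zper.shift {E : Type*} {f : Rd d → E} (hf : Zper f) (t : Rd d) :
    Zper (fun x => f (x + t)) := fun x z => by
  have h : tr z x + t = tr z (x + t) := by rw [tr_eq, tr_eq]; abel
  change f (tr z x + t) = f (x + t)
  rw [h, hf]

/-- the periodic extension of the values on the open cube -/
def pext {d : ℕ} {E : Type*} [Zero E] (f : Rd d → E) (x : Rd d) : E :=
  indicator (Qcube d) f (fun i => Int.fract (x i))

lemma pext_zper {E : Type*} [Zero E] (f : Rd d → E) : Zper (pext f) := fun x z => by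
  simp [pext, tr]

lemma pext_eq {E : Type*} [Zero E] (f : Rd d → E) (hx : x ∈ Qcube d) :
    pext f x = f x := by
  have : (fun i => Int.fract (x i)) = x := by
    funext i; exact Int.fract_eq_self.2 ⟨(hx i).1.le, (hx i).2⟩
  rw [pext, this, indicator_of_mem hx]

/-- a continuous periodic function is bounded -/
lemma Zper.bdd {E : Type*} [NormedAddCommGroup E] {f : Rd d → E} (hf : Zper f)
    (hc : Continuous f) : ∃ K, 0 ≤ K ∧ ∀ x, ‖f x‖ ≤ K := by
  have hcomp : IsCompact (Set.pi univ (fun _ : Fin d => Icc (0 : ℝ) 1)) :=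
    isCompact_univ_pi fun _ => isCompact_Icc
  obtain ⟨K, hK⟩ := hcomp.exists_bound_of_continuousOn hc.continuousOn
  refine ⟨max K 0, le_max_right _ _, fun x => ?_⟩
  have h1 : f x = f (fun i => Int.fract (x i)) := by
    rw [← hf (fun i => Int.fract (x i)) (fun i => ⌊x i⌋)]
    congr 1
    funext i
    simp [tr]
  rw [h1]
  refine (hK _ ?_).trans (le_max_left _ _)
  intro i _
  exact ⟨Int.fract_nonneg _, (Int.fract_lt_one _).le⟩

lemma zper_fderiv {E : Type*} [NormedAddCommGroup E] [NormedSpace ℝ E] {f : Rd d → E}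
    (hf : Zper f) : Zper (fun x => fderiv ℝ f x) := fun x z => by
  change fderiv ℝ f (tr z x) = fderiv ℝ f x
  rw [tr_eq, ← fderiv_comp_add_right]
  congr 1
  funext y
  exact hf y z

lemma zper_ch (m : Fin d → ℤ) : Zper (ch (zr m)) := fun x z => by
  rw [tr_eq, ch_add]
  have : ch (zr m) (zr z) = 1 := by
    have h : dot (zr m) (zr z) = ((∑ i, m i * z i : ℤ) : ℝ) := by simp [dot, zr]
    rw [ch, h, Complex.exp_eq_one_iff]
    refine ⟨∑ i, m i * z i, ?_⟩
    push_cast; ring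
  rw [this, mul_one]

lemma hasFDerivAt_ch (ω x : Rd d) (i : Fin d) :
    HasDerivAt (fun s : ℝ => ch ω (x + s • Pi.single i 1)) ((2 * Real.pi * ω i : ℝ) * Complex.I * ch ω x) 0 := by
  have h1 : ∀ s : ℝ, ch ω (x + s • Pi.single i 1) = ch ω x * Complex.exp (((2 * Real.pi * ω i : ℝ) * Complex.I) * (s : ℂ)) := by
    intro s
    rw [ch_add]
    congr 1
    rw [ch]
    congr 1
    have : dot ω (s • Pi.single i 1) = s * ω i := by simp [dot, Pi.single_apply, mul_comm]
    rw [this]; push_cast; ring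
  simp_rw [h1]
  have h2 : HasDerivAt (fun s : ℝ => Complex.exp (((2 * Real.pi * ω i : ℝ) * Complex.I) * (s : ℂ)))
      ((2 * Real.pi * ω i : ℝ) * Complex.I) 0 := by
    have := ((Complex.ofRealCLM.hasDerivAt (x := (0:ℝ))).const_mul ((2 * Real.pi * ω i : ℝ) * Complex.I)).cexp
    simpa using this
  have h3 := h2.const_mul (ch ω x)
  rwa [mul_comm (ch ω x)] at h3

lemma contDiff_ch (ω : Rd d) : ContDiff ℝ (⊤ : ℕ∞) (ch ω) := by
  have h : ContDiff ℝ (⊤ : ℕ∞) (fun t : Rd d => 2 * Real.pi * dot ω t) := by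
    unfold dot; fun_prop
  exact ((Complex.ofRealCLM.contDiff.comp h).mul contDiff_const).cexp

lemma fderiv_ch (ω x : Rd d) (i : Fin d) :
    fderiv ℝ (ch ω) x (Pi.single i 1) = (2 * Real.pi * ω i : ℝ) * Complex.I * ch ω x := by
  have h1 : HasFDerivAt (ch ω) (fderiv ℝ (ch ω) x) x :=
    ((contDiff_ch ω).differentiable (by simp) x).hasFDerivAt
  have h2 := h1.hasLineDerivAt (Pi.single i 1)
  exact (HasDerivAt.unique h2 (hasFDerivAt_ch ω x i))

/-! ### Convolution-type operators on periodic functions -/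

lemma secondCountable_of_fd (E : Type*) [NormedAddCommGroup E] [NormedSpace ℝ E]
    [FiniteDimensional ℝ E] : SecondCountableTopology E := by
  have := FiniteDimensional.proper ℝ E
  infer_instance

/-- `T g (x) = ∫ κ(t) g(x+t) dμ(t)` -/
def Tk {d : ℕ} {E : Type*} [NormedAddCommGroup E] [NormedSpace ℝ E] (μ : Measure (Rd d))
    (κ : Rd d → ℝ) (g : Rd d → E) (x : Rd d) : E := ∫ t, κ t • g (x + t) ∂μ

lemma tk_integrable {E : Type*} [NormedAddCommGroup E] [NormedSpace ℝ E]
    [SecondCountableTopology E] {μ : Measure (Rd d)}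
    {κ : Rd d → ℝ} (hκ : Integrable κ μ) {g : Rd d → E} (hg : Continuous g) (hp : Zper g) (x : Rd d) :
    Integrable (fun t => κ t • g (x + t)) μ := by
  obtain ⟨K, hK0, hK⟩ := hp.bdd hg
  refine (hκ.norm.mul_const K).mono' (hκ.aestronglyMeasurable.smul
    (hg.comp (by fun_prop)).aestronglyMeasurable) (.of_forall fun t => ?_)
  rw [norm_smul]; exact mul_le_mul_of_nonneg_left (hK _) (norm_nonneg _)

lemma tk_continuous {E : Type*} [NormedAddCommGroup E] [NormedSpace ℝ E]
    [SecondCountableTopology E] {μ : Measure (Rd d)}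
    {κ : Rd d → ℝ} (hκ : Integrable κ μ) {g : Rd d → E} (hg : Continuous g) (hp : Zper g) :
    Continuous (Tk μ κ g) := by
  obtain ⟨K, hK0, hK⟩ := hp.bdd hg
  refine continuous_of_dominated (bound := fun t => ‖κ t‖ * K)
    (fun x => (tk_integrable hκ hg hp x).aestronglyMeasurable) (fun x => ?_) (hκ.norm.mul_const K) ?_
  · exact Eventually.of_forall fun t => by
      rw [norm_smul]; exact mul_le_mul_of_nonneg_left (hK _) (norm_nonneg _)
  · exact Eventually.of_forall fun t => continuous_const.smul (hg.comp (by fun_prop))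

lemma tk_hasFDerivAt {E : Type*} [NormedAddCommGroup E] [NormedSpace ℝ E]
    [FiniteDimensional ℝ E] {μ : Measure (Rd d)}
    {κ : Rd d → ℝ} (hκ : Integrable κ μ) {g : Rd d → E} (hg : ContDiff ℝ 1 g) (hp : Zper g)
    (x : Rd d) : HasFDerivAt (Tk μ κ g) (Tk μ κ (fderiv ℝ g) x) x := by
  have : SecondCountableTopology E := secondCountable_of_fd E
  have : SecondCountableTopology (Rd d →L[ℝ] E) :=
    secondCountable_of_fd (Rd d →L[ℝ] E)
  have hc : Continuous (fderiv ℝ g) := hg.continuous_fderiv (by simp)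
  have hpd : Zper (fderiv ℝ g) := (zper_fderiv hp)
  obtain ⟨K, hK0, hK⟩ := hpd.bdd hc
  refine hasFDerivAt_integral_of_dominated_of_fderiv_le (s := univ) (bound := fun t => ‖κ t‖ * K)
    (F' := fun x t => κ t • fderiv ℝ g (x + t)) univ_mem
    (.of_forall fun x => (tk_integrable hκ hg.continuous hp x).aestronglyMeasurable)
    (tk_integrable hκ hg.continuous hp x) (tk_integrable hκ hc hpd x).aestronglyMeasurable
    (.of_forall fun t x _ => ?_) (hκ.norm.mul_const K)
    (.of_forall fun t x _ => ?_)
  · rw [norm_smul]; exact mul_le_mul_of_nonneg_left (hK _) (norm_nonneg _)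
  · have h1 : HasFDerivAt g (fderiv ℝ g (x + t)) (x + t) :=
      (hg.differentiable (by simp) _).hasFDerivAt
    exact ((hasFDerivAt_comp_add_right t).2 h1).const_smul (κ t)

lemma tk_contDiff {μ : Measure (Rd d)} {κ : Rd d → ℝ} (hκ : Integrable κ μ) (n : ℕ) :
    ∀ {E : Type} [NormedAddCommGroup E] [NormedSpace ℝ E] [FiniteDimensional ℝ E]
      {g : Rd d → E}, ContDiff ℝ n g → Zper g → ContDiff ℝ n (Tk μ κ g) := by
  induction n with
  | zero =>
    intro E _ _ _ g hg hp
    have : SecondCountableTopology E := secondCountable_of_fd E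
    exact contDiff_zero.2 (tk_continuous hκ hg.continuous hp)
  | succ n ih =>
    intro E _ _ _ g hg hp
    have hg1 : ContDiff ℝ 1 g := hg.of_le (by exact_mod_cast Nat.le_add_left 1 n)
    have hd := tk_hasFDerivAt hκ hg1 hp
    push_cast at hg ⊢
    rw [contDiff_succ_iff_fderiv] at hg ⊢
    refine ⟨fun x => (hd x).differentiableAt, by simp, ?_⟩
    have : fderiv ℝ (Tk μ κ g) = Tk μ κ (fderiv ℝ g) := funext fun x => (hd x).fderiv
    rw [this]
    exact ih hg.2.2 (zper_fderiv hp)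

lemma tk_smooth {μ : Measure (Rd d)} {κ : Rd d → ℝ} (hκ : Integrable κ μ)
    {E : Type} [NormedAddCommGroup E] [NormedSpace ℝ E] [FiniteDimensional ℝ E]
    {g : Rd d → E} (hg : ContDiff ℝ (⊤ : ℕ∞) g) (hp : Zper g) : ContDiff ℝ (⊤ : ℕ∞) (Tk μ κ g) :=
  contDiff_infty.2 fun n => tk_contDiff hκ n (contDiff_infty.1 hg n) hp

lemma tk_zper {E : Type*} [NormedAddCommGroup E] [NormedSpace ℝ E] (μ : Measure (Rd d))
    (κ : Rd d → ℝ) {g : Rd d → E} (hp : Zper g) : Zper (Tk μ κ g) := fun x z => by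
  unfold Tk
  congr 1
  funext t
  have : tr z x + t = tr z (x + t) := by rw [tr_eq, tr_eq]; abel
  rw [this, hp]

/-- the integral of a derivative of a periodic function vanishes -/
lemma Zper.integral_fderiv {E : Type} [NormedAddCommGroup E] [NormedSpace ℝ E]
    [FiniteDimensional ℝ E] {g : Rd d → E} (hp : Zper g) (hg : ContDiff ℝ 1 g) (v : Rd d) :
    ∫ x in Qcube d, fderiv ℝ g x v = 0 := by
  have h := tk_hasFDerivAt (μ := volume.restrict (Qcube d)) (κ := fun _ => 1)
    (integrable_const _) hg hp 0
  have hcst : Tk (volume.restrict (Qcube d)) (fun _ => 1) g = fun _ => ∫ x in Qcube d, g x := by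
    funext x
    simp only [Tk, one_smul]
    simp_rw [add_comm x]
    exact hp.integral_shift x
  rw [hcst] at h
  have h0 := h.unique (hasFDerivAt_const _ _)
  have h1 : (Tk (volume.restrict (Qcube d)) (fun _ => 1) (fderiv ℝ g) 0) v
      = ∫ x in Qcube d, fderiv ℝ g x v := by
    unfold Tk
    have : SecondCountableTopology (Rd d →L[ℝ] E) :=
      secondCountable_of_fd (Rd d →L[ℝ] E)
    rw [ContinuousLinearMap.integral_apply]
    · simp
    · exact tk_integrable (integrable_const _) (hg.continuous_fderiv (by simp)) (zper_fderiv hp) 0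
  rw [← h1, h0]; rfl

lemma integrableOn_Q {E : Type*} [NormedAddCommGroup E] {g : Rd d → E}
    (hg : Continuous g) : IntegrableOn g (Qcube d) := by
  have : IntegrableOn g (Set.pi univ (fun _ : Fin d => Icc (0 : ℝ) 1)) :=
    hg.continuousOn.integrableOn_compact (isCompact_univ_pi fun _ => isCompact_Icc)
  refine this.mono_set ?_
  rw [Qcube_eq]
  exact Set.pi_mono fun i _ => Ioo_subset_Icc_self

/-- Fourier coefficients -/
def fc {d : ℕ} (m : Fin d → ℤ) (g : Rd d → ℝ) : ℂ := ∫ x in Qcube d, (g x : ℂ) * ch (zr (-m)) x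

lemma fc_integrable (m : Fin d → ℤ) (hg : Continuous g) :
    IntegrableOn (fun x => (g x : ℂ) * ch (zr (-m)) x) (Qcube d) :=
  integrableOn_Q ((Complex.continuous_ofReal.comp hg).mul (continuous_ch _))

lemma fc_deriv (m : Fin d → ℤ) (hg : ContDiff ℝ 1 g) (hp : Zper g)
    (i : Fin d) : fc m (fun x => fderiv ℝ g x (Pi.single i 1))
      = 2 * Real.pi * Complex.I * (m i : ℂ) * fc m g := by
  have hgc : ContDiff ℝ 1 (fun x => (g x : ℂ)) := Complex.ofRealCLM.contDiff.comp hg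
  have hch : ContDiff ℝ 1 (ch (zr (-m))) := (contDiff_ch (zr (-m))).of_le (by exact_mod_cast le_top)
  have hper : Zper (fun x => (g x : ℂ) * ch (zr (-m)) x) :=
    (hp.map (fun r => (r : ℂ))).map2 (zper_ch (-m)) (· * ·)
  have h := hper.integral_fderiv (hgc.mul hch) (Pi.single i 1)
  have hd : ∀ x, fderiv ℝ (fun x => (g x : ℂ) * ch (zr (-m)) x) x (Pi.single i 1)
      = ((fderiv ℝ g x (Pi.single i 1) : ℝ) : ℂ) * ch (zr (-m)) x
        - 2 * Real.pi * Complex.I * (m i : ℂ) * ((g x : ℂ) * ch (zr (-m)) x) := by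
    intro x
    have h1 : HasFDerivAt (fun x => (g x : ℂ)) (Complex.ofRealCLM.comp (fderiv ℝ g x)) x :=
      Complex.ofRealCLM.hasFDerivAt.comp x (hg.differentiable (by simp) x).hasFDerivAt
    have h2 : HasFDerivAt (ch (zr (-m))) (fderiv ℝ (ch (zr (-m))) x) x :=
      (hch.differentiable (by simp) x).hasFDerivAt
    have h3 : HasFDerivAt (fun x => (g x : ℂ) * ch (zr (-m)) x) _ x := h1.mul h2
    rw [h3.fderiv]
    simp only [add_apply, smul_apply, smul_eq_mul,
      ContinuousLinearMap.comp_apply, fderiv_ch, zr, Pi.neg_apply, Complex.ofRealCLM_apply]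
    push_cast
    ring
  simp_rw [hd] at h
  have hdc : Continuous (fun x => fderiv ℝ g x (Pi.single i 1)) :=
    (hg.continuous_fderiv (by simp)).clm_apply continuous_const
  rw [integral_sub (fc_integrable m hdc) ((fc_integrable m hg.continuous).const_mul _),
    integral_const_mul, sub_eq_zero] at h
  exact h

/-- Fourier coefficients of `Tk` -/
lemma fc_tk (m : Fin d → ℤ) {κ : Rd d → ℝ} (hκ : Integrable κ)
    (hg : Continuous g) (hp : Zper g) :
    fc m (Tk volume κ g) = (∫ t, (κ t : ℂ) * ch (zr m) t) * fc m g := by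
  have h1 : ∀ x, ((Tk volume κ g x : ℝ) : ℂ) * ch (zr (-m)) x
      = ∫ t, (κ t : ℂ) * (g (x + t) : ℂ) * ch (zr (-m)) x := by
    intro x
    rw [Tk, ← integral_complex_ofReal, ← integral_mul_const]
    simp
  obtain ⟨K, hK0, hK⟩ := hp.bdd hg
  unfold fc
  simp_rw [h1]
  rw [integral_integral_swap]
  · have h2 : ∀ t, ∫ x in Qcube d, (κ t : ℂ) * (g (x + t) : ℂ) * ch (zr (-m)) x
        = (κ t : ℂ) * ch (zr m) t * fc m g := by
      intro t
      have hper : Zper (fun x => (g x : ℂ) * ch (zr (-m)) x) :=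
        (hp.map (fun r => (r : ℂ))).map2 (zper_ch (-m)) (· * ·)
      rw [fc, ← hper.integral_shift t, ← integral_const_mul]
      congr 1
      funext x
      rw [ch_add]
      have : ch (zr m) t * ch (zr (-m)) t = 1 := by
        have hz : zr (-m) = -zr m := by funext i; simp [zr]
        rw [hz, ch_neg, Complex.mul_conj, Complex.normSq_eq_norm_sq, norm_ch]; simp
      linear_combination (-((κ t : ℂ) * (g (x + t) : ℂ) * ch (zr (-m)) x)) * this
    simp_rw [h2]
    rw [integral_mul_const]
    rfl
  · have hκ2 : Integrable (fun q : Rd d × Rd d => (κ q.2 : ℂ))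
        ((volume.restrict (Qcube d)).prod volume) := (hκ.ofReal (𝕜 := ℂ)).comp_snd _
    have h3 := hκ2.mul_bdd (c := K) (g := fun q : Rd d × Rd d => (g (q.1 + q.2) : ℂ) * ch (zr (-m)) q.1)
      (by
        refine Continuous.aestronglyMeasurable ?_
        exact (Complex.continuous_ofReal.comp (hg.comp (continuous_fst.add continuous_snd))).mul
          ((continuous_ch _).comp continuous_fst))
      (.of_forall fun q => by
        rw [norm_mul, norm_ch, mul_one, Complex.norm_real]; exact hK _)
    refine h3.congr (.of_forall fun q => ?_)
    simp [Function.uncurry, mul_assoc]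

/-! ### Fourier uniqueness -/

/-- the projection to the torus -/
def tproj (d : ℕ) : Rd d → UnitAddTorus (Fin d) := Pi.map fun _ x => (x : UnitAddCircle)

lemma tproj_quot (d : ℕ) : IsOpenQuotientMap (tproj d) :=
  IsOpenQuotientMap.piMap fun _ => QuotientAddGroup.isOpenQuotientMap_mk

lemma mFourier_tproj (m : Fin d → ℤ) (x : Rd d) :
    UnitAddTorus.mFourier m (tproj d x) = ch (zr m) x := by
  simp only [UnitAddTorus.mFourier, ContinuousMap.coe_mk, tproj, Pi.map]
  simp_rw [fourier_coe_apply]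
  rw [← Complex.exp_sum, ch]
  congr 1
  simp only [dot, zr]
  push_cast
  rw [Finset.mul_sum, Finset.sum_mul]
  refine Finset.sum_congr rfl fun i _ => ?_
  simp; ring

lemma fourier_unique {f : Rd d → ℂ} (hf : Continuous f) (hp : Zper f)
    (h0 : ∀ m : Fin d → ℤ, ∫ x in Qcube d, f x * ch (zr m) x = 0) : ∀ x ∈ Qcube d, f x = 0 := by
  obtain ⟨K, hK0, hK⟩ := hp.bdd hf
  -- descend to the torus
  have hsurj := (tproj_quot d).surjective
  set F0 : UnitAddTorus (Fin d) → ℂ := fun θ => (starRingEnd ℂ) (f (Function.surjInv hsurj θ)) with hF0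
  have hF : ∀ x, F0 (tproj d x) = (starRingEnd ℂ) (f x) := by
    intro x
    have hy := Function.surjInv_eq hsurj (tproj d x)
    set y := Function.surjInv hsurj (tproj d x)
    have : ∃ z : Fin d → ℤ, tr z x = y := by
      have h1 : ∀ i, ∃ n : ℤ, (n : ℝ) = y i - x i := by
        intro i
        have h2 : ((y i : ℝ) : UnitAddCircle) = ((x i : ℝ) : UnitAddCircle) := congrFun hy i
        rw [eq_comm, QuotientAddGroup.eq, AddSubgroup.mem_zmultiples_iff] at h2
        obtain ⟨n, hn⟩ := h2
        exact ⟨n, by simp at hn; linarith⟩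
      choose n hn using h1
      exact ⟨n, by funext i; simp [tr, hn i]⟩
    obtain ⟨z, hz⟩ := this
    simp only [hF0]
    change (starRingEnd ℂ) (f y) = _
    rw [← hz, hp]
  have hFc : Continuous F0 := by
    rw [(tproj_quot d).continuous_comp_iff.symm]
    have : F0 ∘ tproj d = fun x => (starRingEnd ℂ) (f x) := funext hF
    rw [this]; exact Complex.continuous_conj.comp hf
  set F : C(UnitAddTorus (Fin d), ℂ) := ⟨F0, hFc⟩
  have hitg : ∀ g : C(UnitAddTorus (Fin d), ℂ), IntegrableOn (fun x => f x * g (tproj d x)) (Qcube d) :=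
    fun g => integrableOn_Q (hf.mul (g.continuous.comp (tproj_quot d).continuous))
  have hspan : ∀ g ∈ Submodule.span ℂ (range (UnitAddTorus.mFourier (d := Fin d))),
      ∫ x in Qcube d, f x * g (tproj d x) = 0 := by
    intro g hg
    induction hg using Submodule.span_induction with
    | mem g hg => obtain ⟨m, rfl⟩ := hg; simp_rw [mFourier_tproj]; exact h0 m
    | zero => simp
    | add g g' _ _ h1 h2 =>
      simp only [ContinuousMap.add_apply, mul_add]
      rw [integral_add (hitg g) (hitg g'), h1, h2, add_zero]
    | smul c g _ h1 =>
      simp only [ContinuousMap.smul_apply, smul_eq_mul]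
      simp_rw [mul_left_comm _ c]
      rw [integral_const_mul, h1, mul_zero]
  have hI : ∫ x in Qcube d, f x * F (tproj d x) = 0 := by
    have hmem : F ∈ (Submodule.span ℂ (range (UnitAddTorus.mFourier (d := Fin d)))).topologicalClosure := by
      rw [UnitAddTorus.span_mFourier_closure_eq_top]; trivial
    rw [← norm_le_zero_iff]
    refine le_of_forall_pos_le_add fun δ hδ => ?_
    obtain ⟨g, hg, hgF⟩ := Metric.mem_closure_iff.1 hmem (δ / (K + 1)) (by positivity)
    have h1 : ∫ x in Qcube d, f x * F (tproj d x) = ∫ x in Qcube d, (f x * F (tproj d x) - f x * g (tproj d x)) := by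
      rw [integral_sub (hitg F) (hitg g), hspan g hg, sub_zero]
    rw [h1, zero_add]
    have h2 : ∀ x ∈ Qcube d, ‖f x * F (tproj d x) - f x * g (tproj d x)‖ ≤ K * (δ / (K + 1)) := by
      intro x _
      rw [← mul_sub, norm_mul]
      have : ‖F (tproj d x) - g (tproj d x)‖ ≤ δ / (K + 1) := by
        rw [← dist_eq_norm]
        exact (ContinuousMap.dist_apply_le_dist _).trans hgF.le
      exact mul_le_mul (hK x) this (norm_nonneg _) hK0
    have h3 := norm_setIntegral_le_of_norm_le_const (μ := volume) (s := Qcube d)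
      (by rw [volume_Qcube]; simp) h2
    refine h3.trans ?_
    have : volume.real (Qcube d) = 1 := by simp [Measure.real, volume_Qcube]
    rw [this, mul_one, ← mul_div_assoc, div_le_iff₀ (by positivity)]
    nlinarith
  have hI2 : ∫ x in Qcube d, ‖f x‖ ^ 2 = 0 := by
    have h1 : ∀ x, f x * F (tproj d x) = ((‖f x‖ ^ 2 : ℝ) : ℂ) := by
      intro x
      change f x * F0 (tproj d x) = _
      rw [hF, Complex.mul_conj, Complex.normSq_eq_norm_sq]
    simp_rw [h1] at hI
    rw [integral_complex_ofReal] at hI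
    exact_mod_cast hI
  have hae : (fun x => ‖f x‖ ^ 2) =ᵐ[volume.restrict (Qcube d)] 0 := by
    refine (integral_eq_zero_iff_of_nonneg (fun x => by positivity) ?_).1 hI2
    exact integrableOn_Q (by fun_prop)
  have h2 : EqOn (fun x => ‖f x‖ ^ 2) 0 (Qcube d) :=
    Measure.eqOn_open_of_ae_eq hae (isOpen_Qcube d) (by fun_prop) (by fun_prop)
  intro x hx
  simpa using h2 hx

/-! ### The identity `A* S A* = A*` -/

lemma adjApply_eq (A : DiffOp d N M) {ψ : Rd d → Vec M}
    (hψ : DifferentiableAt ℝ ψ x) (n : Fin N) :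
    adjApply A ψ x n = -∑ i, ∑ b, A i (Pi.single n 1) b * fderiv ℝ (fun y => ψ y b) x (Pi.single i 1) := by
  unfold adjApply dot
  congr 1
  refine Finset.sum_congr rfl fun i _ => Finset.sum_congr rfl fun b _ => ?_
  rw [fderiv_apply hψ b]
  rfl

lemma adjApply_smooth (A : DiffOp d N M) {ψ : Rd d → Vec M}
    (hψ : ContDiff ℝ (⊤ : ℕ∞) ψ) : ContDiff ℝ (⊤ : ℕ∞) (adjApply A ψ) := by
  have h1 : ContDiff ℝ (⊤ : ℕ∞) (fderiv ℝ ψ) := hψ.fderiv_right (by simp)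
  unfold adjApply dot
  refine contDiff_pi.2 fun n => ContDiff.neg (ContDiff.sum fun i _ => ContDiff.sum fun b _ => ?_)
  have h2 : ContDiff ℝ (⊤ : ℕ∞) (fun x => fderiv ℝ ψ x (Pi.single i 1)) := h1.clm_apply contDiff_const
  exact contDiff_const.mul (contDiff_pi.1 h2 b)

lemma adjApply_zper (A : DiffOp d N M) {ψ : Rd d → Vec M}
    (hp : Zper ψ) : Zper (adjApply A ψ) :=
  (zper_fderiv hp).map (fun L => fun n => -∑ i, dot (A i (Pi.single n 1)) (L (Pi.single i 1)))

/-- the parametrix -/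
def Sop {d N M : ℕ} (κ : Fin N → Fin M → Rd d → ℝ) (χ : Rd d → Vec N) : Rd d → Vec M :=
  fun x b => ∑ a, Tk volume (κ a b) (fun y => χ y a) x

lemma Sop_smooth {κ : Fin N → Fin M → Rd d → ℝ} (hκ : ∀ a b, Integrable (κ a b))
    {χ : Rd d → Vec N} (hχ : ContDiff ℝ (⊤ : ℕ∞) χ) (hp : Zper χ) :
    ContDiff ℝ (⊤ : ℕ∞) (Sop κ χ) :=
  contDiff_pi.2 fun b => ContDiff.sum fun a _ =>
    tk_smooth (hκ a b) (contDiff_pi.1 hχ a) (hp.map (fun v => v a))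

lemma Sop_zper (κ : Fin N → Fin M → Rd d → ℝ)
    {χ : Rd d → Vec N} (hp : Zper χ) : Zper (Sop κ χ) := fun x z => by
  funext b
  exact Finset.sum_congr rfl fun a _ => tk_zper volume (κ a b) (hp.map (fun v => v a)) x z

lemma fc_sum {ι : Type*} (s : Finset ι) (m : Fin d → ℤ) {g : ι → Rd d → ℝ}
    (hg : ∀ i ∈ s, Continuous (g i)) : fc m (fun x => ∑ i ∈ s, g i x) = ∑ i ∈ s, fc m (g i) := by
  unfold fc
  rw [← integral_finsetSum _ fun i hi => fc_integrable m (hg i hi)]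
  congr 1; funext x; push_cast; rw [Finset.sum_mul]

lemma fc_const_mul (m : Fin d → ℤ) (c : ℝ) (g : Rd d → ℝ) :
    fc m (fun x => c * g x) = c * fc m g := by
  unfold fc
  rw [← integral_const_mul]
  congr 1; funext x; push_cast; ring

lemma fc_neg (m : Fin d → ℤ) (g : Rd d → ℝ) :
    fc m (fun x => - g x) = - fc m g := by
  unfold fc
  rw [← integral_neg]
  congr 1; funext x; push_cast; ring

lemma fc_adj (A : DiffOp d N M) {ψ : Rd d → Vec M}
    (hψ : ContDiff ℝ (⊤ : ℕ∞) ψ) (hp : Zper ψ) (m : Fin d → ℤ) (n : Fin N) :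
    fc m (fun x => adjApply A ψ x n)
      = -(2 * Real.pi * Complex.I) * ∑ b, (sy A (zr m) b n : ℂ) * fc m (fun x => ψ x b) := by
  have hψb : ∀ b, ContDiff ℝ 1 (fun y => ψ y b) := fun b =>
    (contDiff_pi.1 hψ b).of_le (by exact_mod_cast le_top)
  have hc : ∀ b i, Continuous (fun x => fderiv ℝ (fun y => ψ y b) x (Pi.single i 1)) := fun b i =>
    ((hψb b).continuous_fderiv (by simp)).clm_apply continuous_const
  have h1 : (fun x => adjApply A ψ x n) = fun x => -∑ i, ∑ b, A i (Pi.single n 1) b *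
      fderiv ℝ (fun y => ψ y b) x (Pi.single i 1) := by
    funext x
    exact adjApply_eq A (hψ.differentiable (by simp) x) n
  rw [h1, fc_neg, fc_sum]
  · have h2 : ∀ i : Fin d, fc m (fun x => ∑ b, A i (Pi.single n 1) b *
        fderiv ℝ (fun y => ψ y b) x (Pi.single i 1))
        = ∑ b, (A i (Pi.single n 1) b : ℂ) * (2 * Real.pi * Complex.I * (m i : ℂ) * fc m (fun x => ψ x b)) := by
      intro i
      rw [fc_sum]
      · refine Finset.sum_congr rfl fun b _ => ?_
        rw [fc_const_mul, fc_deriv m (hψb b) (hp.map (fun v => v b))]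
      · intro b _; exact continuous_const.mul (hc b i)
    simp_rw [h2]
    rw [Finset.sum_comm, neg_mul, neg_inj, Finset.mul_sum]
    refine Finset.sum_congr rfl fun b _ => ?_
    have h3 : (sy A (zr m) b n : ℂ) = ∑ i, (m i : ℂ) * (A i (Pi.single n 1) b : ℂ) := by
      rw [sy, symb_apply]
      simp [zr, Finset.sum_apply]
    rw [h3, Finset.sum_mul, Finset.mul_sum]
    refine Finset.sum_congr rfl fun i _ => ?_
    ring
  · intro i _
    exact continuous_finsetSum _ fun b _ => continuous_const.mul (hc b i)

lemma exists_parametrix (hA : ConstantRank A) :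
    ∃ κ : Fin N → Fin M → Rd d → ℝ, (∀ a b, Integrable (κ a b)) ∧
      ∀ ψ : Rd d → Vec M, ContDiff ℝ (⊤ : ℕ∞) ψ → Zper ψ → ∀ x ∈ Qcube d,
        adjApply A (Sop κ (adjApply A ψ)) x = adjApply A ψ x := by
  obtain ⟨κ, hκ, hid⟩ := exists_kernel hA
  refine ⟨κ, hκ, fun ψ hψ hp => ?_⟩
  have hχ := adjApply_smooth A hψ
  have hχp := adjApply_zper A hp
  have hφ := Sop_smooth hκ hχ hχp
  have hφp := Sop_zper κ hχp
  have hξ := adjApply_smooth A hφ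
  have hξp := adjApply_zper A hφp
  have key : ∀ (e : Fin N) (m : Fin d → ℤ), fc m (fun x => adjApply A (Sop κ (adjApply A ψ)) x e)
      = fc m (fun x => adjApply A ψ x e) := by
    intro e m
    obtain ⟨H, hH1, hH2⟩ := hid m
    rw [fc_adj A hφ hφp, fc_adj A hψ hp]
    have h1 : ∀ b, fc m (fun x => Sop κ (adjApply A ψ) x b)
        = ∑ a, Complex.I * H a b * fc m (fun x => adjApply A ψ x a) := by
      intro b
      have hb : (fun x => Sop κ (adjApply A ψ) x b)
        = fun x => ∑ a, Tk volume (κ a b) (fun y => adjApply A ψ y a) x := rfl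
      rw [hb, fc_sum]
      · refine Finset.sum_congr rfl fun a _ => ?_
        rw [fc_tk m (hκ a b) (contDiff_pi.1 hχ a).continuous (hχp.map (fun v => v a)), hH1]
      · intro a _
        exact tk_continuous (hκ a b) (contDiff_pi.1 hχ a).continuous (hχp.map (fun v => v a))
    simp_rw [h1, fc_adj A hψ hp]
    have h2 : ∀ c, (sy A (zr m) c e : ℂ) = 2 * Real.pi * ∑ a, ∑ b, (sy A (zr m) c a : ℂ) * H a b * sy A (zr m) b e := by
      intro c
      have := congrArg (fun r : ℝ => (r : ℂ)) (hH2 c e)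
      refine this.symm.trans ?_
      push_cast; rfl
    congr 1
    have h2' : ∑ c, (sy A (zr m) c e : ℂ) * fc m (fun x => ψ x c) = ∑ c, (2 * Real.pi * ∑ a, ∑ b,
        (sy A (zr m) c a : ℂ) * H a b * sy A (zr m) b e) * fc m (fun x => ψ x c) :=
      Finset.sum_congr rfl fun c _ => by rw [← h2 c]
    rw [h2']
    simp_rw [Finset.mul_sum, Finset.sum_mul]
    have h3 : ∀ (b : Fin M) (a : Fin N) (c : Fin M),
        (sy A (zr m) b e : ℂ) * (Complex.I * H a b * (-(2 * Real.pi * Complex.I) * ((sy A (zr m) c a : ℂ) * fc m (fun x => ψ x c))))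
        = 2 * Real.pi * ((sy A (zr m) c a : ℂ) * H a b * sy A (zr m) b e) * fc m (fun x => ψ x c) := by
      intro b a c
      linear_combination (-2 * Real.pi * ((sy A (zr m) c a : ℂ) * H a b * sy A (zr m) b e) * fc m (fun x => ψ x c)) * Complex.I_mul_I
    simp_rw [h3]
    rw [Finset.sum_comm]
    have h4 : ∀ a : Fin N, ∑ b : Fin M, ∑ c : Fin M, 2 * Real.pi * ((sy A (zr m) c a : ℂ) * H a b * sy A (zr m) b e) * fc m (fun x => ψ x c)
        = ∑ c : Fin M, ∑ b : Fin M, 2 * Real.pi * ((sy A (zr m) c a : ℂ) * H a b * sy A (zr m) b e) * fc m (fun x => ψ x c) :=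
      fun a => Finset.sum_comm
    simp_rw [h4]
    rw [Finset.sum_comm]
  intro x hx
  funext e
  have hc1 := (contDiff_pi.1 hξ e).continuous
  have hc2 := (contDiff_pi.1 hχ e).continuous
  have := fourier_unique (f := fun x => ((adjApply A (Sop κ (adjApply A ψ)) x e : ℝ) : ℂ) - ((adjApply A ψ x e : ℝ) : ℂ))
    ((Complex.continuous_ofReal.comp hc1).sub (Complex.continuous_ofReal.comp hc2))
    (hξp.map2 hχp (fun v w => ((v e : ℝ) : ℂ) - ((w e : ℝ) : ℂ))) (fun m => by
      have hk := key e (-m)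
      have hi1 := fc_integrable (-m) hc1
      have hi2 := fc_integrable (-m) hc2
      unfold fc at hk
      rw [neg_neg] at hk hi1 hi2
      simp_rw [sub_mul]
      rw [integral_sub hi1 hi2, hk, sub_self]) x hx
  have h5 := sub_eq_zero.1 this
  exact_mod_cast h5

/-! ## Convolution on the torus -/

def Rk {d : ℕ} (κ g : Rd d → ℝ) (y : Rd d) : ℝ := ∫ t, κ t * g (y - t)

lemma rk_meas {κ g : Rd d → ℝ} (hκ : AEStronglyMeasurable κ volume)
    (hg : AEStronglyMeasurable g volume) :
    AEStronglyMeasurable (fun q : Rd d × Rd d => κ q.2 * g (q.1 - q.2))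
      ((volume.restrict (Qcube d)).prod volume) := by
  have h := AEStronglyMeasurable.convolution_integrand (ContinuousLinearMap.mul ℝ ℝ) hκ hg
  refine AEStronglyMeasurable.mono_ac ?_ h
  exact Measure.AbsolutelyContinuous.prod Measure.restrict_le_self.absolutelyContinuous
    Measure.AbsolutelyContinuous.rfl

lemma jensen_lint {α : Type*} [MeasurableSpace α] {μ : Measure α} (hp : 1 ≤ p)
    {k h : α → ℝ≥0∞} (hk : AEMeasurable k μ) (hh : AEMeasurable (fun a => k a * h a ^ p) μ) :
    (∫⁻ a, k a * h a ∂μ) ^ p ≤ (∫⁻ a, k a ∂μ) ^ (p - 1) * ∫⁻ a, k a * h a ^ p ∂μ := by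
  have hp0 : 0 < p := by linarith
  have hpi : 1 / p ≤ 1 := by rw [div_le_one hp0]; exact hp
  have h1 := ENNReal.lintegral_mul_norm_pow_le hk hh (p := 1 - 1 / p) (q := 1 / p)
    (by linarith) (by positivity) (by ring)
  have h2 : ∀ a, k a * h a = k a ^ (1 - 1 / p) * (k a * h a ^ p) ^ (1 / p) := by
    intro a
    rw [ENNReal.mul_rpow_of_nonneg _ _ (by positivity), ← mul_assoc,
      ← ENNReal.rpow_add_of_nonneg _ _ (by linarith) (by positivity), ← ENNReal.rpow_mul]
    have e1 : 1 - 1 / p + 1 / p = 1 := by ring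
    have e2 : p * (1 / p) = 1 := by field_simp
    rw [e1, e2, ENNReal.rpow_one, ENNReal.rpow_one]
  simp_rw [h2]
  refine (ENNReal.rpow_le_rpow h1 hp0.le).trans (le_of_eq ?_)
  rw [ENNReal.mul_rpow_of_nonneg _ _ hp0.le, ← ENNReal.rpow_mul, ← ENNReal.rpow_mul]
  have e1 : (1 - 1 / p) * p = p - 1 := by field_simp
  have e2 : 1 / p * p = 1 := by field_simp
  rw [e1, e2, ENNReal.rpow_one]

lemma rk_young_lint (hp : 1 ≤ p) {κ g : Rd d → ℝ}
    (hκ : AEStronglyMeasurable κ volume)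
    (hg : AEStronglyMeasurable g volume) (hper : Zper g) :
    ∫⁻ y in Qcube d, (∫⁻ t, ‖κ t‖ₑ * ‖g (y - t)‖ₑ) ^ p
      ≤ (∫⁻ t, ‖κ t‖ₑ) ^ p * ∫⁻ y in Qcube d, ‖g y‖ₑ ^ p := by
  have hp0 : 0 < p := by linarith
  have hgm : ∀ y : Rd d, AEStronglyMeasurable (fun t => g (y - t)) volume := fun y =>
    hg.comp_quasiMeasurePreserving (quasiMeasurePreserving_sub_left volume y)
  have hmeas : AEMeasurable (fun q : Rd d × Rd d => ‖κ q.2‖ₑ * ‖g (q.1 - q.2)‖ₑ ^ p)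
      ((volume.restrict (Qcube d)).prod volume) := by
    have h1 : AEMeasurable (fun q : Rd d × Rd d => ‖κ q.2‖ₑ)
        ((volume.restrict (Qcube d)).prod volume) := hκ.comp_snd.enorm
    have h2 := rk_meas (κ := fun _ => 1) (aestronglyMeasurable_const) hg
    refine h1.mul (AEMeasurable.pow_const ?_ p)
    simpa using h2.enorm
  calc ∫⁻ y in Qcube d, (∫⁻ t, ‖κ t‖ₑ * ‖g (y - t)‖ₑ) ^ p
      ≤ ∫⁻ y in Qcube d, (∫⁻ t, ‖κ t‖ₑ) ^ (p - 1) * ∫⁻ t, ‖κ t‖ₑ * ‖g (y - t)‖ₑ ^ p :=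
        lintegral_mono fun y => jensen_lint hp hκ.enorm (hκ.enorm.mul ((hgm y).enorm.pow_const p))
    _ = (∫⁻ t, ‖κ t‖ₑ) ^ (p - 1) * ∫⁻ y in Qcube d, ∫⁻ t, ‖κ t‖ₑ * ‖g (y - t)‖ₑ ^ p := by
        refine lintegral_const_mul'' _ hmeas.lintegral_prod_right'
    _ = (∫⁻ t, ‖κ t‖ₑ) ^ (p - 1) * ∫⁻ t, ∫⁻ y in Qcube d, ‖κ t‖ₑ * ‖g (y - t)‖ₑ ^ p := by
        rw [lintegral_lintegral_swap hmeas]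
    _ = (∫⁻ t, ‖κ t‖ₑ) ^ (p - 1) * ∫⁻ t, ‖κ t‖ₑ * ∫⁻ y in Qcube d, ‖g y‖ₑ ^ p := by
        congr 1
        refine lintegral_congr fun t => ?_
        rw [lintegral_const_mul' _ _ enorm_ne_top]
        congr 1
        have := Zper.lintegral_shift (hper.map (fun r => ‖r‖ₑ ^ p)) (-t)
        simpa [sub_eq_add_neg] using this
    _ = (∫⁻ t, ‖κ t‖ₑ) ^ p * ∫⁻ y in Qcube d, ‖g y‖ₑ ^ p := by
        rw [lintegral_mul_const'' _ hκ.enorm, ← mul_assoc]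
        congr 1
        conv_lhs => rw [← ENNReal.rpow_one (∫⁻ t, ‖κ t‖ₑ)]
        rw [← ENNReal.rpow_mul, ← ENNReal.rpow_add_of_nonneg _ _ (by linarith) zero_le_one]
        congr 1; ring

lemma rk_zper (κ : Rd d → ℝ) (hg : Zper g) : Zper (Rk κ g) := fun y z => by
  unfold Rk
  congr 1; funext t
  have : tr z y - t = tr z (y - t) := by rw [tr_eq, tr_eq]; abel
  rw [this, hg]

lemma rk_joint {κ g : Rd d → ℝ} (hκ : Integrable κ)
    (hg : IntegrableOn g (Qcube d)) (hper : Zper g) :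
    Integrable (fun q : Rd d × Rd d => κ q.2 * g (q.1 - q.2))
      ((volume.restrict (Qcube d)).prod volume) := by
  have hgm := hper.aesm hg.aestronglyMeasurable
  have hm := rk_meas hκ.aestronglyMeasurable hgm
  refine ⟨hm, ?_⟩
  rw [HasFiniteIntegral, lintegral_prod _ hm.enorm]
  have h := rk_young_lint (le_refl (1:ℝ)) hκ.aestronglyMeasurable hgm hper
  simp only [ENNReal.rpow_one] at h
  simp only [enorm_mul]
  exact h.trans_lt (ENNReal.mul_lt_top hκ.2 hg.2)

lemma rk_ae_integrable {κ g : Rd d → ℝ} (hκ : Integrable κ)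
    (hg : IntegrableOn g (Qcube d)) (hper : Zper g) :
    ∀ᵐ y ∂(volume.restrict (Qcube d)), Integrable (fun t => κ t * g (y - t)) :=
  (rk_joint hκ hg hper).prod_right_ae

lemma rk_integrable {κ g : Rd d → ℝ} (hκ : Integrable κ)
    (hg : IntegrableOn g (Qcube d)) (hper : Zper g) : IntegrableOn (Rk κ g) (Qcube d) :=
  (rk_joint hκ hg hper).integral_prod_left

/-- duality -/
lemma rk_dual {κ g : Rd d → ℝ} (hκ : Integrable κ)
    (hg : IntegrableOn g (Qcube d)) (hper : Zper g) {χ : Rd d → ℝ} (hχ : Continuous χ)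
    (hχp : Zper χ) :
    ∫ y in Qcube d, Rk κ g y * χ y = ∫ y in Qcube d, g y * Tk volume κ χ y := by
  obtain ⟨K, hK0, hK⟩ := hχp.bdd hχ
  have hj := rk_joint hκ hg hper
  have hj1 : Integrable (fun q : Rd d × Rd d => κ q.2 * g (q.1 - q.2) * χ q.1)
      ((volume.restrict (Qcube d)).prod volume) :=
    hj.mul_bdd (c := K) (hχ.comp continuous_fst).aestronglyMeasurable
      (.of_forall fun q => hK _)
  have hj2 : Integrable (fun q : Rd d × Rd d => g q.1 * κ q.2 * χ (q.1 + q.2))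
      ((volume.restrict (Qcube d)).prod volume) :=
    (Integrable.mul_prod hg hκ).mul_bdd (c := K)
      (hχ.comp (by fun_prop)).aestronglyMeasurable
      (.of_forall fun q => hK _)
  calc ∫ y in Qcube d, Rk κ g y * χ y = ∫ y in Qcube d, ∫ t, κ t * g (y - t) * χ y := by
        refine integral_congr_ae (.of_forall fun y => ?_)
        simp only [Rk]
        rw [integral_mul_const]
    _ = ∫ t, ∫ y in Qcube d, κ t * g (y - t) * χ y := integral_integral_swap hj1
    _ = ∫ t, ∫ y in Qcube d, g y * κ t * χ (y + t) := by
        refine integral_congr_ae (.of_forall fun t => ?_)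
        have h := Zper.integral_shift ((hper.map2 (hχp.shift t) (fun a b => a * κ t * b))) (-t)
        simp only
        rw [← h]
        refine integral_congr_ae (.of_forall fun y => ?_)
        simp only [neg_add_cancel_right, sub_eq_add_neg]
        ring
    _ = ∫ y in Qcube d, ∫ t, g y * κ t * χ (y + t) := (integral_integral_swap hj2).symm
    _ = ∫ y in Qcube d, g y * Tk volume κ χ y := by
        refine integral_congr_ae (.of_forall fun y => ?_)
        simp only [Tk, smul_eq_mul]
        rw [← integral_const_mul]
        simp only [mul_assoc]

lemma lint_eq_ofReal {α E : Type*} [MeasurableSpace α] {μ : Measure α} [NormedAddCommGroup E] (hp : 1 < p)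
    {f : α → E} (hf : MemLp f (ENNReal.ofReal p) μ) :
    ∫⁻ y, ‖f y‖ₑ ^ p ∂μ = ENNReal.ofReal (∫ y, ‖f y‖ ^ p ∂μ) := by
  have h := hf.integrable_norm_rpow (by simp; linarith) ENNReal.ofReal_ne_top
  rw [ENNReal.toReal_ofReal (by linarith)] at h
  rw [ofReal_integral_eq_lintegral_ofReal h (.of_forall fun x => by positivity)]
  refine lintegral_congr fun x => ?_
  rw [← ENNReal.ofReal_rpow_of_nonneg (norm_nonneg _) (by linarith), ofReal_norm]

lemma rk_young (hp : 1 < p) {κ g : Rd d → ℝ} (hκ : Integrable κ)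
    (hg : MemLp g (ENNReal.ofReal p) (volume.restrict (Qcube d))) (hper : Zper g) :
    MemLp (Rk κ g) (ENNReal.ofReal p) (volume.restrict (Qcube d)) ∧
    ∫ y in Qcube d, ‖Rk κ g y‖ ^ p ≤ (∫ t, ‖κ t‖) ^ p * ∫ y in Qcube d, ‖g y‖ ^ p := by
  have hp0 : 0 < p := by linarith
  have hgi : IntegrableOn g (Qcube d) := hg.integrable (by simpa using hp.le)
  have hri := rk_integrable hκ hgi hper
  have h0 : ∀ y, ‖Rk κ g y‖ₑ ≤ ∫⁻ t, ‖κ t‖ₑ * ‖g (y - t)‖ₑ := fun y => by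
    refine (enorm_integral_le_lintegral_enorm _).trans (le_of_eq ?_)
    simp only [enorm_mul]
  have h1 : ∫⁻ y in Qcube d, ‖Rk κ g y‖ₑ ^ p ≤ (∫⁻ t, ‖κ t‖ₑ) ^ p * ∫⁻ y in Qcube d, ‖g y‖ₑ ^ p :=
    (lintegral_mono fun y => ENNReal.rpow_le_rpow (h0 y) hp0.le).trans
      (rk_young_lint hp.le hκ.aestronglyMeasurable (hper.aesm hg.1) hper)
  have h2 : (∫⁻ t, ‖κ t‖ₑ) ^ p * ∫⁻ y in Qcube d, ‖g y‖ₑ ^ p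
      = ENNReal.ofReal ((∫ t, ‖κ t‖) ^ p * ∫ y in Qcube d, ‖g y‖ ^ p) := by
    rw [ENNReal.ofReal_mul (by positivity), lint_eq_ofReal hp hg,
      ← ENNReal.ofReal_rpow_of_nonneg (by positivity) hp0.le,
      ofReal_integral_norm_eq_lintegral_enorm hκ]
  rw [h2] at h1
  have hm : MemLp (Rk κ g) (ENNReal.ofReal p) (volume.restrict (Qcube d)) := by
    refine ⟨hri.aestronglyMeasurable, ?_⟩
    rw [eLpNorm_lt_top_iff_lintegral_rpow_enorm_lt_top (by simp; linarith) ENNReal.ofReal_ne_top,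
      ENNReal.toReal_ofReal hp0.le]
    exact h1.trans_lt ENNReal.ofReal_lt_top
  refine ⟨hm, ?_⟩
  rw [lint_eq_ofReal hp hm] at h1
  exact (ENNReal.ofReal_le_ofReal_iff (by positivity)).1 h1

open scoped Pointwise

lemma lat_finite (K : ℝ) : ∃ F : Finset (Lat d), ∀ g : Lat d, g ∉ F → K < ‖(g : Rd d)‖ := by
  have hz : ∀ z : Fin d → ℤ, zr z ∈ Lat d := fun z => by
    rw [Submodule.mem_span_range_iff_exists_fun ℤ]
    refine ⟨z, ?_⟩
    funext i
    simp [zr, Pi.single_apply]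
  refine ⟨(Finset.Icc (fun _ : Fin d => -⌈K⌉) (fun _ => ⌈K⌉)).image (fun z => (⟨zr z, hz z⟩ : Lat d)), ?_⟩
  intro g hg
  by_contra hK
  push Not at hK
  apply hg
  obtain ⟨z, hz'⟩ := lat_exists g
  rw [Finset.mem_image]
  refine ⟨z, ?_, Subtype.ext hz'.symm⟩
  rw [Finset.mem_Icc]
  have hb : ∀ i, |(z i : ℝ)| ≤ K := fun i => by
    have := norm_le_pi_norm (g : Rd d) i
    rw [hz'] at this hK
    simp only [zr, Real.norm_eq_abs] at this
    exact this.trans hK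
  constructor <;> intro i <;> have := abs_le.1 (hb i) <;> have hc := Int.le_ceil K
  · have : (-⌈K⌉ : ℝ) ≤ z i := by linarith
    exact_mod_cast this
  · have : (z i : ℝ) ≤ ⌈K⌉ := by linarith
    exact_mod_cast this

lemma Qcube_norm_le (hx : x ∈ Qcube d) : ‖x‖ ≤ 1 := by
  refine (pi_norm_le_iff_of_nonneg zero_le_one).2 fun i => ?_
  rw [Real.norm_eq_abs, abs_of_pos (hx i).1]
  exact (hx i).2.le

lemma unfold_aux {K : ℝ} {F : Finset (Lat d)}
    (hF : ∀ g : Lat d, g ∉ F → K + 1 < ‖(g : Rd d)‖) (f : Rd d → ℝ) (hf : Integrable f)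
    (h0 : ∀ x, K ≤ ‖x‖ → f x = 0) : ∫ x, f x = ∑ g ∈ F, ∫ x in Qcube d, f (x + g) := by
  rw [(fdQ d).integral_eq_tsum'' f hf, tsum_eq_sum (s := F)]
  · refine Finset.sum_congr rfl fun g _ => ?_
    refine integral_congr_ae (.of_forall fun x => ?_)
    change f ((g : Rd d) + x) = _
    rw [add_comm]
  · intro g hg
    refine setIntegral_eq_zero_of_forall_eq_zero fun x hx => ?_
    refine h0 _ ?_
    change K ≤ ‖(g : Rd d) + x‖
    have h1 := hF g hg
    have h2 : ‖(g : Rd d)‖ ≤ ‖(g : Rd d) + x‖ + ‖x‖ := by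
      simpa using norm_sub_le ((g : Rd d) + x) x
    have h3 := Qcube_norm_le hx
    linarith

lemma unfold_integral (K : ℝ) : ∃ F : Finset (Lat d), ∀ f : Rd d → ℝ, Integrable f →
    (∀ x, K ≤ ‖x‖ → f x = 0) → ∫ x, f x = ∑ g ∈ F, ∫ x in Qcube d, f (x + g) := by
  obtain ⟨F, hF⟩ := lat_finite (d := d) (K + 1)
  exact ⟨F, unfold_aux hF⟩

lemma Zper.intOn_ball (hper : Zper g) (hg : IntegrableOn g (Qcube d)) :
    LocallyIntegrable g volume := by
  rw [locallyIntegrable_iff]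
  intro k hk
  obtain ⟨K, hK⟩ := hk.isBounded.exists_norm_le
  obtain ⟨F, hF⟩ := lat_finite (d := d) (K + 1)
  have h1 : IntegrableOn g (⋃ γ ∈ F, (γ +ᵥ Qcube d)) := by
    rw [integrableOn_finset_iUnion]
    intro γ _
    exact (((fdQ d).vadd γ).integrableOn_iff (fdQ d) (fun g x => hper.lat g x)).2 hg
  refine (h1.mono_set_ae ?_)
  filter_upwards [(fdQ d).ae_covers] with x hx hxk
  obtain ⟨γ, hγ⟩ := hx
  have hxm : x ∈ (-γ) +ᵥ Qcube d := by
    rw [Set.mem_vadd_set_iff_neg_vadd_mem, neg_neg]; exact hγ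
  refine mem_biUnion (x := -γ) ?_ hxm
  by_contra hn
  have h2 := hF _ hn
  have h3 : ‖((-γ : Lat d) : Rd d)‖ ≤ ‖x‖ + ‖(γ : Rd d) + x‖ := by
    have : ((-γ : Lat d) : Rd d) = x - ((γ : Rd d) + x) := by simp
    rw [this]; exact norm_sub_le _ _
  have h4 : ‖(γ : Rd d) + x‖ ≤ 1 := Qcube_norm_le hγ
  linarith [hK x hxk]

lemma rk_cc_tendsto {ι : Type*} {l : Filter ι}
    {κ : Rd d → ℝ} (hκ : Continuous κ) (hs : HasCompactSupport κ) {g : ι → Rd d → ℝ}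
    (hg : ∀ n, IntegrableOn (g n) (Qcube d)) (hper : ∀ n, Zper (g n))
    (hw : ∀ φ : Rd d → ℝ, Continuous φ → Tendsto (fun n => ∫ x in Qcube d, g n x * φ x) l (𝓝 0))
    (y : Rd d) : Tendsto (fun n => Rk κ (g n) y) l (𝓝 0) := by
  have hs' : HasCompactSupport (fun s => κ (y - s)) :=
    hs.comp_homeomorph (Homeomorph.subLeft y)
  have hc' : Continuous (fun s => κ (y - s)) := by fun_prop
  have hi : ∀ n, Integrable (fun s => κ (y - s) * g n s) := fun n => by
    have := ((hper n).intOn_ball (hg n)).integrable_smul_left_of_hasCompactSupport hc' hs'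
    simpa using this
  have h1 : ∀ n, Rk κ (g n) y = ∫ s, κ (y - s) * g n s := fun n => by
    unfold Rk
    rw [← integral_sub_left_eq_self (fun t => κ t * g n (y - t)) volume y]
    simp
  obtain ⟨K, hK⟩ := hs'.isCompact.isBounded.exists_norm_le
  obtain ⟨F, hF⟩ := unfold_integral (d := d) (K + 1)
  have h2 : ∀ n, Rk κ (g n) y = ∑ γ ∈ F, ∫ x in Qcube d, g n x * κ (y - (x + γ)) := fun n => by
    rw [h1, hF _ (hi n)]
    · refine Finset.sum_congr rfl fun γ _ => ?_
      refine integral_congr_ae (.of_forall fun x => ?_)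
      have := (hper n).lat γ x
      have e : (γ +ᵥ x : Rd d) = x + γ := by change (γ : Rd d) + x = _; rw [add_comm]
      rw [e] at this
      simp only [this]
      ring
    · intro x hx
      have : x ∉ tsupport (fun s => κ (y - s)) := fun h => by linarith [hK x h]
      have := image_eq_zero_of_notMem_tsupport this
      rw [this, zero_mul]
  simp_rw [h2]
  have : (0:ℝ) = ∑ γ ∈ F, 0 := by simp
  rw [this]
  refine tendsto_finsetSum _ fun γ _ => ?_
  exact hw (fun x => κ (y - (x + γ))) (by fun_prop)

lemma rk_cc_bound {κ : Rd d → ℝ} (hκ : Continuous κ) (hs : HasCompactSupport κ) :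
    ∃ C, 0 ≤ C ∧ ∀ g : Rd d → ℝ, Zper g → IntegrableOn g (Qcube d) →
      ∀ y ∈ Qcube d, ‖Rk κ g y‖ ≤ C * ∫ x in Qcube d, ‖g x‖ := by
  obtain ⟨B, hB⟩ := hs.exists_bound_of_continuous hκ
  have hB0 : 0 ≤ B := (norm_nonneg _).trans (hB 0)
  obtain ⟨K, hK⟩ := hs.isCompact.isBounded.exists_norm_le
  obtain ⟨F, hF⟩ := unfold_integral (d := d) (K + 2)
  refine ⟨F.card * B, by positivity, fun g hper hg y hy => ?_⟩
  have hs' : HasCompactSupport (fun s => κ (y - s)) :=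
    hs.comp_homeomorph (Homeomorph.subLeft y)
  have hc' : Continuous (fun s => κ (y - s)) := by fun_prop
  have hi : Integrable (fun s => κ (y - s) * g s) := by
    have := (hper.intOn_ball hg).integrable_smul_left_of_hasCompactSupport hc' hs'
    simpa using this
  have h1 : Rk κ g y = ∫ s, κ (y - s) * g s := by
    unfold Rk
    rw [← integral_sub_left_eq_self (fun t => κ t * g (y - t)) volume y]
    simp
  rw [h1, hF _ hi]
  · refine (norm_sum_le _ _).trans ?_
    rw [mul_assoc, ← nsmul_eq_mul]
    refine Finset.sum_le_card_nsmul _ _ _ fun γ _ => ?_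
    rw [← integral_const_mul]
    refine norm_integral_le_of_norm_le (hg.norm.const_mul B) (.of_forall fun x => ?_)
    have := hper.lat γ x
    have e : (γ +ᵥ x : Rd d) = x + γ := by change (γ : Rd d) + x = _; rw [add_comm]
    rw [e] at this
    rw [this, norm_mul]
    exact mul_le_mul_of_nonneg_right (hB _) (norm_nonneg _)
  · intro x hx
    have : y - x ∉ tsupport κ := fun h => by
      have h5 := hK _ h
      have h6 := Qcube_norm_le hy
      have h7 : ‖x‖ ≤ ‖y‖ + ‖y - x‖ := by simpa using norm_sub_le y (y - x)
      linarith
    rw [image_eq_zero_of_notMem_tsupport this, zero_mul]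

lemma l1_le_lp {α : Type*} [MeasurableSpace α] {μ : Measure α} [IsProbabilityMeasure μ]
    {E : Type*} [NormedAddCommGroup E] (hp : 1 < p)
    {f : α → E} (hf : MemLp f (ENNReal.ofReal p) μ) :
    (∫ x, ‖f x‖ ∂μ) ^ p ≤ ∫ x, ‖f x‖ ^ p ∂μ := by
  have h := hf.integrable_norm_rpow (by simp; linarith) ENNReal.ofReal_ne_top
  rw [ENNReal.toReal_ofReal (by linarith)] at h
  exact (convexOn_rpow hp.le).map_integral_le (f := fun x => ‖f x‖)
    ((Real.continuous_rpow_const (by linarith)).continuousOn) isClosed_Ici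
    (.of_forall fun x => norm_nonneg _)
    (hf.integrable (by simpa using hp.le)).norm h

lemma rk_tendsto (hp : 1 < p) {ι : Type*} {l : Filter ι} [l.IsCountablyGenerated]
    {κ : Rd d → ℝ} (hκ : Integrable κ) {g : ι → Rd d → ℝ}
    (hg : ∀ n, MemLp (g n) (ENNReal.ofReal p) (volume.restrict (Qcube d))) (hper : ∀ n, Zper (g n))
    (hB : ∀ n, ∫ x in Qcube d, ‖g n x‖ ^ p ≤ B)
    (hw : ∀ φ : Rd d → ℝ, Continuous φ → Tendsto (fun n => ∫ x in Qcube d, g n x * φ x) l (𝓝 0)) :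
    Tendsto (fun n => ∫ y in Qcube d, ‖Rk κ (g n) y‖ ^ p) l (𝓝 0) := by
  have hp0 : 0 < p := by linarith
  have hgi : ∀ n, IntegrableOn (g n) (Qcube d) := fun n => (hg n).integrable (by simpa using hp.le)
  have key : ∀ κ' : Rd d → ℝ, Continuous κ' → HasCompactSupport κ' →
      Tendsto (fun n => ∫ y in Qcube d, ‖Rk κ' (g n) y‖ ^ p) l (𝓝 0) := by
    intro κ' hc hs
    obtain ⟨C, hC0, hC⟩ := rk_cc_bound hc hs
    have hi' : Integrable κ' := hc.integrable_of_hasCompactSupport hs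
    have h0 : (0:ℝ) = ∫ y in Qcube d, (0:ℝ) := by simp
    rw [h0]
    refine tendsto_integral_filter_of_dominated_convergence (fun _ => C ^ p * B)
      (.of_forall fun n => ?_) (.of_forall fun n => ?_) (integrable_const _) ?_
    · exact ((rk_integrable hi' (hgi n) (hper n)).aestronglyMeasurable.norm.aemeasurable.pow_const p).aestronglyMeasurable
    · filter_upwards [ae_restrict_mem (measurableSet_Qcube d)] with y hy
      have h1 := hC _ (hper n) (hgi n) y hy
      rw [Real.norm_of_nonneg (by positivity)]
      calc ‖Rk κ' (g n) y‖ ^ p ≤ (C * ∫ x in Qcube d, ‖g n x‖) ^ p :=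
            Real.rpow_le_rpow (norm_nonneg _) h1 hp0.le
        _ = C ^ p * (∫ x in Qcube d, ‖g n x‖) ^ p := Real.mul_rpow hC0 (by positivity)
        _ ≤ C ^ p * B := by
            gcongr
            exact (l1_le_lp hp (hg n)).trans (hB n)
    · refine Eventually.of_forall fun y => ?_
      have := (rk_cc_tendsto hc hs hgi hper hw y).norm.rpow_const (p := p) (Or.inr hp0.le)
      simpa [Real.zero_rpow hp0.ne'] using this
  rcases l.eq_or_neBot with rfl | hl
  · exact tendsto_bot
  have hB0 : 0 ≤ B := by
    obtain ⟨n⟩ : Nonempty ι := hl.nonempty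
    exact (integral_nonneg fun x => by positivity).trans (hB n)
  rw [Metric.tendsto_nhds]
  intro ε hε
  obtain ⟨η, hη, hη2⟩ : ∃ η : ℝ, 0 < η ∧ 2 ^ p * (η ^ p * B) < ε / 2 := by
    have : Tendsto (fun η : ℝ => 2 ^ p * (η ^ p * B)) (𝓝[>] 0) (𝓝 (2 ^ p * ((0:ℝ) ^ p * B))) := by
      refine Tendsto.mono_left ?_ nhdsWithin_le_nhds
      have : Continuous (fun η : ℝ => 2 ^ p * (η ^ p * B)) :=
        continuous_const.mul ((Real.continuous_rpow_const hp0.le).mul continuous_const)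
      exact this.tendsto 0
    rw [Real.zero_rpow hp0.ne', zero_mul, mul_zero] at this
    obtain ⟨η, h1, h2⟩ := ((this.eventually (gt_mem_nhds (half_pos hε))).and self_mem_nhdsWithin).exists
    exact ⟨η, h2, h1⟩
  obtain ⟨κ', hs, hd, hc, hi'⟩ := hκ.exists_hasCompactSupport_integral_sub_le hη
  have hk := (key κ' hc hs).const_mul (2 ^ p)
  rw [mul_zero] at hk
  filter_upwards [hk.eventually (gt_mem_nhds (half_pos hε))] with n hn
  rw [Real.dist_0_eq_abs, abs_of_nonneg (integral_nonneg fun x => by positivity)]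
  have hy1 := rk_young hp (hκ.sub hi') (hg n) (hper n)
  have hy2 := rk_young hp hi' (hg n) (hper n)
  have hy3 := rk_young hp hκ (hg n) (hper n)
  have hitg : ∀ {u : Rd d → ℝ}, MemLp u (ENNReal.ofReal p) (volume.restrict (Qcube d)) →
      IntegrableOn (fun x => ‖u x‖ ^ p) (Qcube d) := fun {u} hu => by
    have h := hu.integrable_norm_rpow (by simp; linarith) ENNReal.ofReal_ne_top
    rwa [ENNReal.toReal_ofReal (by linarith)] at h
  have h1 : ∫ y in Qcube d, ‖Rk κ (g n) y‖ ^ p ≤ ∫ y in Qcube d,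
      (2 ^ p * ‖Rk (κ - κ') (g n) y‖ ^ p + 2 ^ p * ‖Rk κ' (g n) y‖ ^ p) := by
    refine integral_mono_ae (hitg hy3.1) (((hitg hy1.1).const_mul _).add ((hitg hy2.1).const_mul _)) ?_
    filter_upwards [rk_ae_integrable hκ (hgi n) (hper n), rk_ae_integrable hi' (hgi n) (hper n)]
      with y h3 h4
    have : Rk κ (g n) y = Rk (κ - κ') (g n) y + Rk κ' (g n) y := by
      have h5 : Integrable (fun t => (κ - κ') t * g n (y - t)) := by
        refine (h3.sub h4).congr (.of_forall fun t => ?_)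
        simp [sub_mul]
      simp only [Rk]
      rw [← integral_add h5 h4]
      refine integral_congr_ae (.of_forall fun t => ?_)
      simp [sub_mul]
    rw [this, ← mul_add]
    have h6 := abs_add_le (Rk (κ - κ') (g n) y) (Rk κ' (g n) y)
    simp only [Real.norm_eq_abs]
    set a := |Rk (κ - κ') (g n) y|
    set b := |Rk κ' (g n) y|
    have ha : 0 ≤ a := abs_nonneg _
    have hb : 0 ≤ b := abs_nonneg _
    calc _ ≤ (a + b) ^ p := Real.rpow_le_rpow (abs_nonneg _) h6 hp0.le
      _ ≤ (2 * max a b) ^ p := by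
          refine Real.rpow_le_rpow (by positivity) ?_ hp0.le
          linarith [le_max_left a b, le_max_right a b]
      _ = 2 ^ p * (max a b) ^ p := Real.mul_rpow (by norm_num) (le_max_of_le_left ha)
      _ ≤ 2 ^ p * (a ^ p + b ^ p) := by
          gcongr
          rcases le_total a b with h | h
          · rw [max_eq_right h]; linarith [Real.rpow_nonneg ha p]
          · rw [max_eq_left h]; linarith [Real.rpow_nonneg hb p]
  rw [integral_add ((hitg hy1.1).const_mul _) ((hitg hy2.1).const_mul _), integral_const_mul,
    integral_const_mul] at h1
  have h7 : ∫ y in Qcube d, ‖Rk (κ - κ') (g n) y‖ ^ p ≤ η ^ p * B := by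
    refine hy1.2.trans ?_
    have : ∫ t, ‖(κ - κ') t‖ ≤ η := by simpa using hd
    gcongr
    exact hB n
  have h8 : (2:ℝ) ^ p * ∫ y in Qcube d, ‖Rk (κ - κ') (g n) y‖ ^ p ≤ 2 ^ p * (η ^ p * B) := by
    gcongr
  linarith

lemma tendsto_eLpNorm_iff {α E ι : Type*} [MeasurableSpace α] {μ : Measure α} [NormedAddCommGroup E]
    (hp : 1 < p) {l : Filter ι} {f : ι → α → E}
    (hf : ∀ n, MemLp (f n) (ENNReal.ofReal p) μ) :
    Tendsto (fun n => ∫ x, ‖f n x‖ ^ p ∂μ) l (𝓝 0) ↔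
      Tendsto (fun n => eLpNorm (f n) (ENNReal.ofReal p) μ) l (𝓝 0) := by
  have hp0 : 0 < p := by linarith
  have h1 : ∀ n, eLpNorm (f n) (ENNReal.ofReal p) μ
      = ENNReal.ofReal ((∫ x, ‖f n x‖ ^ p ∂μ) ^ (1 / p)) := fun n => by
    rw [eLpNorm_eq_lintegral_rpow_enorm_toReal (by simp; linarith) ENNReal.ofReal_ne_top,
      ENNReal.toReal_ofReal hp0.le, lint_eq_ofReal hp (hf n),
      ENNReal.ofReal_rpow_of_nonneg (integral_nonneg fun x => by positivity) (by positivity)]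
  have h0 : ∀ n, 0 ≤ ∫ x, ‖f n x‖ ^ p ∂μ := fun n => integral_nonneg fun x => by positivity
  simp_rw [h1]
  constructor
  · intro h
    have := ENNReal.tendsto_ofReal (h.rpow_const (p := 1 / p) (Or.inr (by positivity)))
    simpa [Real.zero_rpow (inv_ne_zero hp0.ne')] using this
  · intro h
    have h2 := (ENNReal.tendsto_toReal ENNReal.zero_ne_top).comp h
    have h3 := h2.rpow_const (p := p) (Or.inr hp0.le)
    rw [ENNReal.toReal_zero, Real.zero_rpow hp0.ne'] at h3
    refine h3.congr fun n => ?_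
    simp only [Function.comp]
    rw [ENNReal.toReal_ofReal (Real.rpow_nonneg (h0 n) _), ← Real.rpow_mul (h0 n)]
    have : 1 / p * p = 1 := by field_simp
    rw [this, Real.rpow_one]

/-- The commutator `∑ ∂_iΦ A_i V`. -/
def Gc {d N M : ℕ} (A : DiffOp d N M) (Φ : Rd d → ℝ) (V : Rd d → Vec N)
    (b : Fin M) (x : Rd d) : ℝ :=
  ∑ n, (∑ i, fderiv ℝ Φ x (Pi.single i 1) * A i (Pi.single n 1) b) * V x n

lemma adj_mul (A : DiffOp d N M) {Φ : Rd d → ℝ} {φ : Rd d → Vec M}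
    (hΦ : ContDiff ℝ (⊤ : ℕ∞) Φ) (hφ : ContDiff ℝ (⊤ : ℕ∞) φ) (V : Rd d → Vec N) (x : Rd d) :
    dot (V x) (adjApply A (fun y => Φ y • φ y) x)
      = Φ x * dot (V x) (adjApply A φ x) - ∑ b, Gc A Φ V b x * φ x b := by
  have hΦd : DifferentiableAt ℝ Φ x := hΦ.differentiable (by simp) x
  have hφd : DifferentiableAt ℝ φ x := hφ.differentiable (by simp) x
  have hφb : ∀ b, DifferentiableAt ℝ (fun y => φ y b) x := fun b => differentiableAt_pi.1 hφd b
  have h1 : ∀ b i, fderiv ℝ (fun y => (Φ y • φ y) b) x (Pi.single i 1)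
      = Φ x * fderiv ℝ (fun y => φ y b) x (Pi.single i 1)
        + fderiv ℝ Φ x (Pi.single i 1) * φ x b := fun b i => by
    have h3 : HasFDerivAt (fun y => (Φ y • φ y) b) _ x := hΦd.hasFDerivAt.mul (hφb b).hasFDerivAt
    rw [h3.fderiv]
    simp [mul_comm]
  have h2 : ∀ n, adjApply A (fun y => Φ y • φ y) x n = Φ x * adjApply A φ x n
      - ∑ b, (∑ i, fderiv ℝ Φ x (Pi.single i 1) * A i (Pi.single n 1) b) * φ x b := fun n => by
    rw [adjApply_eq A (ψ := fun y => Φ y • φ y) (hΦd.smul hφd) n, adjApply_eq A hφd n]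
    simp_rw [h1, Finset.sum_mul]
    rw [Finset.sum_comm (s := (Finset.univ : Finset (Fin M)))]
    rw [mul_neg, Finset.mul_sum, ← Finset.sum_neg_distrib, ← Finset.sum_neg_distrib,
      ← Finset.sum_sub_distrib]
    refine Finset.sum_congr rfl fun i _ => ?_
    rw [Finset.mul_sum, ← Finset.sum_neg_distrib, ← Finset.sum_neg_distrib, ← Finset.sum_sub_distrib]
    refine Finset.sum_congr rfl fun b _ => ?_
    ring
  simp only [dot, h2, Gc, mul_sub, Finset.sum_sub_distrib, Finset.mul_sum, Finset.sum_mul]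
  congr 1
  · refine Finset.sum_congr rfl fun n _ => by ring
  · rw [Finset.sum_comm]
    refine Finset.sum_congr rfl fun b _ => Finset.sum_congr rfl fun n _ => ?_
    refine Finset.sum_congr rfl fun i _ => ?_
    ring

lemma MemLpOn.comp {V : Rd d → Vec N} (hV : MemLpOn p O V) (n : Fin N) :
    MemLp (fun x => V x n) (ENNReal.ofReal p) (volume.restrict O) :=
  hV.eval n

lemma memLp_bdd_mul {f g : Rd d → ℝ}
    (hg : MemLp g (ENNReal.ofReal p) (volume.restrict O)) (hf : Continuous f)
    {K : ℝ} (hK : ∀ x, |f x| ≤ K) :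
    MemLp (fun x => f x * g x) (ENNReal.ofReal p) (volume.restrict O) := by
  refine MemLp.of_le_mul (c := K) hg (hf.aestronglyMeasurable.mul hg.1) (.of_forall fun x => ?_)
  rw [norm_mul]
  exact mul_le_mul_of_nonneg_right (hK x) (norm_nonneg _)

lemma gc_coef (A : DiffOp d N M) {Φ : Rd d → ℝ}
    (hΦ : ContDiff ℝ (⊤ : ℕ∞) Φ) (hs : HasCompactSupport Φ) (b : Fin M) (n : Fin N) :
    Continuous (fun x => ∑ i, fderiv ℝ Φ x (Pi.single i 1) * A i (Pi.single n 1) b) ∧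
    ∃ K, ∀ x, |∑ i, fderiv ℝ Φ x (Pi.single i 1) * A i (Pi.single n 1) b| ≤ K := by
  have hc : Continuous (fun x => ∑ i, fderiv ℝ Φ x (Pi.single i 1) * A i (Pi.single n 1) b) := by
    have := hΦ.continuous_fderiv (by simp)
    fun_prop
  refine ⟨hc, ?_⟩
  have hcs : HasCompactSupport (fun x => ∑ i, fderiv ℝ Φ x (Pi.single i 1) * A i (Pi.single n 1) b) := by
    refine (hs.fderiv ℝ).mono' ?_
    intro x hx
    apply subset_tsupport
    intro h0
    apply hx
    simp [h0]
  obtain ⟨K, hK⟩ := hcs.exists_bound_of_continuous hc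
  exact ⟨K, hK⟩

lemma gc_memLp (A : DiffOp d N M) {Φ : Rd d → ℝ}
    (hΦ : ContDiff ℝ (⊤ : ℕ∞) Φ) (hs : HasCompactSupport Φ) {V : Rd d → Vec N}
    (hV : MemLpOn p (Qcube d) V) (b : Fin M) :
    MemLp (Gc A Φ V b) (ENNReal.ofReal p) (volume.restrict (Qcube d)) := by
  unfold Gc
  refine memLp_finsetSum _ fun n _ => ?_
  obtain ⟨hc, K, hK⟩ := gc_coef A hΦ hs b n
  exact memLp_bdd_mul (hV.comp n) hc hK

lemma gc_norm (hp : 1 < p) (A : DiffOp d N M) {Φ : Rd d → ℝ}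
    (hΦ : ContDiff ℝ (⊤ : ℕ∞) Φ) (hs : HasCompactSupport Φ) (b : Fin M) :
    ∃ C, 0 ≤ C ∧ ∀ V : Rd d → Vec N, MemLpOn p (Qcube d) V →
      ∫ x in Qcube d, ‖Gc A Φ V b x‖ ^ p ≤ C * ∫ x in Qcube d, ‖V x‖ ^ p := by
  choose hc K hK using fun n => gc_coef A hΦ hs b n
  have hKs : 0 ≤ ∑ n, K n := Finset.sum_nonneg fun n _ => (abs_nonneg _).trans (hK n 0)
  refine ⟨(∑ n, K n) ^ p, by positivity, fun V hV => ?_⟩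
  rw [← integral_const_mul]
  refine integral_mono_of_nonneg (.of_forall fun x => by positivity)
    ((hV.integrable_rpow hp).const_mul _) (.of_forall fun x => ?_)
  simp only
  rw [← Real.mul_rpow hKs (norm_nonneg _)]
  refine Real.rpow_le_rpow (norm_nonneg _) ?_ (by linarith)
  unfold Gc
  refine (norm_sum_le _ _).trans ?_
  rw [Finset.sum_mul]
  refine Finset.sum_le_sum fun n _ => ?_
  rw [norm_mul]
  exact mul_le_mul (hK n x) (norm_le_pi_norm _ _) (norm_nonneg _) ((abs_nonneg _).trans (hK n 0))

lemma pext_ae {E : Type*} [Zero E] (f : Rd d → E) :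
    pext f =ᵐ[volume.restrict (Qcube d)] f := by
  filter_upwards [ae_restrict_mem (measurableSet_Qcube d)] with x hx using pext_eq f hx

lemma gc_supp (A : DiffOp d N M) {Φ : Rd d → ℝ}
    (hs : HasCompactSupport Φ) (b : Fin M) (c : Fin N) (φ : Rd d → ℝ) :
    HasCompactSupport (fun x => (∑ i, fderiv ℝ Φ x (Pi.single i 1) * A i (Pi.single c 1) b) * φ x) ∧
    tsupport (fun x => (∑ i, fderiv ℝ Φ x (Pi.single i 1) * A i (Pi.single c 1) b) * φ x)
      ⊆ tsupport Φ := by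
  have h : Function.support (fun x => (∑ i, fderiv ℝ Φ x (Pi.single i 1) * A i (Pi.single c 1) b) * φ x)
      ⊆ tsupport Φ := by
    intro x hx
    by_contra h0
    apply hx
    have : fderiv ℝ Φ x = 0 := image_eq_zero_of_notMem_tsupport fun h => h0 (tsupport_fderiv_subset ℝ h)
    simp [this]
  exact ⟨hs.mono' h, closure_minimal h (isClosed_tsupport _)⟩

lemma int_bdd_mul {f g : Rd d → ℝ} (hg : IntegrableOn g O)
    (hf : Continuous f) {K : ℝ} (hK : ∀ x, |f x| ≤ K) : IntegrableOn (fun x => g x * f x) O :=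
  Integrable.mul_bdd (c := K) hg hf.aestronglyMeasurable (.of_forall fun x => hK x)

lemma gc_test (hp : 1 < p) (A : DiffOp d N M) {Φ : Rd d → ℝ}
    (hΦ : ContDiff ℝ (⊤ : ℕ∞) Φ) (hs : HasCompactSupport Φ) (hsQ : tsupport Φ ⊆ Qcube d)
    {V : Rd d → Vec N} (hV : MemLpOn p (Qcube d) V) (hfree : AFreeOn A (Qcube d) V)
    {φ : Rd d → Vec M} (hφ : ContDiff ℝ (⊤ : ℕ∞) φ) (hφp : Zper φ) :
    ∫ x in Qcube d, ∑ b, Gc A Φ V b x * φ x b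
      = ∫ x in Qcube d, Φ x * dot (V x) (adjApply A φ x) := by
  have htest : TestOn (Qcube d) (fun y => Φ y • φ y) := by
    refine ⟨hΦ.smul hφ, hs.smul_right, ?_⟩
    refine (closure_mono ?_).trans hsQ
    intro x hx h0
    apply hx
    simp [h0]
  have h0 := hfree _ htest
  simp_rw [adj_mul A hΦ hφ V] at h0
  have hint1 : ∀ n, IntegrableOn (fun x => V x n) (Qcube d) := fun n =>
    (hV.comp n).integrable (by simpa using hp.le)
  obtain ⟨K, hK0, hK⟩ := hφp.bdd hφ.continuous
  have hadj := adjApply_smooth A hφ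
  obtain ⟨K', hK0', hK'⟩ := (adjApply_zper A hφp).bdd hadj.continuous
  obtain ⟨K3, hK3⟩ := hs.exists_bound_of_continuous hΦ.continuous
  have hi1 : IntegrableOn (fun x => Φ x * dot (V x) (adjApply A φ x)) (Qcube d) := by
    have : (fun x => Φ x * dot (V x) (adjApply A φ x))
        = fun x => ∑ n, V x n * adjApply A φ x n * Φ x := by
      funext x; rw [dot, ← Finset.sum_mul, mul_comm]
    rw [this]
    refine integrable_finsetSum _ fun n _ => ?_
    refine int_bdd_mul (int_bdd_mul (hint1 n) ((continuous_apply n).comp hadj.continuous) (K := K')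
      fun x => ?_) hΦ.continuous hK3
    exact (norm_le_pi_norm (adjApply A φ x) n).trans (hK' x)
  have hi2 : IntegrableOn (fun x => ∑ b, Gc A Φ V b x * φ x b) (Qcube d) := by
    refine integrable_finsetSum _ fun b _ => ?_
    exact int_bdd_mul ((gc_memLp A hΦ hs hV b).integrable (by simpa using hp.le))
      ((continuous_apply b).comp hφ.continuous) (K := K)
      (fun x => (norm_le_pi_norm (φ x) b).trans (hK x))
  rw [integral_sub hi1 hi2] at h0
  linarith

lemma int_dot_adj_const (A : DiffOp d N M) (m : Vec N)
    {ψ : Rd d → Vec M} (hψ : ContDiff ℝ (⊤ : ℕ∞) ψ) (hψp : Zper ψ) :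
    ∫ x in Qcube d, dot m (adjApply A ψ x) = 0 := by
  have hψd : ∀ x, DifferentiableAt ℝ ψ x := fun x => hψ.differentiable (by simp) x
  have hψb : ∀ b, ContDiff ℝ 1 (fun y => ψ y b) := fun b =>
    (contDiff_pi.1 hψ b).of_le (by exact_mod_cast le_top)
  have hitg : ∀ b i, IntegrableOn (fun x => fderiv ℝ (fun y => ψ y b) x (Pi.single i 1)) (Qcube d) :=
    fun b i => integrableOn_Q (by
      have := (hψb b).continuous_fderiv (by simp)
      fun_prop)
  simp_rw [dot, adjApply_eq A (hψd _), mul_neg, Finset.mul_sum]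
  rw [integral_finsetSum _ fun n _ => ?_]
  · refine Finset.sum_eq_zero fun n _ => ?_
    rw [integral_neg, integral_finsetSum _ fun i _ => integrable_finsetSum _ fun b _ =>
      ((hitg b i).const_mul _).const_mul _]
    rw [neg_eq_zero]
    refine Finset.sum_eq_zero fun i _ => ?_
    rw [integral_finsetSum _ fun b _ => ((hitg b i).const_mul _).const_mul _]
    refine Finset.sum_eq_zero fun b _ => ?_
    rw [integral_const_mul, integral_const_mul,
      Zper.integral_fderiv (hψp.map (fun v => v b)) (hψb b), mul_zero, mul_zero]
  · exact (integrable_finsetSum _ fun i _ => integrable_finsetSum _ fun b _ =>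
      ((hitg b i).const_mul _).const_mul _).neg

/-- Projection lemma: cut off a weakly null `A`-free sequence and correct it to
a periodic, mean zero, `A`-free one. -/
lemma lemmaC (hp : 1 < p)
    (hA : ConstantRank A) {Φ : Rd d → ℝ}
    (hΦ : ContDiff ℝ (⊤ : ℕ∞) Φ) (hs : HasCompactSupport Φ) (hsQ : tsupport Φ ⊆ Qcube d)
    {ι : Type*} {l : Filter ι} [l.IsCountablyGenerated] {V : ι → Rd d → Vec N}
    (hV : ∀ n, MemLpOn p (Qcube d) (V n)) (hfree : ∀ n, AFreeOn A (Qcube d) (V n))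
    (hB : ∀ n, ∫ x in Qcube d, ‖V n x‖ ^ p ≤ B)
    (hw : ∀ (a : Fin N) (g : Rd d → ℝ), Continuous g → HasCompactSupport g →
    tsupport g ⊆ Qcube d → Tendsto (fun n => ∫ x in Qcube d, V n x a * g x) l (𝓝 0)) :
    ∃ W : ι → Rd d → Vec N, (∀ n, Comp p A (W n)) ∧
      Tendsto (fun n => ∫ x in Qcube d, ‖W n x - Φ x • V n x‖ ^ p) l (𝓝 0) := by
  have hp0 : 0 < p := by linarith
  obtain ⟨κ, hκ, hpar⟩ := exists_parametrix hA
  obtain ⟨K3, hK3⟩ := hs.exists_bound_of_continuous hΦ.continuous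
  have hG := fun n b => gc_memLp A hΦ hs (hV n) b
  set P : ι → Fin M → Rd d → ℝ := fun n b => pext (Gc A Φ (V n) b) with hPdef
  have hPm : ∀ n b, MemLp (P n b) (ENNReal.ofReal p) (volume.restrict (Qcube d)) := fun n b =>
    (hG n b).ae_eq (pext_ae _).symm
  have hPz : ∀ n b, Zper (P n b) := fun n b => pext_zper _
  have hPi : ∀ n b, IntegrableOn (P n b) (Qcube d) := fun n b =>
    (hPm n b).integrable (by simpa using hp.le)
  -- the correction
  set Z : ι → Rd d → Vec N := fun n y a => ∑ b, Rk (κ a b) (P n b) y with hZdef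
  have hZm : ∀ n, MemLp (Z n) (ENNReal.ofReal p) (volume.restrict (Qcube d)) := fun n =>
    MemLp.of_eval fun a => memLp_finsetSum _ fun b _ => (rk_young hp (hκ a b) (hPm n b) (hPz n b)).1
  have hZz : ∀ n, Zper (Z n) := fun n y z => by
    funext a
    exact Finset.sum_congr rfl fun b _ => rk_zper (κ a b) (hPz n b) y z
  have hPw : ∀ b (φ : Rd d → ℝ), Continuous φ →
      Tendsto (fun n => ∫ x in Qcube d, P n b x * φ x) l (𝓝 0) := by
    intro b φ hφ
    have h1 : ∀ n, ∫ x in Qcube d, P n b x * φ x = ∑ c, ∫ x in Qcube d, V n x c *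
        ((∑ i, fderiv ℝ Φ x (Pi.single i 1) * A i (Pi.single c 1) b) * φ x) := by
      intro n
      rw [← integral_finsetSum]
      · refine integral_congr_ae ?_
        filter_upwards [pext_ae (Gc A Φ (V n) b)] with x hx
        simp only [hPdef, hx, Gc, Finset.sum_mul]
        refine Finset.sum_congr rfl fun c _ => ?_
        rw [Finset.mul_sum]
        refine Finset.sum_congr rfl fun i _ => ?_
        ring
      · intro c _
        obtain ⟨hc, K, hK⟩ := gc_coef A hΦ hs b c
        have hcs := (gc_supp A hs b c φ).1
        obtain ⟨K', hK'⟩ := hcs.exists_bound_of_continuous (hc.mul hφ)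
        exact int_bdd_mul (((hV n).comp c).integrable (by simpa using hp.le)) (hc.mul hφ) hK'
    simp_rw [h1]
    have : (0:ℝ) = ∑ c : Fin N, 0 := by simp
    rw [this]
    exact tendsto_finsetSum _ fun c _ => hw c _ ((gc_coef A hΦ hs b c).1.mul hφ)
      (gc_supp A hs b c φ).1 ((gc_supp A hs b c φ).2.trans hsQ)
  have hPB : ∀ b, ∃ B', ∀ n, ∫ x in Qcube d, ‖P n b x‖ ^ p ≤ B' := fun b => by
    obtain ⟨C, hC0, hC⟩ := gc_norm (N := N) hp A hΦ hs b
    refine ⟨C * B, fun n => ?_⟩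
    have : ∫ x in Qcube d, ‖P n b x‖ ^ p = ∫ x in Qcube d, ‖Gc A Φ (V n) b x‖ ^ p := by
      refine integral_congr_ae ?_
      filter_upwards [pext_ae (Gc A Φ (V n) b)] with x hx
      simp only [hPdef, hx]
    rw [this]
    exact (hC _ (hV n)).trans (mul_le_mul_of_nonneg_left (hB n) hC0)
  have hZt : Tendsto (fun n => eLpNorm (Z n) (ENNReal.ofReal p) (volume.restrict (Qcube d))) l (𝓝 0) := by
    have h1 : ∀ a b, Tendsto (fun n => eLpNorm (Rk (κ a b) (P n b)) (ENNReal.ofReal p)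
        (volume.restrict (Qcube d))) l (𝓝 0) := fun a b => by
      obtain ⟨B', hB'⟩ := hPB b
      exact (tendsto_eLpNorm_iff hp fun n => (rk_young hp (hκ a b) (hPm n b) (hPz n b)).1).1
        (rk_tendsto hp (hκ a b) (fun n => hPm n b) (fun n => hPz n b) hB' (hPw b))
    have h2 : ∀ n, eLpNorm (Z n) (ENNReal.ofReal p) (volume.restrict (Qcube d))
        ≤ ∑ a, ∑ b, eLpNorm (Rk (κ a b) (P n b)) (ENNReal.ofReal p) (volume.restrict (Qcube d)) := by
      intro n
      have e1 : Z n = ∑ a, ∑ b, (fun y => (Pi.single a (Rk (κ a b) (P n b) y) : Vec N)) := by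
        funext y
        funext c
        simp only [hZdef, Finset.sum_apply]
        rw [Finset.sum_eq_single c]
        · simp
        · intro a _ hac
          simp [hac.symm]
        · simp
      have hmm : ∀ a b, AEStronglyMeasurable (fun y => (Pi.single a (Rk (κ a b) (P n b) y) : Vec N))
          (volume.restrict (Qcube d)) := fun a b => by
        have := (rk_young hp (hκ a b) (hPm n b) (hPz n b)).1.1
        exact (continuous_single a).comp_aestronglyMeasurable this
      rw [e1]
      refine (eLpNorm_sum_le (fun a _ => ?_) (by simpa using hp.le)).trans ?_
      · exact Finset.aestronglyMeasurable_sum _ fun b _ => hmm a b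
      refine Finset.sum_le_sum fun a _ => ?_
      refine (eLpNorm_sum_le (fun b _ => hmm a b) (by simpa using hp.le)).trans ?_
      refine Finset.sum_le_sum fun b _ => ?_
      refine eLpNorm_mono fun y => ?_
      rw [Pi.norm_single]
    refine tendsto_of_tendsto_of_tendsto_of_le_of_le tendsto_const_nhds ?_ (fun n => zero_le) h2
    have : (0:ℝ≥0∞) = ∑ a : Fin N, ∑ b : Fin M, 0 := by simp
    rw [this]
    exact tendsto_finsetSum _ fun a _ => tendsto_finsetSum _ fun b _ => h1 a b
  -- mean
  have hΦV : ∀ n, MemLp (fun x => Φ x • V n x) (ENNReal.ofReal p) (volume.restrict (Qcube d)) := fun n =>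
    MemLp.of_eval fun a => memLp_bdd_mul ((hV n).comp a) hΦ.continuous hK3
  set U : ι → Rd d → Vec N := fun n x => pext (fun x => Φ x • V n x) x with hUdef
  have hUae : ∀ n, U n =ᵐ[volume.restrict (Qcube d)] fun x => Φ x • V n x := fun n => pext_ae _
  have hUm : ∀ n, MemLp (U n) (ENNReal.ofReal p) (volume.restrict (Qcube d)) := fun n =>
    (hΦV n).ae_eq (hUae n).symm
  set m : ι → Vec N := fun n => ∫ x in Qcube d, (U n x - Z n x) with hmdef
  have hUi : ∀ n, IntegrableOn (U n) (Qcube d) := fun n => (hUm n).integrable (by simpa using hp.le)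
  have hZi : ∀ n, IntegrableOn (Z n) (Qcube d) := fun n => (hZm n).integrable (by simpa using hp.le)
  have hmt : Tendsto m l (𝓝 0) := by
    have h1 : Tendsto (fun n => ∫ x in Qcube d, U n x) l (𝓝 0) := by
      rw [tendsto_pi_nhds]
      intro a
      refine (hw a Φ hΦ.continuous hs hsQ).congr fun n => ?_
      rw [eval_integral (fun a => (hUi n).eval a)]
      refine integral_congr_ae ?_
      filter_upwards [hUae n] with x hx
      rw [hx]
      simp [mul_comm]
    have h2 : Tendsto (fun n => ∫ x in Qcube d, Z n x) l (𝓝 0) := by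
      have h3 := (tendsto_eLpNorm_iff hp hZm).2 hZt
      have h4 := h3.rpow_const (p := 1 / p) (Or.inr (by positivity))
      rw [Real.zero_rpow (by positivity)] at h4
      refine squeeze_zero_norm (fun n => ?_) h4
      refine (norm_integral_le_integral_norm _).trans ?_
      have h5 := l1_le_lp hp (hZm n)
      have h6 : (0:ℝ) ≤ ∫ x in Qcube d, ‖Z n x‖ := integral_nonneg fun x => norm_nonneg _
      calc ∫ x in Qcube d, ‖Z n x‖ = ((∫ x in Qcube d, ‖Z n x‖) ^ p) ^ (1 / p) := by
            rw [← Real.rpow_mul h6]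
            have : p * (1 / p) = 1 := by field_simp
            rw [this, Real.rpow_one]
        _ ≤ _ := Real.rpow_le_rpow (by positivity) h5 (by positivity)
    have h3 := h1.sub h2
    rw [sub_zero] at h3
    refine h3.congr fun n => ?_
    rw [hmdef]
    simp only
    rw [integral_sub (hUi n) (hZi n)]
  have hUZ : ∀ n, MemLp (fun x => U n x - Z n x) (ENNReal.ofReal p) (volume.restrict (Qcube d)) :=
    fun n => (hUm n).sub (hZm n)
  refine ⟨fun n x => U n x - Z n x - m n, fun n => ⟨?_, ?_, ?_, ?_⟩, ?_⟩
  · exact (hUZ n).sub (memLp_const _)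
  · intro x z
    simp only [hUdef]
    rw [pext_zper _ x z, hZz n x z]
  · have hUZi : IntegrableOn (fun x => U n x - Z n x) (Qcube d) := (hUi n).sub (hZi n)
    change ∫ y in Qcube d, (U n y - Z n y - m n) = 0
    rw [integral_sub hUZi (integrable_const _)]
    simp [hmdef]
  · intro ψ hψ hψp
    have hadj := adjApply_smooth A hψ
    have hadjp := adjApply_zper A hψp
    obtain ⟨K', hK0', hK'⟩ := hadjp.bdd hadj.continuous
    have hSs := Sop_smooth hκ hadj hadjp
    have hSp := Sop_zper κ hadjp
    have hKn : ∀ c x, |adjApply A ψ x c| ≤ K' := fun c x => (norm_le_pi_norm _ c).trans (hK' x)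
    have hcn : ∀ c, Continuous (fun x => adjApply A ψ x c) := fun c =>
      (continuous_apply c).comp hadj.continuous
    have hd : ∀ {u : Rd d → Vec N}, IntegrableOn u (Qcube d) →
        IntegrableOn (fun x => dot (u x) (adjApply A ψ x)) (Qcube d) := fun {u} hu =>
      integrable_finsetSum _ fun c _ => int_bdd_mul (hu.eval c) (hcn c) (hKn c)
    have e1 : ∀ x, dot (U n x - Z n x - m n) (adjApply A ψ x)
        = dot (U n x) (adjApply A ψ x) - dot (Z n x) (adjApply A ψ x) - dot (m n) (adjApply A ψ x) := by
      intro x; simp [dot, sub_mul, Finset.sum_sub_distrib]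
    simp_rw [e1]
    have hdd : IntegrableOn (fun x => dot (U n x) (adjApply A ψ x) - dot (Z n x) (adjApply A ψ x))
        (Qcube d) := (hd (hUi n)).sub (hd (hZi n))
    rw [integral_sub hdd (hd (u := fun _ => m n) (integrable_const _)),
      integral_sub (hd (hUi n)) (hd (hZi n)), int_dot_adj_const A (m n) hψ hψp, sub_zero, sub_eq_zero]
    have e2 : ∫ x in Qcube d, dot (Z n x) (adjApply A ψ x)
        = ∫ x in Qcube d, ∑ b, P n b x * Sop κ (adjApply A ψ) x b := by
      have hRi : ∀ a b, IntegrableOn (Rk (κ a b) (P n b)) (Qcube d) := fun a b =>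
        rk_integrable (hκ a b) (hPi n b) (hPz n b)
      have htc : ∀ a b, Continuous (Tk volume (κ a b) (fun y => adjApply A ψ y a)) := fun a b =>
        tk_continuous (hκ a b) (hcn a) (hadjp.map fun v => v a)
      have htb : ∀ a b, ∃ K, 0 ≤ K ∧ ∀ x, ‖Tk volume (κ a b) (fun y => adjApply A ψ y a) x‖ ≤ K := fun a b =>
        (tk_zper volume (κ a b) (hadjp.map fun v => v a)).bdd (htc a b)
      have l1 : ∫ x in Qcube d, dot (Z n x) (adjApply A ψ x)
          = ∑ a, ∑ b, ∫ x in Qcube d, Rk (κ a b) (P n b) x * adjApply A ψ x a := by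
        simp_rw [dot, hZdef, Finset.sum_mul]
        rw [integral_finsetSum _ fun a _ => integrable_finsetSum _ fun b _ =>
          int_bdd_mul (hRi a b) (hcn a) (hKn a)]
        refine Finset.sum_congr rfl fun a _ => ?_
        rw [integral_finsetSum _ fun b _ => int_bdd_mul (hRi a b) (hcn a) (hKn a)]
      have l2 : ∫ x in Qcube d, ∑ b, P n b x * Sop κ (adjApply A ψ) x b
          = ∑ b, ∑ a, ∫ x in Qcube d, P n b x * Tk volume (κ a b) (fun y => adjApply A ψ y a) x := by
        simp_rw [Sop, Finset.mul_sum]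
        have hii : ∀ a b, IntegrableOn (fun x => P n b x * Tk volume (κ a b) (fun y => adjApply A ψ y a) x)
            (Qcube d) := fun a b => by
          obtain ⟨K, _, hK⟩ := htb a b
          exact int_bdd_mul (hPi n b) (htc a b) hK
        rw [integral_finsetSum _ fun b _ => integrable_finsetSum _ fun a _ => hii a b]
        refine Finset.sum_congr rfl fun b _ => ?_
        rw [integral_finsetSum _ fun a _ => hii a b]
      rw [l1, l2, Finset.sum_comm]
      refine Finset.sum_congr rfl fun b _ => Finset.sum_congr rfl fun a _ => ?_
      exact rk_dual (hκ a b) (hPi n b) (hPz n b) (hcn a) (hadjp.map fun v => v a)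
    have e3 : ∫ x in Qcube d, ∑ b, P n b x * Sop κ (adjApply A ψ) x b
        = ∫ x in Qcube d, ∑ b, Gc A Φ (V n) b x * Sop κ (adjApply A ψ) x b := by
      refine setIntegral_congr_fun (measurableSet_Qcube d) fun x hx => ?_
      simp only [hPdef, pext_eq _ hx]
    rw [e2, e3, gc_test hp A hΦ hs hsQ (hV n) (hfree n) hSs hSp]
    refine setIntegral_congr_fun (measurableSet_Qcube d) fun x hx => ?_
    simp only [hUdef, pext_eq _ hx]
    rw [hpar ψ hψ hψp x hx]
    simp [dot, Finset.mul_sum, mul_assoc]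
  · have hZmm : ∀ n, MemLp (fun x => -Z n x - m n) (ENNReal.ofReal p) (volume.restrict (Qcube d)) :=
      fun n => (hZm n).neg.sub (memLp_const _)
    have h1 : Tendsto (fun n => ∫ x in Qcube d, ‖-Z n x - m n‖ ^ p) l (𝓝 0) := by
      rw [tendsto_eLpNorm_iff hp hZmm]
      have h2 : Tendsto (fun n => eLpNorm (fun _ : Rd d => m n) (ENNReal.ofReal p)
          (volume.restrict (Qcube d))) l (𝓝 0) := by
        have : ∀ n, eLpNorm (fun _ : Rd d => m n) (ENNReal.ofReal p)
          (volume.restrict (Qcube d)) = ‖m n‖ₑ := fun n => by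
          rw [eLpNorm_const _ (by simp; linarith) (NeZero.ne _)]
          simp
        simp_rw [this]
        have := hmt.enorm
        simpa using this
      have h3 := hZt.add h2
      rw [add_zero] at h3
      refine tendsto_of_tendsto_of_tendsto_of_le_of_le tendsto_const_nhds h3 (fun n => zero_le) fun n => ?_
      have h4 := eLpNorm_sub_le (hZm n).neg.1 (memLp_const (m n) (μ := volume.restrict (Qcube d)) (p := ENNReal.ofReal p)).1
        (p := ENNReal.ofReal p) (by simpa using hp.le)
      rw [eLpNorm_neg] at h4
      exact h4
    refine h1.congr fun n => ?_
    refine integral_congr_ae ?_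
    filter_upwards [hUae n] with x hx
    rw [hx]
    congr 2
    abel

/-! ### Part 5a: affine changes of variables -/

/-- The affine map `y ↦ X + r y`. -/
def aff {d : ℕ} (X : Rd d) (r : ℝ) (y : Rd d) : Rd d := X + r • y

lemma cell_eq (ε : ℝ) (z : Fin d → ℤ) (S : Set (Rd d)) :
    cell ε z S = aff (ε • zr z) ε '' S := by
  unfold cell
  congr 1
  funext y i
  simp [aff, zr]
  ring

lemma aff_cont (X : Rd d) (r : ℝ) : Continuous (aff X r) := by
  unfold aff; fun_prop

lemma aff_inv (X : Rd d) (hr : 0 < r) (x : Rd d) :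
    aff X r (aff (-(r⁻¹ • X)) r⁻¹ x) = x := by
  unfold aff
  rw [smul_add, smul_neg, smul_smul, smul_smul, mul_inv_cancel₀ hr.ne']
  simp

lemma aff_inv' (X : Rd d) (hr : 0 < r) (x : Rd d) :
    aff (-(r⁻¹ • X)) r⁻¹ (aff X r x) = x := by
  unfold aff
  rw [smul_add, smul_smul, inv_mul_cancel₀ hr.ne']
  simp

/-- `aff` as a homeomorphism. -/
def affH {d : ℕ} (X : Rd d) {r : ℝ} (hr : 0 < r) : Rd d ≃ₜ Rd d where
  toFun := aff X r
  invFun := aff (-(r⁻¹ • X)) r⁻¹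
  left_inv := aff_inv' X hr
  right_inv := aff_inv X hr
  continuous_toFun := aff_cont _ _
  continuous_invFun := aff_cont _ _

lemma aff_me (X : Rd d) (hr : 0 < r) : MeasurableEmbedding (aff X r) :=
  (affH X hr).measurableEmbedding

lemma aff_inj (X : Rd d) (hr : 0 < r) : Function.Injective (aff X r) :=
  (affH X hr).injective

lemma aff_open (X : Rd d) (hr : 0 < r) (hS : IsOpen S) :
    IsOpen (aff X r '' S) := (affH X hr).isOpenMap S hS

lemma aff_measurableSet (X : Rd d) (hr : 0 < r)
    (hS : MeasurableSet S) : MeasurableSet (aff X r '' S) := (aff_me X hr).measurableSet_image.2 hS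

lemma aff_map (X : Rd d) (hr : 0 < r) :
    Measure.map (aff X r) volume = ENNReal.ofReal (r ^ d)⁻¹ • (volume : Measure (Rd d)) := by
  have h1 : aff X r = (fun y => X + y) ∘ (fun y => r • y) := rfl
  rw [h1, ← Measure.map_map (measurable_const_add X) (measurable_const_smul r),
    Measure.map_addHaar_smul _ hr.ne', Measure.map_smul, map_add_left_eq_self]
  congr 2
  rw [Module.finrank_fin_fun, abs_of_pos (by positivity)]

lemma aff_map_restrict (X : Rd d) (hr : 0 < r) (S : Set (Rd d)) :
    Measure.map (aff X r) (volume.restrict S) =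
      ENNReal.ofReal (r ^ d)⁻¹ • (volume : Measure (Rd d)).restrict (aff X r '' S) := by
  rw [← Measure.restrict_smul, ← aff_map X hr, (aff_me X hr).restrict_map,
    preimage_image_eq _ (aff_inj X hr)]

lemma aff_integral (X : Rd d) (hr : 0 < r) (S : Set (Rd d)) {E : Type*}
    [NormedAddCommGroup E] [NormedSpace ℝ E] (f : Rd d → E) :
    ∫ x in aff X r '' S, f x = r ^ d • ∫ y in S, f (aff X r y) := by
  have h := (aff_me X hr).integral_map (μ := volume.restrict S) f
  rw [aff_map_restrict X hr, integral_smul_measure, ENNReal.toReal_ofReal (by positivity)] at h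
  rw [← h, smul_smul, mul_inv_cancel₀ (by positivity), one_smul]

lemma aff_integrableOn (X : Rd d) (hr : 0 < r) {E : Type*}
    [NormedAddCommGroup E] {f : Rd d → E} :
    IntegrableOn f (aff X r '' S) ↔ IntegrableOn (fun y => f (aff X r y)) S := by
  have h := (aff_me X hr).integrable_map_iff (μ := volume.restrict S) (g := f)
  rw [aff_map_restrict X hr] at h
  unfold IntegrableOn
  rw [show (fun y => f (aff X r y)) = f ∘ aff X r from rfl, ← h, integrable_smul_measure]
  · simp; positivity
  · simp

lemma aff_memLp (X : Rd d) (hr : 0 < r)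
    (h : MemLpOn p (aff X r '' S) u) :
    MemLpOn p S (fun y => u (aff X r y)) := by
  have h1 := (aff_me X hr).memLp_map_measure_iff (μ := volume.restrict S) (g := u) (p := ENNReal.ofReal p)
  rw [aff_map_restrict X hr] at h1
  exact h1.1 (h.smul_measure (by simp))

lemma aff_volume (X : Rd d) (hr : 0 < r) :
    volume.real (aff X r '' Qcube d) = r ^ d := by
  have h := aff_integral X hr (Qcube d) (fun _ => (1 : ℝ))
  simpa [measureReal_def, volume_Qcube] using h

lemma aff_bounded (X : Rd d) (r : ℝ) : IsBounded (aff X r '' Qcube d) := by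
  refine (isBounded_iff_forall_norm_le).2 ⟨‖X‖ + |r|, ?_⟩
  rintro _ ⟨y, hy, rfl⟩
  unfold aff
  have h1 := Qcube_norm_le hy
  calc ‖X + r • y‖ ≤ ‖X‖ + ‖r • y‖ := norm_add_le _ _
    _ = ‖X‖ + |r| * ‖y‖ := by rw [norm_smul, Real.norm_eq_abs]
    _ ≤ _ := by nlinarith [abs_nonneg r]

lemma AFreeOn.mono {O O' : Set (Rd d)}
    (h : AFreeOn A O u) (hO : MeasurableSet O) (hs : O' ⊆ O) :
    AFreeOn A O' u := by
  rintro ψ ⟨h1, h2, h3⟩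
  rw [← h ψ ⟨h1, h2, h3.trans hs⟩]
  refine (setIntegral_eq_of_subset_of_forall_sdiff_eq_zero hO hs fun x hx => ?_).symm
  have hx2 : x ∉ tsupport (fderiv ℝ ψ) := fun h => hx.2 (h3 (tsupport_fderiv_subset ℝ h))
  simp [dot, adjApply, image_eq_zero_of_notMem_tsupport hx2]

lemma AFreeOn.aff
    (hr : 0 < r) (h : AFreeOn A (aff X r '' O) u) :
    AFreeOn A O (fun y => u (aff X r y)) := by
  rintro ψ ⟨h1, h2, h3⟩
  set ψ' : Rd d → Vec M := fun x => ψ (HC.aff (-(r⁻¹ • X)) r⁻¹ x) with hψ'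
  have ha : ContDiff ℝ (⊤ : ℕ∞) (HC.aff (-(r⁻¹ • X)) r⁻¹) := by
    unfold HC.aff; fun_prop
  have hT : TestOn (HC.aff X r '' O) ψ' := by
    refine ⟨h1.comp ha, h2.comp_homeomorph (affH X hr).symm, ?_⟩
    have : tsupport ψ' = (affH X hr).symm ⁻¹' tsupport ψ :=
      tsupport_comp_eq_preimage ψ (affH X hr).symm
    rw [this]
    intro x hx
    exact ⟨_, h3 hx, aff_inv X hr x⟩
  have h4 := h ψ' hT
  rw [aff_integral X hr] at h4
  have h5 : ∀ y, adjApply A ψ' (HC.aff X r y) = r⁻¹ • adjApply A ψ y := by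
    intro y
    have hd : HasFDerivAt (HC.aff (-(r⁻¹ • X)) r⁻¹) (r⁻¹ • ContinuousLinearMap.id ℝ (Rd d)) (HC.aff X r y) := by
      have := ((hasFDerivAt_id (𝕜 := ℝ) (HC.aff X r y)).const_smul r⁻¹).const_add (-(r⁻¹ • X))
      exact this
    have hd2 : HasFDerivAt ψ (fderiv ℝ ψ y) (HC.aff (-(r⁻¹ • X)) r⁻¹ (HC.aff X r y)) := by
      rw [aff_inv' X hr]
      exact (h1.differentiable (by simp) y).hasFDerivAt
    have hd3 := (hd2.comp (HC.aff X r y) hd).fderiv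
    have hd4 : fderiv ℝ ψ' (HC.aff X r y) = r⁻¹ • fderiv ℝ ψ y := by
      have : ψ' = ψ ∘ HC.aff (-(r⁻¹ • X)) r⁻¹ := rfl
      rw [this, hd3]
      ext v; simp
    funext n
    simp only [adjApply, hd4, Pi.smul_apply, smul_eq_mul, mul_neg, Finset.mul_sum, dot]
    congr 1
    refine Finset.sum_congr rfl fun i _ => Finset.sum_congr rfl fun j _ => ?_
    simp
    ring
  have h6 : ∀ y, dot (u (HC.aff X r y)) (adjApply A ψ' (HC.aff X r y)) =
      r⁻¹ * dot (u (HC.aff X r y)) (adjApply A ψ y) := by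
    intro y
    rw [h5]
    simp only [dot, Finset.mul_sum, Pi.smul_apply, smul_eq_mul]
    refine Finset.sum_congr rfl fun i _ => by ring
  simp only [h6, integral_const_mul, smul_eq_mul] at h4
  have hr' : r ^ d * r⁻¹ ≠ 0 := by positivity
  rw [← mul_assoc] at h4
  exact (mul_eq_zero.1 h4).resolve_left hr'

lemma adj_cs (A : DiffOp d N M) {ψ : Rd d → Vec M}
    (h2 : HasCompactSupport ψ) (n : Fin N) : HasCompactSupport (fun x => adjApply A ψ x n) := by
  refine (h2.fderiv ℝ).mono fun x hx => ?_
  contrapose! hx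
  simp only [Function.mem_support, not_not] at hx ⊢
  simp [adjApply, hx, dot]

lemma int_dot_adj (A : DiffOp d N M)
    (hu : IntegrableOn u O) {ψ : Rd d → Vec M} (h1 : ContDiff ℝ (⊤ : ℕ∞) ψ)
    (h2 : HasCompactSupport ψ) : IntegrableOn (fun x => dot (u x) (adjApply A ψ x)) O := by
  unfold dot
  refine integrable_finsetSum _ fun n _ => ?_
  have hc : Continuous (fun x => adjApply A ψ x n) := by
    have := (adjApply_smooth A h1).continuous
    exact (continuous_apply n).comp this
  obtain ⟨K, hK⟩ := (adj_cs A h2 n).exists_bound_of_continuous hc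
  exact int_bdd_mul (hu.eval n) hc hK

lemma dot_add_left (a b c : Vec N) : dot (a + b) c = dot a c + dot b c := by
  simp [dot, add_mul, Finset.sum_add_distrib]

lemma dot_sub_left (a b c : Vec N) : dot (a - b) c = dot a c - dot b c := by
  simp [dot, sub_mul, Finset.sum_sub_distrib]

lemma AFreeOn.add
    (hu : AFreeOn A O u) (hv : AFreeOn A O v) (iu : IntegrableOn u O)
    (iv : IntegrableOn v O) : AFreeOn A O (fun x => u x + v x) := by
  rintro ψ ⟨h1, h2, h3⟩
  simp only [dot_add_left]
  rw [integral_add (int_dot_adj A iu h1 h2) (int_dot_adj A iv h1 h2), hu ψ ⟨h1, h2, h3⟩,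
    hv ψ ⟨h1, h2, h3⟩, add_zero]

lemma AFreeOn.sub
    (hu : AFreeOn A O u) (hv : AFreeOn A O v) (iu : IntegrableOn u O)
    (iv : IntegrableOn v O) : AFreeOn A O (fun x => u x - v x) := by
  rintro ψ ⟨h1, h2, h3⟩
  simp only [dot_sub_left]
  rw [integral_sub (int_dot_adj A iu h1 h2) (int_dot_adj A iv h1 h2), hu ψ ⟨h1, h2, h3⟩,
    hv ψ ⟨h1, h2, h3⟩, sub_zero]

/-! ### Part 5b: torus-free fields are free on the whole space -/

lemma torus_free
    (hz : Zper v) (hi : IntegrableOn v (Qcube d)) (h : AFreeTorus A v) :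
    AFreeOn A univ v := by
  rintro ψ ⟨h1, h2, -⟩
  obtain ⟨K, hK⟩ := h2.isBounded.exists_norm_le
  have h0 : ∀ x, K + 1 ≤ ‖x‖ → x ∉ tsupport ψ := fun x hx hm => by
    have := hK x hm
    linarith
  set Ψ : Rd d → Vec M := fun x => ∑' g : Lat d, ψ (x + g) with hΨ
  -- local representation
  have hloc : ∀ (R : ℝ) (F : Finset (Lat d)), (∀ g : Lat d, g ∉ F → K + 1 + R < ‖(g : Rd d)‖) →
      ∀ x, ‖x‖ ≤ R → Ψ x = ∑ g ∈ F, ψ (x + g) := by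
    intro R F hF x hx
    refine tsum_eq_sum fun g hg => ?_
    have h3 := hF g hg
    have h4 : ‖(g : Rd d)‖ ≤ ‖x + (g : Rd d)‖ + ‖x‖ := by
      simpa using norm_sub_le (x + (g : Rd d)) x
    exact image_eq_zero_of_notMem_tsupport (h0 _ (by linarith))
  have hsm : ContDiff ℝ (⊤ : ℕ∞) Ψ := by
    rw [contDiff_iff_contDiffAt]
    intro x
    obtain ⟨F, hF⟩ := lat_finite (d := d) (K + 1 + (‖x‖ + 1))
    have : ContDiffAt ℝ (⊤ : ℕ∞) (fun x => ∑ g ∈ F, ψ (x + (g : Rd d))) x := by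
      refine ContDiffAt.sum fun g _ => ?_
      exact (h1.comp (contDiff_id.add contDiff_const)).contDiffAt
    refine this.congr_of_eventuallyEq ?_
    filter_upwards [Metric.ball_mem_nhds x zero_lt_one] with y hy
    refine hloc _ F hF y ?_
    rw [mem_ball_iff_norm] at hy
    have : ‖y‖ ≤ ‖y - x‖ + ‖x‖ := by simpa using norm_add_le (y - x) x
    linarith
  have hlatz : ∀ z : Fin d → ℤ, zr z ∈ Lat d := fun z => by
    rw [Submodule.mem_span_range_iff_exists_fun ℤ]
    refine ⟨z, ?_⟩
    funext i
    simp [zr, Pi.single_apply]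
  have hper : Zper Ψ := by
    intro x z
    simp only [hΨ, tr_eq]
    rw [← (Equiv.addLeft (⟨zr z, hlatz z⟩ : Lat d)).tsum_eq (fun g : Lat d => ψ (x + g))]
    refine tsum_congr fun g => ?_
    simp [add_assoc]
  obtain ⟨F, hF⟩ := lat_finite (d := d) (K + 1 + 1)
  have hadjQ : ∀ x ∈ Qcube d, adjApply A Ψ x = ∑ g ∈ F, adjApply A ψ (x + g) := by
    intro x hx
    have hev : Ψ =ᶠ[𝓝 x] fun x => ∑ g ∈ F, ψ (x + (g : Rd d)) := by
      filter_upwards [(isOpen_Qcube d).mem_nhds hx] with y hy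
      exact hloc 1 F hF y (Qcube_norm_le hy)
    have hd : fderiv ℝ Ψ x = ∑ g ∈ F, fderiv ℝ ψ (x + (g : Rd d)) := by
      rw [hev.fderiv_eq, fderiv_fun_sum]
      · refine Finset.sum_congr rfl fun g _ => ?_
        rw [fderiv_comp_add_right]
      · intro g _
        exact ((h1.comp (contDiff_id.add contDiff_const)).differentiable (by simp)) x
    funext n
    simp only [adjApply, hd, Finset.sum_apply, dot, _root_.sum_apply, Finset.mul_sum,
      Finset.sum_neg_distrib]
    congr 1
    rw [Finset.sum_comm (s := F)]
    refine Finset.sum_congr rfl fun i _ => ?_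
    rw [Finset.sum_comm]
  have hfi : Integrable (fun x => dot (v x) (adjApply A ψ x)) := by
    unfold dot
    refine integrable_finsetSum _ fun n _ => ?_
    have hl : LocallyIntegrable (fun x => v x n) volume :=
      Zper.intOn_ball (hz.map (fun w => w n)) (hi.eval n)
    have hc : Continuous (fun x => adjApply A ψ x n) :=
      (continuous_apply n).comp (adjApply_smooth A h1).continuous
    have := hl.integrable_smul_left_of_hasCompactSupport hc (adj_cs A h2 n)
    refine this.congr (.of_forall fun x => ?_)
    simp [mul_comm]
  have hvg : ∀ (g : Lat d) x, v (x + g) = v x := fun g x => by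
    have := hz.lat g x
    rw [add_comm]; exact this
  have hf0 : ∀ x, K + 1 ≤ ‖x‖ → dot (v x) (adjApply A ψ x) = 0 := by
    intro x hx
    have hx2 : x ∉ tsupport (fderiv ℝ ψ) := fun h => h0 x hx (tsupport_fderiv_subset ℝ h)
    simp [dot, adjApply, image_eq_zero_of_notMem_tsupport hx2]
  rw [Measure.restrict_univ, unfold_aux hF _ hfi hf0, ← h Ψ hsm hper, ← integral_finsetSum]
  · refine setIntegral_congr_fun (measurableSet_Qcube d) fun x hx => ?_
    simp only [hadjQ x hx, hvg, dot, Finset.sum_apply, Finset.mul_sum]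
    rw [Finset.sum_comm]
  · intro g _
    simp only [hvg]
    have := int_dot_adj A hi (h1.comp (contDiff_id.add (contDiff_const (c := (g : Rd d)))))
      (h2.comp_homeomorph (Homeomorph.addRight (g : Rd d)))
    refine this.congr (.of_forall fun x => ?_)
    have e : adjApply A (fun y => ψ (y + (g : Rd d))) x = adjApply A ψ (x + g) := by
      unfold adjApply
      rw [fderiv_comp_add_right]
    change dot (v x) (adjApply A (fun y => ψ (y + (g : Rd d))) x) = _
    rw [e]

/-! ### Part 5c: cells, boundary bands, step functions -/

lemma mem_cell_Q (hs : 0 < s) :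
    x ∈ cell s z (Qcube d) ↔ ∀ i, s * z i < x i ∧ x i < s * (z i + 1) := by
  constructor
  · rintro ⟨y, hy, rfl⟩ i
    have := hy i
    simp only
    constructor <;> nlinarith [this.1, this.2]
  · intro h
    refine ⟨fun i => s⁻¹ * x i - z i, fun i => ?_, ?_⟩
    · obtain ⟨h1, h2⟩ := h i
      constructor
      · rw [sub_pos, lt_inv_mul_iff₀ hs]; exact h1
      · rw [sub_lt_iff_lt_add, inv_mul_lt_iff₀ hs, add_comm 1]; exact h2
    · funext i
      simp
      rw [mul_inv_cancel_left₀ hs.ne']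

lemma isOpen_cell (hs : 0 < s) (z : Fin d → ℤ) : IsOpen (cell s z (Qcube d)) := by
  rw [cell_eq]; exact aff_open _ hs (isOpen_Qcube d)

lemma cell_index (hs : 0 < s) {z w : Fin d → ℤ}
    (h1 : x ∈ cell s z (Qcube d)) (h2 : x ∈ cell s w (Qcube d)) : z = w := by
  rw [mem_cell_Q hs] at h1 h2
  funext i
  have a := h1 i
  have b := h2 i
  have c : (z i : ℝ) < w i + 1 := lt_of_mul_lt_mul_left (a.1.trans b.2) hs.le
  have c' : (w i : ℝ) < z i + 1 := lt_of_mul_lt_mul_left (b.1.trans a.2) hs.le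
  have d1 : z i < w i + 1 := by exact_mod_cast c
  have d2 : w i < z i + 1 := by exact_mod_cast c'
  omega

lemma cell_disjoint (hs : 0 < s) {z w : Fin d → ℤ} (h : z ≠ w) :
    Disjoint (cell s z (Qcube d)) (cell s w (Qcube d)) :=
  Set.disjoint_left.2 fun _ h1 h2 => h (cell_index hs h1 h2)

lemma cell_dist (hs : 0 < s) {x y : Rd d}
    (h1 : x ∈ cell s z (Qcube d)) (h2 : y ∈ cell s z (Qcube d)) : ‖x - y‖ ≤ s := by
  rw [mem_cell_Q hs] at h1 h2
  refine (pi_norm_le_iff_of_nonneg hs.le).2 fun i => ?_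
  rw [Real.norm_eq_abs, abs_le, Pi.sub_apply]
  have a := h1 i
  have b := h2 i
  constructor <;> linarith

/-- grid of hyperplanes -/
def grid (d : ℕ) (s : ℝ) : Set (Rd d) := ⋃ i : Fin d, ⋃ m : ℤ, {x | x i = s * m}

lemma grid_null (d : ℕ) (s : ℝ) : volume (grid d s) = 0 := by
  unfold grid
  simp only [measure_iUnion_null_iff]
  intro i m
  exact Measure.pi_hyperplane (μ := fun _ : Fin d => (volume : Measure ℝ)) i (s * m)

lemma mem_cell_of_notMem_grid (hs : 0 < s) (hx : x ∉ grid d s) :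
    x ∈ cell s (fun i => ⌊x i / s⌋) (Qcube d) := by
  rw [mem_cell_Q hs]
  intro i
  have h1 := Int.floor_le (x i / s)
  have h2 := Int.lt_floor_add_one (x i / s)
  rw [le_div_iff₀ hs] at h1
  rw [div_lt_iff₀ hs] at h2
  refine ⟨lt_of_le_of_ne (by linarith) fun h => hx ?_, by linarith⟩
  simp only [grid, mem_iUnion]
  exact ⟨i, _, h.symm⟩

/-- boundary band -/
def band {d : ℕ} (Ω : Set (Rd d)) (s : ℝ) : Set (Rd d) :=
  Ω ∩ {x | infEDist x Ωᶜ ≤ ENNReal.ofReal s}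

lemma band_meas (hΩ : IsOpen Ω) (s : ℝ) : MeasurableSet (band Ω s) :=
  hΩ.measurableSet.inter (measurableSet_le continuous_infEDist.measurable measurable_const)

lemma band_subset (Ω : Set (Rd d)) (s : ℝ) : band Ω s ⊆ Ω := inter_subset_left

lemma band_tendsto {E : Type*} [NormedAddCommGroup E] (hΩ : IsOpen Ω)
    {h : Rd d → E} (hi : IntegrableOn h Ω) :
    Tendsto (fun s => ∫ x in band Ω s, ‖h x‖) (𝓝[>] (0 : ℝ)) (𝓝 0) := by
  have e : ∀ s, ∫ x in band Ω s, ‖h x‖ = ∫ x in Ω, (band Ω s).indicator (fun x => ‖h x‖) x := by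
    intro s
    rw [setIntegral_indicator (band_meas hΩ s), inter_eq_self_of_subset_right (band_subset Ω s)]
  simp only [e]
  suffices hk : Tendsto (fun s => ∫ x in Ω, (band Ω s).indicator (fun x => ‖h x‖) x) (𝓝[>] (0 : ℝ))
      (𝓝 (∫ x in Ω, (0 : ℝ))) by simpa using hk
  refine tendsto_integral_filter_of_dominated_convergence (fun x => ‖h x‖) ?_ ?_ hi.norm ?_
  · exact Eventually.of_forall fun s => (hi.norm.aestronglyMeasurable).indicator (band_meas hΩ s)
  · refine Eventually.of_forall fun s => Eventually.of_forall fun x => ?_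
    rw [norm_indicator_eq_indicator_norm]
    exact (indicator_le_self' (fun _ _ => by positivity) x).trans (by simp)
  · rw [ae_restrict_iff' hΩ.measurableSet]
    refine Eventually.of_forall fun x hx => ?_
    have hpos : 0 < infEDist x Ωᶜ := by
      rw [infEDist_pos_iff_notMem_closure, hΩ.isClosed_compl.closure_eq]
      simpa using hx
    have hev : ∀ᶠ s in 𝓝[>] (0 : ℝ), ENNReal.ofReal s < infEDist x Ωᶜ := by
      have : Tendsto ENNReal.ofReal (𝓝[>] (0 : ℝ)) (𝓝 (ENNReal.ofReal 0)) :=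
        (ENNReal.continuous_ofReal.tendsto 0).mono_left nhdsWithin_le_nhds
      rw [ENNReal.ofReal_zero] at this
      exact this.eventually_lt_const hpos
    refine tendsto_const_nhds.congr' ?_
    filter_upwards [hev] with s hs
    rw [indicator_of_notMem]
    exact fun hm => absurd hm.2 (not_le.2 hs)

lemma hat_subset (s : ℝ) (Ω : Set (Rd d)) : hatOmega s Ω ⊆ Ω := by
  unfold hatOmega
  exact iUnion₂_subset fun z hz => hz

lemma isOpen_hat (hs : 0 < s) (Ω : Set (Rd d)) : IsOpen (hatOmega s Ω) :=
  isOpen_biUnion fun z _ => isOpen_cell hs z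

lemma sdiff_hat_subset (hs : 0 < s) (Ω : Set (Rd d)) :
    Ω \ hatOmega s Ω ⊆ band Ω s ∪ grid d s := by
  rintro x ⟨hx, hh⟩
  by_cases hg : x ∈ grid d s
  · exact Or.inr hg
  left
  refine ⟨hx, ?_⟩
  have hc := mem_cell_of_notMem_grid hs hg
  have : ¬ cell s (fun i => ⌊x i / s⌋) (Qcube d) ⊆ Ω := fun h => hh (by
    unfold hatOmega
    simp only [mem_iUnion]
    exact ⟨_, h, hc⟩)
  obtain ⟨y, hy, hyΩ⟩ := not_subset.1 this
  change infEDist x Ωᶜ ≤ _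
  refine (infEDist_le_edist_of_mem (show y ∈ Ωᶜ from hyΩ)).trans ?_
  rw [edist_dist]
  refine ENNReal.ofReal_le_ofReal ?_
  rw [dist_eq_norm]
  exact cell_dist hs hc hy

lemma sdiff_hat_integral_le (hs : 0 < s)
    (hi : IntegrableOn h Ω) :
    ∫ x in Ω \ hatOmega s Ω, ‖h x‖ ≤ ∫ x in band Ω s, ‖h x‖ := by
  have e : (band Ω s ∪ grid d s : Set (Rd d)) =ᵐ[volume] band Ω s :=
    union_ae_eq_left_of_ae_eq_empty (ae_eq_empty.2 (grid_null d s))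
  rw [← setIntegral_congr_set e]
  refine setIntegral_mono_set ?_ (.of_forall fun x => norm_nonneg _)
    (sdiff_hat_subset hs Ω).eventuallyLE
  exact ((hi.mono_set (band_subset Ω s)).congr_set_ae e).norm

/-- the periodic stiff set at scale `ε` -/
def Sper {d : ℕ} (D0 : Set (Rd d)) (ε : ℝ) : Set (Rd d) := {x | ε⁻¹ • x ∈ D1per D0}

lemma Sper_meas (hD : IsOpen D0) (ε : ℝ) : MeasurableSet (Sper D0 ε) :=
  (measurable_const_smul ε⁻¹) (measurableSet_D1per hD)

lemma cell_mono (ε : ℝ) (z : Fin d → ℤ) {S T : Set (Rd d)} (h : S ⊆ T) :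
    cell ε z S ⊆ cell ε z T := image_mono h

lemma Sper_subset_stiff (hDQ : D0 ⊆ Qcube d) {ε : ℝ} (hε : 0 < ε) :
    Ω ∩ Sper D0 ε ⊆ stiffPart ε Ω D0 := by
  rintro x ⟨hx, hS⟩
  refine ⟨hx, fun hm => ?_⟩
  simp only [softPart, mem_iUnion] at hm
  obtain ⟨z, -, hz⟩ := hm
  simp only [Sper, D1per, mem_ofPred_eq, mem_iUnion] at hS
  obtain ⟨w, y, hy, hyx⟩ := hS
  have hxw : x ∈ cell ε w {y} := by
    refine ⟨y, rfl, ?_⟩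
    funext i
    have := congrFun hyx i
    simp only [tr, Pi.smul_apply, smul_eq_mul] at this
    simp only [this]
    rw [mul_inv_cancel_left₀ hε.ne']
  have hzw : z = w := cell_index hε (cell_mono ε z hDQ hz)
    (cell_mono ε w (singleton_subset_iff.2 hy.1) hxw)
  subst hzw
  have hinj : Function.Injective (fun y : Rd d => fun i => ε * (y i + (z i : ℝ))) := by
    intro a b hab
    funext i
    have := congrFun hab i
    simp only at this
    have := mul_left_cancel₀ hε.ne' this
    linarith
  obtain ⟨y1, hy1, e1⟩ := hz
  obtain ⟨y2, hy2, e2⟩ := hxw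
  have : y1 = y2 := hinj (e1.trans e2.symm)
  rw [mem_singleton_iff] at hy2
  exact hy.2 (by rw [← hy2, ← this]; exact hy1)

lemma stiff_hat_subset (hDQ : D0 ⊆ Qcube d) {ε : ℝ} (hε : 0 < ε) :
    stiffPart ε Ω D0 ∩ hatOmega ε Ω ⊆ Sper D0 ε := by
  rintro x ⟨hx, hh⟩
  simp only [hatOmega, mem_iUnion] at hh
  obtain ⟨z, hz, y, hy, rfl⟩ := hh
  have hyD : y ∉ D0 := fun hD => hx.2 (by
    simp only [softPart, mem_iUnion]
    exact ⟨z, (cell_mono ε z hDQ).trans hz, y, hD, rfl⟩)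
  simp only [Sper, D1per, mem_ofPred_eq, mem_iUnion]
  refine ⟨z, y, ⟨hy, hyD⟩, ?_⟩
  funext i
  simp only [tr, Pi.smul_apply, smul_eq_mul]
  rw [inv_mul_cancel_left₀ hε.ne']

lemma soft_meas (hD : IsOpen D0) {ε : ℝ} (hε : 0 < ε) :
    IsOpen (softPart ε Ω D0) :=
  isOpen_biUnion fun z _ => by rw [cell_eq]; exact aff_open _ hε hD

lemma stiff_meas (hΩ : IsOpen Ω) (hD : IsOpen D0) {ε : ℝ} (hε : 0 < ε) :
    MeasurableSet (stiffPart ε Ω D0) := hΩ.measurableSet.diff (soft_meas hD hε).measurableSet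

lemma cells_finite (hb : IsBounded Ω) (hs : 0 < s) :
    {z : Fin d → ℤ | cell s z (Qcube d) ⊆ Ω}.Finite := by
  obtain ⟨R, hR⟩ := hb.exists_norm_le
  refine (Set.finite_Icc (fun _ : Fin d => -⌈R / s + 1⌉) (fun _ => ⌈R / s + 1⌉)).subset ?_
  intro z hz
  have hm : (fun i => s * (1 / 2 + (z i : ℝ))) ∈ cell s z (Qcube d) :=
    ⟨fun _ => 1 / 2, fun i => by norm_num, rfl⟩
  have h1 := hR _ (hz hm)
  have hb : ∀ i, |(z i : ℝ)| ≤ R / s + 1 := fun i => by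
    have h2 := (norm_le_pi_norm _ i).trans h1
    rw [Real.norm_eq_abs, abs_mul, abs_of_pos hs, mul_comm, ← le_div_iff₀ hs] at h2
    rw [abs_le] at h2 ⊢
    constructor <;> linarith [h2.1, h2.2]
  have hc := Int.le_ceil (R / s + 1)
  constructor <;> intro i <;> have := abs_le.1 (hb i)
  · have : (-⌈R / s + 1⌉ : ℝ) ≤ z i := by linarith
    exact_mod_cast this
  · have : (z i : ℝ) ≤ ⌈R / s + 1⌉ := by linarith
    exact_mod_cast this

/-- the indices of the cells inside `Ω` -/
def cidx {d : ℕ} (Ω : Set (Rd d)) (s : ℝ) : Finset (Fin d → ℤ) :=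
  if h : {z : Fin d → ℤ | cell s z (Qcube d) ⊆ Ω}.Finite then h.toFinset else ∅

lemma mem_cidx (hb : IsBounded Ω) (hs : 0 < s)
    : z ∈ cidx Ω s ↔ cell s z (Qcube d) ⊆ Ω := by
  unfold cidx
  rw [dif_pos (cells_finite hb hs)]
  simp

lemma hat_eq (hb : IsBounded Ω) (hs : 0 < s) :
    hatOmega s Ω = ⋃ z ∈ cidx Ω s, cell s z (Qcube d) := by
  unfold hatOmega
  refine iUnion_congr fun z => ?_
  simp only [mem_cidx hb hs, mem_ofPred_eq]

lemma hat_integral {E : Type*} [NormedAddCommGroup E] [NormedSpace ℝ E]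
    (hb : IsBounded Ω) (hs : 0 < s) {T : Set (Rd d)}
    (hT : MeasurableSet T) {h : Rd d → E} (hi : IntegrableOn h (Ω ∩ T)) :
    ∫ x in hatOmega s Ω ∩ T, h x = ∑ z ∈ cidx Ω s, ∫ x in cell s z (Qcube d) ∩ T, h x := by
  rw [hat_eq hb hs, iUnion₂_inter, integral_biUnion_finset]
  · exact fun z _ => (isOpen_cell hs z).measurableSet.inter hT
  · intro z _ w _ hzw
    exact (cell_disjoint hs hzw).mono inter_subset_left inter_subset_left
  · intro z hz
    exact hi.mono_set (inter_subset_inter_left _ ((mem_cidx hb hs).1 hz))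

lemma step_approx (hp : 1 < p) (hΩ : IsOpen Ω)
    (hb : IsBounded Ω) (hu : MemLpOn p Ω u) {η : ℝ} (hη : 0 < η) :
    ∃ s : ℝ, 0 < s ∧ s < η ∧ ∃ ξ : (Fin d → ℤ) → Vec N,
      ∑ z ∈ cidx Ω s, ∫ x in cell s z (Qcube d), ‖u x - ξ z‖ ^ p ≤ η ∧
      ∫ x in Ω \ hatOmega s Ω, (1 + ‖u x‖ ^ p) ≤ η := by
  have hp0 : 0 < p := by linarith
  have hvol : volume Ω ≠ ⊤ := hb.measure_lt_top.ne
  have h2p : (0 : ℝ) < 2 ^ p := by positivity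
  set η1 : ℝ := η / (2 ^ p * 2) with hη1
  have hη1p : 0 < η1 := by positivity
  obtain ⟨φ, hφs, hφ, hφc, hφm⟩ := MemLp.exists_hasCompactSupport_integral_rpow_sub_le
    (μ := volume.restrict Ω) (p := p) hp0 (f := u) hu hη1p
  set V : ℝ := volume.real Ω with hV
  have hV0 : 0 ≤ V := measureReal_nonneg
  set η2 : ℝ := (η1 / (V + 1)) ^ p⁻¹ with hη2
  have hη2p : 0 < η2 := by positivity
  have hη2e : η2 ^ p = η1 / (V + 1) := by
    rw [hη2, ← Real.rpow_mul (by positivity), inv_mul_cancel₀ hp0.ne', Real.rpow_one]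
  obtain ⟨δ, hδ, hδu⟩ := Metric.uniformContinuous_iff.1
    (hφs.uniformContinuous_of_continuous hφc) η2 hη2p
  have hitg : IntegrableOn (fun x => 1 + ‖u x‖ ^ p) Ω :=
    (integrableOn_const hvol).add (hu.integrable_rpow hp)
  have hbt := band_tendsto hΩ hitg
  have hev : ∀ᶠ s in 𝓝[>] (0 : ℝ), ∫ x in band Ω s, ‖1 + ‖u x‖ ^ p‖ < η :=
    hbt.eventually_lt_const hη
  have hev2 : ∀ᶠ s in 𝓝[>] (0 : ℝ), s < δ := by
    filter_upwards [Ioo_mem_nhdsGT hδ] with s hs using hs.2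
  have hev3 : ∀ᶠ s in 𝓝[>] (0 : ℝ), s < η := by
    filter_upwards [Ioo_mem_nhdsGT hη] with s hs using hs.2
  obtain ⟨s, ⟨⟨hs1, hs2⟩, hs3⟩, hs0⟩ := (((hev.and hev2).and hev3).and self_mem_nhdsWithin).exists
  have hs0 : 0 < s := hs0
  refine ⟨s, hs0, hs3, fun z => φ (fun i => s * (1 / 2 + (z i : ℝ))), ?_, ?_⟩
  · have hcen : ∀ z : Fin d → ℤ, (fun i => s * (1 / 2 + (z i : ℝ))) ∈ cell s z (Qcube d) := fun z =>
      ⟨fun _ => 1 / 2, fun i => by norm_num, rfl⟩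
    have huφ : IntegrableOn (fun x => ‖u x - φ x‖ ^ p) Ω := by
      have : MemLpOn p Ω (fun x => u x - φ x) := MemLp.sub hu hφm
      exact this.integrable_rpow hp
    have hi2 : IntegrableOn (fun x => 2 ^ p * (‖u x - φ x‖ ^ p + η2 ^ p)) Ω :=
      (huφ.add (integrableOn_const hvol)).const_mul _
    have hb1 : ∀ z ∈ cidx Ω s, ∫ x in cell s z (Qcube d), ‖u x - φ (fun i => s * (1 / 2 + (z i : ℝ)))‖ ^ p
        ≤ ∫ x in cell s z (Qcube d) ∩ univ, 2 ^ p * (‖u x - φ x‖ ^ p + η2 ^ p) := by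
      intro z hz
      have hzΩ := (mem_cidx hb hs0).1 hz
      rw [inter_univ]
      have hmz : MemLpOn p (cell s z (Qcube d)) (fun x => u x - φ (fun i => s * (1 / 2 + (z i : ℝ)))) :=
        MemLp.sub (hu.mono hzΩ) (memLpOn_const (ne_top_of_le_ne_top hvol (measure_mono hzΩ)) _)
      refine setIntegral_mono_on (hmz.integrable_rpow hp) (hi2.mono_set hzΩ)
        (isOpen_cell hs0 z).measurableSet fun x hx => ?_
      have h1 := norm_add_rpow_le hp (u x - φ x) (φ x - φ (fun i => s * (1 / 2 + (z i : ℝ))))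
      rw [sub_add_sub_cancel] at h1
      refine h1.trans ?_
      have h2 : ‖φ x - φ (fun i => s * (1 / 2 + (z i : ℝ)))‖ ≤ η2 := by
        rw [← dist_eq_norm]
        refine (hδu ?_).le
        rw [dist_eq_norm]
        exact (cell_dist hs0 hx (hcen z)).trans_lt hs2
      gcongr
    refine (Finset.sum_le_sum hb1).trans ?_
    rw [← hat_integral hb hs0 MeasurableSet.univ (by simpa using hi2), inter_univ]
    refine (setIntegral_mono_set hi2 (.of_forall fun x => by
      simp only [Pi.zero_apply]; positivity) (hat_subset s Ω).eventuallyLE).trans ?_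
    rw [integral_const_mul, integral_add huφ (integrableOn_const hvol), setIntegral_const, hη2e,
      smul_eq_mul]
    have h3 : volume.real Ω * (η1 / (V + 1)) ≤ η1 := by
      rw [← mul_div_assoc, div_le_iff₀ (by positivity)]
      nlinarith
    have h4 : 2 ^ p * (η1 + η1) = η := by rw [hη1]; field_simp; ring
    rw [← h4]
    gcongr
  · have h := (sdiff_hat_integral_le hs0 hitg).trans hs1.le
    refine le_trans (le_of_eq ?_) h
    refine integral_congr_ae (.of_forall fun x => ?_)
    simp only
    rw [Real.norm_of_nonneg (by positivity)]

/-! ### Part 6a: the slicing lemma -/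

lemma GF.mod1 (hp : 1 < p) (h : GF p C f)
    {η : ℝ} (hη : 0 < η) : ∃ D, 0 ≤ D ∧ ∀ (x : Rd d) (ξ ζ : Vec N),
      |f x ξ - f x ζ| ≤ η * (1 + ‖ζ‖ ^ p) + D * ‖ξ - ζ‖ ^ p := by
  have h2p : (0 : ℝ) < 2 ^ p := by positivity
  obtain ⟨D, hD, hm⟩ := h.modulus hp (η := η / (1 + 2 ^ p)) (by positivity)
  refine ⟨D + η, by positivity, fun x ξ ζ => (hm x ξ ζ).trans ?_⟩
  have h1 := norm_rpow_le_sub hp ξ ζ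
  have h2 : 0 ≤ ‖ξ - ζ‖ ^ p := by positivity
  have h3 : 0 ≤ ‖ζ‖ ^ p := by positivity
  have h4 : η / (1 + 2 ^ p) * (1 + ‖ξ‖ ^ p + ‖ζ‖ ^ p) ≤
      η / (1 + 2 ^ p) * ((1 + 2 ^ p) * (1 + ‖ζ‖ ^ p) + (1 + 2 ^ p) * ‖ξ - ζ‖ ^ p) := by
    refine mul_le_mul_of_nonneg_left ?_ (by positivity)
    nlinarith
  have h5 : η / (1 + 2 ^ p) * ((1 + 2 ^ p) * (1 + ‖ζ‖ ^ p) + (1 + 2 ^ p) * ‖ξ - ζ‖ ^ p)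
      = η * (1 + ‖ζ‖ ^ p) + η * ‖ξ - ζ‖ ^ p := by
    field_simp
  nlinarith

/-- centre of the unit cube -/
def ctr (d : ℕ) : Rd d := fun _ => 1 / 2

lemma Qcube_ball (d : ℕ) : Qcube d = ball (ctr d) (1 / 2) := by
  rw [Qcube_eq, ball_pi _ (by norm_num)]
  refine Set.pi_congr rfl fun i _ => ?_
  rw [Real.ball_eq_Ioo]
  norm_num [ctr]

lemma exists_bump {r R : ℝ} (hr : 0 < r) (hR : r < R) (c : Rd d) :
    ∃ Φ : Rd d → ℝ, ContDiff ℝ (⊤ : ℕ∞) Φ ∧ HasCompactSupport Φ ∧ tsupport Φ ⊆ closedBall c R ∧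
      (∀ x ∈ closedBall c r, Φ x = 1) ∧ (∀ x, x ∉ ball c R → Φ x = 0) ∧ ∀ x, 0 ≤ Φ x ∧ Φ x ≤ 1 := by
  let f : ContDiffBump c := ⟨r, R, hr, hR⟩
  refine ⟨f, f.contDiff, f.hasCompactSupport, f.tsupport_eq.le, fun x hx => f.one_of_mem_closedBall hx,
    fun x hx => ?_, fun x => ⟨f.nonneg, f.le_one⟩⟩
  have := f.support_eq
  by_contra h0
  exact hx (this ▸ (Function.mem_support.2 h0))

lemma volume_ball_ctr (hr : 0 < r) (c : Rd d) :
    volume.real (closedBall c r) = (2 * r) ^ d := by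
  rw [measureReal_def, Real.volume_pi_closedBall _ hr.le, ENNReal.toReal_ofReal (by positivity)]
  simp

lemma cut_bound (hp : 1 < p) (h : GF p C f) (x : Rd d)
    (ξ v : Vec N) {t : ℝ} (h0 : 0 ≤ t) (h1 : t ≤ 1) :
    f x (ξ + t • v) ≤ f x (ξ + v) + (if t = 1 then 0 else C * (2 + 2 ^ p * ‖ξ‖ ^ p)) +
      (if t = 1 ∨ t = 0 then 0 else C * 2 ^ p * ‖v‖ ^ p) := by
  have hC := h.one_le
  have h2p : (0 : ℝ) < 2 ^ p := by positivity
  by_cases ht : t = 1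
  · simp [ht]
  have a1 := (abs_le.1 (h.upper x (ξ + t • v))).2
  have a2 := h.lower x (ξ + v)
  have a3 := norm_add_rpow_le hp ξ (t • v)
  have a4 : ‖t • v‖ ^ p ≤ (if t = 0 then 0 else ‖v‖ ^ p) := by
    by_cases ht0 : t = 0
    · simp [ht0, Real.zero_rpow (by linarith : p ≠ 0)]
    · simp only [ht0, if_false]
      refine Real.rpow_le_rpow (norm_nonneg _) ?_ (by linarith)
      rw [norm_smul, Real.norm_of_nonneg h0]
      nlinarith [norm_nonneg v]
  have a5 : C * (1 + ‖ξ + t • v‖ ^ p) ≤ C * (1 + 2 ^ p * (‖ξ‖ ^ p + (if t = 0 then 0 else ‖v‖ ^ p))) := by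
    have : 2 ^ p * (‖ξ‖ ^ p + ‖t • v‖ ^ p) ≤ 2 ^ p * (‖ξ‖ ^ p + (if t = 0 then 0 else ‖v‖ ^ p)) := by
      gcongr
    refine mul_le_mul_of_nonneg_left ?_ (by linarith)
    linarith
  by_cases ht0 : t = 0
  · simp only [ht0, if_true, or_true] at a5 ⊢
    simp only [ht0, zero_smul, add_zero] at a1 a5 a3 ⊢
    norm_num
    nlinarith
  · simp only [ht, ht0, if_false, or_self] at a5 ⊢
    nlinarith

lemma cut_energy (hp : 1 < p) (hf : GF p C f)
    {S O : Set (Rd d)} (hSO : S ⊆ O) (hO : MeasurableSet O) (hOf : volume O ≠ ⊤)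
    {V W : Rd d → Vec N} (hV : MemLpOn p O V) (hW : MemLpOn p O W) {φ : Rd d → Rd d}
    (hφ : Measurable φ) {Φ : Rd d → ℝ} (hΦ : Continuous Φ) (h01 : ∀ x, 0 ≤ Φ x ∧ Φ x ≤ 1)
    {G L : Set (Rd d)} (hG : MeasurableSet G) (hL : MeasurableSet L) (hGΦ : ∀ x ∈ O, x ∈ G → Φ x = 1)
    (hLO : L ⊆ O)
    (hLΦ : ∀ x ∈ O, Φ x ≠ 0 → Φ x ≠ 1 → x ∈ L) (ξ : Vec N) {η D : ℝ} (hη : 0 ≤ η) (hD : 0 ≤ D)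
    (hmod : ∀ (x : Rd d) (ξ ζ : Vec N),
    |f x ξ - f x ζ| ≤ η * (1 + ‖ζ‖ ^ p) + D * ‖ξ - ζ‖ ^ p) :
    ∫ x in S, f (φ x) (ξ + W x) ≤ (∫ x in S, f (φ x) (ξ + V x)) +
      (η * ((1 + 2 ^ p * ‖ξ‖ ^ p) * volume.real O + 2 ^ p * ∫ x in O, ‖V x‖ ^ p)
       + D * ∫ x in O, ‖W x - Φ x • V x‖ ^ p)
      + C * (2 + 2 ^ p * ‖ξ‖ ^ p) * volume.real (O \ G) + C * 2 ^ p * ∫ x in L, ‖V x‖ ^ p := by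
  have hC := hf.one_le
  have hSf : volume S ≠ ⊤ := ne_top_of_le_ne_top hOf (measure_mono hSO)
  have h2p : (0 : ℝ) < 2 ^ p := by positivity
  have mW : MemLpOn p S (fun x => ξ + W x) :=
    MemLpOn.mono (O := O) (MemLp.add (memLpOn_const hOf ξ) hW) hSO
  have mV : MemLpOn p S (fun x => ξ + V x) :=
    MemLpOn.mono (O := O) (MemLp.add (memLpOn_const hOf ξ) hV) hSO
  have mΦV : MemLpOn p O (fun x => Φ x • V x) := by
    refine MemLp.of_le hV (hΦ.aestronglyMeasurable.smul hV.1) (ae_of_all _ fun x => ?_)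
    rw [norm_smul, Real.norm_of_nonneg (h01 x).1]
    nlinarith [norm_nonneg (V x), (h01 x).2]
  have iV : IntegrableOn (fun x => ‖V x‖ ^ p) O := MemLpOn.integrable_rpow hp hV
  have iWV : IntegrableOn (fun x => ‖W x - Φ x • V x‖ ^ p) O :=
    MemLpOn.integrable_rpow hp (u := fun x => W x - Φ x • V x) (MemLp.sub hW mΦV)
  have i1 : IntegrableOn (fun x => f (φ x) (ξ + W x)) S := hf.integrable hp hSf mW hφ
  have i2 : IntegrableOn (fun x => f (φ x) (ξ + V x)) S := hf.integrable hp hSf mV hφ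
  let R : Rd d → ℝ := fun x => ((η * ((1 + 2 ^ p * ‖ξ‖ ^ p) + 2 ^ p * ‖V x‖ ^ p)
       + D * ‖W x - Φ x • V x‖ ^ p) + (O \ G).indicator (fun _ => C * (2 + 2 ^ p * ‖ξ‖ ^ p)) x)
      + L.indicator (fun x => C * 2 ^ p * ‖V x‖ ^ p) x
  have c1 : IntegrableOn (fun _ : Rd d => (1 + 2 ^ p * ‖ξ‖ ^ p : ℝ)) O := integrableOn_const hOf
  have c2 : IntegrableOn (fun x => 2 ^ p * ‖V x‖ ^ p) O := iV.const_mul _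
  have c3 : IntegrableOn (fun x => (1 + 2 ^ p * ‖ξ‖ ^ p) + 2 ^ p * ‖V x‖ ^ p) O := c1.add c2
  have c4 : IntegrableOn (fun x => η * ((1 + 2 ^ p * ‖ξ‖ ^ p) + 2 ^ p * ‖V x‖ ^ p)) O :=
    c3.const_mul _
  have c5 : IntegrableOn (fun x => D * ‖W x - Φ x • V x‖ ^ p) O := iWV.const_mul _
  have c6 : IntegrableOn (fun x => η * ((1 + 2 ^ p * ‖ξ‖ ^ p) + 2 ^ p * ‖V x‖ ^ p)
       + D * ‖W x - Φ x • V x‖ ^ p) O := c4.add c5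
  have c7 : IntegrableOn ((O \ G).indicator (fun _ => C * (2 + 2 ^ p * ‖ξ‖ ^ p))) O :=
    IntegrableOn.indicator (integrableOn_const hOf) (hO.diff hG)
  have c8 : IntegrableOn (L.indicator (fun x => C * 2 ^ p * ‖V x‖ ^ p)) O :=
    IntegrableOn.indicator (iV.const_mul _) hL
  have c9 : IntegrableOn (fun x => (η * ((1 + 2 ^ p * ‖ξ‖ ^ p) + 2 ^ p * ‖V x‖ ^ p)
       + D * ‖W x - Φ x • V x‖ ^ p) + (O \ G).indicator (fun _ => C * (2 + 2 ^ p * ‖ξ‖ ^ p)) x) O :=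
    c6.add c7
  have iR : IntegrableOn R O := c9.add c8
  have hR0 : ∀ x, 0 ≤ R x := fun x => by
    have t1 : 0 ≤ (O \ G).indicator (fun _ => C * (2 + 2 ^ p * ‖ξ‖ ^ p)) x :=
      indicator_nonneg (fun _ _ => by positivity) x
    have t2 : 0 ≤ L.indicator (fun x => C * 2 ^ p * ‖V x‖ ^ p) x :=
      indicator_nonneg (fun _ _ => by positivity) x
    have t3 : 0 ≤ η * ((1 + 2 ^ p * ‖ξ‖ ^ p) + 2 ^ p * ‖V x‖ ^ p) + D * ‖W x - Φ x • V x‖ ^ p := by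
      positivity
    show 0 ≤ _ + _ + _
    positivity
  have hpt : ∀ x ∈ O, f (φ x) (ξ + W x) ≤ f (φ x) (ξ + V x) + R x := fun x hx => by
    have a1 := (abs_le.1 (hmod (φ x) (ξ + W x) (ξ + Φ x • V x))).2
    have a2 := cut_bound hp hf (φ x) ξ (V x) (h01 x).1 (h01 x).2
    have a3 : (if Φ x = 1 then 0 else C * (2 + 2 ^ p * ‖ξ‖ ^ p)) ≤
        (O \ G).indicator (fun _ => C * (2 + 2 ^ p * ‖ξ‖ ^ p)) x := by
      split_ifs with hc
      · exact indicator_nonneg (fun _ _ => by positivity) x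
      · rw [indicator_of_mem (show x ∈ O \ G from ⟨hx, fun hg => hc (hGΦ x hx hg)⟩)]
    have a4 : (if Φ x = 1 ∨ Φ x = 0 then 0 else C * 2 ^ p * ‖V x‖ ^ p) ≤
        L.indicator (fun x => C * 2 ^ p * ‖V x‖ ^ p) x := by
      split_ifs with hc
      · exact indicator_nonneg (fun _ _ => by positivity) x
      · push Not at hc
        rw [indicator_of_mem (hLΦ x hx hc.2 hc.1)]
    have a5 : ‖ξ + Φ x • V x‖ ^ p ≤ 2 ^ p * ‖ξ‖ ^ p + 2 ^ p * ‖V x‖ ^ p := by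
      have b1 := norm_add_rpow_le hp ξ (Φ x • V x)
      have b2 : ‖Φ x • V x‖ ^ p ≤ ‖V x‖ ^ p := by
        refine Real.rpow_le_rpow (norm_nonneg _) ?_ (by linarith)
        rw [norm_smul, Real.norm_of_nonneg (h01 x).1]
        nlinarith [norm_nonneg (V x), (h01 x).2]
      nlinarith
    have a6 : ξ + W x - (ξ + Φ x • V x) = W x - Φ x • V x := by abel
    rw [a6] at a1
    have a7 := mul_le_mul_of_nonneg_left a5 hη
    show _ ≤ _ + (_ + _ + _)
    nlinarith
  have iRS : IntegrableOn R S := iR.mono_set hSO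
  calc ∫ x in S, f (φ x) (ξ + W x) ≤ ∫ x in S, (f (φ x) (ξ + V x) + R x) := by
        refine integral_mono_ae i1 (i2.add iRS) ?_
        exact ae_restrict_of_ae_restrict_of_subset hSO ((ae_restrict_iff' hO).2 (ae_of_all _ hpt))
    _ = (∫ x in S, f (φ x) (ξ + V x)) + ∫ x in S, R x := integral_add i2 iRS
    _ ≤ (∫ x in S, f (φ x) (ξ + V x)) + ∫ x in O, R x := by
        have := setIntegral_mono_set iR (ae_of_all _ hR0) (LE.le.eventuallyLE hSO)
        linarith
    _ = _ := by
        have e1 : ∫ x in O, R x = _ := integral_add c9 c8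
        have e2 := integral_add c6 c7
        have e3 := integral_add c4 c5
        rw [integral_const_mul, integral_const_mul] at e3
        have e4 := integral_add c1 c2
        rw [integral_const_mul, setIntegral_const, smul_eq_mul] at e4
        rw [setIntegral_indicator (hO.diff hG), setIntegral_const, smul_eq_mul,
          inter_eq_self_of_subset_right sdiff_subset] at e2
        rw [setIntegral_indicator hL, inter_eq_self_of_subset_right hLO, integral_const_mul] at e1
        rw [e1, e2, e3, e4]
        ring

lemma slice_pigeon (hp : 1 < p) {V : Rd d → Vec N}
    (hV : MemLpOn p O V) {J : ℕ} (hJ : 0 < J) {L : ℕ → Set (Rd d)} (hL : ∀ i, MeasurableSet (L i))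
    (hLO : ∀ i < J, L i ⊆ O) (hdis : ∀ i j, i < j → Disjoint (L i) (L j))
    (hB : ∫ x in O, ‖V x‖ ^ p ≤ B) : ∃ i < J, ∫ x in L i, ‖V x‖ ^ p ≤ B / J := by
  by_contra hcon
  push Not at hcon
  have iV : IntegrableOn (fun x => ‖V x‖ ^ p) O := MemLpOn.integrable_rpow hp hV
  have h1 : ∫ x in ⋃ i ∈ Finset.range J, L i, ‖V x‖ ^ p = ∑ i ∈ Finset.range J, ∫ x in L i, ‖V x‖ ^ p := by
    refine integral_biUnion_finset _ (fun i _ => hL i) ?_ (fun i hi => iV.mono_set (hLO i (Finset.mem_range.1 hi)))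
    intro i _ j _ hij
    rcases lt_or_gt_of_ne hij with h | h
    · exact hdis i j h
    · exact (hdis j i h).symm
  have h2 : ∫ x in ⋃ i ∈ Finset.range J, L i, ‖V x‖ ^ p ≤ ∫ x in O, ‖V x‖ ^ p :=
    setIntegral_mono_set iV (ae_of_all _ fun x => by positivity) (LE.le.eventuallyLE
      (iUnion₂_subset fun i hi => hLO i (Finset.mem_range.1 hi)))
  have h3 : ∑ i ∈ Finset.range J, B / J < ∑ i ∈ Finset.range J, ∫ x in L i, ‖V x‖ ^ p :=
    Finset.sum_lt_sum_of_nonempty ⟨0, Finset.mem_range.2 hJ⟩ fun i hi => hcon i (Finset.mem_range.1 hi)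
  have h4 : ∑ i ∈ Finset.range J, B / J = B := by
    rw [Finset.sum_const, Finset.card_range, nsmul_eq_mul]
    have : (J : ℝ) ≠ 0 := by positivity
    field_simp
  linarith

lemma slice (hp : 1 < p)
    (hA : ConstantRank A) (hf : GF p C f1)
    {ι : Type*} {l : Filter ι} [l.IsCountablyGenerated] {V : ι → Rd d → Vec N}
    (hV : ∀ n, MemLpOn p (Qcube d) (V n)) (hfree : ∀ n, AFreeOn A (Qcube d) (V n))
    (hB : ∀ n, ∫ x in Qcube d, ‖V n x‖ ^ p ≤ B)
    (hw : ∀ (a : Fin N) (g : Rd d → ℝ), Continuous g → HasCompactSupport g →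
    tsupport g ⊆ Qcube d → Tendsto (fun n => ∫ x in Qcube d, V n x a * g x) l (𝓝 0))
    (k : ι → ℕ) (ξ : Vec N) {η : ℝ} (hη : 0 < η) :
    ∀ᶠ n in l, sInf (cset p A D0 f1 (k n) ξ) - η ≤
      ∫ y in Dk D0 (k n), f1 ((k n : ℝ) • y) (ξ + V n y) := by
  have hC := hf.one_le
  have h2p : (0 : ℝ) < 2 ^ p := by positivity
  set B' : ℝ := max B 0 with hB'
  have hB'0 : 0 ≤ B' := le_max_right _ _
  have hBB : ∀ n, ∫ x in Qcube d, ‖V n x‖ ^ p ≤ B' := fun n => (hB n).trans (le_max_left _ _)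
  set T : ℝ := (1 + 2 ^ p * ‖ξ‖ ^ p) + 2 ^ p * B' with hT
  have hT0 : 0 < T := by positivity
  obtain ⟨D, hD, hmod⟩ := hf.mod1 hp (η := η / (4 * T)) (by positivity)
  set K0 : ℝ := C * (2 + 2 ^ p * ‖ξ‖ ^ p) with hK0
  have hK00 : 0 < K0 := by positivity
  -- the inner radius
  obtain ⟨ρ, hρ0, hρ1, hρ⟩ : ∃ ρ : ℝ, 0 < ρ ∧ ρ < 1 / 2 ∧ K0 * (1 - (2 * ρ) ^ d) ≤ η / 4 := by
    have ht : Tendsto (fun ρ : ℝ => K0 * (1 - (2 * ρ) ^ d)) (𝓝[<] (1 / 2)) (𝓝 0) := by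
      have : Tendsto (fun ρ : ℝ => K0 * (1 - (2 * ρ) ^ d)) (𝓝 (1 / 2)) (𝓝 (K0 * (1 - (2 * (1 / 2)) ^ d))) :=
        Continuous.tendsto (by fun_prop) _
      norm_num at this
      exact (by simpa using this : Tendsto (fun ρ : ℝ => K0 * (1 - (2 * ρ) ^ d)) (𝓝 (1 / 2)) (𝓝 0)).mono_left
        nhdsWithin_le_nhds
    have e1 := ht.eventually (Iio_mem_nhds (show (0 : ℝ) < η / 4 by positivity))
    have e2 : ∀ᶠ ρ : ℝ in 𝓝[<] (1 / 2), ρ ∈ Ioo (0 : ℝ) (1 / 2) := Ioo_mem_nhdsLT (by norm_num)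
    obtain ⟨ρ, h1, h2⟩ := (e1.and e2).exists
    exact ⟨ρ, h2.1, h2.2, le_of_lt h1⟩
  obtain ⟨J, hJ⟩ := exists_nat_gt (4 * (C * 2 ^ p * B') / η)
  have hJ0 : (0 : ℝ) < J := lt_of_le_of_lt (by positivity) hJ
  have hJn : 0 < J := by exact_mod_cast hJ0
  set τ : ℝ := (1 / 2 - ρ) / (J + 1) with hτ
  have hτ0 : 0 < τ := by have : 0 < 1 / 2 - ρ := by linarith
                         positivity
  set r : ℕ → ℝ := fun i => ρ + τ * i with hr
  have hr0 : ∀ i, 0 < r i := fun i => by simp only [hr]; positivity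
  have hrs : ∀ i, r i < r (i + 1) := fun i => by simp only [hr]; push_cast; nlinarith
  have hrm : Monotone r := monotone_nat_of_le_succ fun i => (hrs i).le
  have hrJ : ∀ i < J, r (i + 1) < 1 / 2 := fun i hi => by
    have h1 : r (i + 1) ≤ r J := hrm hi
    have h2 : r J < 1 / 2 := by
      have : τ * (J + 1) = 1 / 2 - ρ := by rw [hτ]; field_simp
      simp only [hr]; nlinarith
    linarith
  choose Φ Φs Φc Φt Φ1 Φ0 Φb using fun i => exists_bump (hr0 i) (hrs i) (ctr d)
  have hΦQ : ∀ i < J, tsupport (Φ i) ⊆ Qcube d := fun i hi =>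
    (Φt i).trans (by rw [Qcube_ball]; exact closedBall_subset_ball (hrJ i hi))
  have hlc := fun i : Fin J => lemmaC hp hA (Φs i) (Φc i) (hΦQ i i.2) hV hfree hB hw
  choose W hW hWt using hlc
  set L : ℕ → Set (Rd d) := fun i => ball (ctr d) (r (i + 1)) \ closedBall (ctr d) (r i) with hL
  have hLm : ∀ i, MeasurableSet (L i) := fun i => measurableSet_ball.diff measurableSet_closedBall
  have hLQ : ∀ i < J, L i ⊆ Qcube d := fun i hi => by
    rw [Qcube_ball]; exact sdiff_subset.trans (ball_subset_ball (hrJ i hi).le)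
  have hLd : ∀ i j, i < j → Disjoint (L i) (L j) := fun i j hij => by
    refine Set.disjoint_left.2 fun x hx hx' => hx'.2 ?_
    exact closedBall_subset_closedBall (hrm (Nat.succ_le_of_lt hij)) (ball_subset_closedBall hx.1)
  have hev : ∀ᶠ n in l, ∀ i : Fin J, D * ∫ x in Qcube d, ‖W i n x - Φ i x • V n x‖ ^ p ≤ η / 4 := by
    rw [eventually_all]
    intro i
    have := (hWt i).const_mul D
    rw [mul_zero] at this
    exact (this.eventually (Iio_mem_nhds (show (0 : ℝ) < η / 4 by positivity))).mono fun _ h => le_of_lt h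
  filter_upwards [hev] with n hn
  obtain ⟨i, hi, hLi⟩ := slice_pigeon hp (hV n) hJn hLm hLQ hLd (hBB n)
  have h1 := cmin_le (D0 := D0) hp A hf (hW ⟨i, hi⟩ n) ξ (k n)
  have h2 := cut_energy hp hf (Dk_subset D0 (k n)) (measurableSet_Qcube d) (volume_Qcube_ne d)
    (hV n) (hW ⟨i, hi⟩ n).1 (measurable_const_smul (k n : ℝ)) (Φs i).continuous (Φb i)
    (G := closedBall (ctr d) ρ) measurableSet_closedBall (hLm i)
    (fun x _ hx => Φ1 i x (closedBall_subset_closedBall (by simp only [hr]; nlinarith [(Nat.cast_nonneg i : (0:ℝ) ≤ i)]) hx))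
    (hLQ i hi)
    (fun x _ h0 h1 => ⟨by by_contra hc; exact h0 (Φ0 i x hc), fun hc => h1 (Φ1 i x hc)⟩)
    ξ (by positivity) hD hmod
  have hvQ : volume.real (Qcube d) = 1 := by simp [measureReal_def, volume_Qcube]
  have h3 : volume.real (Qcube d \ closedBall (ctr d) ρ) = 1 - (2 * ρ) ^ d := by
    rw [measureReal_sdiff (by rw [Qcube_ball]; exact closedBall_subset_ball hρ1)
      measurableSet_closedBall (volume_Qcube_ne d), hvQ, volume_ball_ctr hρ0]
  rw [h3, hvQ, mul_one] at h2
  have h4 : η / (4 * T) * (1 + 2 ^ p * ‖ξ‖ ^ p + 2 ^ p * ∫ x in Qcube d, ‖V n x‖ ^ p) ≤ η / 4 := by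
    have e : η / (4 * T) * T = η / 4 := by field_simp
    rw [← e]
    refine mul_le_mul_of_nonneg_left ?_ (by positivity)
    have := mul_le_mul_of_nonneg_left (hBB n) h2p.le
    simp only [hT]; linarith
  have h5 : C * 2 ^ p * ∫ x in L i, ‖V n x‖ ^ p ≤ η / 4 := by
    have e1 : C * 2 ^ p * ∫ x in L i, ‖V n x‖ ^ p ≤ C * 2 ^ p * (B' / J) :=
      mul_le_mul_of_nonneg_left hLi (by positivity)
    have e2 : C * 2 ^ p * (B' / J) ≤ η / 4 := by
      rw [div_lt_iff₀ hη] at hJ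
      rw [← mul_div_assoc, div_le_iff₀ hJ0]
      linarith
    linarith
  have h6 := hn ⟨i, hi⟩
  simp only at h6
  linarith

lemma abs_le_one_add_rpow (hp : 1 < p) (v : Vec N) (a : Fin N) :
    |v a| ≤ 1 + ‖v‖ ^ p := by
  have h1 : |v a| ≤ ‖v‖ := norm_le_pi_norm v a
  have h0 : 0 ≤ ‖v‖ ^ p := by positivity
  rcases le_total ‖v‖ 1 with h | h
  · linarith
  · have : ‖v‖ ^ (1 : ℝ) ≤ ‖v‖ ^ p := Real.rpow_le_rpow_of_exponent_le h hp.le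
    rw [Real.rpow_one] at this
    linarith

lemma weak_rescale (hp : 1 < p) (hs : 0 < s)
    {v : ℕ → Rd d → Vec N} (hv : ∀ n, MemLpOn p (aff X s '' Qcube d) (v n))
    (hB : ∀ n, ∫ x in aff X s '' Qcube d, ‖v n x‖ ^ p ≤ B) (a : Fin N)
    (hw : ∀ (g : Rd d → ℝ), Continuous g → HasCompactSupport g →
    tsupport g ⊆ aff X s '' Qcube d →
    Tendsto (fun n => ∫ x in aff X s '' Qcube d, v n x a * g x) atTop (𝓝 0))
    {Xn : ℕ → Rd d} {r : ℕ → ℝ} (hr : ∀ n, 0 < r n) (hX : Tendsto Xn atTop (𝓝 X))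
    (hrs : Tendsto r atTop (𝓝 s)) (hsub : ∀ n, aff (Xn n) (r n) '' Qcube d ⊆ aff X s '' Qcube d)
    (hg : Continuous g) (hgc : HasCompactSupport g) (hgQ : tsupport g ⊆ Qcube d) :
    Tendsto (fun n => ∫ y in Qcube d, v n (aff (Xn n) (r n) y) a * g y) atTop (𝓝 0) := by
  set O := aff X s '' Qcube d with hO
  have hOm : MeasurableSet O := aff_measurableSet X hs (measurableSet_Qcube d)
  have hOb : IsBounded O := aff_bounded X s
  have hOf : volume O ≠ ⊤ := hOb.measure_lt_top.ne
  set T : ℕ → Rd d → Rd d := fun n => aff (-((r n)⁻¹ • Xn n)) (r n)⁻¹ with hT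
  set T0 : Rd d → Rd d := aff (-(s⁻¹ • X)) s⁻¹ with hT0
  have hTc : ∀ n, Continuous (T n) := fun n => aff_cont _ _
  have hT0c : Continuous T0 := aff_cont _ _
  obtain ⟨K, hK⟩ := hgc.exists_bound_of_continuous hg
  have hK' : ∀ x, |g x| ≤ K := fun x => hK x
  have iv : ∀ n, IntegrableOn (fun x => v n x a) O := fun n =>
    Integrable.eval (MemLpOn.integrable hp hOf (hv n)) a
  have ir : ∀ n, IntegrableOn (fun x => 1 + ‖v n x‖ ^ p) O := fun n =>
    (integrableOn_const hOf).add (MemLpOn.integrable_rpow hp (hv n))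
  have i1 : ∀ n, IntegrableOn (fun x => v n x a * g (T n x)) O := fun n =>
    int_bdd_mul (iv n) (hg.comp (hTc n)) (fun x => hK' _)
  have i2 : ∀ n, IntegrableOn (fun x => v n x a * g (T0 x)) O := fun n =>
    int_bdd_mul (iv n) (hg.comp hT0c) (fun x => hK' _)
  -- change of variables
  have hcv : ∀ n, ∫ x in O, v n x a * g (T n x) =
      (r n) ^ d * ∫ y in Qcube d, v n (aff (Xn n) (r n) y) a * g y := by
    intro n
    rw [setIntegral_eq_of_subset_of_forall_sdiff_eq_zero hOm (hsub n) (fun x hx => ?_),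
      aff_integral (Xn n) (hr n), smul_eq_mul]
    · simp only [hT, aff_inv' (Xn n) (hr n)]
    · have : T n x ∉ tsupport g := fun hc => hx.2 ⟨T n x, hgQ hc, aff_inv (Xn n) (hr n) x⟩
      rw [image_eq_zero_of_notMem_tsupport this, mul_zero]
  -- the fixed limit test function
  have hlim : Tendsto (fun n => ∫ x in O, v n x a * g (T0 x)) atTop (𝓝 0) := by
    have hts : tsupport (fun x => g (T0 x)) ⊆ O := by
      have h1 : tsupport (g ∘ T0) ⊆ T0 ⁻¹' tsupport g := tsupport_comp_subset_preimage g hT0c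
      exact h1.trans fun x hx => ⟨T0 x, hgQ hx, aff_inv X hs x⟩
    refine hw _ (hg.comp hT0c) ?_ hts
    exact HasCompactSupport.of_support_subset_isCompact
      (K := aff X s '' tsupport g) (hgc.isCompact.image (aff_cont X s)) fun x hx =>
        ⟨T0 x, subset_tsupport _ hx, aff_inv X hs x⟩
  -- uniform closeness
  obtain ⟨R, hR⟩ := isBounded_iff_forall_norm_le.1 hOb
  have hdiff : Tendsto (fun n => ∫ x in O, (v n x a * g (T n x) - v n x a * g (T0 x))) atTop (𝓝 0) := by
    have huc := hgc.uniformContinuous_of_continuous hg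
    have hri : Tendsto (fun n => (r n)⁻¹) atTop (𝓝 s⁻¹) := hrs.inv₀ hs.ne'
    have he : Tendsto (fun n => ‖(r n)⁻¹ • Xn n - s⁻¹ • X‖ + |(r n)⁻¹ - s⁻¹| * |R|) atTop (𝓝 0) := by
      have e1 : Tendsto (fun n => ‖(r n)⁻¹ • Xn n - s⁻¹ • X‖) atTop (𝓝 ‖s⁻¹ • X - s⁻¹ • X‖) :=
        ((hri.smul hX).sub tendsto_const_nhds).norm
      have e2 : Tendsto (fun n => |(r n)⁻¹ - s⁻¹| * |R|) atTop (𝓝 (|s⁻¹ - s⁻¹| * |R|)) :=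
        ((hri.sub tendsto_const_nhds).abs).mul_const _
      have := e1.add e2
      simpa using this
    have hB0 : 0 ≤ volume.real O + B := by
      have h1 : 0 ≤ ∫ x in O, ‖v 0 x‖ ^ p := integral_nonneg fun x => by positivity
      have h2 : 0 ≤ volume.real O := measureReal_nonneg
      linarith [hB 0]
    rw [Metric.tendsto_atTop]
    intro η hη
    set η' := η / (volume.real O + B + 1) with hη'
    have hη'0 : 0 < η' := by positivity
    obtain ⟨δ, hδ, hδg⟩ := Metric.uniformContinuous_iff.1 huc η' hη'0
    obtain ⟨n0, hn0⟩ := (Metric.tendsto_atTop.1 he) δ hδ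
    refine ⟨n0, fun n hn => ?_⟩
    have hclose : ∀ x ∈ O, |g (T n x) - g (T0 x)| ≤ η' := fun x hx => by
      refine le_of_lt (hδg ?_)
      have h1 := hn0 n hn
      rw [Real.dist_0_eq_abs, abs_of_nonneg (by positivity)] at h1
      refine lt_of_le_of_lt ?_ h1
      rw [dist_eq_norm]
      have : T n x - T0 x = -((r n)⁻¹ • Xn n - s⁻¹ • X) + ((r n)⁻¹ - s⁻¹) • x := by
        simp only [hT, hT0, aff, sub_smul]; abel
      rw [this]
      refine (norm_add_le _ _).trans ?_
      rw [norm_neg, norm_smul, Real.norm_eq_abs]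
      have h3 : ‖x‖ ≤ |R| := (hR x hx).trans (le_abs_self R)
      gcongr
    rw [dist_zero_right]
    have hle : ‖∫ x in O, (v n x a * g (T n x) - v n x a * g (T0 x))‖ ≤
        ∫ x in O, η' * (1 + ‖v n x‖ ^ p) := by
      refine norm_integral_le_of_norm_le ((ir n).const_mul η') ?_
      refine (ae_restrict_iff' hOm).2 (ae_of_all _ fun x hx => ?_)
      rw [← mul_sub, norm_mul, mul_comm]
      exact mul_le_mul (hclose x hx) (abs_le_one_add_rpow hp _ a) (norm_nonneg _) hη'0.le
    have e3 : ∫ x in O, (1 + ‖v n x‖ ^ p) = volume.real O + ∫ x in O, ‖v n x‖ ^ p := by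
      have hc : IntegrableOn (fun _ : Rd d => (1 : ℝ)) O := integrableOn_const hOf
      rw [integral_add hc (MemLpOn.integrable_rpow hp (hv n)), setIntegral_const]
      simp
    rw [integral_const_mul, e3] at hle
    calc _ ≤ η' * (volume.real O + ∫ x in O, ‖v n x‖ ^ p) := hle
      _ ≤ η' * (volume.real O + B) := by gcongr; exact hB n
      _ < η' * (volume.real O + B + 1) := by nlinarith
      _ = η := by rw [hη']; field_simp
  have hsum := hdiff.add hlim
  have hrd : Tendsto (fun n => ((r n) ^ d)⁻¹) atTop (𝓝 (s ^ d)⁻¹) := (hrs.pow d).inv₀ (by positivity)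
  have := hrd.mul hsum
  rw [add_zero, mul_zero] at this
  refine this.congr fun n => ?_
  rw [integral_sub (i1 n) (i2 n), sub_add_cancel, hcv n, ← mul_assoc,
    inv_mul_cancel₀ (pow_ne_zero d (hr n).ne'), one_mul]

lemma aff_Q_mem (hs : 0 < s) :
    x ∈ aff X s '' Qcube d ↔ ∀ i, X i < x i ∧ x i < X i + s := by
  constructor
  · rintro ⟨y, hy, rfl⟩ i
    have := hy i
    simp only [aff, Pi.add_apply, Pi.smul_apply, smul_eq_mul]
    constructor <;> nlinarith [this.1, this.2]
  · intro h
    refine ⟨aff (-(s⁻¹ • X)) s⁻¹ x, fun i => ?_, aff_inv X hs x⟩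
    have := h i
    simp only [aff, Pi.add_apply, Pi.smul_apply, Pi.neg_apply, smul_eq_mul]
    have e : -(s⁻¹ * X i) + s⁻¹ * x i = (x i - X i) / s := by field_simp; ring
    rw [e]
    exact ⟨by apply div_pos <;> linarith, by rw [div_lt_one hs]; linarith⟩

lemma cube_liminf (hp : 1 < p)
    (hA : ConstantRank A) (hD : IsOpen D0)
    (hf : GF p C f1) (hs : 0 < s)
    {v : ℕ → Rd d → Vec N} (hv : ∀ n, MemLpOn p (aff X s '' Qcube d) (v n))
    (hfree : ∀ n, AFreeOn A (aff X s '' Qcube d) (v n))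
    (hB : ∀ n, ∫ x in aff X s '' Qcube d, ‖v n x‖ ^ p ≤ B)
    (hw : ∀ (a : Fin N) (g : Rd d → ℝ), Continuous g → HasCompactSupport g →
    tsupport g ⊆ aff X s '' Qcube d →
    Tendsto (fun n => ∫ x in aff X s '' Qcube d, v n x a * g x) atTop (𝓝 0))
    {ε : ℕ → ℝ} (hε : ∀ n, 0 < ε n) (hε4 : ∀ n, 4 * ε n ≤ s) (hε0 : Tendsto ε atTop (𝓝 0))
    (ξ : Vec N) {η : ℝ} (hη : 0 < η) :
    ∀ᶠ n in atTop, s ^ d * fhom p A D0 f1 ξ - η ≤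
      ∫ x in (aff X s '' Qcube d) ∩ Sper D0 (ε n), f1 ((ε n)⁻¹ • x) (ξ + v n x) := by
  set O := aff X s '' Qcube d with hO
  have hC := hf.one_le
  have hOm : MeasurableSet O := aff_measurableSet X hs (measurableSet_Qcube d)
  have hOf : volume O ≠ ⊤ := (aff_bounded X s).measure_lt_top.ne
  set k : ℕ → ℕ := fun n => ⌊s / ε n⌋₊ - 1 with hk
  set z : ℕ → Fin d → ℤ := fun n i => ⌈X i / ε n⌉ with hz
  set Xn : ℕ → Rd d := fun n => ε n • zr (z n) with hXn
  set r : ℕ → ℝ := fun n => ε n * k n with hr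
  have hfl : ∀ n, 4 ≤ ⌊s / ε n⌋₊ := fun n => by
    rw [Nat.le_floor_iff (by have := hε n; positivity), le_div_iff₀ (hε n)]
    exact_mod_cast hε4 n
  have hkc : ∀ n, (k n : ℝ) = (⌊s / ε n⌋₊ : ℝ) - 1 := fun n => by
    simp only [hk]
    rw [Nat.cast_sub (by have := hfl n; omega)]; simp
  have hkb : ∀ n, s - 2 * ε n ≤ r n ∧ r n ≤ s - ε n := fun n => by
    have h1 := Nat.floor_le (show 0 ≤ s / ε n by have := hε n; positivity)
    have h2 := Nat.lt_floor_add_one (s / ε n)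
    rw [le_div_iff₀ (hε n)] at h1
    rw [div_lt_iff₀ (hε n)] at h2
    simp only [hr, hkc]
    constructor <;> nlinarith
  have hr0 : ∀ n, 0 < r n := fun n => by have := (hkb n).1; have := hε4 n; have := hε n; linarith
  have hXb : ∀ n i, X i ≤ Xn n i ∧ Xn n i ≤ X i + ε n := fun n i => by
    have h1 := Int.le_ceil (X i / ε n)
    have h2 := Int.ceil_lt_add_one (X i / ε n)
    rw [div_le_iff₀ (hε n)] at h1
    have h3 : (⌈X i / ε n⌉ : ℝ) * ε n ≤ X i + ε n := by
      have := mul_lt_mul_of_pos_right h2 (hε n)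
      rw [add_mul, div_mul_cancel₀ _ (hε n).ne'] at this
      linarith
    simp only [hXn, Pi.smul_apply, smul_eq_mul, zr, hz]
    constructor <;> linarith
  have hrs : Tendsto r atTop (𝓝 s) := by
    refine tendsto_of_tendsto_of_tendsto_of_le_of_le (g := fun n => s - 2 * ε n) (h := fun n => s - ε n)
      ?_ ?_ (fun n => (hkb n).1) (fun n => (hkb n).2)
    · simpa using tendsto_const_nhds.sub (hε0.const_mul 2)
    · simpa using tendsto_const_nhds.sub hε0
  have hXt : Tendsto Xn atTop (𝓝 X) := by
    rw [tendsto_pi_nhds]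
    intro i
    refine tendsto_of_tendsto_of_tendsto_of_le_of_le (g := fun n => X i) (h := fun n => X i + ε n)
      tendsto_const_nhds ?_ (fun n => (hXb n i).1) (fun n => (hXb n i).2)
    simpa using tendsto_const_nhds.add hε0
  have hsub : ∀ n, aff (Xn n) (r n) '' Qcube d ⊆ O := fun n x hx => by
    rw [aff_Q_mem (hr0 n)] at hx
    rw [hO, aff_Q_mem hs]
    intro i
    have h1 := hx i
    have h2 := hXb n i
    have h3 := hkb n
    constructor <;> linarith
  have hkt : Tendsto k atTop atTop := by
    have h1 : Tendsto (fun n => s / ε n - 2) atTop atTop := by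
      refine tendsto_atTop_add_const_right _ _ ?_
      simp only [div_eq_mul_inv]
      refine Tendsto.const_mul_atTop hs ?_
      exact (tendsto_inv_nhdsGT_zero).comp (tendsto_nhdsWithin_iff.2 ⟨hε0, Eventually.of_forall hε⟩)
    rw [← tendsto_natCast_atTop_iff (R := ℝ)]
    refine tendsto_atTop_mono (fun n => ?_) h1
    have h2 := Nat.lt_floor_add_one (s / ε n)
    rw [hkc]; linarith
  set V : ℕ → Rd d → Vec N := fun n y => v n (aff (Xn n) (r n) y) with hV
  have mV : ∀ n, MemLpOn p (Qcube d) (V n) := fun n => aff_memLp (Xn n) (hr0 n) (MemLpOn.mono (hv n) (hsub n))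
  have fV : ∀ n, AFreeOn A (Qcube d) (V n) := fun n => AFreeOn.aff (hr0 n) ((hfree n).mono hOm (hsub n))
  have hBn : ∀ n, ∫ y in Qcube d, ‖V n y‖ ^ p ≤ ((s / 2) ^ d)⁻¹ * B := fun n => by
    have h1 := aff_integral (Xn n) (hr0 n) (Qcube d) (fun x => ‖v n x‖ ^ p)
    rw [smul_eq_mul] at h1
    have h2 : ∫ x in aff (Xn n) (r n) '' Qcube d, ‖v n x‖ ^ p ≤ ∫ x in O, ‖v n x‖ ^ p :=
      setIntegral_mono_set (MemLpOn.integrable_rpow hp (hv n)) (ae_of_all _ fun x => by positivity)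
        (LE.le.eventuallyLE (hsub n))
    have h3 : (s / 2) ^ d ≤ (r n) ^ d := by
      refine pow_le_pow_left₀ (by positivity) ?_ d
      have := (hkb n).1; have := hε4 n; linarith
    have h4 : 0 ≤ ∫ y in Qcube d, ‖V n y‖ ^ p := integral_nonneg fun x => by positivity
    have h5 : (s / 2) ^ d * ∫ y in Qcube d, ‖V n y‖ ^ p ≤ B := by
      calc _ ≤ (r n) ^ d * ∫ y in Qcube d, ‖V n y‖ ^ p := by gcongr
        _ ≤ B := by rw [← h1]; exact h2.trans (hB n)
    rw [← div_eq_inv_mul, le_div_iff₀ (by positivity)]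
    linarith
  have hVw : ∀ (a : Fin N) (g : Rd d → ℝ), Continuous g → HasCompactSupport g →
      tsupport g ⊆ Qcube d → Tendsto (fun n => ∫ x in Qcube d, V n x a * g x) atTop (𝓝 0) :=
    fun a g h1 h2 h3 => weak_rescale hp hs hv hB a (hw a) hr0 hXt hrs hsub h1 h2 h3
  have hsl := slice (D0 := D0) hp hA hf mV fV hBn hVw k ξ (η := η / (4 * s ^ d)) (by positivity)
  have hcm := hkt.eventually (eventually_cmin_gt (D0 := D0) hp A hf ξ (η := η / (4 * s ^ d)) (by positivity))
  -- energy identity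
  have hen : ∀ n, (r n) ^ d * (∫ y in Dk D0 (k n), f1 ((k n : ℝ) • y) (ξ + V n y))
      - C * (s ^ d - (r n) ^ d) ≤
      ∫ x in O ∩ Sper D0 (ε n), f1 ((ε n)⁻¹ • x) (ξ + v n x) := by
    intro n
    have hS := Sper_meas (d := d) hD (ε n)
    set O' := aff (Xn n) (r n) '' Qcube d with hO'
    have hO'm : MeasurableSet O' := aff_measurableSet _ (hr0 n) (measurableSet_Qcube d)
    have key : ∀ y, (ε n)⁻¹ • aff (Xn n) (r n) y = tr (z n) ((k n : ℝ) • y) := fun y => by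
      rw [tr_eq]
      simp only [aff, hXn, hr, smul_add, smul_smul]
      rw [inv_mul_cancel₀ (hε n).ne', one_smul, ← mul_assoc, inv_mul_cancel₀ (hε n).ne', one_mul, add_comm]
    have hset : O' ∩ Sper D0 (ε n) = aff (Xn n) (r n) '' Dk D0 (k n) := by
      ext x
      constructor
      · rintro ⟨⟨y, hy, rfl⟩, hx⟩
        refine ⟨y, ⟨hy, ?_⟩, rfl⟩
        have hx' : (ε n)⁻¹ • aff (Xn n) (r n) y ∈ D1per D0 := hx
        rw [key, mem_D1per_tr] at hx'
        exact hx'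
      · rintro ⟨y, ⟨hy, hy2⟩, rfl⟩
        refine ⟨⟨y, hy, rfl⟩, ?_⟩
        show (ε n)⁻¹ • aff (Xn n) (r n) y ∈ D1per D0
        rw [key, mem_D1per_tr]
        exact hy2
    have h1 : ∫ x in O' ∩ Sper D0 (ε n), f1 ((ε n)⁻¹ • x) (ξ + v n x) =
        (r n) ^ d * ∫ y in Dk D0 (k n), f1 ((k n : ℝ) • y) (ξ + V n y) := by
      rw [hset, aff_integral _ (hr0 n), smul_eq_mul]
      simp only [key, hf.per]
      rfl
    have iO : IntegrableOn (fun x => f1 ((ε n)⁻¹ • x) (ξ + v n x)) O :=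
      hf.integrable hp hOf (MemLp.add (memLpOn_const hOf ξ) (hv n)) (measurable_const_smul _)
    have iC : IntegrableOn (fun x => f1 ((ε n)⁻¹ • x) (ξ + v n x) + C) O := iO.add (integrableOn_const hOf)
    have h2 : ∫ x in O' ∩ Sper D0 (ε n), (f1 ((ε n)⁻¹ • x) (ξ + v n x) + C) ≤
        ∫ x in O ∩ Sper D0 (ε n), (f1 ((ε n)⁻¹ • x) (ξ + v n x) + C) := by
      refine setIntegral_mono_set (iC.mono_set inter_subset_left) (ae_of_all _ fun x => ?_)
        (LE.le.eventuallyLE (inter_subset_inter_left _ (hsub n)))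
      have := hf.lower ((ε n)⁻¹ • x) (ξ + v n x)
      simp only [Pi.zero_apply]; linarith
    have hcO : IntegrableOn (fun _ : Rd d => C) O := integrableOn_const hOf
    have sO' : O' ∩ Sper D0 (ε n) ⊆ O := inter_subset_left.trans (hsub n)
    rw [integral_add (iO.mono_set sO') (hcO.mono_set sO'),
      integral_add (iO.mono_set inter_subset_left) (hcO.mono_set inter_subset_left), h1,
      setIntegral_const, setIntegral_const, smul_eq_mul, smul_eq_mul] at h2
    have h3 : volume.real (O ∩ Sper D0 (ε n)) - volume.real (O' ∩ Sper D0 (ε n)) ≤ s ^ d - (r n) ^ d := by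
      rw [← aff_volume X hs, ← aff_volume (Xn n) (hr0 n)]
      have e1 : volume.real (O \ O') = volume.real O - volume.real O' := measureReal_sdiff (hsub n) hO'm hOf
      have e2 : volume.real (O ∩ Sper D0 (ε n)) ≤ volume.real (O' ∩ Sper D0 (ε n)) + volume.real (O \ O') := by
        refine (measureReal_mono (fun x hx => ?_) ?_).trans (measureReal_union_le _ _)
        · by_cases hxo : x ∈ O'
          · exact Or.inl ⟨hxo, hx.2⟩
          · exact Or.inr ⟨hx.1, hxo⟩
        · exact ne_top_of_le_ne_top hOf (measure_mono (union_subset sO' sdiff_subset))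
      linarith
    nlinarith
  -- conclusion
  have hfin : Tendsto (fun n => (r n) ^ d * (fhom p A D0 f1 ξ - η / (2 * s ^ d)) - C * (s ^ d - (r n) ^ d))
      atTop (𝓝 (s ^ d * (fhom p A D0 f1 ξ - η / (2 * s ^ d)) - C * (s ^ d - s ^ d))) :=
    ((hrs.pow d).mul_const _).sub ((tendsto_const_nhds.sub (hrs.pow d)).const_mul C)
  have hval : s ^ d * (fhom p A D0 f1 ξ - η / (2 * s ^ d)) - C * (s ^ d - s ^ d) =
      s ^ d * fhom p A D0 f1 ξ - η / 2 := by
    have : (0 : ℝ) < s ^ d := by positivity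
    field_simp; ring
  rw [hval] at hfin
  have hev := hfin.eventually (Ioi_mem_nhds (show s ^ d * fhom p A D0 f1 ξ - η <
    s ^ d * fhom p A D0 f1 ξ - η / 2 by linarith))
  filter_upwards [hsl, hcm, hev] with n h1 h2 h3
  refine (le_of_lt h3).trans (le_trans ?_ (hen n))
  have h4 : fhom p A D0 f1 ξ - η / (2 * s ^ d) ≤
      ∫ y in Dk D0 (k n), f1 ((k n : ℝ) • y) (ξ + V n y) := by
    have e : η / (2 * s ^ d) = η / (4 * s ^ d) + η / (4 * s ^ d) := by
      have : (0 : ℝ) < s ^ d := by positivity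
      field_simp; norm_num
    linarith
  have h5 : 0 ≤ (r n) ^ d := by have := hr0 n; positivity
  have := mul_le_mul_of_nonneg_left h4 h5
  linarith

/-! ### Part 6e: weak convergence tools -/

lemma conj_hc (hp : 1 < p) : p.HolderConjugate (conjExp p) :=
  (Real.holderConjugate_iff_eq_conjExponent hp).2 rfl

lemma one_lt_conj (hp : 1 < p) : 1 < conjExp p := (conj_hc hp).symm.lt

lemma bdd_of_weak_scalar {α : Type*} [MeasurableSpace α] {μ : Measure α} (hp : 1 < p)
    {f : ℕ → α → ℝ} (hf : ∀ n, MemLp (f n) (ENNReal.ofReal p) μ)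
    (h : ∀ g, MemLp g (ENNReal.ofReal (conjExp p)) μ → ∃ K, ∀ n, |∫ x, f n x * g x ∂μ| ≤ K) :
    ∃ B, ∀ n, ∫ x, |f n x| ^ p ∂μ ≤ B := by
  have hc := conj_hc hp
  set q := conjExp p with hq
  have hq1 : 1 < q := one_lt_conj hp
  have hfp : Fact (1 ≤ ENNReal.ofReal p) := ⟨by simpa using hp.le⟩
  have hfq : Fact (1 ≤ ENNReal.ofReal q) := ⟨by simpa using hq1.le⟩
  have hcE : ENNReal.HolderConjugate (ENNReal.ofReal p) (ENNReal.ofReal q) := hc.ennrealOfReal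
  set T : ℕ → (Lp ℝ (ENNReal.ofReal q) μ →L[ℝ] ℝ) := fun n =>
    (ContinuousLinearMap.mul ℝ ℝ).lpPairing μ (ENNReal.ofReal p) (ENNReal.ofReal q) ((hf n).toLp (f n))
  have hT : ∀ n (g : α → ℝ) (hg : MemLp g (ENNReal.ofReal q) μ), T n (hg.toLp g) = ∫ x, f n x * g x ∂μ := by
    intro n g hg
    simp only [T]
    rw [ContinuousLinearMap.lpPairing_eq_integral]
    refine integral_congr_ae ?_
    filter_upwards [(hf n).coeFn_toLp, hg.coeFn_toLp] with x h1 h2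
    simp [h1, h2]
  obtain ⟨K, hK⟩ : ∃ K, ∀ n, ‖T n‖ ≤ K := by
    refine banach_steinhaus fun g => ?_
    obtain ⟨K, hK⟩ := h g (Lp.memLp g)
    refine ⟨K, fun n => ?_⟩
    have := hT n g (Lp.memLp g)
    rw [Lp.toLp_coeFn] at this
    rw [this]
    exact hK n
  refine ⟨|K| ^ p, fun n => ?_⟩
  set g : α → ℝ := fun x => SignType.sign (f n x) * |f n x| ^ (p - 1) with hgdef
  have hgabs : ∀ x, |g x| ^ q = |f n x| ^ p := fun x => by
    have e : (p - 1) * q = p := by rw [hq, conjExp]; field_simp [show p - 1 ≠ 0 by linarith]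
    rcases eq_or_ne (f n x) 0 with h0 | h0
    · simp [hgdef, h0, Real.zero_rpow (by linarith : p ≠ 0), Real.zero_rpow (by linarith : q ≠ 0)]
    · have hs : |((SignType.sign (f n x) : SignType) : ℝ)| = 1 := by
        rcases lt_or_gt_of_ne h0 with h | h
        · simp [sign_neg h]
        · simp [sign_pos h]
      rw [hgdef]
      simp only [abs_mul, hs, one_mul]
      rw [abs_of_nonneg (by positivity), ← Real.rpow_mul (abs_nonneg _), e]
  have hgm : AEStronglyMeasurable g μ := by
    have h1 := (hf n).1.aemeasurable
    have h2 : Measurable (fun t : ℝ => ((SignType.sign t : SignType) : ℝ) * |t| ^ (p - 1)) := by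
      refine Measurable.mul ?_ (by fun_prop)
      have h3 : (fun t : ℝ => ((SignType.sign t : SignType) : ℝ)) =
          fun t => if t ∈ Ioi (0:ℝ) then 1 else if t ∈ Iio (0:ℝ) then -1 else 0 := by
        funext t
        rcases lt_trichotomy t 0 with h | h | h
        · simp [sign_neg h, h, not_lt.2 h.le]
        · simp [h]
        · simp [sign_pos h, h]
      rw [h3]
      exact Measurable.ite measurableSet_Ioi measurable_const
        (Measurable.ite measurableSet_Iio measurable_const measurable_const)
    exact (h2.comp_aemeasurable h1).aestronglyMeasurable
  have hfi : Integrable (fun x => |f n x| ^ p) μ := by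
    have := (hf n).integrable_norm_rpow (by simp; linarith) ENNReal.ofReal_ne_top
    rwa [ENNReal.toReal_ofReal (by linarith)] at this
  have hg : MemLp g (ENNReal.ofReal q) μ := by
    rw [← integrable_norm_rpow_iff hgm (by simp; linarith) ENNReal.ofReal_ne_top,
      ENNReal.toReal_ofReal (by linarith)]
    exact hfi.congr (ae_of_all _ fun x => (hgabs x).symm)
  have hfg : ∫ x, f n x * g x ∂μ = ∫ x, |f n x| ^ p ∂μ := by
    refine integral_congr_ae (ae_of_all _ fun x => ?_)
    show f n x * (((SignType.sign (f n x) : SignType) : ℝ) * |f n x| ^ (p - 1)) = _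
    rw [← mul_assoc, mul_comm (f n x) _, sign_mul_self]
    rcases eq_or_ne (f n x) 0 with h0 | h0
    · simp [h0, Real.zero_rpow (by linarith : p ≠ 0)]
    · have h1 : 0 < |f n x| := abs_pos.2 h0
      calc |f n x| * |f n x| ^ (p - 1) = |f n x| ^ (1 : ℝ) * |f n x| ^ (p - 1) := by rw [Real.rpow_one]
        _ = _ := by rw [← Real.rpow_add h1]; congr 1; ring
  set I := ∫ x, |f n x| ^ p ∂μ with hI
  have hI0 : 0 ≤ I := integral_nonneg fun x => by positivity
  have hnorm : ‖hg.toLp g‖ = I ^ (1 / q) := by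
    rw [Lp.norm_toLp, hg.eLpNorm_eq_integral_rpow_norm (by simp; linarith) ENNReal.ofReal_ne_top,
      ENNReal.toReal_ofReal (by linarith : 0 ≤ q), ENNReal.toReal_ofReal (by positivity), one_div]
    congr 1
    exact integral_congr_ae (ae_of_all _ fun x => hgabs x)
  have hmain : I ≤ |K| * I ^ (1 / q) := by
    have h1 := (T n).le_opNorm (hg.toLp g)
    rw [hT, hfg, hnorm, Real.norm_of_nonneg hI0] at h1
    refine h1.trans (mul_le_mul_of_nonneg_right ((hK n).trans (le_abs_self K)) (by positivity))
  rcases hI0.eq_or_lt with h0 | h0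
  · rw [← h0]; positivity
  · have h1 : I ^ (1 / p) * I ^ (1 / q) = I := by
      rw [← Real.rpow_add h0]
      have := hc.inv_add_inv_eq_one
      rw [one_div, one_div, this, Real.rpow_one]
    have h2 : 0 < I ^ (1 / q) := by positivity
    have h3 : I ^ (1 / p) ≤ |K| := by
      by_contra hcon
      push Not at hcon
      have := mul_lt_mul_of_pos_right hcon h2
      linarith
    calc I = (I ^ (1 / p)) ^ p := by
            rw [← Real.rpow_mul h0.le, one_div, inv_mul_cancel₀ (by linarith), Real.rpow_one]
      _ ≤ |K| ^ p := Real.rpow_le_rpow (by positivity) h3 (by linarith)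

lemma norm_rpow_le_sum (hp : 1 < p) (v : Vec N) : ‖v‖ ^ p ≤ ∑ a, |v a| ^ p := by
  rcases isEmpty_or_nonempty (Fin N) with hN | hN
  · have : v = 0 := Subsingleton.elim _ _
    simp [this, Real.zero_rpow (by linarith : p ≠ 0)]
  · obtain ⟨a, ha⟩ := Finite.exists_max (fun a => ‖v a‖)
    have h1 : ‖v‖ ≤ ‖v a‖ := (pi_norm_le_iff_of_nonneg (norm_nonneg _)).2 ha
    calc ‖v‖ ^ p ≤ |v a| ^ p := Real.rpow_le_rpow (norm_nonneg _) h1 (by linarith)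
      _ ≤ _ := Finset.single_le_sum (f := fun a => |v a| ^ p) (fun i _ => by positivity) (Finset.mem_univ a)

lemma dot_single (v : Vec N) (a : Fin N) (t : ℝ) : dot v (Pi.single a t) = v a * t := by
  unfold dot
  rw [Finset.sum_eq_single a]
  · simp
  · intro b _ hb; simp [hb]
  · simp

lemma memLp_single {q : ℝ}
    (hg : MemLp g (ENNReal.ofReal q) (volume.restrict O)) (a : Fin N) :
    MemLpOn q O (fun x => (Pi.single a (g x) : Vec N)) := by
  refine MemLp.of_le hg ?_ (ae_of_all _ fun x => ?_)
  · have hcont : Continuous (fun t : ℝ => (Pi.single a t : Vec N)) := by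
      refine continuous_pi fun b => ?_
      rcases eq_or_ne b a with rfl | hb
      · simp only [Pi.single_eq_same]; exact continuous_id
      · simpa [hb] using continuous_const
    exact hcont.comp_aestronglyMeasurable hg.1
  · rw [Pi.norm_single]

lemma bdd_of_weak (hp : 1 < p) {u : ℕ → Rd d → Vec N}
    (hu : ∀ n, MemLpOn p O (u n)) (hw : WeakLpTendsto p O atTop u v) :
    ∃ B, ∀ n, ∫ x in O, ‖u n x‖ ^ p ≤ B := by
  have h1 : ∀ a : Fin N, ∃ B, ∀ n, ∫ x in O, |u n x a| ^ p ≤ B := fun a => by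
    refine bdd_of_weak_scalar hp (f := fun n x => u n x a) (fun n => (hu n).comp a) fun g hg => ?_
    have h2 := hw _ (memLp_single hg a)
    simp only [dot_single] at h2
    obtain ⟨K, hK⟩ := h2.norm.bddAbove_range
    exact ⟨K, fun n => hK ⟨n, rfl⟩⟩
  choose B hB using h1
  refine ⟨∑ a, B a, fun n => ?_⟩
  have hi : ∀ a : Fin N, IntegrableOn (fun x => |u n x a| ^ p) O := fun a => by
    have := ((hu n).comp a).integrable_norm_rpow (by simp; linarith) ENNReal.ofReal_ne_top
    rwa [ENNReal.toReal_ofReal (by linarith)] at this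
  calc ∫ x in O, ‖u n x‖ ^ p ≤ ∫ x in O, ∑ a, |u n x a| ^ p :=
        integral_mono (MemLpOn.integrable_rpow hp (hu n)) (integrable_finsetSum _ fun a _ => hi a)
          fun x => norm_rpow_le_sum hp _
    _ = ∑ a, ∫ x in O, |u n x a| ^ p := integral_finsetSum _ fun a _ => hi a
    _ ≤ _ := Finset.sum_le_sum fun a _ => hB a n

lemma memLp_cc {q : ℝ} (hg : Continuous g)
    (hc : HasCompactSupport g) : MemLp g (ENNReal.ofReal q) (volume.restrict O) :=
  (hg.memLp_of_hasCompactSupport hc).restrict O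

lemma weak_test_cc {ι : Type*} {l : Filter ι}
    {u : ι → Rd d → Vec N} (hw : WeakLpTendsto p O l u v) (a : Fin N)
    (hg : Continuous g) (hc : HasCompactSupport g) :
    Tendsto (fun n => ∫ x in O, u n x a * g x) l (𝓝 (∫ x in O, v x a * g x)) := by
  have := hw _ (memLp_single (memLp_cc hg hc) a)
  simpa only [dot_single] using this

lemma weak_afree {ι : Type*}
    {l : Filter ι} [l.NeBot] {u : ι → Rd d → Vec N}
    (hw : WeakLpTendsto p O l u v) (hfree : ∀ n, AFreeOn A O (u n)) : AFreeOn A O v := by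
  rintro ψ ⟨h1, h2, h3⟩
  have hm : MemLpOn (conjExp p) O (adjApply A ψ) := by
    refine MemLp.of_eval fun n => ?_
    have hc : Continuous (fun x => adjApply A ψ x n) := by
      have := adjApply_smooth A h1
      exact (continuous_pi_iff.1 this.continuous n)
    exact memLp_cc hc (adj_cs A h2 n)
  have h4 := hw _ hm
  refine tendsto_nhds_unique h4 ?_
  simp only [hfree _ ψ ⟨h1, h2, h3⟩]
  exact tendsto_const_nhds

/-! ### Part 6f: the liminf inequality -/

lemma cell_real (hs : 0 < s) (z : Fin d → ℤ) : volume.real (cell s z (Qcube d)) = s ^ d := by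
  rw [cell_eq]; exact aff_volume _ hs

lemma cell_ne_top (s : ℝ) (z : Fin d → ℤ) : volume (cell s z (Qcube d)) ≠ ⊤ := by
  rw [cell_eq]; exact (aff_bounded _ s).measure_lt_top.ne

lemma fhom_mod1 (hp : 1 < p) (A : DiffOp d N M)
    (hf : GF p C f1)
    {η : ℝ} (hη : 0 < η) : ∃ D, 0 ≤ D ∧ ∀ (ξ ζ : Vec N),
      |fhom p A D0 f1 ξ - fhom p A D0 f1 ζ| ≤ η * (1 + ‖ζ‖ ^ p) + D * ‖ξ - ζ‖ ^ p := by
  have h2p : (0 : ℝ) < 2 ^ p := by positivity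
  obtain ⟨D, hD, hm⟩ := fhom_modulus (D0 := D0) hp A hf (η := η / (1 + 2 ^ p)) (by positivity)
  refine ⟨D + η, by positivity, fun ξ ζ => (hm ξ ζ).trans ?_⟩
  have h1 := norm_rpow_le_sub hp ξ ζ
  have h3 : 0 ≤ ‖ξ - ζ‖ ^ p := by positivity
  have h4 : 0 ≤ ‖ζ‖ ^ p := by positivity
  have h5 : η / (1 + 2 ^ p) * (1 + ‖ξ‖ ^ p + ‖ζ‖ ^ p) ≤
      η / (1 + 2 ^ p) * ((1 + 2 ^ p) * (1 + ‖ζ‖ ^ p + ‖ξ - ζ‖ ^ p)) := by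
    gcongr
    nlinarith
  have h6 : η / (1 + 2 ^ p) * ((1 + 2 ^ p) * (1 + ‖ζ‖ ^ p + ‖ξ - ζ‖ ^ p)) =
      η * (1 + ‖ζ‖ ^ p + ‖ξ - ζ‖ ^ p) := by field_simp
  nlinarith

lemma fhom_integrable (hp : 1 < p) (A : DiffOp d N M)
    (hf : GF p C f1) (hS : volume S ≠ ⊤)
    (hu : MemLpOn p S u) : IntegrableOn (fun x => fhom p A D0 f1 (u x)) S := by
  have h1 : IntegrableOn (fun x => C * (1 + ‖u x‖ ^ p)) S :=
    ((integrableOn_const hS).add (hu.integrable_rpow hp)).const_mul C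
  refine Integrable.mono' h1 ((fhom_continuous hp A hf).comp_aestronglyMeasurable hu.aesm)
    (.of_forall fun x => ?_)
  rw [Real.norm_eq_abs, abs_le]
  have h2 := fhom_lower (D0 := D0) hp A hf (u x)
  have h3 := fhom_upper (D0 := D0) hp A hf (u x)
  have h4 : 0 ≤ ‖u x‖ ^ p := by positivity
  have := hf.one_le
  exact ⟨by nlinarith, h3⟩

lemma hat_sum (hb : IsBounded Ω) (hs : 0 < s)
    (hi : IntegrableOn h Ω) :
    ∫ x in hatOmega s Ω, h x = ∑ z ∈ cidx Ω s, ∫ x in cell s z (Qcube d), h x := by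
  have := hat_integral hb hs MeasurableSet.univ (h := h) (by simpa using hi)
  simpa using this

lemma sum_cells_le (hb : IsBounded Ω) (hs : 0 < s)
    (hi : IntegrableOn h Ω) (h0 : ∀ x, 0 ≤ h x) :
    ∑ z ∈ cidx Ω s, ∫ x in cell s z (Qcube d), h x ≤ ∫ x in Ω, h x := by
  rw [← hat_sum hb hs hi]
  exact setIntegral_mono_set hi (.of_forall h0) (hat_subset s Ω).eventuallyLE

lemma step_approx2 (hp : 1 < p) (A : DiffOp d N M)
    (hf : GF p C f1) (hΩ : IsOpen Ω)
    (hb : IsBounded Ω) (hu : MemLpOn p Ω u) {η : ℝ} (hη : 0 < η) :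
    ∃ s : ℝ, 0 < s ∧ s < η ∧ ∃ ξ : (Fin d → ℤ) → Vec N,
      ∑ z ∈ cidx Ω s, ∫ x in cell s z (Qcube d), ‖u x - ξ z‖ ^ p ≤ η ∧
      ∫ x in Ω \ hatOmega s Ω, (1 + ‖u x‖ ^ p) ≤ η ∧
      |(∫ x in Ω, fhom p A D0 f1 (u x)) - ∑ z ∈ cidx Ω s, s ^ d * fhom p A D0 f1 (ξ z)| ≤ η := by
  have hvol : volume Ω ≠ ⊤ := hb.measure_lt_top.ne
  have hC := hf.one_le
  have hi1 : IntegrableOn (fun x => 1 + ‖u x‖ ^ p) Ω :=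
    (integrableOn_const hvol).add (hu.integrable_rpow hp)
  set K := ∫ x in Ω, (1 + ‖u x‖ ^ p) with hK
  have hK0 : 0 ≤ K := integral_nonneg fun x => by positivity
  obtain ⟨D, hD0, hD⟩ := fhom_mod1 (D0 := D0) hp A hf (η := η / (3 * (K + 1))) (by positivity)
  set η2 := min η (min (η / (3 * (D + 1))) (η / (3 * C))) with hη2
  have hη2p : 0 < η2 := by simp only [hη2, lt_min_iff]; exact ⟨hη, by positivity, by positivity⟩
  obtain ⟨s, hs, hsη, ξ, h1, h2⟩ := step_approx hp hΩ hb hu hη2p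
  have l1 : η2 ≤ η := min_le_left _ _
  have l2 : D * η2 ≤ η / 3 := by
    have : η2 ≤ η / (3 * (D + 1)) := (min_le_right _ _).trans (min_le_left _ _)
    rw [le_div_iff₀ (by positivity)] at this
    nlinarith
  have l3 : C * η2 ≤ η / 3 := by
    have : η2 ≤ η / (3 * C) := (min_le_right _ _).trans (min_le_right _ _)
    rw [le_div_iff₀ (by positivity)] at this
    nlinarith
  refine ⟨s, hs, hsη.trans_le l1, ξ, h1.trans l1, h2.trans l1, ?_⟩
  have hif := fhom_integrable (D0 := D0) hp A hf hvol hu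
  have hhm := (isOpen_hat hs Ω).measurableSet
  have e1 : ∫ x in Ω, fhom p A D0 f1 (u x) = (∫ x in Ω \ hatOmega s Ω, fhom p A D0 f1 (u x)) +
      ∑ z ∈ cidx Ω s, ∫ x in cell s z (Qcube d), fhom p A D0 f1 (u x) := by
    rw [← hat_sum hb hs hif, add_comm, ← setIntegral_union (disjoint_sdiff_right)
      (hΩ.measurableSet.diff hhm) (hif.mono_set (hat_subset s Ω)) (hif.mono_set sdiff_subset),
      union_sdiff_cancel (hat_subset s Ω)]
  have b1 : |∫ x in Ω \ hatOmega s Ω, fhom p A D0 f1 (u x)| ≤ C * η2 := by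
    rw [← Real.norm_eq_abs]
    have : ‖∫ x in Ω \ hatOmega s Ω, fhom p A D0 f1 (u x)‖ ≤
        ∫ x in Ω \ hatOmega s Ω, C * (1 + ‖u x‖ ^ p) := by
      refine norm_integral_le_of_norm_le ((hi1.mono_set sdiff_subset).const_mul C) (ae_of_all _ fun x => ?_)
      have h2 := fhom_lower (D0 := D0) hp A hf (u x)
      have h3 := fhom_upper (D0 := D0) hp A hf (u x)
      have h4 : 0 ≤ ‖u x‖ ^ p := by positivity
      rw [Real.norm_eq_abs, abs_le]
      exact ⟨by nlinarith, h3⟩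
    refine this.trans ?_
    rw [integral_const_mul]
    exact mul_le_mul_of_nonneg_left h2 (by linarith)
  have b2 : |(∑ z ∈ cidx Ω s, ∫ x in cell s z (Qcube d), fhom p A D0 f1 (u x)) -
      ∑ z ∈ cidx Ω s, s ^ d * fhom p A D0 f1 (ξ z)| ≤ η / (3 * (K + 1)) * K + D * η2 := by
    rw [← Finset.sum_sub_distrib]
    refine (Finset.abs_sum_le_sum_abs _ _).trans ?_
    have hz : ∀ z ∈ cidx Ω s, |(∫ x in cell s z (Qcube d), fhom p A D0 f1 (u x)) -
        s ^ d * fhom p A D0 f1 (ξ z)| ≤ η / (3 * (K + 1)) * (∫ x in cell s z (Qcube d), (1 + ‖u x‖ ^ p))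
          + D * ∫ x in cell s z (Qcube d), ‖u x - ξ z‖ ^ p := by
      intro z hz
      have hzΩ := (mem_cidx hb hs).1 hz
      have hzf := cell_ne_top (d := d) s z
      have i1 := hif.mono_set hzΩ
      have i2 := hi1.mono_set hzΩ
      have i3 : IntegrableOn (fun x => ‖u x - ξ z‖ ^ p) (cell s z (Qcube d)) :=
        MemLpOn.integrable_rpow hp ((hu.mono hzΩ).sub (memLpOn_const hzf (ξ z)))
      have e2 : (∫ x in cell s z (Qcube d), fhom p A D0 f1 (u x)) - s ^ d * fhom p A D0 f1 (ξ z) =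
          ∫ x in cell s z (Qcube d), (fhom p A D0 f1 (u x) - fhom p A D0 f1 (ξ z)) := by
        rw [integral_sub i1 (integrableOn_const hzf), setIntegral_const, cell_real hs, smul_eq_mul]
      rw [e2, ← integral_const_mul, ← integral_const_mul, ← integral_add (i2.const_mul _) (i3.const_mul _),
        ← Real.norm_eq_abs]
      refine norm_integral_le_of_norm_le ((i2.const_mul _).add (i3.const_mul _)) (ae_of_all _ fun x => ?_)
      have := hD (ξ z) (u x)
      rw [Real.norm_eq_abs, abs_sub_comm, norm_sub_rev (u x)]
      exact this
    refine (Finset.sum_le_sum hz).trans ?_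
    rw [Finset.sum_add_distrib, ← Finset.mul_sum, ← Finset.mul_sum]
    refine add_le_add (mul_le_mul_of_nonneg_left ?_ (by positivity)) (mul_le_mul_of_nonneg_left h1 hD0)
    exact sum_cells_le hb hs hi1 fun x => by positivity
  have b3 : η / (3 * (K + 1)) * K ≤ η / 3 := by
    rw [div_mul_eq_mul_div, div_le_div_iff₀ (by positivity) (by positivity)]
    nlinarith
  rw [e1]
  have := abs_add_le (∫ x in Ω \ hatOmega s Ω, fhom p A D0 f1 (u x))
    ((∑ z ∈ cidx Ω s, ∫ x in cell s z (Qcube d), fhom p A D0 f1 (u x)) -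
      ∑ z ∈ cidx Ω s, s ^ d * fhom p A D0 f1 (ξ z))
  rw [← add_sub_assoc] at this
  linarith

lemma hat_eps_small (hΩ : IsOpen Ω) (hb : IsBounded Ω) :
    Tendsto (fun ε => volume.real (Ω \ hatOmega ε Ω)) (𝓝[>] (0 : ℝ)) (𝓝 0) := by
  have hvol : volume Ω ≠ ⊤ := hb.measure_lt_top.ne
  have hi : IntegrableOn (fun _ : Rd d => (1 : ℝ)) Ω := integrableOn_const hvol
  refine squeeze_zero' (.of_forall fun _ => measureReal_nonneg) ?_ (band_tendsto hΩ hi)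
  filter_upwards [self_mem_nhdsWithin] with s hs
  have := sdiff_hat_integral_le hs hi
  simpa using this

lemma liminf_seq (hp : 1 < p)
    (hA : ConstantRank A) (hD : IsOpen D0) (hDQ : D0 ⊆ Qcube d)
    (hf : GF p C f1) (hΩ : IsOpen Ω)
    (hb : IsBounded Ω) (hu : MemLpOn p Ω u) (hufree : AFreeOn A Ω u)
    {w : ℕ → Rd d → Vec N} (hwm : ∀ n, MemLpOn p Ω (w n)) (hfree : ∀ n, AFreeOn A Ω (w n))
    (hweak : WeakLpTendsto p Ω atTop w u) {ε : ℕ → ℝ} (hε : ∀ n, 0 < ε n)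
    (hε0 : Tendsto ε atTop (𝓝 0)) {η : ℝ} (hη : 0 < η) :
    ∀ᶠ n in atTop, (∫ x in Ω, fhom p A D0 f1 (u x)) - η ≤
      ∫ x in stiffPart (ε n) Ω D0, f1 ((ε n)⁻¹ • x) (w n x) := by
  have hvol : volume Ω ≠ ⊤ := hb.measure_lt_top.ne
  have hC := hf.one_le
  have hΩm := hΩ.measurableSet
  obtain ⟨B, hB⟩ := bdd_of_weak hp hwm hweak
  have hiw : ∀ n, IntegrableOn (fun x => 1 + ‖w n x‖ ^ p) Ω := fun n =>
    (integrableOn_const hvol).add ((hwm n).integrable_rpow hp)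
  set K := volume.real Ω + B with hK
  have hKw : ∀ n, ∫ x in Ω, (1 + ‖w n x‖ ^ p) ≤ K := fun n => by
    have hc1 : Integrable (fun _ : Rd d => (1 : ℝ)) (volume.restrict Ω) := integrableOn_const hvol
    rw [integral_add hc1 ((hwm n).integrable_rpow hp), setIntegral_const]
    simp only [smul_eq_mul, mul_one]
    linarith [hB n]
  have hK0 : 0 ≤ K := (integral_nonneg fun x => by positivity).trans (hKw 0)
  set κ := η / (6 * (K + 1)) with hκ
  have hκp : 0 < κ := by positivity
  obtain ⟨D, hD0, hDm⟩ := hf.mod1 hp (η := κ) hκp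
  set η2 := min (η / 6) (min (η / (6 * (D + 1))) (η / (6 * C))) with hη2
  have hη2p : 0 < η2 := by simp only [hη2, lt_min_iff]; exact ⟨by positivity, by positivity, by positivity⟩
  have l1 : η2 ≤ η / 6 := min_le_left _ _
  have l2 : D * η2 ≤ η / 6 := by
    have : η2 ≤ η / (6 * (D + 1)) := (min_le_right _ _).trans (min_le_left _ _)
    rw [le_div_iff₀ (by positivity)] at this
    nlinarith
  have l3 : C * η2 ≤ η / 6 := by
    have : η2 ≤ η / (6 * C) := (min_le_right _ _).trans (min_le_right _ _)
    rw [le_div_iff₀ (by positivity)] at this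
    nlinarith
  have l4 : κ * K ≤ η / 6 := by
    rw [hκ, div_mul_eq_mul_div, div_le_div_iff₀ (by positivity) (by positivity)]
    nlinarith
  obtain ⟨s, hs, hsη, ξ, h1, h2, h3⟩ := step_approx2 (D0 := D0) hp A hf hΩ hb hu hη2p
  set J := cidx Ω s with hJ
  set η3 := η / (6 * (J.card + 1)) with hη3
  have hη3p : 0 < η3 := by positivity
  have l5 : J.card * η3 ≤ η / 6 := by
    rw [hη3, mul_div_assoc', div_le_div_iff₀ (by positivity) (by positivity)]
    nlinarith
  -- lower bound on each cell
  have hcell : ∀ z ∈ J, ∀ᶠ n in atTop, s ^ d * fhom p A D0 f1 (ξ z) - η3 ≤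
      ∫ x in cell s z (Qcube d) ∩ Sper D0 (ε n), f1 ((ε n)⁻¹ • x) (ξ z + (w n x - u x)) := by
    intro z hz
    have hzΩ := (mem_cidx hb hs).1 hz
    have hzm := (isOpen_cell hs z).measurableSet
    have hεs : ∀ᶠ n in atTop, 4 * ε n ≤ s := by
      have : ∀ᶠ n in atTop, ε n < s / 4 := hε0.eventually_lt_const (by positivity)
      filter_upwards [this] with n hn
      linarith
    obtain ⟨n0, hn0⟩ := eventually_atTop.1 hεs
    have hadd : Tendsto (fun n => n + n0) atTop atTop := tendsto_add_atTop_nat n0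
    rw [cell_eq] at hzΩ hzm ⊢
    set O := aff (s • zr z) s '' Qcube d with hO
    have hvm : ∀ n, MemLpOn p Ω (fun x => w n x - u x) := fun n => (hwm n).sub hu
    have key := cube_liminf (X := s • zr z) (v := fun n x => w (n + n0) x - u x) hp hA hD hf hs
      (fun n => (hvm _).mono hzΩ)
      (fun n => ((hfree (n + n0)).sub hufree ((hwm _).integrable hp hvol)
        (hu.integrable hp hvol)).mono hΩm hzΩ) (B := 2 ^ p * (B + ∫ x in Ω, ‖u x‖ ^ p))
      (fun n => ?_) (fun a g hg hgc hgs => ?_) (ε := fun n => ε (n + n0)) (fun n => hε _)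
      (fun n => hn0 _ (Nat.le_add_left _ _)) (hε0.comp hadd) (ξ z) hη3p
    · have h4 := (tendsto_sub_atTop_nat n0).eventually key
      filter_upwards [h4, eventually_ge_atTop n0] with n hn hnn
      rwa [Nat.sub_add_cancel hnn] at hn
    · have i1 := (hwm (n + n0)).integrable_rpow hp
      have i2 := hu.integrable_rpow hp
      calc ∫ x in O, ‖w (n + n0) x - u x‖ ^ p ≤ ∫ x in Ω, ‖w (n + n0) x - u x‖ ^ p :=
            setIntegral_mono_set ((hvm _).integrable_rpow hp)
              (.of_forall fun x => by positivity) hzΩ.eventuallyLE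
        _ ≤ ∫ x in Ω, 2 ^ p * (‖w (n + n0) x‖ ^ p + ‖u x‖ ^ p) :=
            integral_mono ((hvm _).integrable_rpow hp) ((i1.add i2).const_mul _)
              fun x => norm_sub_rpow_le hp _ _
        _ = 2 ^ p * ((∫ x in Ω, ‖w (n + n0) x‖ ^ p) + ∫ x in Ω, ‖u x‖ ^ p) := by
            rw [integral_const_mul, integral_add i1 i2]
        _ ≤ _ := by gcongr; exact hB _
    · have h5 := (weak_test_cc hweak a hg hgc).comp hadd
      obtain ⟨Kg, hKg⟩ := hgc.exists_bound_of_continuous hg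
      have iu : IntegrableOn (fun x => u x a * g x) Ω :=
        int_bdd_mul ((hu.integrable hp hvol).eval a) hg hKg
      have iw : ∀ n, IntegrableOn (fun x => w n x a * g x) Ω := fun n =>
        int_bdd_mul (((hwm n).integrable hp hvol).eval a) hg hKg
      have e : ∀ n, ∫ x in O, (w (n + n0) x - u x) a * g x =
          (∫ x in Ω, w (n + n0) x a * g x) - ∫ x in Ω, u x a * g x := fun n => by
        rw [← integral_sub (iw _) iu]
        have : ∫ x in O, (w (n + n0) x - u x) a * g x = ∫ x in Ω, (w (n + n0) x - u x) a * g x :=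
          (setIntegral_eq_of_subset_of_forall_sdiff_eq_zero hΩm hzΩ fun x hx => by
            rw [image_eq_zero_of_notMem_tsupport fun h => hx.2 (hgs h), mul_zero]).symm
        rw [this]
        refine integral_congr_ae (ae_of_all _ fun x => ?_)
        show (w (n + n0) x a - u x a) * g x = _
        ring
      have h6 := h5.sub_const (∫ x in Ω, u x a * g x)
      rw [sub_self] at h6
      exact h6.congr fun n => (e n).symm
  have hall := (Finset.eventually_all J).2 hcell
  have hεp : Tendsto ε atTop (𝓝[>] 0) :=
    tendsto_nhdsWithin_iff.2 ⟨hε0, Eventually.of_forall hε⟩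
  have hsmall : ∀ᶠ n in atTop, volume.real (Ω \ hatOmega (ε n) Ω) < η2 :=
    ((hat_eps_small hΩ hb).comp hεp).eventually_lt_const hη2p
  filter_upwards [hall, hsmall] with n hn hsm
  set F : Rd d → ℝ := fun x => f1 ((ε n)⁻¹ • x) (w n x) with hF
  have hSm := Sper_meas hD (ε n)
  have hhm := (isOpen_hat hs Ω).measurableSet
  have hst := stiff_meas hΩ hD (D0 := D0) (hε n)
  have hiF : IntegrableOn F Ω := hf.integrable hp hvol (hwm n) (measurable_const_smul _)
  -- restrict to the periodic part of the cells
  have c1 : ∫ x in hatOmega s Ω ∩ Sper D0 (ε n), F x =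
      ∑ z ∈ J, ∫ x in cell s z (Qcube d) ∩ Sper D0 (ε n), F x :=
    hat_integral hb hs hSm (hiF.mono_set inter_subset_left)
  have c2 : ∀ z ∈ J, s ^ d * fhom p A D0 f1 (ξ z) - η3 -
      (κ * (∫ x in cell s z (Qcube d), (1 + ‖w n x‖ ^ p)) +
        D * ∫ x in cell s z (Qcube d), ‖u x - ξ z‖ ^ p) ≤
      ∫ x in cell s z (Qcube d) ∩ Sper D0 (ε n), F x := by
    intro z hz
    have hzΩ := (mem_cidx hb hs).1 hz
    have hzm := (isOpen_cell hs z).measurableSet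
    have hzf := cell_ne_top (d := d) s z
    have i3 : IntegrableOn (fun x => ‖u x - ξ z‖ ^ p) (cell s z (Qcube d)) :=
      MemLpOn.integrable_rpow hp ((hu.mono hzΩ).sub (memLpOn_const hzf (ξ z)))
    have i2 := (hiw n).mono_set hzΩ
    have i4 : IntegrableOn (fun x => f1 ((ε n)⁻¹ • x) (ξ z + (w n x - u x))) (cell s z (Qcube d)) :=
      hf.integrable hp hzf ((memLpOn_const hzf (ξ z)).add (MemLpOn.mono ((hwm n).sub hu) hzΩ)) (measurable_const_smul _)
    have i5 : IntegrableOn (fun x => κ * (1 + ‖w n x‖ ^ p) + D * ‖u x - ξ z‖ ^ p)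
        (cell s z (Qcube d)) := (i2.const_mul _).add (i3.const_mul _)
    have hsub : cell s z (Qcube d) ∩ Sper D0 (ε n) ⊆ cell s z (Qcube d) := inter_subset_left
    have e1 : ∫ x in cell s z (Qcube d) ∩ Sper D0 (ε n), (κ * (1 + ‖w n x‖ ^ p) + D * ‖u x - ξ z‖ ^ p)
        ≤ κ * (∫ x in cell s z (Qcube d), (1 + ‖w n x‖ ^ p)) +
        D * ∫ x in cell s z (Qcube d), ‖u x - ξ z‖ ^ p := by
      rw [← integral_const_mul, ← integral_const_mul, ← integral_add (i2.const_mul _) (i3.const_mul _)]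
      exact setIntegral_mono_set i5 (.of_forall fun x => by positivity) hsub.eventuallyLE
    have e2 : ∫ x in cell s z (Qcube d) ∩ Sper D0 (ε n), f1 ((ε n)⁻¹ • x) (ξ z + (w n x - u x)) ≤
        (∫ x in cell s z (Qcube d) ∩ Sper D0 (ε n), F x) +
        ∫ x in cell s z (Qcube d) ∩ Sper D0 (ε n), (κ * (1 + ‖w n x‖ ^ p) + D * ‖u x - ξ z‖ ^ p) := by
      rw [← integral_add (hiF.mono_set (hsub.trans hzΩ)) (i5.mono_set hsub)]
      refine integral_mono (i4.mono_set hsub) ((hiF.mono_set (hsub.trans hzΩ)).add (i5.mono_set hsub)) fun x => ?_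
      have h7 := (abs_le.1 (hDm ((ε n)⁻¹ • x) (ξ z + (w n x - u x)) (w n x))).2
      have h8 : ξ z + (w n x - u x) - w n x = -(u x - ξ z) := by abel
      rw [h8, norm_neg] at h7
      simp only [hF]
      linarith
    have := hn z hz
    linarith
  have c3 := Finset.sum_le_sum c2
  rw [← c1, Finset.sum_sub_distrib, Finset.sum_sub_distrib, Finset.sum_add_distrib,
    ← Finset.mul_sum, ← Finset.mul_sum, ← Finset.mul_sum, Finset.sum_const, nsmul_eq_mul,
    Finset.mul_sum J _ (s ^ d)] at c3
  have c4 : κ * ∑ z ∈ J, ∫ x in cell s z (Qcube d), (1 + ‖w n x‖ ^ p) ≤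
      κ * K :=
    mul_le_mul_of_nonneg_left ((sum_cells_le hb hs (hiw n) fun x => by positivity).trans (hKw n))
      (by positivity)
  have c5 : D * ∑ z ∈ J, ∫ x in cell s z (Qcube d), ‖u x - ξ z‖ ^ p ≤ D * η2 :=
    mul_le_mul_of_nonneg_left h1 hD0
  -- from the periodic part to the whole stiff part
  have hTs : hatOmega s Ω ∩ Sper D0 (ε n) ⊆ stiffPart (ε n) Ω D0 :=
    (inter_subset_inter_left _ (hat_subset s Ω)).trans (Sper_subset_stiff hDQ (hε n))
  have hsΩ : stiffPart (ε n) Ω D0 ⊆ Ω := sdiff_subset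
  have hTm := hhm.inter hSm
  have hiFC : IntegrableOn (fun x => F x + C) Ω := hiF.add (integrableOn_const hvol)
  have c6 : ∫ x in hatOmega s Ω ∩ Sper D0 (ε n), (F x + C) ≤ ∫ x in stiffPart (ε n) Ω D0, (F x + C) := by
    refine setIntegral_mono_set (hiFC.mono_set hsΩ) (.of_forall fun x => ?_) hTs.eventuallyLE
    have := hf.lower ((ε n)⁻¹ • x) (w n x)
    simp only [hF, Pi.zero_apply]; linarith
  have hfs : volume (stiffPart (ε n) Ω D0) ≠ ⊤ := ((measure_mono hsΩ).trans_lt hvol.lt_top).ne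
  have hfT : volume (hatOmega s Ω ∩ Sper D0 (ε n)) ≠ ⊤ := ((measure_mono hTs).trans_lt hfs.lt_top).ne
  rw [integral_add (hiF.mono_set (hTs.trans hsΩ)) (integrableOn_const hfT),
    integral_add (hiF.mono_set hsΩ) (integrableOn_const hfs), setIntegral_const, setIntegral_const,
    smul_eq_mul, smul_eq_mul] at c6
  have c7 : volume.real (stiffPart (ε n) Ω D0) ≤ volume.real (hatOmega s Ω ∩ Sper D0 (ε n)) +
      (volume.real (Ω \ hatOmega s Ω) + volume.real (Ω \ hatOmega (ε n) Ω)) := by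
    have hsub : stiffPart (ε n) Ω D0 ⊆ (hatOmega s Ω ∩ Sper D0 (ε n)) ∪
        ((Ω \ hatOmega s Ω) ∪ (Ω \ hatOmega (ε n) Ω)) := by
      intro x hx
      by_cases hx1 : x ∈ hatOmega s Ω
      · by_cases hx2 : x ∈ hatOmega (ε n) Ω
        · exact Or.inl ⟨hx1, stiff_hat_subset hDQ (hε n) ⟨hx, hx2⟩⟩
        · exact Or.inr (Or.inr ⟨hsΩ hx, hx2⟩)
      · exact Or.inr (Or.inl ⟨hsΩ hx, hx1⟩)
    have hfin : volume ((hatOmega s Ω ∩ Sper D0 (ε n)) ∪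
        ((Ω \ hatOmega s Ω) ∪ (Ω \ hatOmega (ε n) Ω))) ≠ ⊤ := by
      refine ((measure_mono (union_subset (hTs.trans hsΩ) (union_subset sdiff_subset sdiff_subset))).trans_lt hvol.lt_top).ne
    refine (measureReal_mono hsub hfin).trans ((measureReal_union_le _ _).trans ?_)
    gcongr
    exact measureReal_union_le _ _
  have c8 : volume.real (Ω \ hatOmega s Ω) ≤ η2 := by
    refine le_trans ?_ h2
    have hi1 : IntegrableOn (fun x => 1 + ‖u x‖ ^ p) Ω :=
      (integrableOn_const hvol).add (hu.integrable_rpow hp)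
    have hfd : volume (Ω \ hatOmega s Ω) ≠ ⊤ := ((measure_mono sdiff_subset).trans_lt hvol.lt_top).ne
    have : ∫ x in Ω \ hatOmega s Ω, (1 : ℝ) ≤ ∫ x in Ω \ hatOmega s Ω, (1 + ‖u x‖ ^ p) :=
      integral_mono (integrableOn_const hfd) (hi1.mono_set sdiff_subset)
        fun x => by simp only [le_add_iff_nonneg_right]; positivity
    simpa using this
  have c9 := (abs_le.1 h3).2
  have c10 : volume.real (stiffPart (ε n) Ω D0) * C ≤ (volume.real (hatOmega s Ω ∩ Sper D0 (ε n)) +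
      (η2 + η2)) * C := by
    refine mul_le_mul_of_nonneg_right ?_ (by linarith)
    linarith
  show _ ≤ ∫ x in stiffPart (ε n) Ω D0, F x
  have c4' := c4.trans l4
  have c5' := c5.trans l2
  clear_value κ F
  have c11 : (∑ z ∈ J, s ^ d * fhom p A D0 f1 (ξ z)) - 3 * (η / 6) ≤
      ∫ x in hatOmega s Ω ∩ Sper D0 (ε n), F x := by linarith
  have c12 : (volume.real (stiffPart (ε n) Ω D0) - volume.real (hatOmega s Ω ∩ Sper D0 (ε n))) * C ≤
      2 * (η / 6) := by nlinarith
  linarith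

lemma gamma_liminf (hp : 1 < p)
    (hA : ConstantRank A) (hD : IsOpen D0) (hDQ : D0 ⊆ Qcube d)
    (hf : GF p C f1) (hΩ : IsOpen Ω)
    (hb : IsBounded Ω) (hu : MemLpOn p Ω u)
    {us : ℝ → Rd d → Vec N}
    (hw : WeakLpTendsto p Ω (𝓝[>] (0 : ℝ)) us u) :
    F1lim p A Ω D0 f1 u ≤ Filter.liminf (fun ε => F1eps p A Ω D0 f1 ε (us ε)) (𝓝[>] (0 : ℝ)) := by
  by_contra hcon
  push Not at hcon
  obtain ⟨c, hc1, hc2⟩ := EReal.lt_iff_exists_real_btwn.1 hcon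
  have hfr : ∃ᶠ ε in 𝓝[>] (0 : ℝ), F1eps p A Ω D0 f1 ε (us ε) < c ∧ 0 < ε :=
    (frequently_lt_of_liminf_lt (by isBoundedDefault) hc1).and_eventually self_mem_nhdsWithin
  obtain ⟨ε, hεt, hε⟩ := exists_seq_forall_of_frequently hfr
  have hε0 : Tendsto ε atTop (𝓝 0) := hεt.mono_right nhdsWithin_le_nhds
  have hU : ∀ n, us (ε n) ∈ U1 p A Ω := fun n => by
    by_contra h
    have := (hε n).1
    unfold F1eps at this
    rw [if_neg h] at this
    exact absurd this (not_lt.2 le_top)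
  have hweak : WeakLpTendsto p Ω atTop (fun n => us (ε n)) u := fun g hg => (hw g hg).comp hεt
  have hufree : AFreeOn A Ω u := weak_afree hweak fun n => (hU n).2
  have huU : u ∈ U1 p A Ω := ⟨hu, hufree⟩
  unfold F1lim at hc2
  rw [if_pos huU, EReal.coe_lt_coe_iff] at hc2
  have key := liminf_seq (D0 := D0) hp hA hD hDQ hf hΩ hb hu hufree (fun n => (hU n).1) (fun n => (hU n).2)
    hweak (fun n => (hε n).2) hε0 (sub_pos.2 hc2)
  obtain ⟨n, hn⟩ := key.exists
  have h1 := (hε n).1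
  unfold F1eps at h1
  rw [if_pos (hU n), EReal.coe_lt_coe_iff] at h1
  linarith

/-! ### Riemann–Lebesgue type lemma for oscillating periodic functions -/

lemma rl_aux {h G : Rd d → ℝ} (hz : Zper h) (hi : IntegrableOn h (Qcube d))
    (hG : Continuous G) (hs : HasCompactSupport G) {R ω : ℝ} (hR : 0 < R)
    (h0 : ∀ y, R ≤ ‖y‖ → G y = 0) (hω : ∀ y t, ‖t‖ ≤ 1 → |G (y - t) - G y| ≤ ω) :
    |(∫ y, h y * G y) - (∫ y in Qcube d, h y) * ∫ y, G y| ≤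
      ω * (2 * (R + 1)) ^ d * ∫ y in Qcube d, |h y| := by
  have hm : AEStronglyMeasurable h volume := hz.aesm hi.aestronglyMeasurable
  have hitg : Integrable (fun y => h y * G y) := by
    have := (hz.intOn_ball hi).integrable_smul_left_of_hasCompactSupport hG hs
    simpa [mul_comm] using this
  have hGi : Integrable G := hG.integrable_of_hasCompactSupport hs
  have hsm : AEStronglyMeasurable (fun q : Rd d × Rd d => h (q.1 - q.2))
      ((volume : Measure (Rd d)).prod (volume.restrict (Qcube d))) := by
    have h1 := AEStronglyMeasurable.convolution_integrand (ContinuousLinearMap.mul ℝ ℝ)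
      (μ := volume) (ν := volume) (f := fun _ : Rd d => (1 : ℝ)) aestronglyMeasurable_const hm
    refine AEStronglyMeasurable.mono_ac ?_ (by simpa using h1)
    exact Measure.AbsolutelyContinuous.prod Measure.AbsolutelyContinuous.rfl
      Measure.restrict_le_self.absolutelyContinuous
  have hsh : ∀ {k : Rd d → ℝ}, Zper k → ∀ y, ∫ t in Qcube d, k (y - t) = ∫ t in Qcube d, k t := by
    intro k hk y
    have e1 : ∫ t in Qcube d, k (y - t) = ∫ t in Qcube d, k (t + (y - (fun _ => (1:ℝ)))) := by
      have e2 : ∀ t, k (y - t) = (fun s => k (s + (y - fun _ => (1:ℝ)))) ((fun _ => (1:ℝ)) - t) := by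
        intro t; simp only []; congr 1; abel
      simp_rw [e2]
      have := (Measure.measurePreserving_sub_left (volume : Measure (Rd d)) (fun _ => (1:ℝ))).setIntegral_preimage_emb
        (Homeomorph.subLeft (fun _ : Fin d => (1:ℝ))).measurableEmbedding
        (fun s => k (s + (y - fun _ => (1:ℝ)))) (Qcube d)
      rw [← this]
      congr 2
      ext t
      simp only [Qcube, mem_preimage, mem_ofPred_eq, Pi.sub_apply, mem_Ioo]
      refine forall_congr' fun i => ?_
      constructor <;> rintro ⟨a, b⟩ <;> constructor <;> linarith
    rw [e1, hk.integral_shift]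
  have hshi : ∀ y, IntegrableOn (fun t => h (y - t)) (Qcube d) := by
    intro y
    have e1 : (fun t => h (y - t)) = (fun s => h (s + (y - fun _ => (1:ℝ)))) ∘
        (fun t => (fun _ => (1:ℝ)) - t) := by
      ext t; simp only [Function.comp]; congr 1; abel
    have hpre : (fun t : Rd d => (fun _ => (1:ℝ)) - t) ⁻¹' Qcube d = Qcube d := by
      ext t
      simp only [Qcube, mem_preimage, mem_ofPred_eq, Pi.sub_apply, mem_Ioo]
      refine forall_congr' fun i => ?_
      constructor <;> rintro ⟨a, b⟩ <;> constructor <;> linarith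
    have := (Measure.measurePreserving_sub_left (volume : Measure (Rd d)) (fun _ => (1:ℝ))).integrableOn_comp_preimage
        (Homeomorph.subLeft (fun _ : Fin d => (1:ℝ))).measurableEmbedding
        (f := fun s => h (s + (y - fun _ => (1:ℝ)))) (s := Qcube d)
    rw [hpre] at this
    rw [e1]
    exact this.2 (hz.integrableOn_shift hi _)
  -- the two product integrands
  have hI1 : Integrable (fun q : Rd d × Rd d => h (q.1 - q.2) * G (q.1 - q.2))
      ((volume : Measure (Rd d)).prod (volume.restrict (Qcube d))) := by
    have hmm : AEStronglyMeasurable (fun q : Rd d × Rd d => h (q.1 - q.2) * G (q.1 - q.2))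
        ((volume : Measure (Rd d)).prod (volume.restrict (Qcube d))) :=
      hsm.mul (Continuous.aestronglyMeasurable (by fun_prop))
    rw [integrable_prod_iff' hmm]
    refine ⟨Eventually.of_forall fun t => hitg.comp_sub_right t, ?_⟩
    have : ∀ t : Rd d, ∫ x, ‖h (x - t) * G (x - t)‖ = ∫ x, ‖h x * G x‖ := fun t =>
      integral_sub_right_eq_self (fun x => ‖h x * G x‖) t
    simp only [this]
    exact integrable_const _
  have hI2 : Integrable (fun q : Rd d × Rd d => h (q.1 - q.2) * G q.1)
      ((volume : Measure (Rd d)).prod (volume.restrict (Qcube d))) := by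
    have hmm : AEStronglyMeasurable (fun q : Rd d × Rd d => h (q.1 - q.2) * G q.1)
        ((volume : Measure (Rd d)).prod (volume.restrict (Qcube d))) :=
      hsm.mul (Continuous.aestronglyMeasurable (by fun_prop))
    rw [integrable_prod_iff hmm]
    refine ⟨Eventually.of_forall fun y => (hshi y).mul_const (G y), ?_⟩
    have : ∀ y : Rd d, ∫ t in Qcube d, ‖h (y - t) * G y‖ = (∫ t in Qcube d, |h t|) * ‖G y‖ := by
      intro y
      simp only [norm_mul]
      rw [integral_mul_const]
      congr 1
      exact hsh (hz.map (fun r => |r|)) y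
    simp only [this]
    exact hGi.norm.const_mul _
  have E1 : ∫ y, h y * G y = ∫ y, ∫ t in Qcube d, h (y - t) * G (y - t) := by
    rw [integral_integral_swap hI1]
    have : ∀ t : Rd d, ∫ x, h (x - t) * G (x - t) = ∫ x, h x * G x := fun t =>
      integral_sub_right_eq_self (fun x => h x * G x) t
    simp only [this]
    simp
  have E2 : (∫ y in Qcube d, h y) * ∫ y, G y = ∫ y, ∫ t in Qcube d, h (y - t) * G y := by
    rw [← integral_const_mul]
    refine integral_congr_ae (.of_forall fun y => ?_)
    simp only []
    rw [integral_mul_const, hsh hz]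
  rw [E1, E2, ← integral_sub hI1.integral_prod_left hI2.integral_prod_left]
  have hωn : 0 ≤ ω := (abs_nonneg _).trans (hω 0 0 (by simp))
  have key : ∀ y, ‖(∫ t in Qcube d, h (y - t) * G (y - t)) - ∫ t in Qcube d, h (y - t) * G y‖ ≤
      (closedBall (0 : Rd d) (R + 1)).indicator (fun _ => ω * ∫ t in Qcube d, |h t|) y := by
    intro y
    by_cases hy : y ∈ closedBall (0 : Rd d) (R + 1)
    · rw [indicator_of_mem hy]
      obtain ⟨K, hK⟩ := hs.exists_bound_of_continuous hG
      have i1 : IntegrableOn (fun t => h (y - t) * G (y - t)) (Qcube d) := by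
        exact int_bdd_mul (hshi y) (f := fun t => G (y - t)) (by fun_prop) (fun x => hK _)
      have i2 : IntegrableOn (fun t => h (y - t) * G y) (Qcube d) := (hshi y).mul_const _
      rw [← integral_sub i1 i2, ← hsh (hz.map (fun r => |r|)) y, ← integral_const_mul]
      refine norm_integral_le_of_norm_le (((hshi y).abs).const_mul ω) ?_
      filter_upwards [ae_restrict_mem (measurableSet_Qcube d)] with t ht
      rw [← mul_sub, norm_mul, mul_comm]
      exact mul_le_mul_of_nonneg_right (hω y t (Qcube_norm_le ht)) (norm_nonneg _)
    · rw [indicator_of_notMem hy]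
      have hy' : R + 1 < ‖y‖ := by simpa using hy
      have : ∀ t ∈ Qcube d, G (y - t) = 0 := fun t ht => h0 _ (by
        have := norm_sub_norm_le y t
        have := Qcube_norm_le ht
        linarith)
      rw [h0 y (by linarith), setIntegral_congr_fun (g := fun _ => (0:ℝ)) (measurableSet_Qcube d)
        (fun t ht => by simp only [this t ht, mul_zero])]
      simp
  have hfin := norm_integral_le_of_norm_le (μ := (volume : Measure (Rd d)))
    ((integrableOn_const (C := ω * ∫ t in Qcube d, |h t|)
      (isCompact_closedBall (0 : Rd d) (R + 1)).measure_lt_top.ne).integrable_indicator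
        measurableSet_closedBall)
    (.of_forall key)
  rw [integral_indicator measurableSet_closedBall, setIntegral_const,
    volume_ball_ctr (by linarith), smul_eq_mul] at hfin
  rw [← Real.norm_eq_abs]
  refine hfin.trans (le_of_eq (by ring))

/-- weak convergence of oscillating periodic functions to their mean -/
lemma rl {h g : Rd d → ℝ} (hz : Zper h) (hi : IntegrableOn h (Qcube d))
    (hg : Continuous g) (hs : HasCompactSupport g) {c : ℝ} (hc : 0 < c) :
    Tendsto (fun ε : ℝ => ∫ x, h ((c * ε)⁻¹ • x) * g x) (𝓝[>] (0 : ℝ))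
      (𝓝 ((∫ y in Qcube d, h y) * ∫ x, g x)) := by
  obtain ⟨R, hR0, hR⟩ : ∃ R : ℝ, 0 < R ∧ ∀ y, R ≤ ‖y‖ → g y = 0 := by
    obtain ⟨R, hR⟩ := hs.isCompact.isBounded.exists_norm_le
    refine ⟨|R| + 1, by positivity, fun y hy => image_eq_zero_of_notMem_tsupport fun hm => ?_⟩
    have := hR y hm
    linarith [le_abs_self R]
  have huc := Metric.uniformContinuous_iff.1 (hs.uniformContinuous_of_continuous hg)
  rw [Metric.tendsto_nhds]
  intro η hη
  set I := ∫ y in Qcube d, |h y| with hI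
  have hI0 : 0 ≤ I := integral_nonneg fun _ => abs_nonneg _
  set κ := η / (2 * ((2 * (R + 1)) ^ d * I + 1)) with hκ
  have hκ0 : 0 < κ := by positivity
  have hκe : κ * ((2 * (R + 1)) ^ d * I) < η := by
    rw [hκ, div_mul_eq_mul_div, div_lt_iff₀ (by positivity)]
    have : 0 ≤ (2 * (R + 1)) ^ d * I := by positivity
    nlinarith
  obtain ⟨δ0, hδ0, hδ⟩ := huc κ hκ0
  filter_upwards [Ioo_mem_nhdsGT (show (0:ℝ) < min (δ0 / c) (1 / c) from
    lt_min (by positivity) (by positivity))] with ε hε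
  have hε0 : 0 < ε := hε.1
  set δ := c * ε with hδd
  have hδ0' : 0 < δ := by positivity
  have hlt1 : δ < δ0 := by
    have := hε.2.trans_le (min_le_left _ _)
    rw [lt_div_iff₀ hc] at this; linarith
  have hlt2 : δ < 1 := by
    have := hε.2.trans_le (min_le_right _ _)
    rw [lt_div_iff₀ hc] at this; linarith
  have hsc : ∀ k : Rd d → ℝ, ∫ x, k x = δ ^ d * ∫ y, k (δ • y) := by
    intro k
    have := aff_integral (0 : Rd d) hδ0' univ k
    have hun : aff (0 : Rd d) δ '' univ = univ := image_univ_of_surjective (affH (0 : Rd d) hδ0').surjective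
    rw [hun] at this
    simpa [aff] using this
  have haux := rl_aux hz hi (G := fun y => g (δ • y)) (by fun_prop)
    (hs.comp_homeomorph (Homeomorph.smulOfNeZero δ hδ0'.ne')) (R := R / δ) (ω := κ) (by positivity)
    (fun y hy => hR _ (by
      rw [norm_smul, Real.norm_of_nonneg hδ0'.le]
      rw [div_le_iff₀ hδ0'] at hy; linarith))
    (fun y t ht => by
      refine (hδ ?_).le
      rw [dist_eq_norm, ← smul_sub, norm_smul, Real.norm_of_nonneg hδ0'.le]
      simp only [sub_sub_cancel_left, norm_neg]
      nlinarith)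
  rw [hsc (fun x => h (δ⁻¹ • x) * g x), hsc g, Real.dist_eq]
  have e : ∀ y : Rd d, h (δ⁻¹ • δ • y) = h y := fun y => by
    rw [smul_smul, inv_mul_cancel₀ hδ0'.ne', one_smul]
  simp only [e]
  have e2 : δ ^ d * (∫ y, h y * g (δ • y)) - (∫ y in Qcube d, h y) * (δ ^ d * ∫ y, g (δ • y)) =
      δ ^ d * ((∫ y, h y * g (δ • y)) - (∫ y in Qcube d, h y) * ∫ y, g (δ • y)) := by ring
  rw [e2, abs_mul, abs_of_pos (by positivity)]
  calc δ ^ d * |(∫ y, h y * g (δ • y)) - (∫ y in Qcube d, h y) * ∫ y, g (δ • y)|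
      ≤ δ ^ d * (κ * (2 * (R / δ + 1)) ^ d * I) := by gcongr
    _ = κ * ((2 * (R + δ)) ^ d * I) := by
        have : δ ^ d * (2 * (R / δ + 1)) ^ d = (2 * (R + δ)) ^ d := by
          rw [← mul_pow]; congr 1; field_simp
        rw [← this]; ring
    _ ≤ κ * ((2 * (R + 1)) ^ d * I) := by gcongr
    _ < η := hκe

lemma per_integrable (hz : Zper h) (hi : IntegrableOn h (Qcube d))
    (hb : IsBounded O) {δ : ℝ} (hδ : 0 < δ) :
    IntegrableOn (fun x => h (δ⁻¹ • x)) O := by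
  have hb' : IsBounded (aff (0 : Rd d) δ⁻¹ '' O) := by
    obtain ⟨R, hR⟩ := isBounded_iff_forall_norm_le.1 hb
    refine isBounded_iff_forall_norm_le.2 ⟨δ⁻¹ * R, ?_⟩
    rintro _ ⟨x, hx, rfl⟩
    rw [aff, zero_add, norm_smul, Real.norm_of_nonneg (by positivity)]
    have := hR x hx
    gcongr
  have h1 : IntegrableOn h (aff (0 : Rd d) δ⁻¹ '' O) :=
    ((hz.intOn_ball hi).integrableOn_isCompact hb'.isCompact_closure).mono_set subset_closure
  have h2 := (aff_integrableOn (0 : Rd d) (inv_pos.2 hδ)).1 h1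
  simpa [aff] using h2

lemma per_memLp (hp : 1 < p) (hz : Zper v)
    (hv : MemLpOn p (Qcube d) v) (hb : IsBounded O) :
    MemLpOn p O v := by
  refine memLpOn_of_integrable hp (hz.aesm hv.aesm).restrict ?_
  have := per_integrable (hz.map (fun w => ‖w‖ ^ p)) (hv.integrable_rpow hp) hb one_pos
  simpa using this

lemma osc_memLp (hp : 1 < p) (hz : Zper v)
    (hv : MemLpOn p (Qcube d) v) (hb : IsBounded O) {δ : ℝ}
    (hδ : 0 < δ) : MemLpOn p O (fun x => v (δ⁻¹ • x)) := by
  have hb' : IsBounded (aff (0 : Rd d) δ⁻¹ '' O) := by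
    obtain ⟨R, hR⟩ := isBounded_iff_forall_norm_le.1 hb
    refine isBounded_iff_forall_norm_le.2 ⟨δ⁻¹ * R, ?_⟩
    rintro _ ⟨x, hx, rfl⟩
    rw [aff, zero_add, norm_smul, Real.norm_of_nonneg (by positivity)]
    have := hR x hx
    gcongr
  have := aff_memLp (0 : Rd d) (inv_pos.2 hδ) (per_memLp hp hz hv hb')
  simpa [aff] using this

lemma osc_free (hp : 1 < p)
    (hv : Comp p A v) (O : Set (Rd d)) {δ : ℝ}
    (hδ : 0 < δ) : AFreeOn A O (fun x => v (δ⁻¹ • x)) := by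
  have h1 := torus_free hv.2.1 (MemLpOn.integrable hp (volume_Qcube_ne d) hv.1) hv.2.2.2
  have h2 := AFreeOn.aff (X := 0) (inv_pos.2 hδ)
    (h1.mono MeasurableSet.univ (subset_univ (aff (0 : Rd d) δ⁻¹ '' O)))
  simpa [aff] using h2

lemma bump_int_le {c : Rd d} {R : ℝ} (hR : 0 < R) {Φ : Rd d → ℝ} (hc : Continuous Φ)
    (hs : HasCompactSupport Φ) (h0 : ∀ x, x ∉ ball c R → Φ x = 0) (h1 : ∀ x, Φ x ≤ 1) :
    ∫ x, Φ x ≤ (2 * R) ^ d := by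
  rw [← volume_ball_ctr hR c]
  have : ∫ x, Φ x = ∫ x in closedBall c R, Φ x := by
    rw [setIntegral_eq_integral_of_forall_compl_eq_zero]
    intro x hx
    exact h0 x fun h => hx (ball_subset_closedBall h)
  rw [this]
  have hi : Integrable Φ := hc.integrable_of_hasCompactSupport hs
  calc ∫ x in closedBall c R, Φ x ≤ ∫ x in closedBall c R, (1 : ℝ) :=
        setIntegral_mono hi.integrableOn
          (integrableOn_const (isCompact_closedBall c R).measure_lt_top.ne) h1
    _ = _ := by simp

lemma bump_int_ge {c : Rd d} (hr : 0 < r) {Φ : Rd d → ℝ} (hc : Continuous Φ)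
    (hs : HasCompactSupport Φ) (h0 : ∀ x ∈ closedBall c r, Φ x = 1) (h1 : ∀ x, 0 ≤ Φ x) :
    (2 * r) ^ d ≤ ∫ x, Φ x := by
  rw [← volume_ball_ctr hr c]
  have hi : Integrable Φ := hc.integrable_of_hasCompactSupport hs
  calc volume.real (closedBall c r) = ∫ x in closedBall c r, (1 : ℝ) := by simp
    _ = ∫ x in closedBall c r, Φ x :=
        setIntegral_congr_fun measurableSet_closedBall fun x hx => (h0 x hx).symm
    _ ≤ ∫ x, Φ x := setIntegral_le_integral hi (.of_forall h1)

/-- the Riemann–Lebesgue lemma with sharp cut-off on a cube -/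
lemma rl_ball (hz : Zper h) (hi : IntegrableOn h (Qcube d))
    {k : ℝ} (hk : 0 < k) (c : Rd d) (hr : 0 < r) :
    Tendsto (fun ε : ℝ => ∫ x in ball c r, h ((k * ε)⁻¹ • x)) (𝓝[>] (0 : ℝ))
      (𝓝 ((∫ y in Qcube d, h y) * (2 * r) ^ d)) := by
  rw [Metric.tendsto_nhds]
  intro η hη
  set I := ∫ y in Qcube d, |h y| with hI
  set m := ∫ y in Qcube d, h y with hm
  have hI0 : 0 ≤ I := integral_nonneg fun _ => abs_nonneg _
  have hmI : |m| ≤ I := abs_integral_le_integral_abs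
  set κ := η / (2 * I + 3) with hκ
  have hκ0 : 0 < κ := by positivity
  have hκe : κ * (2 * I + 3) = η := by rw [hκ]; field_simp
  clear_value κ
  obtain ⟨ρ, hρ0, hρr, hρ⟩ : ∃ ρ, 0 < ρ ∧ ρ < r ∧ (2 * (r + ρ)) ^ d - (2 * (r - ρ)) ^ d < κ := by
    have hcont : Continuous (fun ρ : ℝ => (2 * (r + ρ)) ^ d - (2 * (r - ρ)) ^ d) := by fun_prop
    have h1 : Tendsto (fun ρ : ℝ => (2 * (r + ρ)) ^ d - (2 * (r - ρ)) ^ d) (𝓝[>] 0) (𝓝 0) := by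
      have := hcont.tendsto 0
      simp only [add_zero, sub_zero, sub_self] at this
      exact this.mono_left nhdsWithin_le_nhds
    obtain ⟨ρ, h2, h3⟩ := ((h1.eventually (gt_mem_nhds hκ0)).and (Ioo_mem_nhdsGT hr)).exists
    exact ⟨ρ, h3.1, h3.2, h2⟩
  obtain ⟨Φ, a1, a2, -, a4, a5, a6⟩ := exists_bump (r := r - ρ) (R := r) (by linarith) (by linarith) c
  obtain ⟨g, b1, b2, -, b4, b5, b6⟩ := exists_bump (r := r) (R := r + ρ) hr (by linarith) c
  have p1 := bump_int_ge (by linarith) a1.continuous a2 a4 (fun x => (a6 x).1)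
  have p2 := bump_int_le hr a1.continuous a2 a5 (fun x => (a6 x).2)
  have p3 := bump_int_le (by linarith) b1.continuous b2 b5 (fun x => (b6 x).2)
  have p4 : (2 * r) ^ d ≤ (2 * (r + ρ)) ^ d := by gcongr; linarith
  have iΦ : Integrable Φ := a1.continuous.integrable_of_hasCompactSupport a2
  have ig : Integrable g := b1.continuous.integrable_of_hasCompactSupport b2
  have hgi : ∫ x, (g x - Φ x) ≤ κ := by rw [integral_sub ig iΦ]; linarith
  have hgc : HasCompactSupport (fun x => g x - Φ x) := b2.sub a2
  have hcont : Continuous (fun x => g x - Φ x) := b1.continuous.sub a1.continuous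
  have hzabs := hz.map (fun r => |r|)
  have t1 := rl hz hi a1.continuous a2 hk
  have t2 := rl hzabs hi.abs hcont hgc hk
  have e1 := (Metric.tendsto_nhds.1 t1) κ hκ0
  have e2 := (Metric.tendsto_nhds.1 t2) κ hκ0
  filter_upwards [e1, e2, self_mem_nhdsWithin] with ε h1 h2 hε
  have hδ : 0 < k * ε := mul_pos hk hε
  set δ := k * ε with hδd
  have hL : ∀ {φ : Rd d → ℝ}, Continuous φ → HasCompactSupport φ → ∀ {h' : Rd d → ℝ}, Zper h' →
      IntegrableOn h' (Qcube d) → Integrable (fun x => h' (δ⁻¹ • x) * φ x) := by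
    intro φ hφ hφs h' hz' hi'
    obtain ⟨K, hK⟩ := hφs.exists_bound_of_continuous hφ
    have hb : IsBounded (tsupport φ) := hφs.isCompact.isBounded
    have i1 := int_bdd_mul (per_integrable hz' hi' hb hδ) hφ hK
    rw [← integrable_indicator_iff (isClosed_tsupport φ).measurableSet] at i1
    refine i1.congr (.of_forall fun x => ?_)
    by_cases hx : x ∈ tsupport φ
    · simp only [indicator_of_mem hx]
    · simp only [indicator_of_notMem hx, image_eq_zero_of_notMem_tsupport hx, mul_zero]
  have ib : IntegrableOn (fun x => h (δ⁻¹ • x)) (ball c r) := per_integrable hz hi isBounded_ball hδ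
  have hd : |(∫ x in ball c r, h (δ⁻¹ • x)) - ∫ x, h (δ⁻¹ • x) * Φ x| ≤
      ∫ x, |h (δ⁻¹ • x)| * (g x - Φ x) := by
    rw [← integral_indicator (f := fun x => h (δ⁻¹ • x)) measurableSet_ball, ← integral_sub
      (ib.integrable_indicator measurableSet_ball) (hL a1.continuous a2 hz hi)]
    rw [← Real.norm_eq_abs]
    refine norm_integral_le_of_norm_le (hL hcont hgc hzabs hi.abs)
      (.of_forall fun x => ?_)
    by_cases hx : x ∈ ball c r
    · rw [indicator_of_mem hx, b4 x (ball_subset_closedBall hx)]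
      have : h (δ⁻¹ • x) - h (δ⁻¹ • x) * Φ x = h (δ⁻¹ • x) * (1 - Φ x) := by ring
      rw [this, norm_mul, Real.norm_eq_abs, Real.norm_of_nonneg (by linarith [(a6 x).2])]
    · rw [indicator_of_notMem hx, a5 x hx]
      simp only [mul_zero, sub_zero, norm_zero]
      exact mul_nonneg (abs_nonneg _) (b6 x).1
  rw [Real.dist_eq] at h1 h2 ⊢
  have h2' := (abs_lt.1 h2).2
  have h3 : |m * (∫ x, Φ x) - m * (2 * r) ^ d| ≤ I * κ := by
    rw [← mul_sub, abs_mul]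
    refine mul_le_mul hmI ?_ (abs_nonneg _) hI0
    rw [abs_le]; constructor <;> linarith
  have h4 : I * ∫ x, (g x - Φ x) ≤ I * κ := mul_le_mul_of_nonneg_left hgi hI0
  have h5 : ∫ x, |h (δ⁻¹ • x)| * (g x - Φ x) ≤ I * κ + κ := by linarith
  calc |(∫ x in ball c r, h (δ⁻¹ • x)) - m * (2 * r) ^ d|
      ≤ |(∫ x in ball c r, h (δ⁻¹ • x)) - ∫ x, h (δ⁻¹ • x) * Φ x| +
        |(∫ x, h (δ⁻¹ • x) * Φ x) - m * ∫ x, Φ x| + |m * (∫ x, Φ x) - m * (2 * r) ^ d| := by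
        refine (abs_sub_le _ (m * ∫ x, Φ x) _).trans ?_
        gcongr
        exact abs_sub_le _ _ _
    _ < η := by nlinarith

lemma t_le (hp : 1 < p) {M t : ℝ} (hM : 0 < M) (ht : 0 ≤ t) :
    t ≤ M + M ^ (1 - p) * t ^ p := by
  rcases le_or_gt t M with h | h
  · have : 0 ≤ M ^ (1 - p) * t ^ p := by positivity
    linarith
  · have ht' : 0 < t := hM.trans h
    have h1 : t ^ (1 - p) ≤ M ^ (1 - p) := Real.rpow_le_rpow_of_nonpos hM h.le (by linarith)
    have h2 : t ^ (1 - p) * t ^ p = t := by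
      rw [← Real.rpow_add ht']; simp
    have : t ^ (1 - p) * t ^ p ≤ M ^ (1 - p) * t ^ p := by gcongr
    linarith

/-- convergence in `L^p` implies convergence in `L^1` (elementary version) -/
lemma l1_of_lp (hp : 1 < p) (hO : volume O ≠ ⊤) {ι : Type*}
    {l : Filter ι} {w : ι → Rd d → Vec N} (hw : ∀ᶠ n in l, MemLpOn p O (w n))
    (ht : Tendsto (fun n => ∫ x in O, ‖w n x‖ ^ p) l (𝓝 0)) :
    Tendsto (fun n => ∫ x in O, ‖w n x‖) l (𝓝 0) := by
  rw [Metric.tendsto_nhds]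
  intro η hη
  set V := volume.real O with hV
  have hV0 : 0 ≤ V := measureReal_nonneg
  set κ := η / (2 * (V + 1)) with hκ
  have hκ0 : 0 < κ := by positivity
  have hκV : κ * V < η / 2 := by
    rw [hκ, div_mul_eq_mul_div, div_lt_div_iff₀ (by positivity) (by positivity)]; nlinarith
  have ht2 : Tendsto (fun n => κ ^ (1 - p) * ∫ x in O, ‖w n x‖ ^ p) l (𝓝 0) := by
    simpa using ht.const_mul (κ ^ (1 - p))
  filter_upwards [hw, ht2.eventually (gt_mem_nhds (half_pos hη))] with n h1 h2
  rw [Real.dist_eq, sub_zero, abs_of_nonneg (integral_nonneg fun _ => norm_nonneg _)]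
  have hc1 : Integrable (fun _ => κ) (volume.restrict O) := integrableOn_const hO
  have hc2 := (h1.integrable_rpow hp).const_mul (κ ^ (1 - p))
  calc ∫ x in O, ‖w n x‖ ≤ ∫ x in O, (κ + κ ^ (1 - p) * ‖w n x‖ ^ p) :=
        setIntegral_mono (MemLpOn.integrable hp hO h1).norm (hc1.add hc2)
          fun x => t_le hp hκ0 (norm_nonneg _)
    _ = κ * V + κ ^ (1 - p) * ∫ x in O, ‖w n x‖ ^ p := by
        rw [integral_add hc1 hc2, integral_const_mul]
        simp [mul_comm, hV]
    _ < η := by linarith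

/-- truncated oscillating fields can be corrected to be `A`-free -/
lemma osc_cut (hp : 1 < p)
    (hA : ConstantRank A) (hb : IsBounded Ω)
    (hv : Comp p A v) {k : ℝ} (hk : 0 < k) {Φ : Rd d → ℝ}
    (hΦ : ContDiff ℝ (⊤ : ℕ∞) Φ) (hs : HasCompactSupport Φ) (hsΩ : tsupport Φ ⊆ Ω) :
    ∃ W : ℝ → Rd d → Vec N, (∀ ε, MemLpOn p Ω (W ε)) ∧ (∀ ε, AFreeOn A Ω (W ε)) ∧
      Tendsto (fun ε => ∫ x in Ω, ‖W ε x - Φ x • v ((k * ε)⁻¹ • x)‖ ^ p) (𝓝[>] (0 : ℝ)) (𝓝 0) := by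
  obtain ⟨hvm, hvz, hv0, hvf⟩ := id hv
  obtain ⟨R, hR0, hR⟩ : ∃ R : ℝ, 0 < R ∧ ∀ x ∈ Ω, ‖x‖ < R := by
    obtain ⟨R, hR⟩ := isBounded_iff_forall_norm_le.1 hb
    exact ⟨|R| + 1, by positivity, fun x hx => by linarith [hR x hx, le_abs_self R]⟩
  set X : Rd d := fun _ => -R with hX
  set L : ℝ := 2 * R with hLd
  have hL : 0 < L := by positivity
  have hLi : 0 < L⁻¹ := inv_pos.2 hL
  set O := aff X L '' Qcube d with hO
  have hOm : MeasurableSet O := aff_measurableSet X hL (measurableSet_Qcube d)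
  have hOb : IsBounded O := aff_bounded X L
  have hΩO : Ω ⊆ O := fun x hx => by
    rw [hO, aff_Q_mem hL]
    intro i
    have := (norm_le_pi_norm x i).trans_lt (hR x hx)
    rw [Real.norm_eq_abs, abs_lt] at this
    simp only [hX, hLd]; constructor <;> linarith
  have hOball : O ⊆ ball 0 (R + 1) := fun x hx => by
    rw [hO, aff_Q_mem hL] at hx
    rw [mem_ball_zero_iff, pi_norm_lt_iff (by positivity)]
    intro i
    have := hx i
    simp only [hX, hLd] at this
    rw [Real.norm_eq_abs, abs_lt]; constructor <;> linarith
  set T := aff X L with hT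
  set Ti := aff (-(L⁻¹ • X)) L⁻¹ with hTi
  have hTc : Continuous T := aff_cont _ _
  have hTic : Continuous Ti := aff_cont _ _
  have hTT : ∀ x, T (Ti x) = x := aff_inv X hL
  have hTT' : ∀ x, Ti (T x) = x := aff_inv' X hL
  have hTiO : ∀ x ∈ O, Ti x ∈ Qcube d := by
    rintro _ ⟨y, hy, rfl⟩; rw [hTT']; exact hy
  -- the oscillating field on the unit cube
  set V0 : ℝ → Rd d → Vec N := fun ε y => v ((k * ε)⁻¹ • T y) with hV0
  have hzp := hvz.map (fun w => ‖w‖ ^ p)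
  have hip : IntegrableOn (fun x => ‖v x‖ ^ p) (Qcube d) := MemLpOn.integrable_rpow hp hvm
  set B0 := (∫ y in Qcube d, ‖v y‖ ^ p) * (2 * (R + 1)) ^ d + 1 with hB0
  set B := (L ^ d)⁻¹ * B0 with hB
  have hev : ∀ᶠ ε in 𝓝[>] (0 : ℝ), 0 < ε ∧ ∫ y in Qcube d, ‖V0 ε y‖ ^ p ≤ B := by
    have t := rl_ball hzp hip hk (0 : Rd d) (r := R + 1) (by positivity)
    filter_upwards [t.eventually (gt_mem_nhds (lt_add_one _)), self_mem_nhdsWithin] with ε h1 h2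
    refine ⟨h2, ?_⟩
    have hδ : 0 < k * ε := mul_pos hk h2
    have h3 := aff_integral X hL (Qcube d) (fun x => ‖v ((k * ε)⁻¹ • x)‖ ^ p)
    have h4 : ∫ x in O, ‖v ((k * ε)⁻¹ • x)‖ ^ p ≤ B0 :=
      (setIntegral_mono_set (per_integrable hzp hip isBounded_ball hδ)
        (.of_forall fun x => by positivity) hOball.eventuallyLE).trans h1.le
    have h5 : ∫ y in Qcube d, ‖V0 ε y‖ ^ p = (L ^ d)⁻¹ * ∫ x in O, ‖v ((k * ε)⁻¹ • x)‖ ^ p := by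
      rw [h3, smul_eq_mul, ← mul_assoc, inv_mul_cancel₀ (by positivity), one_mul]
    rw [h5, hB]
    gcongr
  have hB0' : 0 ≤ B := by
    have : 0 ≤ ∫ y in Qcube d, ‖v y‖ ^ p := integral_nonneg fun _ => by positivity
    positivity
  set V : ℝ → Rd d → Vec N := fun ε =>
    if 0 < ε ∧ ∫ y in Qcube d, ‖V0 ε y‖ ^ p ≤ B then V0 ε else fun _ => 0 with hV
  have hVe : ∀ᶠ ε in 𝓝[>] (0 : ℝ), V ε = V0 ε := by
    filter_upwards [hev] with ε h
    simp only [hV, if_pos h]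
  have hVm : ∀ ε, MemLpOn p (Qcube d) (V ε) := by
    intro ε
    by_cases h : 0 < ε ∧ ∫ y in Qcube d, ‖V0 ε y‖ ^ p ≤ B
    · simp only [hV, if_pos h]
      exact aff_memLp X hL (osc_memLp hp hvz hvm hOb (mul_pos hk h.1))
    · simp only [hV, if_neg h]
      exact memLpOn_const (volume_Qcube_ne d) 0
  have hVf : ∀ ε, AFreeOn A (Qcube d) (V ε) := by
    intro ε
    by_cases h : 0 < ε ∧ ∫ y in Qcube d, ‖V0 ε y‖ ^ p ≤ B
    · simp only [hV, if_pos h]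
      exact AFreeOn.aff hL (osc_free hp hv _ (mul_pos hk h.1))
    · simp only [hV, if_neg h]
      intro ψ _
      simp [dot]
  have hVB : ∀ ε, ∫ x in Qcube d, ‖V ε x‖ ^ p ≤ B := by
    intro ε
    by_cases h : 0 < ε ∧ ∫ y in Qcube d, ‖V0 ε y‖ ^ p ≤ B
    · simp only [hV, if_pos h]; exact h.2
    · simp only [hV, if_neg h]
      simpa [Real.zero_rpow (by linarith : p ≠ 0)] using hB0'
  have hw : ∀ (a : Fin N) (g : Rd d → ℝ), Continuous g → HasCompactSupport g →
      tsupport g ⊆ Qcube d →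
      Tendsto (fun ε => ∫ x in Qcube d, V ε x a * g x) (𝓝[>] (0 : ℝ)) (𝓝 0) := by
    intro a g hg hgc hgQ
    have hza : Zper (fun x => v x a) := hvz.map (fun w => w a)
    have hvi : IntegrableOn v (Qcube d) := MemLpOn.integrable hp (volume_Qcube_ne d) hvm
    have hia : IntegrableOn (fun x => v x a) (Qcube d) := Integrable.eval hvi a
    have hma : ∫ x in Qcube d, v x a = 0 := by
      rw [← eval_integral (fun i => Integrable.eval hvi i), hv0]; rfl
    have t := rl hza hia (hg.comp hTic) (hgc.comp_homeomorph (affH X hL).symm) hk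
    rw [hma, zero_mul] at t
    have t2 := t.const_mul ((L ^ d)⁻¹)
    rw [mul_zero] at t2
    refine t2.congr' ?_
    filter_upwards [hVe] with ε h
    rw [h]
    have h3 := aff_integral X hL (Qcube d) (fun x => v ((k * ε)⁻¹ • x) a * (g ∘ Ti) x)
    have h4 : ∫ x, v ((k * ε)⁻¹ • x) a * (g ∘ Ti) x = ∫ x in O, v ((k * ε)⁻¹ • x) a * (g ∘ Ti) x := by
      rw [setIntegral_eq_integral_of_forall_compl_eq_zero]
      intro x hx
      have : Ti x ∉ tsupport g := fun hc => hx ⟨Ti x, hgQ hc, hTT x⟩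
      simp only [Function.comp, image_eq_zero_of_notMem_tsupport this, mul_zero]
    rw [h4, h3, smul_eq_mul, ← mul_assoc, inv_mul_cancel₀ (by positivity), one_mul]
    simp only [Function.comp, hTT', hV0, ← hT]
  have hΦs : tsupport (fun y => Φ (T y)) ⊆ Qcube d := by
    have h1 : tsupport (Φ ∘ T) ⊆ T ⁻¹' tsupport Φ := tsupport_comp_subset_preimage Φ hTc
    refine h1.trans fun y hy => ?_
    have := hTiO _ (hΩO (hsΩ hy))
    rwa [hTT'] at this
  have hTs : ContDiff ℝ (⊤ : ℕ∞) T := by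
    rw [hT]; unfold aff; fun_prop
  obtain ⟨W, hWc, hWt⟩ := lemmaC hp hA (hΦ.comp hTs) (hs.comp_homeomorph (affH X hL)) hΦs hVm hVf hVB hw
  have hTiΩ : Ti '' Ω ⊆ Qcube d := by
    rintro _ ⟨x, hx, rfl⟩; exact hTiO x (hΩO hx)
  refine ⟨fun ε x => W ε (Ti x), fun ε => aff_memLp _ hLi (MemLpOn.mono (hWc ε).1 hTiΩ), fun ε => ?_, ?_⟩
  · have h1 := torus_free (hWc ε).2.1 (MemLpOn.integrable hp (volume_Qcube_ne d) (hWc ε).1) (hWc ε).2.2.2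
    exact AFreeOn.aff hLi (h1.mono MeasurableSet.univ (subset_univ _))
  · have t2 := hWt.const_mul (L ^ d)
    rw [mul_zero] at t2
    refine tendsto_of_tendsto_of_tendsto_of_le_of_le' tendsto_const_nhds t2
      (.of_forall fun ε => integral_nonneg fun x => by positivity) ?_
    filter_upwards [hVe, self_mem_nhdsWithin] with ε h hε
    have hδ : 0 < k * ε := mul_pos hk hε
    have h3 := aff_integral X hL (Qcube d) (fun x => ‖W ε (Ti x) - Φ x • v ((k * ε)⁻¹ • x)‖ ^ p)
    have h4 : (∫ y in Qcube d, ‖W ε (Ti (T y)) - Φ (T y) • v ((k * ε)⁻¹ • T y)‖ ^ p) =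
        ∫ y in Qcube d, ‖W ε y - (Φ ∘ T) y • V ε y‖ ^ p := by
      simp only [hTT', h, hV0, Function.comp]
    rw [smul_eq_mul] at h3
    rw [← h4]
    refine le_trans ?_ h3.le
    refine setIntegral_mono_set ?_ (.of_forall fun x => by positivity) hΩO.eventuallyLE
    have hTiO' : Ti '' O ⊆ Qcube d := by
      rintro _ ⟨x, hx, rfl⟩; exact hTiO x hx
    have m1 : MemLpOn p O (fun x => W ε (Ti x)) := aff_memLp _ hLi (MemLpOn.mono (hWc ε).1 hTiO')
    obtain ⟨K, hK⟩ := hs.exists_bound_of_continuous hΦ.continuous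
    have m2 : MemLpOn p O (fun x => Φ x • v ((k * ε)⁻¹ • x)) :=
      MemLp.of_le_mul (c := K) (osc_memLp hp hvz hvm hOb hδ)
        (hΦ.continuous.aestronglyMeasurable.smul (osc_memLp hp hvz hvm hOb hδ).1)
        (.of_forall fun x => by
          rw [norm_smul]; exact mul_le_mul_of_nonneg_right (hK x) (norm_nonneg _))
    exact MemLpOn.integrable_rpow hp (m1.sub m2)

/-- Local recovery sequence on one cube (a sup-norm ball). -/
lemma cell_recov (hp : 1 < p)
    (hA : ConstantRank A) (hD : IsOpen D0)
    (hf : GF p C f1) (hΩm : MeasurableSet Ω) (hb : IsBounded Ω) {c : Rd d} (hr : 0 < r)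
    (hc : ball c r ⊆ Ω) (ξ : Vec N) {η : ℝ} (hη : 0 < η) :
    ∃ W Z : ℝ → Rd d → Vec N, (∀ ε, MemLpOn p Ω (W ε)) ∧ (∀ ε, AFreeOn A Ω (W ε)) ∧
      (∃ ρ > 0, ∀ ε x, Z ε x ≠ 0 → closedBall x ρ ⊆ ball c r) ∧
      (∀ ε > 0, MemLpOn p Ω (Z ε)) ∧
      Tendsto (fun ε => ∫ x in Ω, ‖W ε x - Z ε x‖ ^ p) (𝓝[>] (0 : ℝ)) (𝓝 0) ∧
      (∀ (a : Fin N) (g : Rd d → ℝ), Continuous g → HasCompactSupport g →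
        Tendsto (fun ε => ∫ x in Ω, W ε x a * g x) (𝓝[>] (0 : ℝ)) (𝓝 0)) ∧
      (∀ᶠ ε in 𝓝[>] (0 : ℝ), ∫ x in ball c r ∩ Sper D0 ε, f1 (ε⁻¹ • x) (ξ + Z ε x) ≤
        (2 * r) ^ d * fhom p A D0 f1 ξ + η) ∧
      (∃ K, ∀ᶠ ε in 𝓝[>] (0 : ℝ), ∫ x in Ω, ‖Z ε x‖ ^ p ≤ K) := by
  have hC := hf.one_le
  have hV0 : 0 < (2 * r) ^ d := by positivity
  set V0 := (2 * r) ^ d with hV0d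
  -- choice of v
  obtain ⟨k, hkm, hk1⟩ := ((frequently_cmin_lt (D0 := D0) hp A hf ξ
    (η := η / (4 * V0)) (by positivity)).and_eventually (eventually_ge_atTop 1)).exists
  obtain ⟨v, hv, hvE⟩ := exists_near_min A k ξ hkm
  have hkr : (0 : ℝ) < k := by exact_mod_cast hk1
  have hvm : MemLpOn p (Qcube d) v := hv.1
  have hvz := hv.2.1
  have hQne := volume_Qcube_ne d
  have hξv : MemLpOn p (Qcube d) (fun y => ξ + v y) := (memLpOn_const hQne ξ).add hvm
  set h1 : Rd d → ℝ := fun y => if (k : ℝ) • y ∈ D1per D0 then f1 ((k : ℝ) • y) (ξ + v y) else 0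
    with hh1
  set h2 : Rd d → ℝ := fun y => 1 + ‖ξ + v y‖ ^ p with hh2
  set h3 : Rd d → ℝ := fun y => ‖v y‖ ^ p with hh3
  have hktr : ∀ (y : Rd d) (z : Fin d → ℤ), (k : ℝ) • tr z y = tr (fun i => (k : ℤ) * z i) ((k : ℝ) • y) := by
    intro y z; ext i; simp only [tr, Pi.smul_apply, smul_eq_mul]; push_cast; ring
  have h1z : Zper h1 := by
    intro y z
    simp only [hh1, hktr, mem_D1per_tr, hf.per, hvz y z]
  have h2z : Zper h2 := hvz.map (fun w => 1 + ‖ξ + w‖ ^ p)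
  have h3z : Zper h3 := hvz.map (fun w => ‖w‖ ^ p)
  have h1ind : h1 = {y | (k : ℝ) • y ∈ D1per D0}.indicator (fun y => f1 ((k : ℝ) • y) (ξ + v y)) := by
    ext y; simp only [hh1, Set.indicator, mem_ofPred_eq]
  have hmk : MeasurableSet {y : Rd d | (k : ℝ) • y ∈ D1per D0} :=
    (measurableSet_D1per hD).preimage (measurable_const_smul _)
  have h1i : IntegrableOn h1 (Qcube d) := by
    rw [h1ind]
    exact (hf.integrable hp hQne hξv (measurable_const_smul _)).indicator hmk
  have hc1 : IntegrableOn (fun _ => (1 : ℝ)) (Qcube d) := integrableOn_const hQne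
  have h2i : IntegrableOn h2 (Qcube d) := hc1.add (hξv.integrable_rpow hp)
  have h3i : IntegrableOn h3 (Qcube d) := hvm.integrable_rpow hp
  have h1I : ∫ y in Qcube d, h1 y < fhom p A D0 f1 ξ + η / (4 * V0) := by
    rw [h1ind, setIntegral_indicator hmk]; exact hvE
  have h2I : 0 ≤ ∫ y in Qcube d, h2 y := integral_nonneg fun y => by positivity
  have h3I : 0 ≤ ∫ y in Qcube d, h3 y := integral_nonneg fun y => by positivity
  set I1 := ∫ y in Qcube d, h1 y
  set I2 := ∫ y in Qcube d, h2 y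
  set I3 := ∫ y in Qcube d, h3 y
  set κ := η / (4 * V0 * (I2 + 1)) with hκ
  have hκ0 : 0 < κ := by positivity
  obtain ⟨D, hD0, hDm⟩ := hf.mod1 hp (η := κ) hκ0
  -- inner radius
  obtain ⟨r', hr'0, hr'r, hr'V⟩ : ∃ r', 0 < r' ∧ r' < r ∧ V0 - (2 * r') ^ d < η / (4 * (D * I3 + 1)) := by
    have ht : Tendsto (fun t : ℝ => V0 - (2 * t) ^ d) (𝓝[<] r) (𝓝 (V0 - (2 * r) ^ d)) :=
      ((by fun_prop : Continuous fun t : ℝ => V0 - (2 * t) ^ d).tendsto r).mono_left nhdsWithin_le_nhds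
    rw [← hV0d, sub_self] at ht
    have e1 := ht.eventually (gt_mem_nhds (show (0:ℝ) < η / (4 * (D * I3 + 1)) by positivity))
    obtain ⟨t, ht1, ht2⟩ := (e1.and (Ioo_mem_nhdsLT hr)).exists
    exact ⟨t, ht2.1, ht2.2, ht1⟩
  set R := (r' + r) / 2 with hR
  have hRr : R < r := by rw [hR]; linarith
  have hr'R : r' < R := by rw [hR]; linarith
  have hR0 : 0 < R := hr'0.trans hr'R
  obtain ⟨Φ, hΦ, hΦc, hΦs, hΦ1, hΦ0, hΦb⟩ := exists_bump hr'0 hr'R c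
  have hsB : tsupport Φ ⊆ ball c r := hΦs.trans (closedBall_subset_ball hRr)
  have hΦ0' : ∀ x ∉ ball c r, Φ x = 0 := fun x hx => hΦ0 x fun h => hx (ball_subset_ball hRr.le h)
  obtain ⟨W, hW1, hW2, hW3⟩ := osc_cut hp hA hb hv hkr hΦ hΦc (hsB.trans hc)
  have hVol : volume Ω ≠ ⊤ := hb.measure_lt_top.ne
  have hZm : ∀ ε : ℝ, 0 < ε → ∀ O : Set (Rd d), IsBounded O →
      MemLpOn p O (fun x => Φ x • v ((k * ε)⁻¹ • x)) := fun ε hε O hO => by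
    have m := osc_memLp hp hvz hvm hO (mul_pos hkr hε)
    refine MemLp.of_le_mul (c := 1) m (hΦ.continuous.aestronglyMeasurable.smul m.1)
        (.of_forall fun x => ?_)
    rw [norm_smul, Real.norm_eq_abs, abs_of_nonneg (hΦb x).1]
    exact mul_le_mul_of_nonneg_right (hΦb x).2 (norm_nonneg _)
  have hballb : IsBounded (ball c r) := isBounded_ball
  refine ⟨W, fun ε x => Φ x • v ((k * ε)⁻¹ • x), hW1, hW2, ⟨r - R, by linarith, ?_⟩,
    fun ε hε => hZm ε hε Ω hb, hW3, ?_, ?_, ?_⟩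
  · intro ε x hx y hy
    have hxR : x ∈ ball c R := by
      by_contra h
      exact hx (by simp [hΦ0 x h])
    rw [mem_ball] at hxR ⊢
    rw [mem_closedBall] at hy
    linarith [dist_triangle y x c]
  · intro a g hg hgc
    obtain ⟨G, hG⟩ := hgc.exists_bound_of_continuous hg
    have hG0 : 0 ≤ G := (norm_nonneg _).trans (hG 0)
    have hvi : IntegrableOn v (Qcube d) := MemLpOn.integrable hp hQne hvm
    have hia : IntegrableOn (fun x => v x a) (Qcube d) := Integrable.eval hvi a
    have hma : ∫ x in Qcube d, v x a = 0 := by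
      rw [← eval_integral (fun i => Integrable.eval hvi i), hv.2.2.1]; rfl
    have t1 := rl (hvz.map (fun w => w a)) hia (g := fun x => Φ x * g x) (hΦ.continuous.mul hg) hΦc.mul_right hkr
    rw [hma, zero_mul] at t1
    have t2 := l1_of_lp hp hVol (l := 𝓝[>] (0:ℝ))
      (w := fun ε x => W ε x - Φ x • v ((k * ε)⁻¹ • x))
      (by filter_upwards [self_mem_nhdsWithin] with ε hε using (hW1 ε).sub (hZm ε hε Ω hb)) hW3
    have t3 : Tendsto (fun ε => ∫ x in Ω, (W ε x a - Φ x * v ((k * ε)⁻¹ • x) a) * g x) (𝓝[>] (0:ℝ)) (𝓝 0) := by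
      have t4 := t2.const_mul G
      rw [mul_zero] at t4
      refine squeeze_zero_norm' ?_ t4
      filter_upwards [self_mem_nhdsWithin] with ε hε
      rw [← integral_const_mul]
      refine norm_integral_le_of_norm_le
        ((MemLpOn.integrable hp hVol ((hW1 ε).sub (hZm ε hε Ω hb))).norm.const_mul G)
        (.of_forall fun x => ?_)
      rw [norm_mul, mul_comm]
      exact mul_le_mul (hG x) (norm_le_pi_norm (W ε x - Φ x • v ((k * ε)⁻¹ • x)) a) (norm_nonneg _) hG0
    have t5 := t3.add t1
    rw [add_zero] at t5
    refine t5.congr' ?_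
    filter_upwards [self_mem_nhdsWithin] with ε hε
    have e1 : ∫ x, v ((k * ε)⁻¹ • x) a * (Φ x * g x) = ∫ x in Ω, v ((k * ε)⁻¹ • x) a * (Φ x * g x) := by
      rw [setIntegral_eq_integral_of_forall_compl_eq_zero]
      intro x hx
      rw [hΦ0' x (fun h => hx (hc h))]; ring
    have i1 : IntegrableOn (fun x => (Φ x * v ((k * ε)⁻¹ • x) a)) Ω :=
      Integrable.eval (MemLpOn.integrable hp hVol (hZm ε hε Ω hb)) a
    have i2 : IntegrableOn (fun x => W ε x a) Ω := Integrable.eval (MemLpOn.integrable hp hVol (hW1 ε)) a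
    have i3 : IntegrableOn (fun x => (W ε x a - Φ x * v ((k * ε)⁻¹ • x) a) * g x) Ω :=
      (i2.sub i1).mul_bdd (c := G) hg.aestronglyMeasurable (.of_forall hG)
    have i4 : IntegrableOn (fun x => v ((k * ε)⁻¹ • x) a * (Φ x * g x)) Ω :=
      (i1.mul_bdd (c := G) hg.aestronglyMeasurable (.of_forall hG)).congr
        (.of_forall fun x => by simp only []; ring)
    rw [e1, ← integral_add i3 i4]
    exact integral_congr_ae (.of_forall fun x => by simp only []; ring)
  · have T1 := rl_ball h1z h1i hkr c hr
    have T2 := rl_ball h2z h2i hkr c hr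
    have T3 := rl_ball h3z h3i hkr c hr
    have T4 := rl h3z h3i hΦ.continuous hΦc hkr
    have TT := (T1.add (T2.const_mul κ)).add ((T3.sub T4).const_mul D)
    have hlt : I1 * V0 + κ * (I2 * V0) + D * (I3 * V0 - I3 * ∫ x, Φ x) < V0 * fhom p A D0 f1 ξ + η := by
      have b1 : I1 * V0 ≤ V0 * fhom p A D0 f1 ξ + η / 4 := by
        have := mul_le_mul_of_nonneg_right h1I.le hV0.le
        have e : (fhom p A D0 f1 ξ + η / (4 * V0)) * V0 = V0 * fhom p A D0 f1 ξ + η / 4 := by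
          field_simp
        linarith
      have b2 : κ * (I2 * V0) ≤ η / 4 := by
        have e : κ * ((I2 + 1) * V0) = η / 4 := by rw [hκ]; field_simp
        rw [← e]; gcongr; linarith
      have b3 : D * (I3 * V0 - I3 * ∫ x, Φ x) ≤ η / 4 := by
        have g1 := bump_int_ge hr'0 hΦ.continuous hΦc hΦ1 (fun x => (hΦb x).1)
        have e : (D * I3 + 1) * (η / (4 * (D * I3 + 1))) = η / 4 := by field_simp
        have e2 : D * (I3 * V0 - I3 * ∫ x, Φ x) = (D * I3) * (V0 - ∫ x, Φ x) := by ring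
        rw [e2, ← e]
        have hDI : 0 ≤ D * I3 := by positivity
        calc (D * I3) * (V0 - ∫ x, Φ x) ≤ (D * I3) * (η / (4 * (D * I3 + 1))) := by
              gcongr; linarith
          _ ≤ _ := by gcongr; linarith
      linarith
    filter_upwards [TT.eventually (gt_mem_nhds hlt), self_mem_nhdsWithin] with ε hlt2 hε
    have hδ : 0 < k * ε := mul_pos hkr hε
    refine le_trans ?_ hlt2.le
    have hbs : ∀ x : Rd d, (k : ℝ) • ((k * ε)⁻¹ • x) = ε⁻¹ • x := by
      intro x; rw [smul_smul]; congr 1; field_simp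
    have j1 := per_integrable h1z h1i hballb hδ
    have j2 := per_integrable h2z h2i hballb hδ
    have j3 := per_integrable h3z h3i hballb hδ
    have j4 : IntegrableOn (fun x => h3 ((k * ε)⁻¹ • x) * Φ x) (ball c r) :=
      j3.mul_bdd (c := 1) hΦ.continuous.aestronglyMeasurable (.of_forall fun x => by
        rw [Real.norm_eq_abs, abs_of_nonneg (hΦb x).1]; exact (hΦb x).2)
    have e1 : ∫ x, h3 ((k * ε)⁻¹ • x) * Φ x = ∫ x in ball c r, h3 ((k * ε)⁻¹ • x) * Φ x := by
      rw [setIntegral_eq_integral_of_forall_compl_eq_zero]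
      intro x hx
      rw [hΦ0' x hx]; ring
    have j12 : IntegrableOn (fun x => h1 ((k * ε)⁻¹ • x) + κ * h2 ((k * ε)⁻¹ • x)) (ball c r) :=
      j1.add (j2.const_mul κ)
    have j34 : IntegrableOn (fun x => D * (h3 ((k * ε)⁻¹ • x) - h3 ((k * ε)⁻¹ • x) * Φ x)) (ball c r) :=
      (j3.sub j4).const_mul D
    rw [e1, ← integral_const_mul, ← integral_sub j3 j4, ← integral_const_mul,
      ← integral_add j1 (j2.const_mul κ), ← integral_add j12 j34,
      ← setIntegral_indicator (Sper_meas hD ε)]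
    have jl : IntegrableOn ((Sper D0 ε).indicator fun x => f1 (ε⁻¹ • x) (ξ + Φ x • v ((k * ε)⁻¹ • x))) (ball c r) := by
      refine Integrable.indicator ?_ (Sper_meas hD ε)
      exact hf.integrable hp hballb.measure_lt_top.ne
        ((memLpOn_const hballb.measure_lt_top.ne ξ).add (hZm ε hε _ hballb)) (measurable_const_smul _)
    refine integral_mono jl (j12.add j34) fun x => ?_
    set V := v ((k * ε)⁻¹ • x) with hVd
    have hn : 0 ≤ h3 ((k * ε)⁻¹ • x) - h3 ((k * ε)⁻¹ • x) * Φ x := by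
      have : 0 ≤ h3 ((k * ε)⁻¹ • x) := by simp only [hh3]; positivity
      nlinarith [(hΦb x).2]
    have hn2 : 0 ≤ κ * h2 ((k * ε)⁻¹ • x) := by simp only [hh2]; positivity
    by_cases hx : x ∈ Sper D0 ε
    · rw [Set.indicator_of_mem hx]
      have hx' : ε⁻¹ • x ∈ D1per D0 := hx
      simp only [hh1, hbs, if_pos hx']
      have m := (abs_le.1 (hDm (ε⁻¹ • x) (ξ + Φ x • V) (ξ + V))).2
      have e : ‖(ξ + Φ x • V) - (ξ + V)‖ ^ p ≤ (1 - Φ x) * ‖V‖ ^ p := by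
        have e2 : (ξ + Φ x • V) - (ξ + V) = -((1 - Φ x) • V) := by
          rw [sub_smul, one_smul]; abel
        have h01 : 0 ≤ 1 - Φ x := by linarith [(hΦb x).2]
        rw [e2, norm_neg, norm_smul, Real.norm_eq_abs, abs_of_nonneg h01,
          Real.mul_rpow h01 (norm_nonneg _)]
        gcongr
        exact Real.rpow_le_self_of_le_one h01 (by linarith [(hΦb x).1]) hp.le
      have e3 := mul_le_mul_of_nonneg_left e hD0
      have e4 : D * (h3 ((k * ε)⁻¹ • x) - h3 ((k * ε)⁻¹ • x) * Φ x) = D * ((1 - Φ x) * ‖V‖ ^ p) := by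
        simp only [hh3, ← hVd]; ring
      show _ ≤ _ + κ * (1 + ‖ξ + V‖ ^ p) + D * (h3 ((k * ε)⁻¹ • x) - h3 ((k * ε)⁻¹ • x) * Φ x)
      rw [e4]
      linarith
    · rw [Set.indicator_of_notMem hx]
      have hx' : ¬ ε⁻¹ • x ∈ D1per D0 := hx
      have : h1 ((k * ε)⁻¹ • x) = 0 := by simp only [hh1, hbs, if_neg hx']
      show 0 ≤ h1 ((k * ε)⁻¹ • x) + κ * h2 ((k * ε)⁻¹ • x) + D * (h3 ((k * ε)⁻¹ • x) - h3 ((k * ε)⁻¹ • x) * Φ x)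
      rw [this]
      have := mul_nonneg hD0 hn
      linarith
  · have T3 := rl_ball h3z h3i hkr c hr
    refine ⟨I3 * V0 + 1, ?_⟩
    filter_upwards [T3.eventually (gt_mem_nhds (lt_add_one _)), self_mem_nhdsWithin] with ε h hε
    refine le_trans ?_ h.le
    have e1 : ∫ x in Ω, ‖Φ x • v ((k * ε)⁻¹ • x)‖ ^ p = ∫ x in ball c r, ‖Φ x • v ((k * ε)⁻¹ • x)‖ ^ p := by
      symm
      rw [← setIntegral_eq_of_subset_of_forall_sdiff_eq_zero hΩm hc]
      intro x hx
      rw [hΦ0' x hx.2, zero_smul, norm_zero, Real.zero_rpow (by linarith)]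
    rw [e1]
    refine integral_mono ((hZm ε hε _ hballb).integrable_rpow hp)
      (per_integrable h3z h3i hballb (mul_pos hkr hε)) fun x => ?_
    simp only [hh3]
    refine Real.rpow_le_rpow (norm_nonneg _) ?_ (by linarith)
    rw [norm_smul, Real.norm_eq_abs, abs_of_nonneg (hΦb x).1]
    exact mul_le_of_le_one_left (norm_nonneg _) (hΦb x).2

lemma sum_rpow_le {ι E : Type*} [SeminormedAddCommGroup E] (hp : 1 < p) (F : Finset ι)
    (w : ι → E) : ‖∑ z ∈ F, w z‖ ^ p ≤ (F.card : ℝ) ^ (p - 1) * ∑ z ∈ F, ‖w z‖ ^ p := by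
  have h1 : ‖∑ z ∈ F, w z‖ ^ p ≤ (∑ z ∈ F, |‖w z‖|) ^ p := by
    refine Real.rpow_le_rpow (norm_nonneg _) ?_ (by linarith)
    simpa using norm_sum_le F w
  refine h1.trans ((Real.rpow_sum_le_const_mul_sum_rpow F (fun z => ‖w z‖) hp.le).trans (le_of_eq ?_))
  simp

lemma int_sum_rpow_le {ι : Type*} (hp : 1 < p) (F : Finset ι)
    {w : ι → Rd d → Vec N} (hw : ∀ z ∈ F, MemLpOn p Ω (w z)) :
    ∫ x in Ω, ‖∑ z ∈ F, w z x‖ ^ p ≤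
      (F.card : ℝ) ^ (p - 1) * ∑ z ∈ F, ∫ x in Ω, ‖w z x‖ ^ p := by
  have hi : ∀ z ∈ F, Integrable (fun x => ‖w z x‖ ^ p) (volume.restrict Ω) :=
    fun z hz => (hw z hz).integrable_rpow hp
  rw [← integral_finsetSum F hi, ← integral_const_mul]
  refine integral_mono_of_nonneg (.of_forall fun x => by positivity)
    ((integrable_finsetSum F hi).const_mul _) (.of_forall fun x => sum_rpow_le hp F _)

lemma AFreeOn.sum {ι : Type*}
    (F : Finset ι) {w : ι → Rd d → Vec N} (hw : ∀ z, AFreeOn A O (w z))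
    (hi : ∀ z, IntegrableOn (w z) O) : AFreeOn A O (fun x => ∑ z ∈ F, w z x) := by
  induction F using Finset.induction_on with
  | empty => intro ψ _; simp [dot]
  | insert a F ha ih =>
    simp only [Finset.sum_insert ha]
    exact (hw a).add ih (hi a) (integrable_finsetSum F fun z _ => hi z)

lemma cell_ball (hs : 0 < s) (z : Fin d → ℤ) :
    cell s z (Qcube d) = ball (HC.aff (s • zr z) s (ctr d)) (s / 2) := by
  rw [cell_eq, Qcube_ball]
  ext x
  rw [mem_ball, dist_eq_norm]
  constructor
  · rintro ⟨y, hy, rfl⟩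
    rw [mem_ball, dist_eq_norm] at hy
    have : HC.aff (s • zr z) s y - HC.aff (s • zr z) s (ctr d) = s • (y - ctr d) := by
      unfold HC.aff; rw [smul_sub]; abel
    rw [this, norm_smul, Real.norm_eq_abs, abs_of_pos hs]
    nlinarith
  · intro hx
    refine ⟨s⁻¹ • (x - s • zr z), ?_, ?_⟩
    · rw [mem_ball, dist_eq_norm]
      have : s⁻¹ • (x - s • zr z) - ctr d = s⁻¹ • (x - HC.aff (s • zr z) s (ctr d)) := by
        unfold HC.aff; simp only [smul_sub, smul_add, smul_smul, inv_mul_cancel₀ hs.ne', one_smul]; abel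
      rw [this, norm_smul, Real.norm_eq_abs, abs_of_pos (inv_pos.2 hs), inv_mul_lt_iff₀ hs]
      linarith
    · unfold HC.aff
      rw [smul_smul, mul_inv_cancel₀ hs.ne', one_smul]; abel

/-- Glueing of the local recovery sequences. -/
lemma glue (hp : 1 < p)
    (hA : ConstantRank A) (hD : IsOpen D0)
    (hf : GF p C f1) (hΩm : MeasurableSet Ω) (hb : IsBounded Ω) (hs : 0 < s)
    (ξ : (Fin d → ℤ) → Vec N) {η : ℝ} (hη : 0 < η) :
    ∃ W Z : ℝ → Rd d → Vec N, (∀ ε, MemLpOn p Ω (W ε)) ∧ (∀ ε, AFreeOn A Ω (W ε)) ∧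
      (∃ ρ > 0, ∀ ε x, Z ε x ≠ 0 → ∃ z ∈ cidx Ω s, closedBall x ρ ⊆ cell s z (Qcube d)) ∧
      (∀ ε > 0, MemLpOn p Ω (Z ε)) ∧
      Tendsto (fun ε => ∫ x in Ω, ‖W ε x - Z ε x‖ ^ p) (𝓝[>] (0 : ℝ)) (𝓝 0) ∧
      (∀ (a : Fin N) (g : Rd d → ℝ), Continuous g → HasCompactSupport g →
        Tendsto (fun ε => ∫ x in Ω, W ε x a * g x) (𝓝[>] (0 : ℝ)) (𝓝 0)) ∧
      (∀ᶠ ε in 𝓝[>] (0 : ℝ), ∀ z ∈ cidx Ω s,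
        ∫ x in cell s z (Qcube d) ∩ Sper D0 ε, f1 (ε⁻¹ • x) (ξ z + Z ε x) ≤
        s ^ d * fhom p A D0 f1 (ξ z) + η) ∧
      (∃ K, ∀ᶠ ε in 𝓝[>] (0 : ℝ), ∫ x in Ω, ‖Z ε x‖ ^ p ≤ K) := by
  have hVol : volume Ω ≠ ⊤ := hb.measure_lt_top.ne
  set F := cidx Ω s with hF
  have key : ∀ z : F, _ := fun z => cell_recov hp hA hD hf hΩm hb (half_pos hs)
    ((cell_ball hs z.1).symm.subset.trans ((mem_cidx hb hs).1 z.2)) (ξ z.1) hη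
  simp only [← cell_ball hs, mul_div_cancel₀ s (two_ne_zero' ℝ)] at key
  choose W Z hW1 hW2 hρ0 hZm hR hcc hE hK0 using key
  choose ρ hρ hZρ using hρ0
  choose K hK using hK0
  have hZc : ∀ (z : F) ε x, Z z ε x ≠ 0 → x ∈ cell s z.1 (Qcube d) := fun z ε x h =>
    hZρ z ε x h (mem_closedBall_self (hρ z).le)
  refine ⟨fun ε x => ∑ z, W z ε x, fun ε x => ∑ z, Z z ε x, ?_, ?_, ?_, ?_, ?_, ?_, ?_, ?_⟩
  · exact fun ε => memLp_finsetSum _ fun z _ => hW1 z ε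
  · exact fun ε => AFreeOn.sum _ (fun z => hW2 z ε) fun z => MemLpOn.integrable hp hVol (hW1 z ε)
  · obtain ⟨ρ0, h0, h1⟩ : ∃ ρ0 > 0, ∀ z, ρ0 ≤ ρ z := by
      have := (Finset.eventually_all (Finset.univ : Finset F) (l := 𝓝[>] (0:ℝ)) (p := fun z t => t < ρ z)).2
        fun z _ => mem_of_superset (Ioo_mem_nhdsGT (hρ z)) fun t ht => ht.2
      obtain ⟨t, ht, ht0⟩ := (this.and self_mem_nhdsWithin).exists
      exact ⟨t, ht0, fun z => (ht z (Finset.mem_univ _)).le⟩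
    refine ⟨ρ0, h0, fun ε x hx => ?_⟩
    obtain ⟨z, _, hz⟩ := Finset.exists_ne_zero_of_sum_ne_zero hx
    exact ⟨z.1, z.2, (closedBall_subset_closedBall (h1 z)).trans (hZρ z ε x hz)⟩
  · exact fun ε hε => memLp_finsetSum _ fun z _ => hZm z ε hε
  · have t := (tendsto_finsetSum (Finset.univ : Finset F) fun z _ => hR z).const_mul
      (((Finset.univ : Finset F).card : ℝ) ^ (p - 1))
    simp only [Finset.sum_const_zero, mul_zero] at t
    refine squeeze_zero' (.of_forall fun ε => integral_nonneg fun x => by positivity) ?_ t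
    filter_upwards [self_mem_nhdsWithin] with ε hε
    simp only [← Finset.sum_sub_distrib]
    exact int_sum_rpow_le (w := fun z x => W z ε x - Z z ε x) hp Finset.univ fun z _ => (hW1 z ε).sub (hZm z ε hε)
  · intro a g hg hgc
    obtain ⟨G, hG⟩ := hgc.exists_bound_of_continuous hg
    have t := tendsto_finsetSum (Finset.univ : Finset F) fun z _ => hcc z a g hg hgc
    simp only [Finset.sum_const_zero] at t
    refine t.congr fun ε => ?_
    rw [← integral_finsetSum]
    · simp only [Finset.sum_apply, Finset.sum_mul]
    · intro z _
      have i2 : IntegrableOn (fun x => W z ε x a) Ω :=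
        Integrable.eval (MemLpOn.integrable hp hVol (hW1 z ε)) a
      exact i2.mul_bdd (c := G) hg.aestronglyMeasurable (.of_forall hG)
  · have := (Finset.eventually_all (Finset.univ : Finset F)).2 fun z _ => hE z
    filter_upwards [this] with ε h z hz
    refine le_trans (le_of_eq ?_) (h ⟨z, hz⟩ (Finset.mem_univ _))
    refine setIntegral_congr_fun (((isOpen_cell hs z).measurableSet).inter (Sper_meas hD ε)) fun x hx => ?_
    have : ∑ w, Z w ε x = Z ⟨z, hz⟩ ε x := by
      refine Finset.sum_eq_single_of_mem _ (Finset.mem_univ _) fun w _ hw => ?_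
      by_contra hne
      have := cell_disjoint hs (z := w.1) (w := z) (fun h => hw (Subtype.ext h))
      exact disjoint_left.1 this (hZc w ε x hne) hx.1
    simp only [this]
  · refine ⟨((Finset.univ : Finset F).card : ℝ) ^ (p - 1) * ∑ z, K z, ?_⟩
    have := (Finset.eventually_all (Finset.univ : Finset F)).2 fun z _ => hK z
    filter_upwards [this, self_mem_nhdsWithin] with ε h hε
    refine (int_sum_rpow_le (w := fun z x => Z z ε x) hp Finset.univ fun z _ => hZm z ε hε).trans ?_
    gcongr with z hz
    exact h z hz

lemma setIntegral_union_le' {S T Ω : Set (Rd d)} (hS : MeasurableSet S)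
    (hT : MeasurableSet T) (hSΩ : S ⊆ Ω) (hTΩ : T ⊆ Ω) (hi : IntegrableOn h Ω)
    (h0 : ∀ x, 0 ≤ h x) : ∫ x in S ∪ T, h x ≤ (∫ x in S, h x) + ∫ x in T, h x := by
  rw [← union_sdiff_self, setIntegral_union disjoint_sdiff_right (hT.diff hS) (hi.mono_set hSΩ)
    (hi.mono_set (sdiff_subset.trans hTΩ))]
  refine add_le_add le_rfl ?_
  exact setIntegral_mono_set (hi.mono_set hTΩ) (.of_forall h0) sdiff_subset.eventuallyLE

/-- Energy estimate for the glued sequence, for a fixed `ε`. -/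
lemma energy_est (hp : 1 < p)
    (hD : IsOpen D0) (hDQ : D0 ⊆ Qcube d)
    (hf : GF p C f1) (hΩ : IsOpen Ω) (hb : IsBounded Ω) {s ε : ℝ} (hs : 0 < s) (hε : 0 < ε)
    {u W Z : Rd d → Vec N} (hu : MemLpOn p Ω u) (hW : MemLpOn p Ω W) (hZ : MemLpOn p Ω Z)
    {ξ : (Fin d → ℤ) → Vec N} {κ D ηc : ℝ} (hκ : 0 < κ) (hD0 : 0 ≤ D)
    (hDm : ∀ (x : Rd d) (ξ ζ : Vec N), |f1 x ξ - f1 x ζ| ≤ κ * (1 + ‖ζ‖ ^ p) + D * ‖ξ - ζ‖ ^ p)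
    (hZ0 : ∀ᵐ x ∂volume.restrict (stiffPart ε Ω D0 \ (hatOmega s Ω ∩ Sper D0 ε)), Z x = 0)
    (hc : ∀ z ∈ cidx Ω s, ∫ x in cell s z (Qcube d) ∩ Sper D0 ε, f1 (ε⁻¹ • x) (ξ z + Z x) ≤
    s ^ d * fhom p A D0 f1 (ξ z) + ηc) :
    ∫ x in stiffPart ε Ω D0, f1 (ε⁻¹ • x) (u x + W x) ≤
      (1 + κ * C) * (∑ z ∈ cidx Ω s, (s ^ d * fhom p A D0 f1 (ξ z) + ηc)) +
      κ * (1 + C ^ 2) * volume.real Ω +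
      D * 2 ^ p * ((∑ z ∈ cidx Ω s, ∫ x in cell s z (Qcube d), ‖u x - ξ z‖ ^ p) +
        ∫ x in Ω, ‖W x - Z x‖ ^ p) +
      C * 2 ^ p * ((∫ x in Ω \ hatOmega s Ω, (1 + ‖u x‖ ^ p)) +
        (∫ x in Ω \ hatOmega ε Ω, (1 + ‖u x‖ ^ p)) + ∫ x in Ω, ‖W x - Z x‖ ^ p) := by
  have hC := hf.one_le
  have hVol : volume Ω ≠ ⊤ := hb.measure_lt_top.ne
  have hst : MeasurableSet (stiffPart ε Ω D0) := stiff_meas hΩ hD hε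
  have hSm := Sper_meas hD ε
  have hhm : MeasurableSet (hatOmega s Ω) := (isOpen_hat hs Ω).measurableSet
  set S1 := hatOmega s Ω ∩ Sper D0 ε with hS1
  have hS1s : S1 ⊆ stiffPart ε Ω D0 := fun x hx => Sper_subset_stiff hDQ hε ⟨hat_subset s Ω hx.1, hx.2⟩
  have hfi : IntegrableOn (fun x => f1 (ε⁻¹ • x) (u x + W x)) Ω :=
    hf.integrable hp hVol (hu.add hW) (measurable_const_smul _)
  have hsΩ : stiffPart ε Ω D0 ⊆ Ω := sdiff_subset
  have hWZ := (MemLpOn.integrable_rpow hp (u := fun x => W x - Z x) (hW.sub hZ))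
  have hui : IntegrableOn (fun x => ‖u x‖ ^ p) Ω := hu.integrable_rpow hp
  have hc1 : IntegrableOn (fun _ => (1 : ℝ)) Ω := integrableOn_const hVol
  have h1u : IntegrableOn (fun x => 1 + ‖u x‖ ^ p) Ω := hc1.add hui
  have hp2 : (1 : ℝ) ≤ 2 ^ p := Real.one_le_rpow (by norm_num) (by linarith)
  rw [← union_sdiff_cancel hS1s, setIntegral_union disjoint_sdiff_right (hst.diff (hhm.inter hSm))
    (hfi.mono_set (hS1s.trans hsΩ)) (hfi.mono_set (sdiff_subset.trans hsΩ))]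
  refine add_le_add ?_ ?_
  · rw [hat_integral hb hs hSm (hfi.mono_set inter_subset_left)]
    have hz : ∀ z ∈ cidx Ω s, ∫ x in cell s z (Qcube d) ∩ Sper D0 ε, f1 (ε⁻¹ • x) (u x + W x) ≤
        (1 + κ * C) * (s ^ d * fhom p A D0 f1 (ξ z) + ηc) + κ * (1 + C ^ 2) * (∫ x in cell s z (Qcube d), (1:ℝ)) +
        D * 2 ^ p * ((∫ x in cell s z (Qcube d), ‖u x - ξ z‖ ^ p) + ∫ x in cell s z (Qcube d), ‖W x - Z x‖ ^ p) := by
      intro z hz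
      have hcΩ := (mem_cidx hb hs).1 hz
      have hcne : volume (cell s z (Qcube d)) ≠ ⊤ := cell_ne_top s z
      have hξ : MemLpOn p (cell s z (Qcube d)) (fun _ => ξ z) := memLpOn_const hcne _
      have i1 : IntegrableOn (fun x => f1 (ε⁻¹ • x) (ξ z + Z x)) (cell s z (Qcube d)) :=
        hf.integrable hp hcne (hξ.add (MemLpOn.mono hZ hcΩ)) (measurable_const_smul _)
      have i2 : IntegrableOn (fun x => ‖u x - ξ z‖ ^ p) (cell s z (Qcube d)) :=
        MemLpOn.integrable_rpow hp (u := fun x => u x - ξ z) ((MemLpOn.mono hu hcΩ).sub hξ)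
      have i3 := hWZ.mono_set hcΩ
      have i4 : IntegrableOn (fun _ => (1:ℝ)) (cell s z (Qcube d)) := integrableOn_const hcne
      have hsub : cell s z (Qcube d) ∩ Sper D0 ε ⊆ cell s z (Qcube d) := inter_subset_left
      set O := cell s z (Qcube d)
      have j : IntegrableOn (fun x => κ * (1 + C ^ 2) * 1 + D * 2 ^ p * (‖u x - ξ z‖ ^ p + ‖W x - Z x‖ ^ p)) O :=
        (i4.const_mul _).add ((i2.add i3).const_mul _)
      have j1 : IntegrableOn (fun x => (1 + κ * C) * f1 (ε⁻¹ • x) (ξ z + Z x)) O := i1.const_mul _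
      calc ∫ x in O ∩ Sper D0 ε, f1 (ε⁻¹ • x) (u x + W x)
          ≤ ∫ x in O ∩ Sper D0 ε, ((1 + κ * C) * f1 (ε⁻¹ • x) (ξ z + Z x) +
            (κ * (1 + C ^ 2) * 1 + D * 2 ^ p * (‖u x - ξ z‖ ^ p + ‖W x - Z x‖ ^ p))) := by
            refine integral_mono (hfi.mono_set (hsub.trans hcΩ))
              ((j1.mono_set hsub).add (j.mono_set hsub)) fun x => ?_
            have m := (abs_le.1 (hDm (ε⁻¹ • x) (u x + W x) (ξ z + Z x))).2
            have e : (u x + W x) - (ξ z + Z x) = (u x - ξ z) + (W x - Z x) := by abel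
            have m2 := norm_add_rpow_le hp (u x - ξ z) (W x - Z x)
            rw [← e] at m2
            have m3 := mul_le_mul_of_nonneg_left m2 hD0
            have m4 := mul_le_mul_of_nonneg_left (hf.coer (ε⁻¹ • x) (ξ z + Z x)) hκ.le
            simp only []
            nlinarith
        _ = (1 + κ * C) * (∫ x in O ∩ Sper D0 ε, f1 (ε⁻¹ • x) (ξ z + Z x)) +
            ∫ x in O ∩ Sper D0 ε, (κ * (1 + C ^ 2) * 1 + D * 2 ^ p * (‖u x - ξ z‖ ^ p + ‖W x - Z x‖ ^ p)) := by
            rw [integral_add (j1.mono_set hsub) (j.mono_set hsub), integral_const_mul]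
        _ ≤ (1 + κ * C) * (s ^ d * fhom p A D0 f1 (ξ z) + ηc) +
            ∫ x in O, (κ * (1 + C ^ 2) * 1 + D * 2 ^ p * (‖u x - ξ z‖ ^ p + ‖W x - Z x‖ ^ p)) := by
            refine add_le_add (mul_le_mul_of_nonneg_left (hc z hz) (by positivity)) ?_
            exact setIntegral_mono_set j (.of_forall fun x => by positivity) hsub.eventuallyLE
        _ = _ := by
            have j2 : IntegrableOn (fun x => D * 2 ^ p * (‖u x - ξ z‖ ^ p + ‖W x - Z x‖ ^ p)) O :=
              (i2.add i3).const_mul _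
            rw [integral_add (i4.const_mul _) j2, integral_const_mul, integral_const_mul,
              integral_add i2 i3]
            ring
    refine (Finset.sum_le_sum hz).trans ?_
    rw [Finset.sum_add_distrib, Finset.sum_add_distrib, ← Finset.mul_sum, ← Finset.mul_sum, ← Finset.mul_sum]
    have q1 := sum_cells_le hb hs hc1 (fun _ => zero_le_one)
    have q2 := sum_cells_le hb hs hWZ (fun _ => by positivity)
    have q3 : ∫ x in Ω, (1:ℝ) = volume.real Ω := by simp
    rw [q3] at q1
    exact add_le_add (add_le_add le_rfl (mul_le_mul_of_nonneg_left q1 (by positivity)))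
      (mul_le_mul_of_nonneg_left (Finset.sum_add_distrib.trans_le (add_le_add le_rfl q2)) (by positivity))
  · set S2 := stiffPart ε Ω D0 \ S1 with hS2
    have hS2m : MeasurableSet S2 := hst.diff (hhm.inter hSm)
    have hS2Ω : S2 ⊆ Ω := sdiff_subset.trans hsΩ
    have hsub : S2 ⊆ (Ω \ hatOmega s Ω) ∪ (Ω \ hatOmega ε Ω) := by
      intro x hx
      by_cases h1 : x ∈ hatOmega s Ω
      · right
        refine ⟨hS2Ω hx, fun h2 => hx.2 ⟨h1, stiff_hat_subset hDQ hε ⟨hx.1, h2⟩⟩⟩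
      · left; exact ⟨hS2Ω hx, h1⟩
    have hitg : IntegrableOn (fun x => C * 2 ^ p * ((1 + ‖u x‖ ^ p) + ‖W x - Z x‖ ^ p)) Ω :=
      (h1u.add hWZ).const_mul _
    calc ∫ x in S2, f1 (ε⁻¹ • x) (u x + W x)
        ≤ ∫ x in S2, C * 2 ^ p * ((1 + ‖u x‖ ^ p) + ‖W x - Z x‖ ^ p) := by
          refine integral_mono_ae (hfi.mono_set hS2Ω) (hitg.mono_set hS2Ω) ?_
          filter_upwards [hZ0] with x hx
          have m1 := (le_abs_self _).trans (hf.upper (ε⁻¹ • x) (u x + W x))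
          have m2 := norm_add_rpow_le hp (u x) (W x - Z x)
          rw [hx, sub_zero] at m2
          simp only [hx, sub_zero]
          refine m1.trans ?_
          rw [mul_assoc]
          refine mul_le_mul_of_nonneg_left ?_ (by linarith)
          nlinarith
      _ = C * 2 ^ p * ((∫ x in S2, (1 + ‖u x‖ ^ p)) + ∫ x in S2, ‖W x - Z x‖ ^ p) := by
          rw [integral_const_mul, integral_add (h1u.mono_set hS2Ω) (hWZ.mono_set hS2Ω)]
      _ ≤ _ := by
          have q1 : ∫ x in S2, (1 + ‖u x‖ ^ p) ≤ _ :=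
            (setIntegral_mono_set (h1u.mono_set (union_subset sdiff_subset sdiff_subset))
              (.of_forall fun x => by positivity) hsub.eventuallyLE).trans
            (setIntegral_union_le' (hΩ.measurableSet.diff hhm)
              (hΩ.measurableSet.diff (isOpen_hat hε Ω).measurableSet) sdiff_subset sdiff_subset h1u
              fun x => by positivity)
          have q2 : ∫ x in S2, ‖W x - Z x‖ ^ p ≤ ∫ x in Ω, ‖W x - Z x‖ ^ p :=
            setIntegral_mono_set hWZ (.of_forall fun x => by positivity) hS2Ω.eventuallyLE
          gcongr

lemma pre_recov (hp : 1 < p)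
    (hA : ConstantRank A) (hD : IsOpen D0) (hDQ : D0 ⊆ Qcube d)
    (hf : GF p C f1) (hΩ : IsOpen Ω) (hb : IsBounded Ω)
    (hu : MemLpOn p Ω u) (hfree : AFreeOn A Ω u) {η : ℝ} (hη : 0 < η) :
    ∃ v : ℝ → Rd d → Vec N, (∀ ε, MemLpOn p Ω (v ε)) ∧ (∀ ε, AFreeOn A Ω (v ε)) ∧
      (∀ (a : Fin N) (g : Rd d → ℝ), Continuous g → HasCompactSupport g →
        Tendsto (fun ε => ∫ x in Ω, v ε x a * g x) (𝓝[>] (0 : ℝ)) (𝓝 (∫ x in Ω, u x a * g x))) ∧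
      (∀ᶠ ε in 𝓝[>] (0 : ℝ), ∫ x in stiffPart ε Ω D0, f1 (ε⁻¹ • x) (v ε x) ≤
        (∫ x in Ω, fhom p A D0 f1 (u x)) + η) ∧
      (∃ K, ∀ᶠ ε in 𝓝[>] (0 : ℝ), ∫ x in Ω, ‖v ε x‖ ^ p ≤ K) := by
  have hC := hf.one_le
  have hVol : volume Ω ≠ ⊤ := hb.measure_lt_top.ne
  set F := ∫ x in Ω, fhom p A D0 f1 (u x) with hF
  set Vr := volume.real Ω with hVr
  have hVr0 : 0 ≤ Vr := measureReal_nonneg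
  set L := C * |F| + 2 * C + (1 + C ^ 2) * Vr + 1 with hL
  have hL0 : 0 < L := by positivity
  set κ := η / (4 * L) with hκ
  have hκ0 : 0 < κ := by positivity
  have hκL : κ * L = η / 4 := by rw [hκ]; field_simp
  clear_value κ
  obtain ⟨D, hD0, hDm⟩ := hf.mod1 hp (η := κ) hκ0
  set P : ℝ := 2 ^ p with hP
  have hP0 : 0 < P := by positivity
  set L2 := 2 + D * P + C * P with hL2
  have hL20 : 0 < L2 := by positivity
  obtain ⟨σ, hσ0, hσ1, hσL⟩ : ∃ σ, 0 < σ ∧ σ ≤ 1 ∧ L2 * σ ≤ η / 4 := by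
    refine ⟨min 1 (η / (4 * L2)), by positivity, min_le_left _ _, ?_⟩
    calc L2 * min 1 (η / (4 * L2)) ≤ L2 * (η / (4 * L2)) := by gcongr; exact min_le_right _ _
      _ = η / 4 := by field_simp
  obtain ⟨s, hs, -, ξ, hξ1, hξ2, hξ3⟩ := step_approx2 (D0 := D0) hp A hf hΩ hb hu hσ0
  set m : ℝ := ((cidx Ω s).card : ℝ) with hm
  have hm0 : 0 ≤ m := by positivity
  obtain ⟨W, Z, hW1, hW2, ⟨ρ, hρ, hZρ⟩, hZm, hR, hcc, hE, K, hK⟩ :=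
    glue hp hA hD hf hΩ.measurableSet hb hs ξ (η := σ / (m + 1)) (by positivity)
  have hui : IntegrableOn (fun x => ‖u x‖ ^ p) Ω := hu.integrable_rpow hp
  have hc1 : IntegrableOn (fun _ => (1 : ℝ)) Ω := integrableOn_const hVol
  have h1u : IntegrableOn (fun x => 1 + ‖u x‖ ^ p) Ω := hc1.add hui
  refine ⟨fun ε x => u x + W ε x, fun ε => hu.add (hW1 ε), fun ε => ?_, ?_, ?_, ?_⟩
  · exact hfree.add (hW2 ε) (MemLpOn.integrable hp hVol hu) (MemLpOn.integrable hp hVol (hW1 ε))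
  · intro a g hg hgc
    obtain ⟨G, hG⟩ := hgc.exists_bound_of_continuous hg
    have t := (hcc a g hg hgc).const_add (∫ x in Ω, u x a * g x)
    rw [add_zero] at t
    refine t.congr fun ε => ?_
    have i1 : IntegrableOn (fun x => u x a * g x) Ω :=
      (Integrable.eval (MemLpOn.integrable hp hVol hu) a).mul_bdd (c := G) hg.aestronglyMeasurable
        (.of_forall hG)
    have i2 : IntegrableOn (fun x => W ε x a * g x) Ω :=
      (Integrable.eval (MemLpOn.integrable hp hVol (hW1 ε)) a).mul_bdd (c := G) hg.aestronglyMeasurable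
        (.of_forall hG)
    rw [← integral_add i1 i2]
    exact integral_congr_ae (.of_forall fun x => by simp only [Pi.add_apply]; ring)
  · have tT : Tendsto (fun ε => ∫ x in Ω \ hatOmega ε Ω, (1 + ‖u x‖ ^ p)) (𝓝[>] (0:ℝ)) (𝓝 0) := by
      refine squeeze_zero' (.of_forall fun ε => integral_nonneg fun x => by positivity) ?_
        (band_tendsto hΩ h1u)
      filter_upwards [self_mem_nhdsWithin] with ε hε
      refine le_trans (le_of_eq ?_) (sdiff_hat_integral_le hε h1u)
      refine integral_congr_ae (.of_forall fun x => ?_)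
      simp only []
      rw [Real.norm_eq_abs, abs_of_nonneg (by positivity)]
    have tt := ((hR.const_mul (D * P)).add ((tT.add hR).const_mul (C * P)))
    simp only [mul_zero, add_zero] at tt
    filter_upwards [tt.eventually (gt_mem_nhds (show (0:ℝ) < η / 4 by positivity)), hE,
      self_mem_nhdsWithin, Ioo_mem_nhdsGT hρ] with ε h1 h2 hε hερ
    have hε : 0 < ε := hε
    have est := energy_est hp hD hDQ hf hΩ hb hs hε hu (hW1 ε) (hZm ε hε) hκ0 hD0 hDm ?_ h2
    · refine est.trans ?_
      rw [Finset.sum_add_distrib, Finset.sum_const, nsmul_eq_mul]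
      have a1 : ∑ z ∈ cidx Ω s, s ^ d * fhom p A D0 f1 (ξ z) ≤ F + σ := by
        linarith [(abs_le.1 hξ3).1]
      have a2 : m * (σ / (m + 1)) ≤ σ := by
        rw [mul_div_assoc', div_le_iff₀ (by positivity)]; nlinarith
      have a3 : (1 + κ * C) * (∑ z ∈ cidx Ω s, s ^ d * fhom p A D0 f1 (ξ z) + m * (σ / (m + 1))) ≤
          (1 + κ * C) * (F + 2 * σ) :=
        mul_le_mul_of_nonneg_left (by linarith) (by positivity)
      have a4 : κ * C * F ≤ κ * C * |F| := mul_le_mul_of_nonneg_left (le_abs_self F) (by positivity)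
      have a5 : κ * C * σ ≤ κ * C * 1 := mul_le_mul_of_nonneg_left hσ1 (by positivity)
      have a6 : κ * C * |F| + κ * (2 * C) + κ * (1 + C ^ 2) * Vr + κ = η / 4 := by
        rw [← hκL, hL]; ring
      have a7 : 2 * σ + D * P * σ + C * P * σ ≤ η / 4 := by
        refine le_trans (le_of_eq ?_) hσL; rw [hL2]; ring
      have a8 := mul_le_mul_of_nonneg_left hξ1 (show 0 ≤ D * P by positivity)
      have a9 := mul_le_mul_of_nonneg_left hξ2 (show 0 ≤ C * P by positivity)
      rw [← hm]
      simp only [mul_add] at a3 a4 a5 a6 a7 a8 a9 h1 ⊢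
      linarith
    · have hg : ∀ᵐ x ∂(volume : Measure (Rd d)), x ∉ grid d ε := by
        rw [ae_iff]; simpa using grid_null d ε
      have hm2 : MeasurableSet (stiffPart ε Ω D0 \ (hatOmega s Ω ∩ Sper D0 ε)) :=
        (stiff_meas hΩ hD hε).diff ((isOpen_hat hs Ω).measurableSet.inter (Sper_meas hD ε))
      rw [ae_restrict_iff' hm2]
      filter_upwards [hg] with x hx hxS
      by_contra hne
      obtain ⟨z, hz, hzb⟩ := hZρ ε x hne
      have hcΩ := (mem_cidx hb hs).1 hz
      have hxc : x ∈ cell s z (Qcube d) := hzb (mem_closedBall_self hρ.le)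
      have hxh : x ∈ hatOmega s Ω := by
        rw [hat_eq hb hs]; exact mem_biUnion hz hxc
      have hxn : x ∉ hatOmega ε Ω := fun h => hxS.2 ⟨hxh, stiff_hat_subset hDQ hε ⟨hxS.1, h⟩⟩
      rcases sdiff_hat_subset hε Ω ⟨hcΩ hxc, hxn⟩ with h | h
      · have h3 : ENNReal.ofReal ρ ≤ infEDist x Ωᶜ := by
          refine le_infEDist.2 fun y hy => ?_
          rw [edist_dist]
          refine ENNReal.ofReal_le_ofReal ?_
          by_contra hlt
          push Not at hlt
          exact hy (hcΩ (hzb (by rw [mem_closedBall, dist_comm]; exact hlt.le)))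
        have h4 := h3.trans h.2
        rw [ENNReal.ofReal_le_ofReal_iff hε.le] at h4
        linarith [hερ.2]
      · exact hx h
  · refine ⟨P * ((∫ x in Ω, ‖u x‖ ^ p) + P * (1 + K)), ?_⟩
    filter_upwards [hK, hR.eventually (gt_mem_nhds zero_lt_one), self_mem_nhdsWithin] with ε h1 h2 hε
    have hWi := (hW1 ε).integrable_rpow hp
    have hZi := (hZm ε hε).integrable_rpow hp
    have hWZ := (MemLpOn.integrable_rpow hp (u := fun x => W ε x - Z ε x) ((hW1 ε).sub (hZm ε hε)))
    calc ∫ x in Ω, ‖u x + W ε x‖ ^ p ≤ ∫ x in Ω, P * (‖u x‖ ^ p + P * (‖W ε x - Z ε x‖ ^ p + ‖Z ε x‖ ^ p)) := by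
          refine integral_mono_of_nonneg (.of_forall fun x => by positivity)
            ((hui.add ((hWZ.add hZi).const_mul P)).const_mul P) (.of_forall fun x => ?_)
          have := norm_rpow_le_sub hp (W ε x) (Z ε x)
          refine (norm_add_rpow_le hp (u x) (W ε x)).trans ?_
          simp only [Pi.add_apply]
          gcongr
      _ = P * ((∫ x in Ω, ‖u x‖ ^ p) + P * ((∫ x in Ω, ‖W ε x - Z ε x‖ ^ p) + ∫ x in Ω, ‖Z ε x‖ ^ p)) := by
          have i : IntegrableOn (fun x => P * (‖W ε x - Z ε x‖ ^ p + ‖Z ε x‖ ^ p)) Ω := (hWZ.add hZi).const_mul P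
          rw [integral_const_mul, integral_add hui i, integral_const_mul, integral_add hWZ hZi]
      _ ≤ _ := by gcongr

lemma null_unit
    (hD : IsOpen D0) (hDc : closure D0 ⊆ Qcube d) (hN : NullAverage p A D0)
    {w : Rd d → Vec N} (hw : MemLpOn p (Qcube d) w) (hfree : AFreeOn A (Qcube d) w)
    (h0 : ∀ᵐ y ∂volume.restrict (Qcube d \ D0), w y = 0) : ∫ y in Qcube d, w y = 0 := by
  have hpe := pext_ae w
  have hQm := measurableSet_Qcube d
  rw [← integral_congr_ae hpe]
  refine hN (pext w) ((memLp_congr_ae hpe).2 hw) (pext_zper w) ?_ ?_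
  · have : ∀ᵐ y ∂volume.restrict (Qcube d \ D0), pext w y = w y :=
      ae_restrict_of_ae_restrict_of_subset sdiff_subset hpe
    filter_upwards [this, h0] with y h1 h2
    rw [h1, h2]
  · intro ψ hψ hψz
    rw [Qcube_ball] at hDc
    obtain ⟨r0, hr0, hr0s⟩ := exists_lt_subset_ball isClosed_closure hDc
    set r := max r0 (1 / 4) with hr
    have hr1 : r < 1 / 2 := max_lt hr0 (by norm_num)
    have hr2 : 0 < r := lt_max_of_lt_right (by norm_num)
    obtain ⟨χ, hχ, hχc, hχs, hχ1, -, -⟩ := exists_bump hr2 (show r < (r + 1 / 2) / 2 by linarith) (ctr d)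
    have hχQ : tsupport χ ⊆ Qcube d := by
      rw [Qcube_ball]
      exact hχs.trans (closedBall_subset_ball (by linarith))
    have hχD : ∀ x ∈ D0, χ x = 1 := fun x hx => hχ1 x (ball_subset_closedBall
      (ball_subset_ball (le_max_left _ _) (hr0s (subset_closure hx))))
    have ht : TestOn (Qcube d) (fun x => χ x • ψ x) := by
      refine ⟨hχ.smul hψ, hχc.smul_right, ?_⟩
      exact (tsupport_smul_subset_left χ ψ).trans hχQ
    rw [← hfree _ ht]
    have h0' : ∀ᵐ y ∂volume.restrict (Qcube d), y ∉ D0 → w y = 0 := by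
      rw [ae_restrict_iff' (hQm.diff hD.measurableSet)] at h0
      rw [ae_restrict_iff' hQm]
      filter_upwards [h0] with y h hy hyD
      exact h ⟨hy, hyD⟩
    refine integral_congr_ae ?_
    filter_upwards [hpe, h0'] with y h1 h2
    rw [h1]
    by_cases hy : y ∈ D0
    · have : (fun x => χ x • ψ x) =ᶠ[𝓝 y] ψ := by
        filter_upwards [hD.mem_nhds hy] with x hx
        rw [hχD x hx, one_smul]
      have e : adjApply A (fun x => χ x • ψ x) y = adjApply A ψ y := by
        unfold adjApply
        rw [this.fderiv_eq]
      rw [e]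
    · rw [h2 hy]; simp [dot]

lemma null_cell
    (hΩ : IsOpen Ω) (hD : IsOpen D0) (hDc : closure D0 ⊆ Qcube d) (hN : NullAverage p A D0)
    {ε : ℝ} (hε : 0 < ε) {w : Rd d → Vec N} (hw : MemLpOn p Ω w) (hfree : AFreeOn A Ω w)
    (h0 : ∀ᵐ y ∂volume.restrict (stiffPart ε Ω D0), w y = 0)
    (hz : cell ε z (Qcube d) ⊆ Ω) : ∫ y in cell ε z (Qcube d), w y = 0 := by
  have hsub : HC.aff (ε • zr z) ε '' (Qcube d \ D0) ⊆ stiffPart ε Ω D0 := by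
    rintro _ ⟨y, hy, rfl⟩
    have hyc : HC.aff (ε • zr z) ε y ∈ cell ε z (Qcube d) := by
      rw [cell_eq]; exact mem_image_of_mem _ hy.1
    refine ⟨hz hyc, fun hs => ?_⟩
    obtain ⟨q, hq, hqm⟩ := mem_iUnion₂.1 hs
    have hq2 := cell_mono ε q (subset_closure.trans hDc) hqm
    have := cell_index hε hyc hq2
    subst this
    rw [cell_eq] at hqm
    obtain ⟨y', hy', he⟩ := hqm
    exact hy.2 (aff_inj _ hε he ▸ hy')
  have h1 := ae_restrict_of_ae_restrict_of_subset hsub h0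
  have h2 : ∀ᵐ y ∂volume.restrict (Qcube d \ D0), w (HC.aff (ε • zr z) ε y) = 0 := by
    refine ae_of_ae_map (aff_me (ε • zr z) hε).measurable.aemeasurable (p := fun x => w x = 0) ?_
    rw [aff_map_restrict _ hε]
    exact Measure.ae_smul_measure h1 _
  rw [cell_eq] at hz ⊢
  rw [aff_integral _ hε, null_unit hD hDc hN (aff_memLp _ hε (MemLpOn.mono hw hz))
    (AFreeOn.aff hε (hfree.mono hΩ.measurableSet hz)) h2, smul_zero]

lemma null_test (hp : 1 < p)
    (hΩ : IsOpen Ω) (hb : IsBounded Ω) (hD : IsOpen D0)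
    (hDc : closure D0 ⊆ Qcube d) (hN : NullAverage p A D0)
    {ε : ℝ} (hε : 0 < ε) {w : Rd d → Vec N} (hw : MemLpOn p Ω w) (hfree : AFreeOn A Ω w)
    (h0 : ∀ᵐ y ∂volume.restrict (stiffPart ε Ω D0), w y = 0) (hg : Continuous g)
    {G ω : ℝ} (hG : ∀ x, |g x| ≤ G) (hω : ∀ x y, ‖x - y‖ ≤ ε → |g x - g y| ≤ ω) (a : Fin N) :
    |∫ x in Ω, w x a * g x| ≤ ω * (∫ x in Ω, ‖w x‖) + G * ∫ x in Ω \ hatOmega ε Ω, ‖w x‖ := by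
  have hVol : volume Ω ≠ ⊤ := hb.measure_lt_top.ne
  have hG0 : 0 ≤ G := (abs_nonneg _).trans (hG 0)
  have hω0 : 0 ≤ ω := (abs_nonneg _).trans (hω 0 0 (by simpa using hε.le))
  have hwi := MemLpOn.integrable hp hVol hw
  have hia : IntegrableOn (fun x => w x a) Ω := Integrable.eval hwi a
  have hig : IntegrableOn (fun x => w x a * g x) Ω :=
    hia.mul_bdd (c := G) hg.aestronglyMeasurable (.of_forall hG)
  have hhm : MeasurableSet (hatOmega ε Ω) := (isOpen_hat hε Ω).measurableSet
  have e1 : ∫ x in Ω, w x a * g x = (∫ x in hatOmega ε Ω, w x a * g x) + ∫ x in Ω \ hatOmega ε Ω, w x a * g x := by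
    rw [← setIntegral_union disjoint_sdiff_right (hΩ.measurableSet.diff hhm)
      (hig.mono_set (hat_subset ε Ω)) (hig.mono_set sdiff_subset), union_sdiff_cancel (hat_subset ε Ω)]
  rw [e1]
  refine (abs_add_le _ _).trans (add_le_add ?_ ?_)
  · rw [hat_sum hb hε hig]
    refine (Finset.abs_sum_le_sum_abs _ _).trans ?_
    refine le_trans ?_ (mul_le_mul_of_nonneg_left (sum_cells_le hb hε hwi.norm fun x => norm_nonneg _) hω0)
    rw [Finset.mul_sum]
    refine Finset.sum_le_sum fun z hz => ?_
    have hcΩ := (mem_cidx hb hε).1 hz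
    set O := cell ε z (Qcube d) with hO
    have hOm : MeasurableSet O := (isOpen_cell hε z).measurableSet
    by_cases hne : O.Nonempty
    · obtain ⟨x0, hx0⟩ := hne
      have hn := null_cell hΩ hD hDc hN hε hw hfree h0 hcΩ
      have hna : ∫ x in O, w x a = 0 := by
        rw [← eval_integral (fun i => Integrable.eval (hwi.mono_set hcΩ) i), hn]; rfl
      have e2 : ∫ x in O, w x a * g x = ∫ x in O, w x a * (g x - g x0) := by
        have : ∫ x in O, w x a * (g x - g x0) = (∫ x in O, w x a * g x) - ∫ x in O, w x a * g x0 := by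
          rw [← integral_sub (hig.mono_set hcΩ) ((hia.mono_set hcΩ).mul_const _)]
          simp only [mul_sub]
        rw [this, integral_mul_const, hna, zero_mul, sub_zero]
      rw [e2, ← integral_const_mul, ← Real.norm_eq_abs]
      refine norm_integral_le_of_norm_le ((IntegrableOn.mono_set hwi.norm hcΩ).const_mul ω) ?_
      rw [ae_restrict_iff' hOm]
      refine Eventually.of_forall fun x hx => ?_
      rw [norm_mul, mul_comm]
      exact mul_le_mul (hω x x0 (cell_dist hε hx hx0)) (norm_le_pi_norm (w x) a) (norm_nonneg _) hω0
    · rw [not_nonempty_iff_eq_empty] at hne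
      rw [hne]; simp
  · rw [← integral_const_mul, ← Real.norm_eq_abs]
    refine norm_integral_le_of_norm_le ((IntegrableOn.mono_set hwi.norm sdiff_subset).const_mul G)
      (.of_forall fun x => ?_)
    rw [norm_mul, mul_comm]
    exact mul_le_mul (hG x) (norm_le_pi_norm (w x) a) (norm_nonneg _) hG0

lemma null_tendsto (hp : 1 < p)
    (hΩ : IsOpen Ω) (hb : IsBounded Ω) (hD : IsOpen D0)
    (hDc : closure D0 ⊆ Qcube d) (hN : NullAverage p A D0)
    {w : ℝ → Rd d → Vec N} (hw : ∀ ε > 0, MemLpOn p Ω (w ε)) (hfree : ∀ ε > 0, AFreeOn A Ω (w ε))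
    (h0 : ∀ ε > 0, ∀ᵐ y ∂volume.restrict (stiffPart ε Ω D0), w ε y = 0) {K : ℝ}
    (hK : ∀ᶠ ε in 𝓝[>] (0:ℝ), ∫ x in Ω, ‖w ε x‖ ^ p ≤ K)
    (hg : Continuous g) (hgc : HasCompactSupport g) (a : Fin N) :
    Tendsto (fun ε => ∫ x in Ω, w ε x a * g x) (𝓝[>] (0:ℝ)) (𝓝 0) := by
  have hVol : volume Ω ≠ ⊤ := hb.measure_lt_top.ne
  obtain ⟨G, hG⟩ := hgc.exists_bound_of_continuous hg
  have hG0 : 0 ≤ G := (norm_nonneg _).trans (hG 0)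
  have huc := hgc.uniformContinuous_of_continuous hg
  have hK0 : 0 ≤ K := by
    obtain ⟨ε, h⟩ := hK.exists
    exact (integral_nonneg fun x => by positivity).trans h
  have hc1 : IntegrableOn (fun _ => (1 : ℝ)) Ω := integrableOn_const hVol
  -- splitting estimate
  have hsplit : ∀ T : ℝ, 0 < T → ∀ ε > 0, ∫ x in Ω, ‖w ε x‖ ^ p ≤ K → ∀ S ⊆ Ω,
      ∫ x in S, ‖w ε x‖ ≤ T * volume.real S + T ^ (1 - p) * K := by
    intro T hT ε hε hk S hS
    have hi := (hw ε hε).integrable_rpow hp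
    have j1 : IntegrableOn (fun _ => T * 1) Ω := hc1.const_mul T
    have j2 : IntegrableOn (fun x => T ^ (1 - p) * ‖w ε x‖ ^ p) Ω := hi.const_mul _
    have i1 : IntegrableOn (fun x => T * 1 + T ^ (1 - p) * ‖w ε x‖ ^ p) Ω := j1.add j2
    calc ∫ x in S, ‖w ε x‖ ≤ ∫ x in S, (T * 1 + T ^ (1 - p) * ‖w ε x‖ ^ p) := by
          refine integral_mono (IntegrableOn.mono_set (MemLpOn.integrable hp hVol (hw ε hε)).norm hS)
            (i1.mono_set hS) fun x => ?_
          have := t_le hp hT (norm_nonneg (w ε x))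
          simp only [mul_one]; exact this
      _ = T * volume.real S + T ^ (1 - p) * ∫ x in S, ‖w ε x‖ ^ p := by
          rw [integral_add (j1.mono_set hS) (j2.mono_set hS),
            integral_const_mul, integral_const_mul]
          simp
      _ ≤ _ := by
          have : ∫ x in S, ‖w ε x‖ ^ p ≤ K :=
            (setIntegral_mono_set hi (.of_forall fun x => by positivity) hS.eventuallyLE).trans hk
          gcongr
  rw [Metric.tendsto_nhds]
  intro δ hδ
  set B := volume.real Ω + K + 1 with hB
  have hB0 : 0 < B := by have : 0 ≤ volume.real Ω := measureReal_nonneg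
                         positivity
  set ω := δ / (3 * B) with hωd
  have hω0 : 0 < ω := by positivity
  obtain ⟨θ, hθ, hθ2⟩ := Metric.uniformContinuous_iff.1 huc ω hω0
  -- choose T large
  have hTt : Tendsto (fun T : ℝ => G * (T ^ (1 - p) * K)) atTop (𝓝 0) := by
    have := ((tendsto_rpow_neg_atTop (show 0 < p - 1 by linarith)).mul_const K).const_mul G
    simp only [zero_mul, mul_zero, neg_sub] at this
    exact this
  obtain ⟨T, hT1, hT0⟩ := ((hTt.eventually (gt_mem_nhds (show (0:ℝ) < δ / 3 by positivity))).and
    (eventually_gt_atTop 0)).exists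
  have hh := ((hat_eps_small hΩ hb).const_mul (G * T))
  rw [mul_zero] at hh
  filter_upwards [hK, self_mem_nhdsWithin, Ioo_mem_nhdsGT hθ,
    hh.eventually (gt_mem_nhds (show (0:ℝ) < δ / 3 by positivity))] with ε h1 hε hεθ h2
  have hε : 0 < ε := hε
  rw [Real.dist_eq, sub_zero]
  have est := null_test hp hΩ hb hD hDc hN hε (hw ε hε) (hfree ε hε) (h0 ε hε) hg (G := G) (ω := ω) hG
    (fun x y hxy => by
      have := hθ2 (a := x) (b := y) (by rw [dist_eq_norm]; linarith [hεθ.2])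
      rw [Real.dist_eq] at this; exact this.le) a
  have e1 := hsplit 1 zero_lt_one ε hε h1 Ω subset_rfl
  rw [Real.one_rpow, one_mul, one_mul] at e1
  have e2 := hsplit T hT0 ε hε h1 (Ω \ hatOmega ε Ω) sdiff_subset
  have e3 : ω * (∫ x in Ω, ‖w ε x‖) ≤ ω * B := mul_le_mul_of_nonneg_left (by linarith) hω0.le
  have e4 : ω * B = δ / 3 := by rw [hωd]; field_simp
  have e5 := mul_le_mul_of_nonneg_left e2 hG0
  rw [mul_add, ← mul_assoc] at e5
  linarith

lemma eLp_toReal {α E : Type*} [MeasurableSpace α] {μ : Measure α} [NormedAddCommGroup E]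
    (hp : 1 < p) {f : α → E} (hf : MemLp f (ENNReal.ofReal p) μ) :
    (eLpNorm f (ENNReal.ofReal p) μ).toReal = (∫ y, ‖f y‖ ^ p ∂μ) ^ (1 / p) := by
  rw [hf.eLpNorm_eq_integral_rpow_norm (by simp; linarith) ENNReal.ofReal_ne_top,
    ENNReal.toReal_ofReal (by positivity), ENNReal.toReal_ofReal (show 0 ≤ p by linarith), one_div]

lemma ext_bound {p c : ℝ} (hp : 1 < p) (hc : 0 < c) {Ω S : Set (Rd d)}
    {w v : Rd d → Vec N} (hw : MemLpOn p Ω w) (hv : MemLpOn p S v)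
    (h : LpNormOn p Ω w ≤ c * LpNormOn p S v) :
    ∫ x in Ω, ‖w x‖ ^ p ≤ (c * ((N : ℝ) + 1)) ^ p * ∫ x in S, ‖v x‖ ^ p := by
  have hcont : Continuous (fun ξ : Vec N => eN ξ) := by unfold eN; fun_prop
  have hE : ∀ {O : Set (Rd d)} {g : Rd d → Vec N}, MemLpOn p O g →
      MemLp (fun x => eN (g x)) (ENNReal.ofReal p) (volume.restrict O) := fun {O g} hg =>
    MemLp.of_le_mul hg (hcont.comp_aestronglyMeasurable hg.aesm) (ae_of_all _ fun x => by
      rw [Real.norm_of_nonneg (eN_nonneg _)]; exact eN_le_norm (g x))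
  have h1 : LpNormOn p S v ≤ ((N : ℝ) + 1) * (∫ x in S, ‖v x‖ ^ p) ^ (1 / p) := by
    rw [← eLp_toReal hp hv]
    have := eLpNorm_le_mul_eLpNorm_of_ae_le_mul (f := fun x => eN (v x)) (g := v)
      (μ := volume.restrict S) (c := (N : ℝ) + 1) (ae_of_all _ fun x => by
        rw [Real.norm_of_nonneg (eN_nonneg _)]; exact eN_le_norm (v x)) (ENNReal.ofReal p)
    have h2 := ENNReal.toReal_mono (ENNReal.mul_ne_top ENNReal.ofReal_ne_top (MemLp.eLpNorm_ne_top hv)) this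
    rwa [ENNReal.toReal_mul, ENNReal.toReal_ofReal (by positivity)] at h2
  have h2 : (∫ x in Ω, ‖w x‖ ^ p) ^ (1 / p) ≤ LpNormOn p Ω w := by
    rw [← eLp_toReal hp hw]
    refine ENNReal.toReal_mono (hE hw).eLpNorm_ne_top (eLpNorm_mono_real fun x => norm_le_eN _)
  have h3 : (∫ x in Ω, ‖w x‖ ^ p) ^ (1 / p) ≤ c * ((N : ℝ) + 1) * (∫ x in S, ‖v x‖ ^ p) ^ (1 / p) :=
    (h2.trans h).trans (by rw [mul_assoc]; exact mul_le_mul_of_nonneg_left h1 hc.le)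
  have i0 : 0 ≤ ∫ x in Ω, ‖w x‖ ^ p := integral_nonneg fun x => by positivity
  have i1 : 0 ≤ ∫ x in S, ‖v x‖ ^ p := integral_nonneg fun x => by positivity
  have h4 := Real.rpow_le_rpow (by positivity) h3 (show 0 ≤ p by linarith)
  rwa [Real.mul_rpow (by positivity) (by positivity), ← Real.rpow_mul i0, ← Real.rpow_mul i1,
    one_div_mul_cancel (by linarith), Real.rpow_one, Real.rpow_one] at h4

lemma dot_holder (hp : 1 < p) {w h : Rd d → Vec N}
    (hw : MemLpOn p O w) (hh : MemLpOn (conjExp p) O h) :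
    IntegrableOn (fun x => dot (w x) (h x)) O ∧ |∫ x in O, dot (w x) (h x)| ≤
      N * ((∫ x in O, ‖w x‖ ^ p) ^ (1 / p) *
        (eLpNorm h (ENNReal.ofReal (conjExp p)) (volume.restrict O)).toReal) := by
  have hc := conj_hc hp
  have hcE : ENNReal.HolderConjugate (ENNReal.ofReal p) (ENNReal.ofReal (conjExp p)) := hc.ennrealOfReal
  have i1 : IntegrableOn (fun x => ‖w x‖ * ‖h x‖) O := MemLp.integrable_mul hw.norm hh.norm
  have hle : ∀ x, ‖dot (w x) (h x)‖ ≤ N * (‖w x‖ * ‖h x‖) := fun x => by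
    unfold dot
    refine (norm_sum_le _ _).trans ?_
    refine (Finset.sum_le_sum (g := fun _ => ‖w x‖ * ‖h x‖) fun j _ => ?_).trans (by simp)
    rw [norm_mul]
    exact mul_le_mul (norm_le_pi_norm _ j) (norm_le_pi_norm _ j) (norm_nonneg _) (norm_nonneg _)
  have hm : AEStronglyMeasurable (fun x => dot (w x) (h x)) (volume.restrict O) := by
    have hcont : Continuous (fun q : Vec N × Vec N => dot q.1 q.2) := by unfold dot; fun_prop
    exact hcont.comp_aestronglyMeasurable (hw.aesm.prodMk hh.aesm)
  refine ⟨Integrable.mono' (i1.const_mul N) hm (ae_of_all _ hle), ?_⟩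
  rw [← Real.norm_eq_abs, eLp_toReal (one_lt_conj hp) hh]
  refine (norm_integral_le_of_norm_le (i1.const_mul (N : ℝ)) (ae_of_all _ hle)).trans ?_
  rw [integral_const_mul]
  exact mul_le_mul_of_nonneg_left (integral_mul_norm_le_Lp_mul_Lq hc hw hh) (by positivity)

/-- Bounded sequences which converge on a dense set of test functions converge weakly. -/
lemma weak_dense {p K : ℝ} (hp : 1 < p)
    (hu : MemLpOn p O u) {w : ℝ → Rd d → Vec N} (hw : ∀ ε > 0, MemLpOn p O (w ε))
    (hK : ∀ᶠ ε in 𝓝[>] (0:ℝ), ∫ x in O, ‖w ε x‖ ^ p ≤ K) (D : Set (Rd d → Vec N))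
    (hDm : ∀ g ∈ D, MemLpOn (conjExp p) O g)
    (hD : ∀ g, MemLpOn (conjExp p) O g → ∀ δ > 0, ∃ h ∈ D,
    eLpNorm (g - h) (ENNReal.ofReal (conjExp p)) (volume.restrict O) ≤ ENNReal.ofReal δ)
    (hT : ∀ g ∈ D, Tendsto (fun ε => ∫ x in O, dot (w ε x) (g x)) (𝓝[>] (0:ℝ))
    (𝓝 (∫ x in O, dot (u x) (g x)))) : WeakLpTendsto p O (𝓝[>] (0:ℝ)) w u := by
  intro g hg
  rw [Metric.tendsto_nhds]
  intro δ hδ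
  set B := (N : ℝ) * (K ^ (1 / p) + (∫ x in O, ‖u x‖ ^ p) ^ (1 / p)) + 1 with hB
  have hK0 : 0 ≤ K := by
    obtain ⟨ε, h⟩ := hK.exists
    exact (integral_nonneg fun x => by positivity).trans h
  have hU0 : 0 ≤ ∫ x in O, ‖u x‖ ^ p := integral_nonneg fun x => by positivity
  have hB0 : 0 < B := by positivity
  obtain ⟨h, hhD, hgh⟩ := hD g hg (δ / (2 * B)) (by positivity)
  have hh := hDm h hhD
  have hmem : MemLpOn (conjExp p) O (g - h) := MemLp.sub hg hh
  have hκ : (eLpNorm (g - h) (ENNReal.ofReal (conjExp p)) (volume.restrict O)).toReal ≤ δ / (2 * B) := by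
    have := ENNReal.toReal_mono ENNReal.ofReal_ne_top hgh
    rwa [ENNReal.toReal_ofReal (by positivity)] at this
  have key : ∀ v : Rd d → Vec N, MemLpOn p O v → |(∫ x in O, dot (v x) (g x)) - ∫ x in O, dot (v x) (h x)|
      ≤ N * (∫ x in O, ‖v x‖ ^ p) ^ (1 / p) * (δ / (2 * B)) := fun v hv => by
    rw [← integral_sub (dot_holder hp hv hg).1 (dot_holder hp hv hh).1]
    have e : ∀ x, dot (v x) (g x) - dot (v x) (h x) = dot (v x) ((g - h) x) := fun x => by
      simp [dot, mul_sub, Finset.sum_sub_distrib]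
    simp only [e]
    refine (dot_holder hp hv hmem).2.trans ?_
    rw [mul_assoc]
    gcongr
  filter_upwards [hK, self_mem_nhdsWithin,
    Metric.tendsto_nhds.1 (hT h hhD) (δ / 2) (by positivity)] with ε h1 hε h2
  have k1 := key _ (hw ε hε)
  have k2 := key _ hu
  have h3 : N * (∫ x in O, ‖w ε x‖ ^ p) ^ (1 / p) * (δ / (2 * B)) ≤ N * K ^ (1 / p) * (δ / (2 * B)) := by
    have : 0 ≤ ∫ x in O, ‖w ε x‖ ^ p := integral_nonneg fun x => by positivity
    gcongr
  have h4 : N * K ^ (1 / p) * (δ / (2 * B)) + N * (∫ x in O, ‖u x‖ ^ p) ^ (1 / p) * (δ / (2 * B)) ≤ δ / 2 := by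
    have : δ / 2 = B * (δ / (2 * B)) := by field_simp
    rw [this, ← add_mul, ← mul_add]
    gcongr
    linarith
  rw [Real.dist_eq] at *
  rw [abs_le] at k1 k2
  rw [abs_lt] at *
  constructor <;> linarith [k1.1, k1.2, k2.1, k2.2, h2.1, h2.2]

lemma recov_eta {c : ℝ} (hp : 1 < p) (hA : ConstantRank A)
    (hD : IsOpen D0) (hDc : closure D0 ⊆ Qcube d) (hN : NullAverage p A D0)
    {E : ℝ → (Rd d → Vec N) → (Rd d → Vec N)} (hE : ExtensionProperty p A Ω D0 c E)
    (hf : GF p C f1) (hΩ : IsOpen Ω) (hb : IsBounded Ω)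
    (hu : MemLpOn p Ω u) (hfree : AFreeOn A Ω u) :
    ∃ K, ∀ η : ℝ, 0 < η → η ≤ 1 → ∃ w : ℝ → Rd d → Vec N, (∀ ε > 0, MemLpOn p Ω (w ε)) ∧
      (∀ ε > 0, AFreeOn A Ω (w ε)) ∧ WeakLpTendsto p Ω (𝓝[>] (0:ℝ)) w u ∧
      (∀ᶠ ε in 𝓝[>] (0:ℝ), ∫ x in stiffPart ε Ω D0, f1 (ε⁻¹ • x) (w ε x) ≤
        (∫ x in Ω, fhom p A D0 f1 (u x)) + η) ∧
      ∀ᶠ ε in 𝓝[>] (0:ℝ), ∫ x in Ω, ‖w ε x‖ ^ p ≤ K := by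
  have hV : volume Ω ≠ ⊤ := hb.measure_lt_top.ne
  obtain ⟨hc, hE, -⟩ := hE
  set F := ∫ x in Ω, fhom p A D0 f1 (u x) with hF
  have hC0 : 0 ≤ C := zero_le_one.trans hf.one_le
  obtain ⟨K, hKe⟩ : ∃ K, K = (c * ((N : ℝ) + 1)) ^ p * (C * (F + 1 + C * volume.real Ω)) := ⟨_, rfl⟩
  refine ⟨K, fun η hη hη1 => ?_⟩
  obtain ⟨v, hv1, hv2, hv3, hv4, L, hL⟩ := pre_recov hp hA hD (subset_closure.trans hDc) hf hΩ hb hu hfree hη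
  have hw1 : ∀ ε > 0, MemLpOn p Ω (E ε (v ε)) := fun ε hε => (hE ε hε _ (hv1 ε) (hv2 ε)).2.1
  have hw2 : ∀ ε > 0, AFreeOn A Ω (E ε (v ε)) := fun ε hε => (hE ε hε _ (hv1 ε) (hv2 ε)).2.2.2
  have hen : ∀ᶠ ε in 𝓝[>] (0:ℝ), ∫ x in stiffPart ε Ω D0, f1 (ε⁻¹ • x) (E ε (v ε) x) ≤ F + η := by
    filter_upwards [hv4, self_mem_nhdsWithin] with ε h1 hε
    refine le_of_eq_of_le (integral_congr_ae ?_) h1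
    filter_upwards [(hE ε hε _ (hv1 ε) (hv2 ε)).1] with x hx
    rw [hx]
  have hbd : ∀ᶠ ε in 𝓝[>] (0:ℝ), ∫ x in Ω, ‖E ε (v ε) x‖ ^ p ≤ K := by
    filter_upwards [hv4, self_mem_nhdsWithin] with ε h1 hε
    have hsub : stiffPart ε Ω D0 ⊆ Ω := sdiff_subset
    have hvS := MemLpOn.mono (hv1 ε) hsub
    refine (ext_bound hp hc (hw1 ε hε) hvS (hE ε hε _ (hv1 ε) (hv2 ε)).2.2.1).trans ?_
    rw [hKe]
    refine mul_le_mul_of_nonneg_left ?_ (by positivity)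
    have hVS : volume (stiffPart ε Ω D0) ≠ ⊤ := ((measure_mono hsub).trans_lt hV.lt_top).ne
    have i1 : IntegrableOn (fun x => f1 (ε⁻¹ • x) (v ε x)) (stiffPart ε Ω D0) :=
      hf.integrable hp hVS hvS (measurable_const_smul _)
    have i2 : IntegrableOn (fun _ : Rd d => C) (stiffPart ε Ω D0) := integrableOn_const hVS
    refine (integral_mono (hvS.integrable_rpow hp) ((i1.add i2).const_mul C)
      fun x => hf.coer (ε⁻¹ • x) (v ε x)).trans ?_
    simp only [Pi.add_apply]
    rw [integral_const_mul, integral_add i1 i2]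
    refine mul_le_mul_of_nonneg_left (add_le_add (h1.trans (by linarith)) ?_) hC0
    rw [setIntegral_const, smul_eq_mul, mul_comm]
    exact mul_le_mul_of_nonneg_left (measureReal_mono hsub hV) hC0
  refine ⟨fun ε => E ε (v ε), hw1, hw2, ?_, hen, hbd⟩
  have hcc : ∀ (a : Fin N) (g : Rd d → ℝ), Continuous g → HasCompactSupport g →
      Tendsto (fun ε => ∫ x in Ω, E ε (v ε) x a * g x) (𝓝[>] (0:ℝ)) (𝓝 (∫ x in Ω, u x a * g x)) := by
    intro a g hg hgc
    obtain ⟨G, hG⟩ := hgc.exists_bound_of_continuous hg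
    have hn := null_tendsto hp hΩ hb hD hDc hN (w := fun ε x => E ε (v ε) x - v ε x)
      (K := 2 ^ p * (K + L))
      (fun ε hε => MemLp.sub (hw1 ε hε) (hv1 ε))
      (fun ε hε => (hw2 ε hε).sub (hv2 ε) (MemLpOn.integrable hp hV (hw1 ε hε)) (MemLpOn.integrable hp hV (hv1 ε)))
      (fun ε hε => by
        filter_upwards [(hE ε hε _ (hv1 ε) (hv2 ε)).1] with x hx
        rw [hx, sub_self])
      (by
        filter_upwards [hbd, hL, self_mem_nhdsWithin] with ε h1 h2 hε
        have i1 := (hw1 ε hε).integrable_rpow hp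
        have i2 := (hv1 ε).integrable_rpow hp
        refine (integral_mono (MemLpOn.integrable_rpow hp (MemLp.sub (hw1 ε hε) (hv1 ε)))
          ((i1.add i2).const_mul (2 ^ p)) fun x => norm_sub_rpow_le hp _ _).trans ?_
        simp only [Pi.add_apply]
        rw [integral_const_mul, integral_add i1 i2]
        gcongr) hg hgc a
    have := hn.add (hv3 a g hg hgc)
    rw [zero_add] at this
    refine this.congr' ?_
    filter_upwards [self_mem_nhdsWithin] with ε hε
    have j : ∀ {z : Rd d → Vec N}, MemLpOn p Ω z → IntegrableOn (fun x => z x a * g x) Ω := fun hz =>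
      (Integrable.eval (MemLpOn.integrable hp hV hz) a).mul_bdd (c := G) hg.aestronglyMeasurable
        (.of_forall hG)
    simp only [Pi.sub_apply, sub_mul]
    rw [integral_sub (j (hw1 ε hε)) (j (hv1 ε)), sub_add_cancel]
  refine weak_dense hp hu hw1 hbd {g | Continuous g ∧ HasCompactSupport g}
    (fun g hg => (hg.1.memLp_of_hasCompactSupport hg.2).restrict Ω) (fun g hg δ hδ => ?_) fun g hg => ?_
  · have : IsFiniteMeasure (volume.restrict Ω) := ⟨by simpa using hV.lt_top⟩
    obtain ⟨h, h1, h2, h3, -⟩ := MemLp.exists_hasCompactSupport_eLpNorm_sub_le ENNReal.ofReal_ne_top hg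
      (ε := ENNReal.ofReal δ) (by simpa using hδ)
    exact ⟨h, ⟨h3, h1⟩, h2⟩
  · have hga : ∀ a : Fin N, Continuous (fun x => g x a) ∧ HasCompactSupport (fun x => g x a) := fun a =>
      ⟨(continuous_apply a).comp hg.1, hg.2.comp_left (g := fun v : Vec N => v a) rfl⟩
    have hi : ∀ z : Rd d → Vec N, MemLpOn p Ω z →
        ∫ x in Ω, dot (z x) (g x) = ∑ a, ∫ x in Ω, z x a * g x a := fun z hz => by
      unfold dot
      refine integral_finsetSum _ fun a _ => ?_
      obtain ⟨G, hG⟩ := (hga a).2.exists_bound_of_continuous (hga a).1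
      exact (Integrable.eval (MemLpOn.integrable hp hV hz) a).mul_bdd (c := G)
        (hga a).1.aestronglyMeasurable (.of_forall hG)
    rw [hi u hu]
    refine (tendsto_finsetSum _ fun a _ => hcc a _ (hga a).1 (hga a).2).congr' ?_
    filter_upwards [self_mem_nhdsWithin] with ε hε
    rw [hi _ (hw1 ε hε)]

lemma gamma_limsup {c : ℝ} (hp : 1 < p) (hA : ConstantRank A)
    (hD : IsOpen D0) (hDc : closure D0 ⊆ Qcube d) (hN : NullAverage p A D0)
    {E : ℝ → (Rd d → Vec N) → (Rd d → Vec N)} (hE : ExtensionProperty p A Ω D0 c E)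
    (hf : GF p C f1) (hΩ : IsOpen Ω) (hb : IsBounded Ω)
    (hu : MemLpOn p Ω u) :
    ∃ us : ℝ → Rd d → Vec N, (∀ ε : ℝ, 0 < ε → MemLpOn p Ω (us ε)) ∧
      WeakLpTendsto p Ω (𝓝[>] (0 : ℝ)) us u ∧
      Filter.limsup (fun ε => F1eps p A Ω D0 f1 ε (us ε)) (𝓝[>] (0 : ℝ)) ≤ F1lim p A Ω D0 f1 u := by
  by_cases hU : u ∈ U1 p A Ω
  swap
  · exact ⟨fun _ => u, fun _ _ => hu, fun g _ => tendsto_const_nhds, by rw [F1lim, if_neg hU]; exact le_top⟩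
  obtain ⟨K, hK⟩ := recov_eta hp hA hD hDc hN hE hf hΩ hb hu hU.2
  set F := ∫ x in Ω, fhom p A D0 f1 (u x) with hF
  have hη : ∀ i : ℕ, (0:ℝ) < 1 / ((i : ℝ) + 1) := fun i => by positivity
  choose w w1 w2 w3 w4 w5 using fun i : ℕ => hK (1 / ((i : ℝ) + 1)) (hη i)
    (by rw [div_le_one (by positivity)]; simp)
  have hq : Fact (1 ≤ ENNReal.ofReal (conjExp p)) := ⟨by simpa using (one_lt_conj hp).le⟩
  have hqt : Fact (ENNReal.ofReal (conjExp p) ≠ ⊤) := ⟨ENNReal.ofReal_ne_top⟩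
  set s := TopologicalSpace.denseSeq (Lp (Vec N) (ENNReal.ofReal (conjExp p)) (volume.restrict Ω)) with hs
  set P : ℕ → ℝ → Prop := fun i ε =>
    (∫ x in stiffPart ε Ω D0, f1 (ε⁻¹ • x) (w i ε x) ≤ F + 1 / ((i : ℝ) + 1)) ∧
    (∫ x in Ω, ‖w i ε x‖ ^ p ≤ K) ∧ ∀ j ∈ Finset.range (i + 1),
      dist (∫ x in Ω, dot (w i ε x) (s j x)) (∫ x in Ω, dot (u x) (s j x)) < 1 / ((i : ℝ) + 1) with hP
  have hPe : ∀ i, ∀ᶠ ε in 𝓝[>] (0:ℝ), P i ε := fun i => (w4 i).and ((w5 i).and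
    ((Finset.eventually_all _).2 fun j _ => Metric.tendsto_nhds.1 (w3 i (s j) (Lp.memLp (s j))) _ (hη i)))
  set I : ℝ → ℕ := fun ε => Nat.findGreatest (fun i => P i ε) ⌊ε⁻¹⌋₊ with hI
  have hIP : ∀ᶠ ε in 𝓝[>] (0:ℝ), P (I ε) ε := by
    filter_upwards [hPe 0] with ε h
    exact Nat.findGreatest_spec (P := fun i => P i ε) (Nat.zero_le _) h
  have hIt : Tendsto I (𝓝[>] (0:ℝ)) atTop := by
    refine tendsto_atTop.2 fun m => ?_
    filter_upwards [hPe m, tendsto_inv_nhdsGT_zero.eventually_ge_atTop (m : ℝ)] with ε h1 h2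
    exact Nat.le_findGreatest (Nat.le_floor h2) h1
  have hIr : Tendsto (fun ε => 1 / ((I ε : ℝ) + 1)) (𝓝[>] (0:ℝ)) (𝓝 0) :=
    tendsto_one_div_add_atTop_nhds_zero_nat.comp hIt
  refine ⟨fun ε => w (I ε) ε, fun ε hε => w1 _ ε hε, ?_, ?_⟩
  · refine weak_dense hp hu (fun ε hε => w1 _ ε hε) (K := K) (hIP.mono fun ε h => h.2.1)
      (range fun j => (s j : Rd d → Vec N)) ?_ (fun g hg δ hδ => ?_) ?_
    · rintro _ ⟨j, rfl⟩; exact Lp.memLp (s j)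
    · obtain ⟨j, hj⟩ := (TopologicalSpace.denseRange_denseSeq _).exists_dist_lt (MemLp.toLp g hg) hδ
      refine ⟨_, ⟨j, rfl⟩, ?_⟩
      rw [← edist_lt_ofReal, Lp.edist_def] at hj
      refine le_of_eq_of_le (eLpNorm_congr_ae ?_) hj.le
      filter_upwards [MemLp.coeFn_toLp hg] with x hx
      simp only [Pi.sub_apply, hx]; rfl
    · rintro _ ⟨j, rfl⟩
      rw [tendsto_iff_dist_tendsto_zero]
      refine squeeze_zero' (.of_forall fun _ => dist_nonneg) ?_ hIr
      filter_upwards [hIP, hIt.eventually_ge_atTop j] with ε h1 h2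
      exact (h1.2.2 j (Finset.mem_range.2 (by omega))).le
  · rw [F1lim, if_pos hU]
    refine EReal.le_of_forall_lt_iff_le.1 fun z hz => limsup_le_of_le ?_ ?_
    · isBoundedDefault
    have hz : F < z := EReal.coe_lt_coe_iff.1 hz
    filter_upwards [hIP, self_mem_nhdsWithin, hIr.eventually (gt_mem_nhds (sub_pos.2 hz))] with ε h1 hε h2
    rw [F1eps, if_pos ⟨w1 _ ε hε, w2 _ ε hε⟩]
    exact EReal.coe_le_coe_iff.2 (h1.1.trans (by linarith))

end HC

namespace HC

/-- Γ-limit of the stiff component.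
The stiff energies `F_{1,ε}` Γ-converge, with respect to weak `L^p(Ω;ℝ^N)`-convergence,
to `F₁(u) = ∫_Ω f_hom(u)` on `U₁` (`+∞` otherwise). -/
theorem stiff_gamma_limit
    {d N M : ℕ} (p a lam Lam mu : ℝ) (hp : 1 < p)
    (Ω D0 : Set (Rd d)) (hset : GoodSetting d Ω D0)
    (A : Fin d → (Vec N →ₗ[ℝ] Vec M))
    (f1 : Rd d → Vec N → ℝ)
    (h1 : H1stiff f1) (h2 : H2 f1) (h3 : H3stiff p a lam Lam f1) (h4 : H4stiff p mu f1)
    (hA : Admissible p A Ω D0) :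
    -- Γ-liminf inequality w.r.t. weak Lᵖ convergence
    (∀ u : Rd d → Vec N, MemLpOn p Ω u →
      ∀ us : ℝ → Rd d → Vec N, (∀ ε : ℝ, 0 < ε → MemLpOn p Ω (us ε)) →
        WeakLpTendsto p Ω (𝓝[>] (0 : ℝ)) us u →
        F1lim p A Ω D0 f1 u ≤
          Filter.liminf (fun ε => F1eps p A Ω D0 f1 ε (us ε)) (𝓝[>] (0 : ℝ)))
    ∧
    -- Γ-limsup inequality (recovery sequences)
    (∀ u : Rd d → Vec N, MemLpOn p Ω u →
      ∃ us : ℝ → Rd d → Vec N, (∀ ε : ℝ, 0 < ε → MemLpOn p Ω (us ε)) ∧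
        WeakLpTendsto p Ω (𝓝[>] (0 : ℝ)) us u ∧
        Filter.limsup (fun ε => F1eps p A Ω D0 f1 ε (us ε)) (𝓝[>] (0 : ℝ)) ≤
          F1lim p A Ω D0 f1 u) := by
  obtain ⟨-, hΩ, -, hb, -, hD, -, -, -, hDc⟩ := hset
  obtain ⟨hR, hN, c, E, hE⟩ := hA
  obtain ⟨C, hf⟩ := exists_GF hp h1 h2 h3 h4
  exact ⟨fun u hu us _ hw => gamma_liminf hp hR hD (subset_closure.trans hDc) hf hΩ hb hu hw,
    fun u hu => gamma_limsup hp hR hD hDc hN hE hf hΩ hb hu⟩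

end HC
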